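/- Let T = (G, P, L) be a canvas and let P, P' be paths of length one in the boundary of the outer face of G. Let 𝒞 be a collection of proper L-colorings of P such that 𝒞 is a government or a confederacy. Then Φ_T(P', 𝒞) contains a government, and furthermore, either (a) Φ_T(P', 𝒞) contains a confederacy, or (b) 𝒞 is a government and T contains a harmonica from P to P' with government 𝒞. -/

import Mathlib

/-!
Common definitions: plane graphs (given by a concrete embedding in the plane),
outer face, canvases, list colorings, governments, harmonicas and coloring
harmonicas, following Postle–Thomas,
"Five-list-coloring graphs on surfaces III".
-/

open Set

universe u

/-- A finite simple graph together with an embedding in the plane: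
each vertex gets a point, each edge a simple arc joining its endpoints;
arcs avoid other vertices, and two distinct edges meet only in common
endpoints. -/
structure PlaneGraph (V : Type u) where
  verts : Set V
  Adj : V → V → Prop
  finite_verts : verts.Finite
  adj_symm : ∀ u v, Adj u v → Adj v u
  adj_irrefl : ∀ v, ¬Adj v v
  adj_mem : ∀ u v, Adj u v → u ∈ verts
  pos : V → ℝ × ℝ
  arc : Sym2 V → Set (ℝ × ℝ)
  pos_injOn : Set.InjOn pos verts
  arc_arc : ∀ u v, Adj u v → ∃ f : ℝ → ℝ × ℝ,
    ContinuousOn f (Set.Icc 0 1) ∧ Set.InjOn f (Set.Icc 0 1) ∧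
    f '' Set.Icc 0 1 = arc s(u, v) ∧ f 0 = pos u ∧ f 1 = pos v
  arc_avoid : ∀ u v, Adj u v → ∀ w ∈ verts, pos w ∈ arc s(u, v) → w = u ∨ w = v
  arc_meet : ∀ u v x y, Adj u v → Adj x y → s(u, v) ≠ s(x, y) →
    arc s(u, v) ∩ arc s(x, y) ⊆ pos '' (({u, v} : Set V) ∩ ({x, y} : Set V))

namespace PlaneGraph

variable {V : Type u}

/-- The point set of the drawing of the plane graph. -/
def image (G : PlaneGraph V) : Set (ℝ × ℝ) :=
  G.pos '' G.verts ∪ ⋃ (u : V) (v : V) (_ : G.Adj u v), G.arc s(u, v)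

/-- The outer (unbounded) face of the drawing. -/
def outerFace (G : PlaneGraph V) : Set (ℝ × ℝ) :=
  {p | p ∉ G.image ∧ ¬Bornology.IsBounded (connectedComponentIn G.imageᶜ p)}

/-- A vertex incident with (i.e. on the boundary of) the outer face. -/
def OnOuter (G : PlaneGraph V) (v : V) : Prop := G.pos v ∈ frontier G.outerFace

/-- An edge incident with (i.e. on the boundary of) the outer face. -/
def EdgeOnOuter (G : PlaneGraph V) (u v : V) : Prop :=
  G.arc s(u, v) ⊆ frontier G.outerFace

/-- The vertices of the boundary of the outer face. -/
def boundaryVerts (G : PlaneGraph V) : Set V := {v | v ∈ G.verts ∧ G.OnOuter v}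

/-- Connectivity of a plane graph. -/
def Connected (G : PlaneGraph V) : Prop :=
  G.verts.Nonempty ∧ ∀ u ∈ G.verts, ∀ v ∈ G.verts, Relation.ReflTransGen G.Adj u v

/-- `H` is a (plane) subgraph of `G`, drawn the same way. -/
def IsSubgraph (H G : PlaneGraph V) : Prop :=
  H.verts ⊆ G.verts ∧ (∀ u v, H.Adj u v → G.Adj u v) ∧
  (∀ v ∈ H.verts, H.pos v = G.pos v) ∧
  (∀ u v, H.Adj u v → H.arc s(u, v) = G.arc s(u, v))

/-- Delete a set of vertices (and all incident edges) from a plane graph. -/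
def deleteVerts (G : PlaneGraph V) (s : Set V) : PlaneGraph V where
  verts := G.verts \ s
  Adj u v := G.Adj u v ∧ u ∉ s ∧ v ∉ s
  finite_verts := G.finite_verts.subset Set.diff_subset
  adj_symm := fun u v h => ⟨G.adj_symm u v h.1, h.2.2, h.2.1⟩
  adj_irrefl := fun v h => G.adj_irrefl v h.1
  adj_mem := fun u v h => ⟨G.adj_mem u v h.1, h.2.1⟩
  pos := G.pos
  arc := G.arc
  pos_injOn := G.pos_injOn.mono Set.diff_subset
  arc_arc := fun u v h => G.arc_arc u v h.1
  arc_avoid := fun u v h w hw hm => G.arc_avoid u v h.1 w hw.1 hm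
  arc_meet := fun u v x y h h' hne => G.arc_meet u v x y h.1 h'.1 hne

/-- `G` has a proper coloring from the lists `L`. -/
def HasLColoring (G : PlaneGraph V) (L : V → Finset ℕ) : Prop :=
  ∃ φ : V → ℕ, (∀ v ∈ G.verts, φ v ∈ L v) ∧ ∀ u v, G.Adj u v → φ u ≠ φ v

/-- A vertex of degree exactly one. -/
def DegreeOne (G : PlaneGraph V) (x : V) : Prop :=
  (∃ a, G.Adj x a) ∧ ∀ a b, G.Adj x a → G.Adj x b → a = b

end PlaneGraph

/-- The cyclic successor of an index in a list. -/
def cycNext {V : Type u} (C : List V) (i : Fin C.length) : Fin C.length :=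
  ⟨((i : ℕ) + 1) % C.length, Nat.mod_lt _ (lt_of_le_of_lt (Nat.zero_le _) i.isLt)⟩

/-- The list `C` is a cycle of `G` whose image is exactly the boundary of the
outer face of `G`; i.e. `G` is a plane graph with outer cycle `C`. -/
def PlaneGraph.IsOuterCycle {V : Type u} (G : PlaneGraph V) (C : List V) : Prop :=
  C.Nodup ∧ 3 ≤ C.length ∧ (∀ v ∈ C, v ∈ G.verts) ∧
  (∀ i : Fin C.length, G.Adj (C.get i) (C.get (cycNext C i))) ∧
  frontier G.outerFace =
    G.pos '' {v | v ∈ C} ∪ ⋃ i : Fin C.length, G.arc s(C.get i, C.get (cycNext C i))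

/-- `pq` is an edge of the cycle (given as a list) `C`. -/
def IsCycleEdge {V : Type u} (C : List V) (p q : V) : Prop :=
  ∃ i : Fin C.length, s(p, q) = s(C.get i, C.get (cycNext C i))

/-- `(G, S, L)` is a canvas, where the subgraph `S` of the boundary of the
outer face of `G` is given by its vertex set `Sverts` and adjacency `SAdj`. -/
structure IsCanvas {V : Type u} (G : PlaneGraph V) (Sverts : Set V) (SAdj : V → V → Prop)
    (L : V → Finset ℕ) : Prop where
  sadj_symm : ∀ u v, SAdj u v → SAdj v u
  sadj_sub : ∀ u v, SAdj u v → G.Adj u v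
  sadj_mem : ∀ u v, SAdj u v → u ∈ Sverts
  sverts_sub : Sverts ⊆ G.verts
  sverts_outer : ∀ v ∈ Sverts, G.OnOuter v
  sedges_outer : ∀ u v, SAdj u v → G.EdgeOnOuter u v
  lists_nonempty : ∀ v ∈ G.verts, (L v).Nonempty
  card_inner : ∀ v ∈ G.verts, ¬G.OnOuter v → 5 ≤ (L v).card
  card_outside_S : ∀ v ∈ G.verts, v ∉ Sverts → 3 ≤ (L v).card
  scolorable : ∃ φ : V → ℕ, (∀ v ∈ Sverts, φ v ∈ L v) ∧ ∀ u v, SAdj u v → φ u ≠ φ v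

/-- The adjacency relation of the single-edge path `p₁p₂`. -/
def pathAdj {V : Type u} (p1 p2 : V) : V → V → Prop :=
  fun u v => (u = p1 ∧ v = p2) ∨ (u = p2 ∧ v = p1)

/-- `(G, P, L)` is a canvas whose precolored subgraph is a path `P = p₁p₂` of
length one (in the boundary of the outer face of `G`). -/
def IsPathCanvas {V : Type u} (G : PlaneGraph V) (p1 p2 : V) (L : V → Finset ℕ) : Prop :=
  p1 ≠ p2 ∧ IsCanvas G {p1, p2} (pathAdj p1 p2) L

/-- `c = (c₁, c₂)` is a proper `L`-coloring of the edge `p₁p₂`. -/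
def ProperEdgeColoring {V : Type u} (L : V → Finset ℕ) (p1 p2 : V) (c : ℕ × ℕ) : Prop :=
  c.1 ∈ L p1 ∧ c.2 ∈ L p2 ∧ c.1 ≠ c.2

/-- `Φ_T(P', 𝒞)`: the colorings of the edge `q₁q₂` extendable to an `L`-coloring
of `G` whose restriction to `p₁p₂` lies in `C`. -/
def Phi {V : Type u} (G : PlaneGraph V) (L : V → Finset ℕ) (p1 p2 q1 q2 : V)
    (C : Set (ℕ × ℕ)) : Set (ℕ × ℕ) :=
  {c | ∃ φ : V → ℕ, (∀ v ∈ G.verts, φ v ∈ L v) ∧ (∀ u v, G.Adj u v → φ u ≠ φ v) ∧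
    (φ p1, φ p2) ∈ C ∧ φ q1 = c.1 ∧ φ q2 = c.2}

/-- The set of colors used on the first vertex of the path. -/
def fstColors (C : Set (ℕ × ℕ)) : Set ℕ := Prod.fst '' C

/-- The set of colors used on the second vertex of the path. -/
def sndColors (C : Set (ℕ × ℕ)) : Set ℕ := Prod.snd '' C

/-- A dictatorship: at least two (distinct) colorings, all agreeing on one of
the two vertices (the dictator). -/
def IsDictatorship (C : Set (ℕ × ℕ)) : Prop :=
  (∃ c ∈ C, ∃ d ∈ C, c ≠ d) ∧
  ((∃ a, ∀ c ∈ C, c.1 = a) ∨ (∃ a, ∀ c ∈ C, c.2 = a))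

/-- A democracy: exactly the two colorings `(x, y)` and `(y, x)`. -/
def IsDemocracy (C : Set (ℕ × ℕ)) : Prop :=
  ∃ x y : ℕ, x ≠ y ∧ C = {(x, y), (y, x)}

/-- A government is a dictatorship or a democracy. -/
def IsGovernment (C : Set (ℕ × ℕ)) : Prop := IsDictatorship C ∨ IsDemocracy C

/-- A confederacy: not a government, but the union of two governments. -/
def IsConfederacy (C : Set (ℕ × ℕ)) : Prop :=
  ¬IsGovernment C ∧ ∃ C1 C2 : Set (ℕ × ℕ), IsGovernment C1 ∧ IsGovernment C2 ∧ C = C1 ∪ C2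

/-- The canvas `(G, p₁p₂, L)` is a harmonica from the path `p₁p₂` to the path
`q₁q₂` with government `C`. -/
inductive IsHarmonica {V : Type u} (L : V → Finset ℕ) :
    PlaneGraph V → V → V → V → V → Set (ℕ × ℕ) → Prop where
  /-- Rule (i): `G = P = P'`. -/
  | same (G : PlaneGraph V) (p1 p2 q1 q2 : V) (C : Set (ℕ × ℕ))
      (hcanvas : IsPathCanvas G p1 p2 L)
      (hproper : ∀ c ∈ C, ProperEdgeColoring L p1 p2 c)
      (hgov : IsGovernment C)
      (hq : (q1 = p1 ∧ q2 = p2) ∨ (q1 = p2 ∧ q2 = p1))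
      (hverts : G.verts = {p1, p2})
      (hedges : ∀ u v, G.Adj u v → pathAdj p1 p2 u v) :
      IsHarmonica L G p1 p2 q1 q2 C
  /-- Rule (ii): `C` is a dictatorship, `G = P ∪ P'`, `V(P) ∩ V(P') = {z}`
  where `z` is the dictator. -/
  | cherry (G : PlaneGraph V) (p1 p2 q1 q2 z : V) (C : Set (ℕ × ℕ))
      (hcanvas : IsPathCanvas G p1 p2 L)
      (hproper : ∀ c ∈ C, ProperEdgeColoring L p1 p2 c)
      (hdict : IsDictatorship C)
      (hq : q1 ≠ q2) (hqadj : G.Adj q1 q2) (hqout : G.EdgeOnOuter q1 q2)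
      (hverts : G.verts = {p1, p2, q1, q2})
      (hedges : ∀ u v, G.Adj u v → pathAdj p1 p2 u v ∨ pathAdj q1 q2 u v)
      (hz : (({p1, p2} : Set V) ∩ ({q1, q2} : Set V)) = {z})
      (hzdict : (z = p1 ∧ ∃ a, ∀ c ∈ C, c.1 = a) ∨ (z = p2 ∧ ∃ a, ∀ c ∈ C, c.2 = a)) :
      IsHarmonica L G p1 p2 q1 q2 C
  /-- Rule (iii): `C` is a dictatorship with dictator `z ∈ V(P)` in color `c`,
  sitting on a triangle `z u₁ u₂`. -/
  | dict (G : PlaneGraph V) (p1 p2 q1 q2 z w u1 u2 : V) (c : ℕ) (L0 : Finset ℕ)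
      (C C' : Set (ℕ × ℕ))
      (hcanvas : IsPathCanvas G p1 p2 L)
      (hproper : ∀ d ∈ C, ProperEdgeColoring L p1 p2 d)
      (hdict : IsDictatorship C)
      (hq : q1 ≠ q2) (hqadj : G.Adj q1 q2) (hqout : G.EdgeOnOuter q1 q2)
      (hz : (z = p1 ∧ w = p2 ∧ (∀ d ∈ C, d.1 = c) ∧
              (u1 = w → sndColors C = (L0 : Set ℕ)) ∧
              (u2 = w → sndColors C = (L0 : Set ℕ))) ∨
            (z = p2 ∧ w = p1 ∧ (∀ d ∈ C, d.2 = c) ∧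
              (u1 = w → fstColors C = (L0 : Set ℕ)) ∧
              (u2 = w → fstColors C = (L0 : Set ℕ))))
      (hzu1 : G.Adj z u1) (hzu2 : G.Adj z u2) (hu12 : G.Adj u1 u2)
      (hL0 : L0.card = 2)
      (hLu1 : u1 ∉ ({p1, p2} : Set V) → L u1 = L0 ∪ {c})
      (hLu2 : u2 ∉ ({p1, p2} : Set V) → L u2 = L0 ∪ {c})
      (hu1P : u1 ∈ ({p1, p2} : Set V) → u1 = w)
      (hu2P : u2 ∈ ({p1, p2} : Set V) → u2 = w)
      (hdem : IsDemocracy C')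
      (hC'1 : fstColors C' = (L0 : Set ℕ)) (hC'2 : sndColors C' = (L0 : Set ℕ))
      (hrec : IsHarmonica L (G.deleteVerts (({p1, p2} : Set V) \ {u1, u2})) u1 u2 q1 q2 C') :
      IsHarmonica L G p1 p2 q1 q2 C
  /-- Rule (iv), with `i = 1`: `C` is a democracy, `z` is a common neighbor of
  `p₁, p₂`, and `p₁` is deleted. -/
  | demo1 (G : PlaneGraph V) (p1 p2 q1 q2 z : V) (a b c : ℕ) (L0 : Finset ℕ)
      (C C' : Set (ℕ × ℕ))
      (hcanvas : IsPathCanvas G p1 p2 L)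
      (hproper : ∀ d ∈ C, ProperEdgeColoring L p1 p2 d)
      (hdemC : IsDemocracy C)
      (hq : q1 ≠ q2) (hqadj : G.Adj q1 q2) (hqout : G.EdgeOnOuter q1 q2)
      (hz1 : G.Adj z p1) (hz2 : G.Adj z p2)
      (hLz : L z = L0 ∪ {c})
      (hC1 : fstColors C = (L0 : Set ℕ)) (hC2 : sndColors C = (L0 : Set ℕ))
      (hab : a ≠ b) (hL0ab : (L0 : Set ℕ) = {a, b})
      (hC' : C' = {(c, a), (c, b)})
      (hrec : IsHarmonica L (G.deleteVerts {p1}) z p2 q1 q2 C') :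
      IsHarmonica L G p1 p2 q1 q2 C
  /-- Rule (iv), with `i = 2`: `C` is a democracy, `z` is a common neighbor of
  `p₁, p₂`, and `p₂` is deleted. -/
  | demo2 (G : PlaneGraph V) (p1 p2 q1 q2 z : V) (a b c : ℕ) (L0 : Finset ℕ)
      (C C' : Set (ℕ × ℕ))
      (hcanvas : IsPathCanvas G p1 p2 L)
      (hproper : ∀ d ∈ C, ProperEdgeColoring L p1 p2 d)
      (hdemC : IsDemocracy C)
      (hq : q1 ≠ q2) (hqadj : G.Adj q1 q2) (hqout : G.EdgeOnOuter q1 q2)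
      (hz1 : G.Adj z p1) (hz2 : G.Adj z p2)
      (hLz : L z = L0 ∪ {c})
      (hC1 : fstColors C = (L0 : Set ℕ)) (hC2 : sndColors C = (L0 : Set ℕ))
      (hab : a ≠ b) (hL0ab : (L0 : Set ℕ) = {a, b})
      (hC' : C' = {(c, a), (c, b)})
      (hrec : IsHarmonica L (G.deleteVerts {p2}) z p1 q1 q2 C') :
      IsHarmonica L G p1 p2 q1 q2 C

/-- `(G, L)` is a coloring harmonica from `uv` to `w` (source `Sum.inr (u, v)`)
or from `u` to `w` (source `Sum.inl u`). -/
inductive IsColoringHarmonica {V : Type u} [DecidableEq V] :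
    PlaneGraph V → (V → Finset ℕ) → V ⊕ V × V → V → Prop where
  /-- `G` is a triangle with vertex set `{u, v, w}`, `L(u) = L(v) = L(w)` and
  `|L(u)| = 2`. -/
  | tri (G : PlaneGraph V) (L : V → Finset ℕ) (u v w : V)
      (hconn : G.Connected) (huv : u ≠ v) (huw : u ≠ w) (hvw : v ≠ w)
      (hu : G.OnOuter u) (hv : G.OnOuter v) (hw : G.OnOuter w)
      (huvout : G.EdgeOnOuter u v)
      (hverts : G.verts = {u, v, w})
      (hadjuv : G.Adj u v) (hadjvw : G.Adj v w) (hadjuw : G.Adj u w)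
      (hLuv : L u = L v) (hLvw : L v = L w) (hcard : (L u).card = 2) :
      IsColoringHarmonica G L (Sum.inr (u, v)) w
  /-- There is a triangle `uvz` on the outer face; delete one or both of
  `u, v` and recurse from `z`. -/
  | step (G : PlaneGraph V) (L : V → Finset ℕ) (u v w z : V) (s : Set V)
      (hconn : G.Connected) (huv : u ≠ v) (huw : u ≠ w) (hvw : v ≠ w)
      (hu : G.OnOuter u) (hv : G.OnOuter v) (hw : G.OnOuter w)
      (huvout : G.EdgeOnOuter u v)
      (hadjuv : G.Adj u v) (hadjuz : G.Adj u z) (hadjvz : G.Adj v z)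
      (hz : G.OnOuter z)
      (hLuv : L u = L v) (hsub : L u ⊆ L z)
      (hcardu : (L u).card = 2) (hcardz : (L z).card = 3)
      (hs : s = {u} ∨ s = {v} ∨ s = ({u, v} : Set V))
      (hrec : IsColoringHarmonica (G.deleteVerts s)
        (Function.update L z (L z \ L u)) (Sum.inl z) w) :
      IsColoringHarmonica G L (Sum.inr (u, v)) w
  /-- `|L(u)| = 1`, `u` sits on a triangle `uxy`; delete `u` and recurse
  from `xy`. -/
  | vert (G : PlaneGraph V) (L : V → Finset ℕ) (u w x y : V)
      (hconn : G.Connected) (huw : u ≠ w)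
      (hu : G.OnOuter u) (hw : G.OnOuter w)
      (hx : G.OnOuter x) (hy : G.OnOuter y)
      (hadjux : G.Adj u x) (hadjuy : G.Adj u y) (hadjxy : G.Adj x y)
      (hcardu : (L u).card = 1)
      (hLxy : L x \ L u = L y \ L u) (hcardx : (L x \ L u).card = 2)
      (hrec : IsColoringHarmonica (G.deleteVerts {u})
        (Function.update (Function.update L x (L x \ L u)) y (L y \ L u))
        (Sum.inr (x, y)) w) :
      IsColoringHarmonica G L (Sum.inl u) w

/-- `(G, L)` contains a coloring harmonica `(H, L')` with the given source and
target: `H` is a subgraph of `G` and `L'` agrees with `L` on `V(H)`. -/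
def ContainsColoringHarmonica {V : Type u} [DecidableEq V] (G : PlaneGraph V)
    (L : V → Finset ℕ) (st : V ⊕ V × V) (w : V) : Prop :=
  ∃ (H : PlaneGraph V) (L' : V → Finset ℕ), H.IsSubgraph G ∧
    (∀ x ∈ H.verts, L' x = L x) ∧ IsColoringHarmonica H L' st w

/-- `v` is a cutvertex of the boundary of the outer face of `G`. -/
def BoundaryCutvertex {V : Type u} (G : PlaneGraph V) (v : V) : Prop :=
  ∃ a b : V, a ∈ G.boundaryVerts ∧ b ∈ G.boundaryVerts ∧ a ≠ v ∧ b ≠ v ∧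
    Relation.ReflTransGen (fun x y => G.Adj x y ∧ G.EdgeOnOuter x y) a b ∧
    ¬Relation.ReflTransGen
      (fun x y => G.Adj x y ∧ G.EdgeOnOuter x y ∧ x ≠ v ∧ y ≠ v) a b

open Classical in
/-- The list assignment of the democratic reduction `T(P, L0, x)`:
remove the colors of `L0` from the list of `x` and from the lists of all
neighbors of `P` other than `y`. -/
noncomputable def reducedL {V : Type u} (G : PlaneGraph V) (L : V → Finset ℕ)
    (L0 : Finset ℕ) (Q : List V) (x y : V) : V → Finset ℕ := fun w =>
  if w = x ∨ (w ≠ y ∧ ∃ p ∈ Q, G.Adj w p) then L w \ L0 else L w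

/-- The vertex set of the precolored subgraph of the democratic reduction:
`S ∖ V(P)`, together with `x` as an isolated vertex if its new list is
smaller than 3. -/
def reducedSverts {V : Type u} (Sverts : Set V) (Q : List V) (x : V)
    (L' : V → Finset ℕ) : Set V :=
  {v | (v ∈ Sverts ∧ v ∉ Q) ∨ (v = x ∧ (L' x).card < 3)}

/-- The adjacency of the precolored subgraph of the democratic reduction:
`S ∖ V(P)`. -/
def reducedSAdj {V : Type u} (SAdj : V → V → Prop) (Q : List V) : V → V → Prop :=
  fun u v => SAdj u v ∧ u ∉ Q ∧ v ∉ Q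

namespace GE

open Function

section
variable {α : Type u} {G : SimpleGraph α} {S T X Y Z A W W' K E R : Set α}
  {u v w x y z r t s q1 q2 p1 p2 : α} {L L' : α → Finset ℕ} {φ ψ χ κ : α → ℕ}
  {L0 X0 Xs Y0 Ys Us : Finset ℕ}

/-! ## Connectivity and minor models -/

/-- Reachability inside the set `S`. -/
def Rch (G : SimpleGraph α) (S : Set α) (u v : α) : Prop :=
  Relation.ReflTransGen (fun a b => G.Adj a b ∧ a ∈ S ∧ b ∈ S) u v

/-- The set `X` induces a (pre)connected subgraph. -/
def Conn (G : SimpleGraph α) (X : Set α) : Prop := ∀ x ∈ X, ∀ y ∈ X, Rch G X x y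

/-- There is an edge between `X` and `Y`. -/
def Adjs (G : SimpleGraph α) (X Y : Set α) : Prop := ∃ x ∈ X, ∃ y ∈ Y, G.Adj x y

/-- The component of `u` in the set `S`. -/
def comp (G : SimpleGraph α) (S : Set α) (u : α) : Set α := {v | u ∈ S ∧ Rch G S u v}

/-- No `K₅` model and no `K₃₃` model. -/
structure NM (G : SimpleGraph α) : Prop where
  k5 : ∀ X : Fin 5 → Set α, (∀ i, (X i).Nonempty) → (∀ i, Conn G (X i)) →
    (∀ i j, i < j → Disjoint (X i) (X j)) → (∀ i j, i < j → Adjs G (X i) (X j)) → False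
  k33 : ∀ X Y : Fin 3 → Set α, (∀ i, (X i).Nonempty) → (∀ i, (Y i).Nonempty) →
    (∀ i, Conn G (X i)) → (∀ i, Conn G (Y i)) →
    (∀ i j, i < j → Disjoint (X i) (X j)) → (∀ i j, i < j → Disjoint (Y i) (Y j)) →
    (∀ i j, Disjoint (X i) (Y j)) → (∀ i j, Adjs G (X i) (Y j)) → False

lemma Rch.symm (h : Rch G S u v) : Rch G S v u := by
  induction h with
  | refl => exact .refl
  | tail _ h ih => exact Relation.ReflTransGen.head ⟨h.1.symm, h.2.2, h.2.1⟩ ih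

lemma Rch.trans (h : Rch G S u v) (h' : Rch G S v w) : Rch G S u w :=
  Relation.ReflTransGen.trans h h'

lemma Rch.mono (h : Rch G S u v) (hS : S ⊆ T) : Rch G T u v :=
  Relation.ReflTransGen.mono (fun _ _ h => ⟨h.1, hS h.2.1, hS h.2.2⟩) _ _ h

lemma Rch.of_adj (h : G.Adj u v) (hu : u ∈ S) (hv : v ∈ S) : Rch G S u v :=
  .single ⟨h, hu, hv⟩

lemma Rch.closed (h : Rch G S u v) (hu : u ∈ X)
    (hX : ∀ a ∈ X, ∀ b ∈ S, G.Adj a b → b ∈ X) : v ∈ X := by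
  induction h with
  | refl => exact hu
  | tail _ h ih => exact hX _ ih _ h.2.2 h.1

lemma comp_sub : comp G S u ⊆ S := fun v hv => by
  exact hv.2.closed hv.1 (fun _ _ b hb _ => hb)

lemma mem_comp (hu : u ∈ S) : u ∈ comp G S u := ⟨hu, .refl⟩

lemma comp_closed (hv : v ∈ comp G S u) (hw : w ∈ S) (h : G.Adj v w) : w ∈ comp G S u :=
  ⟨hv.1, hv.2.trans (Rch.of_adj h (comp_sub hv) hw)⟩

lemma comp_conn : Conn G (comp G S u) := by
  have key : ∀ v, Rch G S u v → u ∈ S → Rch G (comp G S u) u v := by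
    intro v h hu
    induction h with
    | refl => exact .refl
    | tail h1 h2 ih =>
      refine ih.trans (Rch.of_adj h2.1 ⟨hu, h1⟩ ⟨hu, ?_⟩)
      exact Rch.trans h1 (Rch.of_adj h2.1 h2.2.1 h2.2.2)
  intro a ha b hb
  exact (key a ha.2 ha.1).symm.trans (key b hb.2 hb.1)

lemma comp_eq_of_mem (hv : v ∈ comp G S u) : comp G S v = comp G S u := by
  ext w; constructor
  · intro h; exact ⟨hv.1, hv.2.trans h.2⟩
  · intro h; exact ⟨comp_sub hv, hv.2.symm.trans h.2⟩

lemma comp_disj (h : comp G S u ≠ comp G S v) : Disjoint (comp G S u) (comp G S v) := by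
  rw [Set.disjoint_left]
  intro w hu hv
  exact h ((comp_eq_of_mem hu).symm.trans (comp_eq_of_mem hv))

lemma comp_nonempty (hu : u ∈ S) : (comp G S u).Nonempty := ⟨u, mem_comp hu⟩

lemma Adjs.symm (h : Adjs G X Y) : Adjs G Y X := by
  obtain ⟨x, hx, y, hy, h⟩ := h; exact ⟨y, hy, x, hx, h.symm⟩

lemma Adjs.mono (h : Adjs G X Y) (hX : X ⊆ S) (hY : Y ⊆ T) : Adjs G S T := by
  obtain ⟨x, hx, y, hy, h⟩ := h; exact ⟨x, hX hx, y, hY hy, h⟩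

lemma Adjs.of (h : G.Adj x y) (hx : x ∈ X) (hy : y ∈ Y) : Adjs G X Y := ⟨x, hx, y, hy, h⟩

lemma conn_single : Conn G {x} := by
  rintro a rfl b rfl; exact .refl

lemma conn_union (hX : Conn G X) (hY : Conn G Y) (h : Adjs G X Y) : Conn G (X ∪ Y) := by
  obtain ⟨x, hx, y, hy, h⟩ := h
  have hx' : ∀ a ∈ X ∪ Y, Rch G (X ∪ Y) x a := by
    rintro a (ha | ha)
    · exact (hX x hx a ha).mono subset_union_left
    · exact (Rch.of_adj h (.inl hx) (.inr hy)).trans ((hY y hy a ha).mono subset_union_right)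
  intro a ha b hb
  exact (hx' a ha).symm.trans (hx' b hb)

lemma conn_insert (hX : Conn G X) (h : Adjs G {x} X) : Conn G (insert x X) :=
  conn_union conn_single hX h

/-- explicit form of the `K₅` obstruction -/
lemma NM.k5' (h : NM G) {a b c d e : Set α}
    (na : a.Nonempty) (nb : b.Nonempty) (nc : c.Nonempty) (nd : d.Nonempty) (ne : e.Nonempty)
    (ca : Conn G a) (cb : Conn G b) (cc : Conn G c) (cd : Conn G d) (ce : Conn G e)
    (dab : Disjoint a b) (dac : Disjoint a c) (dad : Disjoint a d) (dae : Disjoint a e)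
    (dbc : Disjoint b c) (dbd : Disjoint b d) (dbe : Disjoint b e)
    (dcd : Disjoint c d) (dce : Disjoint c e) (dde : Disjoint d e)
    (ab : Adjs G a b) (ac : Adjs G a c) (ad : Adjs G a d) (ae : Adjs G a e)
    (bc : Adjs G b c) (bd : Adjs G b d) (be : Adjs G b e)
    (cd' : Adjs G c d) (ce' : Adjs G c e) (de : Adjs G d e) : False := by
  refine h.k5 ![a, b, c, d, e] ?_ ?_ ?_ ?_
  iterate 2 (intro i; fin_cases i <;> simpa)
  all_goals intro i j hij; fin_cases i <;> fin_cases j <;>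
    first | exact absurd hij (by decide) | assumption

/-- explicit form of the `K₃₃` obstruction -/
lemma NM.k33' (h : NM G) {a b c x y z : Set α}
    (na : a.Nonempty) (nb : b.Nonempty) (nc : c.Nonempty)
    (nx : x.Nonempty) (ny : y.Nonempty) (nz : z.Nonempty)
    (ca : Conn G a) (cb : Conn G b) (cc : Conn G c) (cx : Conn G x) (cy : Conn G y) (cz : Conn G z)
    (dab : Disjoint a b) (dac : Disjoint a c) (dbc : Disjoint b c)
    (dxy : Disjoint x y) (dxz : Disjoint x z) (dyz : Disjoint y z)
    (dax : Disjoint a x) (day : Disjoint a y) (daz : Disjoint a z)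
    (dbx : Disjoint b x) (dby : Disjoint b y) (dbz : Disjoint b z)
    (dcx : Disjoint c x) (dcy : Disjoint c y) (dcz : Disjoint c z)
    (ax : Adjs G a x) (ay : Adjs G a y) (az : Adjs G a z)
    (bx : Adjs G b x) (by' : Adjs G b y) (bz : Adjs G b z)
    (cx' : Adjs G c x) (cy' : Adjs G c y) (cz' : Adjs G c z) : False := by
  refine h.k33 ![a, b, c] ![x, y, z] ?_ ?_ ?_ ?_ ?_ ?_ ?_ ?_
  iterate 4 (intro i; fin_cases i <;> simpa)
  iterate 2 (intro i j hij; fin_cases i <;> fin_cases j <;>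
    first | exact absurd hij (by decide) | assumption)
  all_goals intro i j; fin_cases i <;> fin_cases j <;> assumption

/-- boundary vertices: neighbours of the apex blob -/
def Bd (G : SimpleGraph α) (A : Set α) (v : α) : Prop := ∃ a ∈ A, G.Adj a v

/-- Standing assumptions. -/
structure Ctx (G : SimpleGraph α) (A W : Set α) : Prop where
  nm : NM G
  conn : Conn G A
  ne : A.Nonempty
  disj : ∀ a ∈ A, a ∉ W
  fin : W.Finite

lemma Bd.adjs (h : Bd G A v) (hv : v ∈ X) : Adjs G A X := by
  obtain ⟨a, ha, h⟩ := h; exact ⟨a, ha, v, hv, h⟩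

lemma Bd.mono (h : Bd G A v) (hA : A ⊆ X) : Bd G X v := by
  obtain ⟨a, ha, h⟩ := h; exact ⟨a, hA ha, h⟩

lemma Ctx.sub (h : Ctx G A W) (hS : S ⊆ W) : Ctx G A S :=
  ⟨h.nm, h.conn, h.ne, fun a ha hS' => h.disj a ha (hS hS'), h.fin.subset hS⟩

lemma Ctx.del (h : Ctx G A W) (hv : Bd G A v) : Ctx G (insert v A) (W \ {v}) := by
  refine ⟨h.nm, conn_insert h.conn (hv.adjs (mem_singleton v)).symm, ⟨v, by simp⟩, ?_, h.fin.subset sdiff_subset⟩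
  rintro a (rfl | ha) ⟨h1, h2⟩
  · exact h2 rfl
  · exact h.disj a ha h1

lemma Ctx.single (h : Ctx G A W) : Ctx G {w} (W \ {w}) := by
  refine ⟨h.nm, conn_single, ⟨w, rfl⟩, ?_, h.fin.subset sdiff_subset⟩
  rintro a rfl ⟨h1, h2⟩
  exact h2 rfl

/-- `K` is closed in `S`. -/
def Clo (G : SimpleGraph α) (S K : Set α) : Prop :=
  K ⊆ S ∧ ∀ k ∈ K, ∀ w ∈ S, G.Adj k w → w ∈ K

lemma clo_comp : Clo G S (comp G S u) := ⟨comp_sub, fun _ hk _ hw h => comp_closed hk hw h⟩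

lemma Clo.compl (h : Clo G S K) : Clo G S (S \ K) :=
  ⟨sdiff_subset, fun k hk w hw hkw => ⟨hw, fun hwK => hk.2 (h.2 w hwK k hk.1 hkw.symm)⟩⟩

/-- Linking lemma. -/
lemma link_aux (h : Rch G S x w) (hxS : x ∈ S) (hwS : w ∈ S) (hxw : x ≠ w) :
    G.Adj x w ∨ ∃ c ∈ S \ {x, w}, Adjs G {x} (comp G (S \ {x, w}) c) ∧
      Adjs G {w} (comp G (S \ {x, w}) c) := by
  by_contra hcon
  push Not at hcon
  obtain ⟨h1, h2⟩ := hcon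
  have hw : w ∈ ({x} ∪ {c | c ∈ S \ {x, w} ∧ Adjs G {x} (comp G (S \ {x, w}) c)} : Set α) := by
    refine h.closed (.inl rfl) ?_
    rintro a ha b hb hab
    by_cases hbx : b = x
    · left; exact hbx
    right
    rcases ha with rfl | ⟨ha1, ha2⟩
    · have hbw : b ≠ w := by rintro rfl; exact h1 hab
      have hb' : b ∈ S \ {a, w} := ⟨hb, by simp [hbx, hbw]⟩
      exact ⟨hb', a, rfl, b, mem_comp hb', hab⟩
    · have hbw : b ≠ w := by
        rintro rfl
        exact h2 a ha1 ha2 ⟨b, rfl, a, mem_comp ha1, hab.symm⟩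
      have hb' : b ∈ S \ {x, w} := ⟨hb, by simp [hbx, hbw]⟩
      refine ⟨hb', ?_⟩
      rwa [comp_eq_of_mem (comp_closed (mem_comp ha1) hb' hab)]
  rcases hw with hw | hw
  · exact hxw hw.symm
  · exact hw.1.2 (by simp)

/-- A (possibly empty) connected set in `T` linking `x` to `w`. -/
def Lnk (G : SimpleGraph α) (T : Set α) (x w : α) (C : Set α) : Prop :=
  (C = ∅ ∧ G.Adj x w) ∨ ∃ c ∈ T, C = comp G T c ∧ Adjs G {x} C ∧ Adjs G {w} C

lemma lnk_exists (h : Rch G S x w) (hxS : x ∈ S) (hwS : w ∈ S) (hxw : x ≠ w) :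
    ∃ C, Lnk G (S \ {x, w}) x w C := by
  rcases link_aux h hxS hwS hxw with h | ⟨c, hc, h1, h2⟩
  · exact ⟨∅, .inl ⟨rfl, h⟩⟩
  · exact ⟨_, .inr ⟨c, hc, rfl, h1, h2⟩⟩

lemma Lnk.conn {C : Set α} (h : Lnk G T x w C) : Conn G ({x} ∪ C) := by
  rcases h with ⟨rfl, _⟩ | ⟨c, _, rfl, h1, _⟩
  · simpa using conn_single
  · exact conn_union conn_single comp_conn h1

lemma Lnk.adjs {C : Set α} (h : Lnk G T x w C) (hw : w ∈ Y) : Adjs G ({x} ∪ C) Y := by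
  rcases h with ⟨rfl, h⟩ | ⟨c, _, rfl, _, h1⟩
  · exact ⟨x, by simp, w, hw, h⟩
  · exact h1.symm.mono subset_union_right (by simpa using hw)

lemma Lnk.sub {C : Set α} (h : Lnk G T x w C) : C ⊆ T := by
  rcases h with ⟨rfl, _⟩ | ⟨c, _, rfl, _, _⟩
  · simp
  · exact comp_sub

lemma Lnk.disj {C D : Set α} {x' w' : α} (h : Lnk G T x w C) (h' : Lnk G T x' w' D) :
    Disjoint C D ∨ (∃ c ∈ T, C = comp G T c ∧ Adjs G {x} C ∧ Adjs G {w} C ∧ Adjs G {x'} C ∧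
      Adjs G {w'} C) := by
  rcases h with ⟨rfl, _⟩ | ⟨c, hc, rfl, h1, h2⟩
  · simp
  rcases h' with ⟨rfl, _⟩ | ⟨d, hd, rfl, h3, h4⟩
  · simp
  by_cases hcd : comp G T c = comp G T d
  · right; exact ⟨c, hc, rfl, h1, h2, hcd ▸ h3, hcd ▸ h4⟩
  · left; exact comp_disj hcd

/-- Tripod lemma. -/
lemma tripod (h : Ctx G A W) (hv : v ∈ W) (hvB : Bd G A v) (hx : x ∈ W) (hy : y ∈ W) (hw : w ∈ W)
    (hxB : Bd G A x) (hyB : Bd G A y) (hwB : Bd G A w) (hxy : x ≠ y) (hxw : x ≠ w) (hyw : y ≠ w)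
    (hvx : G.Adj v x) (hvy : G.Adj v y) (hvw : G.Adj v w)
    (h1 : Rch G (W \ {v, y}) x w) (h2 : Rch G (W \ {v, w}) y x) (h3 : Rch G (W \ {v, x}) w y) :
    False := by
  have nvx := hvx.ne'
  have nvy := hvy.ne'
  have nvw := hvw.ne'
  set T := W \ {v, x, y, w} with hT
  have e1 : (W \ {v, y}) \ {x, w} = T := by ext; simp [hT]; tauto
  have e2 : (W \ {v, w}) \ {y, x} = T := by ext; simp [hT]; tauto
  have e3 : (W \ {v, x}) \ {w, y} = T := by ext; simp [hT]; tauto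
  obtain ⟨C1, l1⟩ := lnk_exists h1 ⟨hx, by simp [nvx, hxy]⟩ ⟨hw, by simp [nvw, hyw.symm]⟩ hxw
  obtain ⟨C2, l2⟩ := lnk_exists h2 ⟨hy, by simp [nvy, hyw]⟩ ⟨hx, by simp [nvx, hxw]⟩ hxy.symm
  obtain ⟨C3, l3⟩ := lnk_exists h3 ⟨hw, by simp [nvw, hxw.symm]⟩ ⟨hy, by simp [nvy, hxy.symm]⟩ hyw.symm
  rw [e1] at l1; rw [e2] at l2; rw [e3] at l3
  have hA := h.disj
  have hTA : ∀ t ∈ T, t ∉ A := fun t ht hA' => h.disj t hA' ht.1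
  have all3 : ∀ c ∈ T, Adjs G {x} (comp G T c) → Adjs G {y} (comp G T c) → Adjs G {w} (comp G T c)
      → False := by
    intro c hc ax ay aw
    have hCT : comp G T c ⊆ T := comp_sub
    have hC : ∀ t ∈ comp G T c, t ≠ v ∧ t ≠ x ∧ t ≠ y ∧ t ≠ w ∧ t ∉ A := by
      intro t ht
      have := hCT ht
      refine ⟨?_, ?_, ?_, ?_, hTA t this⟩ <;> rintro rfl <;> simp [hT] at this
    refine h.nm.k33' (a := A) (b := {v}) (c := comp G T c) (x := {x}) (y := {y}) (z := {w})
      h.ne ⟨v, rfl⟩ (comp_nonempty hc) ⟨x, rfl⟩ ⟨y, rfl⟩ ⟨w, rfl⟩ h.conn conn_single comp_conn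
      conn_single conn_single conn_single ?_ ?_ ?_ ?_ ?_ ?_ ?_ ?_ ?_ ?_ ?_ ?_ ?_ ?_ ?_
      (hxB.adjs rfl) (hyB.adjs rfl) (hwB.adjs rfl) (.of hvx rfl rfl) (.of hvy rfl rfl)
      (.of hvw rfl rfl) ax.symm ay.symm aw.symm
    all_goals (rw [Set.disjoint_left]; (try simp only [mem_singleton_iff]); grind)
  have d12 : Disjoint C1 C2 := by
    rcases l1.disj l2 with h | ⟨c, hc, rfl, a1, a2, a3, a4⟩
    · exact h
    · exact (all3 c hc a1 a3 a2).elim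
  have d13 : Disjoint C1 C3 := by
    rcases l1.disj l3 with h | ⟨c, hc, rfl, a1, a2, a3, a4⟩
    · exact h
    · exact (all3 c hc a1 a4 a2).elim
  have d23 : Disjoint C2 C3 := by
    rcases l2.disj l3 with h | ⟨c, hc, rfl, a1, a2, a3, a4⟩
    · exact h
    · exact (all3 c hc a2 a1 a3).elim
  have aux : ∀ C, C ⊆ T → ∀ t ∈ C, t ≠ v ∧ t ≠ x ∧ t ≠ y ∧ t ≠ w ∧ t ∉ A := by
    intro C hC t ht
    have := hC ht
    refine ⟨?_, ?_, ?_, ?_, hTA t this⟩ <;> rintro rfl <;> simp [hT] at this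
  have a1 := aux C1 l1.sub
  have a2 := aux C2 l2.sub
  have a3 := aux C3 l3.sub
  rw [Set.disjoint_left] at d12 d13 d23
  refine h.nm.k5' (a := A) (b := {v}) (c := {x} ∪ C1) (d := {y} ∪ C2) (e := {w} ∪ C3)
    h.ne ⟨v, rfl⟩ ⟨x, by simp⟩ ⟨y, by simp⟩ ⟨w, by simp⟩ h.conn conn_single l1.conn l2.conn l3.conn
    ?_ ?_ ?_ ?_ ?_ ?_ ?_ ?_ ?_ ?_ (hvB.adjs rfl) (hxB.adjs (by simp)) (hyB.adjs (by simp))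
    (hwB.adjs (by simp)) (.of hvx rfl (by simp)) (.of hvy rfl (by simp)) (.of hvw rfl (by simp))
    (l2.adjs (by simp)).symm (l1.adjs (by simp)) (l3.adjs (by simp)).symm
  all_goals (rw [Set.disjoint_left]; (try simp only [mem_singleton_iff, mem_union]); grind)

/-! ## Colorings and Thomassen's theorem -/

/-- proper list colorings of the subgraph induced by `W` -/
def Col (G : SimpleGraph α) (W : Set α) (L : α → Finset ℕ) (φ : α → ℕ) : Prop :=
  (∀ v ∈ W, φ v ∈ L v) ∧ ∀ u ∈ W, ∀ v ∈ W, G.Adj u v → φ u ≠ φ v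

/-- standard list sizes off the set `X` -/
def Std (G : SimpleGraph α) (A W : Set α) (L : α → Finset ℕ) (X : Set α) : Prop :=
  ∀ v ∈ W, v ∉ X → 3 ≤ (L v).card ∧ (¬ Bd G A v → 5 ≤ (L v).card)

lemma Col.mono (h : Col G W L φ) (hS : S ⊆ W) : Col G S L φ :=
  ⟨fun v hv => h.1 v (hS hv), fun u hu v hv => h.2 u (hS hu) v (hS hv)⟩

lemma Col.lists (h : Col G W L φ) (hL : ∀ v ∈ W, L v ⊆ L' v) : Col G W L' φ :=
  ⟨fun v hv => hL v hv (h.1 v hv), h.2⟩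

lemma Std.sub (h : Std G A W L X) (hS : S ⊆ W) : Std G A S L X :=
  fun v hv hX => h v (hS hv) hX

lemma Std.mono (h : Std G A W L X) (hS : X ⊆ Y) : Std G A W L Y :=
  fun v hv hX => h v hv (fun h => hX (hS h))

lemma Std.congr (h : Std G A W L X) (hL : ∀ v ∈ W, v ∉ X → L' v = L v) : Std G A W L' X :=
  fun v hv hX => by rw [hL v hv hX]; exact h v hv hX

/-- Glue a coloring of `W \ K` and a coloring of `K ∪ E`. -/
lemma glue (hK : Clo G (W \ E) K) (h1 : Col G (W \ K) L φ) (h2 : Col G (K ∪ E) L χ)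
    (hE : ∀ e ∈ E, e ∈ W → χ e = φ e) :
    ∃ ψ, Col G W L ψ ∧ (∀ v ∈ W, v ∉ K → ψ v = φ v) ∧ (∀ v ∈ K, ψ v = χ v) := by
  classical
  refine ⟨fun v => if v ∈ K then χ v else φ v, ⟨?_, ?_⟩, ?_, ?_⟩
  · intro v hv
    by_cases h : v ∈ K
    · simp only [h, if_true]; exact h2.1 v (.inl h)
    · simp only [h, if_false]; exact h1.1 v ⟨hv, h⟩
  · have key : ∀ u ∈ W, ∀ v ∈ W, u ∈ K → v ∉ K → G.Adj u v → χ u ≠ φ v := by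
      intro u hu v hv hku hkv huv
      have : v ∈ E := by
        by_contra hvE
        exact hkv (hK.2 u hku v ⟨hv, hvE⟩ huv)
      rw [← hE v this hv]
      exact h2.2 u (.inl hku) v (.inr this) huv
    intro u hu v hv huv
    by_cases h : u ∈ K <;> by_cases h' : v ∈ K <;> simp only [h, h', if_true, if_false]
    · exact h2.2 u (.inl h) v (.inl h') huv
    · exact key u hu v hv h h' huv
    · exact (key v hv u hu h' h huv.symm).symm
    · exact h1.2 u ⟨hu, h⟩ v ⟨hv, h'⟩ huv
  · intro v _ h; simp [h]
  · intro v h; simp [h]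

/-- boundary neighbours of `v` -/
def Nb (G : SimpleGraph α) (A W : Set α) (v x : α) : Prop := x ∈ W ∧ Bd G A x ∧ G.Adj v x

/-- three boundary neighbours -/
def H3 (G : SimpleGraph α) (A W : Set α) (v : α) : Prop :=
  ∃ x y w, Nb G A W v x ∧ Nb G A W v y ∧ Nb G A W v w ∧ x ≠ y ∧ x ≠ w ∧ y ≠ w

lemma tri_sep (h : Ctx G A W) (hv : v ∈ W) (hvB : Bd G A v)
    (hx : Nb G A W v x) (hy : Nb G A W v y) (hw : Nb G A W v w)
    (hxy : x ≠ y) (hxw : x ≠ w) (hyw : y ≠ w) :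
    (¬ Rch G (W \ {v, y}) x w) ∨ (¬ Rch G (W \ {v, w}) y x) ∨ (¬ Rch G (W \ {v, x}) w y) := by
  by_contra hc
  push Not at hc
  exact tripod h hv hvB hx.1 hy.1 hw.1 hx.2.1 hy.2.1 hw.2.1 hxy hxw hyw hx.2.2 hy.2.2 hw.2.2
    hc.1 hc.2.1 hc.2.2

lemma sep_clo (h : ¬ Rch G S x w) (hx : x ∈ S) (hw : w ∈ S) :
    Clo G S (comp G S x) ∧ x ∈ comp G S x ∧ w ∉ comp G S x :=
  ⟨clo_comp, mem_comp hx, fun h' => h h'.2⟩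

lemma tri_split (h : Ctx G A W) (hv : v ∈ W) (hvB : Bd G A v) (h3 : H3 G A W v) :
    ∃ m K, Nb G A W v m ∧ Clo G (W \ {v, m}) K ∧ K.Nonempty ∧ ((W \ {v, m}) \ K).Nonempty := by
  obtain ⟨x, y, w, hx, hy, hw, hxy, hxw, hyw⟩ := h3
  have nx := hx.2.2.ne'
  have ny := hy.2.2.ne'
  have nw := hw.2.2.ne'
  rcases tri_sep h hv hvB hx hy hw hxy hxw hyw with h | h | h
  · have h1 : x ∈ W \ {v, y} := ⟨hx.1, by simp [nx, hxy]⟩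
    have h2 : w ∈ W \ {v, y} := ⟨hw.1, by simp [nw, hyw.symm]⟩
    obtain ⟨a, b, c⟩ := sep_clo h h1 h2
    exact ⟨y, _, hy, a, ⟨_, b⟩, ⟨w, h2, c⟩⟩
  · have h1 : y ∈ W \ {v, w} := ⟨hy.1, by simp [ny, hyw]⟩
    have h2 : x ∈ W \ {v, w} := ⟨hx.1, by simp [nx, hxw]⟩
    obtain ⟨a, b, c⟩ := sep_clo h h1 h2
    exact ⟨w, _, hw, a, ⟨_, b⟩, ⟨x, h2, c⟩⟩
  · have h1 : w ∈ W \ {v, x} := ⟨hw.1, by simp [nw, hxw.symm]⟩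
    have h2 : y ∈ W \ {v, x} := ⟨hy.1, by simp [ny, hxy.symm]⟩
    obtain ⟨a, b, c⟩ := sep_clo h h1 h2
    exact ⟨x, _, hx, a, ⟨_, b⟩, ⟨y, h2, c⟩⟩

lemma Clo.avoid (h : Clo G S K) (h1 : K.Nonempty) (h2 : (S \ K).Nonempty) {p q : α}
    (hpq : p = q ∨ G.Adj p q) : ∃ K', Clo G S K' ∧ K'.Nonempty ∧ (S \ K').Nonempty ∧
      p ∉ K' ∧ q ∉ K' := by
  have e : S \ (S \ K) = K := by
    ext t; constructor
    · rintro ⟨a, b⟩; by_contra hc; exact b ⟨a, hc⟩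
    · intro ht; exact ⟨h.1 ht, fun hc => hc.2 ht⟩
  by_cases hp : p ∈ K
  · refine ⟨S \ K, h.compl, h2, e.symm ▸ h1, fun hc => hc.2 hp, ?_⟩
    rintro ⟨hq, hqK⟩
    rcases hpq with rfl | hpq
    · exact hqK hp
    · exact hqK (h.2 p hp q hq hpq)
  · by_cases hq : q ∈ K
    · refine ⟨S \ K, h.compl, h2, e.symm ▸ h1, ?_, fun hc => hc.2 hq⟩
      rintro ⟨hpS, hpK⟩
      rcases hpq with rfl | hpq
      · exact hpK hq
      · exact hpK (h.2 q hq p hpS hpq.symm)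
    · exact ⟨K, h, h1, h2, hp, hq⟩

lemma not_H3 (h3 : ¬ H3 G A W v) (hx : Nb G A W v x) (hy : Nb G A W v y) (hxy : x ≠ y)
    (hw : Nb G A W v w) : w = x ∨ w = y := by
  by_contra hc
  push Not at hc
  exact h3 ⟨x, y, w, hx, hy, hw, hxy, hc.1.symm, hc.2.symm⟩

open Classical in
/-- remove the colors `S` from the lists of the non-boundary neighbours of `v` -/
noncomputable def rmI (G : SimpleGraph α) (A : Set α) (v : α) (S : Finset ℕ) (L : α → Finset ℕ) :
    α → Finset ℕ := fun u => if G.Adj v u ∧ ¬ Bd G A u then L u \ S else L u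

open Classical in
/-- remove the color `c` from the lists of all neighbours of `v` -/
noncomputable def rmA (G : SimpleGraph α) (v : α) (c : ℕ) (L : α → Finset ℕ) :
    α → Finset ℕ := fun u => if G.Adj v u then L u \ {c} else L u

lemma rmI_bd (S : Finset ℕ) (h : Bd G A u) : rmI G A v S L u = L u := by simp [rmI, h]
lemma rmI_nadj (S : Finset ℕ) (h : ¬ G.Adj v u) : rmI G A v S L u = L u := by simp [rmI, h]
lemma rmI_adj (S : Finset ℕ) (h : G.Adj v u) (h' : ¬ Bd G A u) : rmI G A v S L u = L u \ S := by
  simp [rmI, h, h']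
lemma rmI_sub (S : Finset ℕ) : rmI G A v S L u ⊆ L u := by
  unfold rmI; split_ifs; exacts [Finset.sdiff_subset, subset_rfl]
lemma rmA_sub (c : ℕ) : rmA G v c L u ⊆ L u := by
  unfold rmA; split_ifs; exacts [Finset.sdiff_subset, subset_rfl]
lemma rmA_adj (c : ℕ) (h : G.Adj v u) : rmA G v c L u = L u \ {c} := by simp [rmA, h]
lemma rmA_nadj (c : ℕ) (h : ¬ G.Adj v u) : rmA G v c L u = L u := by simp [rmA, h]

lemma card_sdiff_ge (s t : Finset ℕ) (n k : ℕ) (h : n + k ≤ s.card) (ht : t.card ≤ k) :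
    n ≤ (s \ t).card := by
  have := Finset.le_card_sdiff t s
  omega

lemma not_bd_insert (h : ¬ Bd G (insert v A) u) : ¬ Bd G A u ∧ ¬ G.Adj v u :=
  ⟨fun ⟨a, ha, hh⟩ => h ⟨a, .inr ha, hh⟩, fun hh => h ⟨v, .inl rfl, hh⟩⟩

lemma Bd.ins (h : Bd G A u) : Bd G (insert v A) u := h.mono (subset_insert _ _)

lemma bd_ins_adj (h : G.Adj v u) : Bd G (insert v A) u := ⟨v, .inl rfl, h⟩

/-- deletion with reserved colors keeps standardness -/
lemma Std.rmI (h : Std G A W L X) (v : α) (S : Finset ℕ) (hS : S.card ≤ 2) :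
    Std G (insert v A) (W \ {v}) (rmI G A v S L) X := by
  intro u hu hX
  obtain ⟨h1, h2⟩ := h u hu.1 hX
  by_cases ha : G.Adj v u
  · by_cases hb : Bd G A u
    · rw [rmI_bd _ hb]; exact ⟨h1, fun hh => (hh (hb.ins)).elim⟩
    · rw [rmI_adj _ ha hb]
      exact ⟨card_sdiff_ge _ _ _ 2 (h2 hb) hS, fun hh => (hh (bd_ins_adj ha)).elim⟩
  · rw [rmI_nadj _ ha]
    exact ⟨h1, fun hh => h2 (not_bd_insert hh).1⟩

/-- deletion of a colored vertex `v` -/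
lemma Std.rmA (h : Std G A W L X) (v : α) (c : ℕ)
    (hN : ∀ u, Nb G A W v u → u ∉ Y → u ∉ X → 4 ≤ (L u).card) (hXY : X ⊆ insert v Y) :
    Std G (insert v A) (W \ {v}) (rmA G v c L) Y := by
  intro u hu hY
  have hX : u ∉ X := fun hX => by
    rcases hXY hX with rfl | h
    · exact hu.2 rfl
    · exact hY h
  obtain ⟨h1, h2⟩ := h u hu.1 hX
  by_cases ha : G.Adj v u
  · rw [rmA_adj _ ha]
    refine ⟨?_, fun hh => (hh (bd_ins_adj ha)).elim⟩
    by_cases hb : Bd G A u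
    · exact card_sdiff_ge _ _ _ 1 (hN u ⟨hu.1, hb, ha⟩ hY hX) (by simp)
    · exact card_sdiff_ge _ _ _ 1 (by have := h2 hb; omega) (by simp)
  · rw [rmA_nadj _ ha]
    exact ⟨h1, fun hh => h2 (not_bd_insert hh).1⟩

open Classical in
lemma Col.upd {c : ℕ} (h : Col G (W \ {v}) L' φ) (hsub : ∀ u ∈ W \ {v}, L' u ⊆ L u)
    (hc : c ∈ L v) (hN : ∀ u ∈ W, G.Adj v u → φ u ≠ c) :
    Col G W L (update φ v c) := by
  constructor
  · intro u hu
    by_cases huv : u = v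
    · subst huv; simpa
    · rw [update_of_ne huv]; exact hsub u ⟨hu, huv⟩ (h.1 u ⟨hu, huv⟩)
  · intro a ha b hb hab
    by_cases hav : a = v
    · subst hav
      rw [update_self, update_of_ne hab.ne']
      exact (hN b hb hab).symm
    · by_cases hbv : b = v
      · subst hbv
        rw [update_self, update_of_ne hav]
        exact (hN a ha hab.symm)
      · rw [update_of_ne hav, update_of_ne hbv]
        exact h.2 a ⟨ha, hav⟩ b ⟨hb, hbv⟩ hab

/-- Extend over `v` after deletion with reserved colors. -/
lemma ext_rmI {c : ℕ} {S : Finset ℕ} (h : Col G (W \ {v}) (rmI G A v S L) φ) (hc : c ∈ L v)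
    (hcS : c ∈ S) (hN : ∀ u, Nb G A W v u → φ u ≠ c) :
    ∃ ψ, Col G W L ψ ∧ ψ v = c ∧ ∀ u, u ≠ v → ψ u = φ u := by
  classical
  refine ⟨update φ v c, h.upd (fun u _ => rmI_sub _) hc ?_, by simp,
    fun u hu => update_of_ne hu _ _⟩
  intro u hu hvu
  by_cases hb : Bd G A u
  · exact hN u ⟨hu, hb, hvu⟩
  · have := h.1 u ⟨hu, hvu.ne'⟩
    rw [rmI_adj _ hvu hb] at this
    rintro rfl
    exact (Finset.mem_sdiff.1 this).2 hcS

lemma ext_rmA {c : ℕ} (h : Col G (W \ {v}) (rmA G v c L) φ) (hc : c ∈ L v) :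
    ∃ ψ, Col G W L ψ ∧ ψ v = c ∧ ∀ u, u ≠ v → ψ u = φ u := by
  classical
  refine ⟨update φ v c, h.upd (fun u _ => rmA_sub _) hc ?_, by simp,
    fun u hu => update_of_ne hu _ _⟩
  intro u hu hvu
  have := h.1 u ⟨hu, hvu.ne'⟩
  rw [rmA_adj _ hvu] at this
  rintro rfl
  exact (Finset.mem_sdiff.1 this).2 (by simp)

lemma fin_induction {P : Set α → Prop}
    (h : ∀ W : Set α, W.Finite → (∀ W', W' ⊂ W → P W') → P W) : ∀ W : Set α, W.Finite → P W := by
  have : ∀ n, ∀ W : Set α, W.Finite → W.ncard = n → P W := by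
    intro n
    induction n using Nat.strong_induction_on with
    | _ n ih =>
      intro W hW hn
      refine h W hW (fun W' hW' => ih W'.ncard ?_ W' (hW.subset hW'.subset) rfl)
      rw [← hn]; exact Set.ncard_lt_ncard hW' hW
  intro W hW
  exact this _ W hW rfl

lemma ssub_del (hv : v ∈ W) : W \ {v} ⊂ W :=
  ⟨sdiff_subset, fun h => (h hv).2 rfl⟩

lemma pick2 (s : Finset ℕ) (h : 2 ≤ s.card) : ∃ a ∈ s, ∃ b ∈ s, a ≠ b :=
  Finset.one_lt_card.1 h

lemma pick2ne (s : Finset ℕ) (h : 3 ≤ s.card) (c : ℕ) :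
    ∃ a ∈ s, ∃ b ∈ s, a ≠ b ∧ a ≠ c ∧ b ≠ c := by
  obtain ⟨a, ha, b, hb, hab⟩ := pick2 (s \ {c}) (card_sdiff_ge _ _ 2 1 h (by simp))
  simp at ha hb
  exact ⟨a, ha.1, b, hb.1, hab, ha.2, hb.2⟩

/-- The three forms of Thomassen's theorem. -/
def ThP (G : SimpleGraph α) (W : Set α) : Prop := ∀ (A : Set α) (L : α → Finset ℕ), Ctx G A W →
  (∀ p1 p2 c1 c2, p1 ∈ W → p2 ∈ W → Bd G A p1 → Bd G A p2 → G.Adj p1 p2 → Std G A W L {p1, p2} →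
    c1 ∈ L p1 → c2 ∈ L p2 → c1 ≠ c2 → ∃ φ, Col G W L φ ∧ φ p1 = c1 ∧ φ p2 = c2) ∧
  (∀ p c, p ∈ W → Bd G A p → Std G A W L {p} → c ∈ L p → ∃ φ, Col G W L φ ∧ φ p = c) ∧
  (Std G A W L ∅ → ∃ φ, Col G W L φ)

lemma clo_union_ssub {a b : α} (hK : Clo G (W \ {a, b}) K) (ha : a ∈ W) (hb : b ∈ W)
    (hne : ((W \ {a, b}) \ K).Nonempty) : K ∪ {a, b} ⊂ W := by
  constructor
  · rintro t (ht | rfl | rfl)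
    · exact (hK.1 ht).1
    · exact ha
    · exact hb
  · intro hh
    obtain ⟨t, ht, htK⟩ := hne
    rcases hh ht.1 with h | h
    · exact htK h
    · exact ht.2 h

lemma sdiff_ssub (hK : K ⊆ W) (hne : K.Nonempty) : W \ K ⊂ W := by
  refine ⟨sdiff_subset, fun hh => ?_⟩
  obtain ⟨k, hk⟩ := hne
  exact (hh (hK hk)).2 hk

lemma th_all (W : Set α) (hW : W.Finite) : ThP G W := by
  refine fin_induction (P := ThP G) ?_ W hW
  clear W hW
  intro W hW IH
  intro A L ctx
  -- splitting
  have split : ∀ (v m p1 p2 : α) (K : Set α) (c1 c2 : ℕ), v ∈ W → Bd G A v → Nb G A W v m →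
      Clo G (W \ {v, m}) K → K.Nonempty → ((W \ {v, m}) \ K).Nonempty → p1 ∈ W → p2 ∈ W →
      Bd G A p1 → Bd G A p2 → G.Adj p1 p2 → Std G A W L {p1, p2} →
      c1 ∈ L p1 → c2 ∈ L p2 → c1 ≠ c2 → ∃ φ, Col G W L φ ∧ φ p1 = c1 ∧ φ p2 = c2 := by
    intro v m p1 p2 K0 c1 c2 hv hvB hm hK0 hne0 hne0' hp1 hp2 hB1 hB2 hadj hstd hc1 hc2 hcc
    obtain ⟨K, hK, hne, hne', hpK1, hpK2⟩ := hK0.avoid hne0 hne0' (.inr hadj)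
    have hKW : K ⊆ W := fun k hk => (hK.1 hk).1
    have hvK : v ∉ K := fun h => (hK.1 h).2 (by simp)
    have hmK : m ∉ K := fun h => (hK.1 h).2 (by simp)
    obtain ⟨φ, hφ, e1, e2⟩ := (IH _ (sdiff_ssub hKW hne) A L (ctx.sub sdiff_subset)).1 p1 p2 c1 c2
      ⟨hp1, hpK1⟩ ⟨hp2, hpK2⟩ hB1 hB2 hadj (hstd.sub sdiff_subset) hc1 hc2 hcc
    have hss := clo_union_ssub hK hv hm.1 hne'
    have hstd' : Std G A (K ∪ {v, m}) L {v, m} := by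
      intro t ht htX
      rcases ht with ht | ht
      · refine hstd t (hKW ht) ?_
        rintro (rfl | rfl)
        · exact hpK1 ht
        · exact hpK2 ht
      · exact (htX ht).elim
    obtain ⟨χ, hχ, f1, f2⟩ := (IH _ hss A L (ctx.sub hss.subset)).1 v m (φ v) (φ m)
      (by simp) (by simp) hvB hm.2.1 hm.2.2 hstd' (hφ.1 v ⟨hv, hvK⟩) (hφ.1 m ⟨hm.1, hmK⟩)
      (hφ.2 v ⟨hv, hvK⟩ m ⟨hm.1, hmK⟩ hm.2.2)
    obtain ⟨ψ, hψ, g1, g2⟩ := glue hK hφ hχ (by rintro e (rfl | rfl) _ <;> assumption)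
    exact ⟨ψ, hψ, by rw [g1 p1 hp1 hpK1, e1], by rw [g1 p2 hp2 hpK2, e2]⟩
  have T2 : ∀ p1 p2 c1 c2, p1 ∈ W → p2 ∈ W → Bd G A p1 → Bd G A p2 → G.Adj p1 p2 →
      Std G A W L {p1, p2} → c1 ∈ L p1 → c2 ∈ L p2 → c1 ≠ c2 →
      ∃ φ, Col G W L φ ∧ φ p1 = c1 ∧ φ p2 = c2 := by
    intro p1 p2 c1 c2 hp1 hp2 hB1 hB2 hadj hstd hc1 hc2 hcc
    by_cases hv : ∃ v, Nb G A W p1 v ∧ v ≠ p2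
    · obtain ⟨v, hv, hvp2⟩ := hv
      have hvp1 : v ≠ p1 := hv.2.2.ne'
      by_cases h3 : H3 G A W v
      · obtain ⟨m, K, hm, hK, hne, hne'⟩ := tri_split ctx hv.1 hv.2.1 h3
        exact split v m p1 p2 K c1 c2 hv.1 hv.2.1 hm hK hne hne' hp1 hp2 hB1 hB2 hadj hstd hc1 hc2 hcc
      · have hvc := (hstd v hv.1 (by simp [hvp1, hvp2])).1
        obtain ⟨a, ha, b, hb, hab, hac, hbc⟩ := pick2ne (L v) hvc c1
        have hs := hstd.rmI v {a, b} (by exact Finset.card_le_two)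
        obtain ⟨φ, hφ, e1, e2⟩ := (IH _ (ssub_del hv.1) _ _ (ctx.del hv.2.1)).1 p1 p2 c1 c2
          ⟨hp1, hvp1.symm⟩ ⟨hp2, hvp2.symm⟩ hB1.ins hB2.ins hadj hs (by rwa [rmI_bd _ hB1])
          (by rwa [rmI_bd _ hB2]) hcc
        have hp1N : Nb G A W v p1 := ⟨hp1, hB1, hv.2.2.symm⟩
        have : ∃ c ∈ ({a, b} : Finset ℕ), c ∈ L v ∧ ∀ u, Nb G A W v u → φ u ≠ c := by
          by_cases hu : ∃ u, Nb G A W v u ∧ u ≠ p1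
          · obtain ⟨u, hu, hup⟩ := hu
            by_cases hua : φ u = a
            · refine ⟨b, by simp, hb, fun w hw => ?_⟩
              rcases not_H3 h3 hp1N hu hup.symm hw with rfl | rfl
              · rw [e1]; exact hbc.symm
              · rw [hua]; exact hab
            · refine ⟨a, by simp, ha, fun w hw => ?_⟩
              rcases not_H3 h3 hp1N hu hup.symm hw with rfl | rfl
              · rw [e1]; exact hac.symm
              · exact hua
          · push Not at hu
            refine ⟨a, by simp, ha, fun w hw => ?_⟩
            rw [hu w hw, e1]; exact hac.symm
        obtain ⟨c, hcS, hcL, hcN⟩ := this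
        obtain ⟨ψ, hψ, _, g⟩ := ext_rmI hφ hcL hcS hcN
        exact ⟨ψ, hψ, by rw [g _ hvp1.symm, e1], by rw [g _ hvp2.symm, e2]⟩
    · push Not at hv
      have hs : Std G (insert p1 A) (W \ {p1}) (rmA G p1 c1 L) {p2} :=
        hstd.rmA p1 c1 (fun u hu hY _ => (hY (hv u hu)).elim) (by simp)
      obtain ⟨φ, hφ, e2⟩ := (IH _ (ssub_del hp1) _ _ (ctx.del hB1)).2.1 p2 c2
          ⟨hp2, hadj.ne'⟩ hB2.ins hs (by rw [rmA_adj _ hadj]; simp [hc2, hcc.symm])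
      obtain ⟨ψ, hψ, g1, g⟩ := ext_rmA hφ hc1
      exact ⟨ψ, hψ, g1, by rw [g _ hadj.ne', e2]⟩
  have T1 : ∀ p c, p ∈ W → Bd G A p → Std G A W L {p} → c ∈ L p → ∃ φ, Col G W L φ ∧ φ p = c := by
    intro p c hp hB hstd hc
    by_cases hv : ∃ v, Nb G A W p v
    · obtain ⟨v, hv⟩ := hv
      have hvp1 : v ≠ p := hv.2.2.ne'
      obtain ⟨a, ha, b, hb, hab, hac, hbc⟩ := pick2ne (L v) (hstd v hv.1 hvp1).1 c
      obtain ⟨φ, hφ, e, _⟩ := T2 p v c a hp hv.1 hB hv.2.1 hv.2.2 (hstd.mono (by simp)) hc ha hac.symm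
      exact ⟨φ, hφ, e⟩
    · push Not at hv
      have hs : Std G (insert p A) (W \ {p}) (rmA G p c L) ∅ :=
        hstd.rmA p c (fun u hu _ _ => (hv u hu).elim) (by simp)
      obtain ⟨φ, hφ⟩ := (IH _ (ssub_del hp) _ _ (ctx.del hB)).2.2 hs
      obtain ⟨ψ, hψ, g1, g⟩ := ext_rmA hφ hc
      exact ⟨ψ, hψ, g1⟩
  refine ⟨T2, T1, ?_⟩
  intro hstd
  rcases W.eq_empty_or_nonempty with rfl | ⟨w, hw⟩
  · exact ⟨fun _ => 0, by simp [Col]⟩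
  by_cases hB : ∃ p ∈ W, Bd G A p
  · obtain ⟨p, hp, hB⟩ := hB
    obtain ⟨c, hc⟩ : (L p).Nonempty := Finset.card_pos.1 (by have := (hstd p hp (by simp)).1; omega)
    obtain ⟨φ, hφ, _⟩ := T1 p c hp hB (hstd.mono (by simp)) hc
    exact ⟨φ, hφ⟩
  · push Not at hB
    obtain ⟨c, hc⟩ : (L w).Nonempty := Finset.card_pos.1 (by have := (hstd w hw (by simp)).1; omega)
    have hs : Std G {w} (W \ {w}) (rmA G w c L) ∅ := by
      intro u hu _
      have h5 := (hstd u hu.1 (by simp)).2 (hB u hu.1)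
      by_cases ha : G.Adj w u
      · rw [rmA_adj _ ha]
        exact ⟨card_sdiff_ge _ _ _ 1 (by omega) (by simp), fun hh => (hh ⟨w, rfl, ha⟩).elim⟩
      · rw [rmA_nadj _ ha]; exact ⟨by omega, fun _ => h5⟩
    obtain ⟨φ, hφ⟩ := (IH _ (ssub_del hw) _ _ ctx.single).2.2 hs
    obtain ⟨ψ, hψ, _⟩ := ext_rmA hφ hc
    exact ⟨ψ, hψ⟩

/-! ## Dropping pieces -/

lemma th2 (ctx : Ctx G A W) {p1 p2 : α} {c1 c2 : ℕ} (h1 : p1 ∈ W) (h2 : p2 ∈ W) (b1 : Bd G A p1)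
    (b2 : Bd G A p2) (hadj : G.Adj p1 p2) (hs : Std G A W L {p1, p2}) (hc1 : c1 ∈ L p1)
    (hc2 : c2 ∈ L p2) (hcc : c1 ≠ c2) : ∃ φ, Col G W L φ ∧ φ p1 = c1 ∧ φ p2 = c2 :=
  (th_all W ctx.fin A L ctx).1 p1 p2 c1 c2 h1 h2 b1 b2 hadj hs hc1 hc2 hcc

lemma th1 (ctx : Ctx G A W) {p : α} {c : ℕ} (h1 : p ∈ W) (b1 : Bd G A p)
    (hs : Std G A W L {p}) (hc1 : c ∈ L p) : ∃ φ, Col G W L φ ∧ φ p = c :=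
  (th_all W ctx.fin A L ctx).2.1 p c h1 b1 hs hc1

lemma drop (ctx : Ctx G A W) (hs : Std G A W L X) (hu : u ∈ W) (hv : v ∈ W) (bu : Bd G A u)
    (bv : Bd G A v) (huv : G.Adj u v) (hK : Clo G (W \ {u, v}) K) (hX : ∀ k ∈ K, k ∉ X)
    (hφ : Col G (W \ K) L φ) : ∃ ψ, Col G W L ψ ∧ ∀ x ∈ W, x ∉ K → ψ x = φ x := by
  have huK : u ∉ K := fun h => (hK.1 h).2 (by simp)
  have hvK : v ∉ K := fun h => (hK.1 h).2 (by simp)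
  have hsub : K ∪ {u, v} ⊆ W := by
    rintro t (ht | rfl | rfl)
    exacts [(hK.1 ht).1, hu, hv]
  have hs' : Std G A (K ∪ {u, v}) L {u, v} := by
    rintro t (ht | ht) htX
    · exact hs t (hK.1 ht).1 (hX t ht)
    · exact (htX ht).elim
  obtain ⟨χ, hχ, e1, e2⟩ := th2 (ctx.sub hsub) (p1 := u) (p2 := v) (by simp) (by simp) bu bv huv hs'
    (hφ.1 u ⟨hu, huK⟩) (hφ.1 v ⟨hv, hvK⟩) (hφ.2 u ⟨hu, huK⟩ v ⟨hv, hvK⟩ huv)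
  obtain ⟨ψ, hψ, g1, _⟩ := glue hK hφ hχ (by rintro e (rfl | rfl) _ <;> assumption)
  exact ⟨ψ, hψ, g1⟩

/-- Drop the inside of a triangle. -/
lemma dropTri (ctx : Ctx G A W) (hs : Std G A W L X) (hx : x ∈ W) (hy : y ∈ W) (hz : z ∈ W)
    (hxy : G.Adj x y) (hxz : G.Adj x z) (hyz : G.Adj y z) (hK : Clo G (W \ {x, y, z}) K)
    (hX : ∀ k ∈ K, k ∉ X) (hB : ∀ k ∈ K, ¬ Bd G A k)
    (hφ : Col G (W \ K) L φ) : ∃ ψ, Col G W L ψ ∧ ∀ x ∈ W, x ∉ K → ψ x = φ x := by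
  classical
  have hxK : x ∉ K := fun h => (hK.1 h).2 (by simp)
  have hyK : y ∉ K := fun h => (hK.1 h).2 (by simp)
  have hzK : z ∉ K := fun h => (hK.1 h).2 (by simp)
  have hsub : K ∪ {y, z} ⊆ W \ {x} := by
    rintro t (ht | rfl | rfl)
    exacts [⟨(hK.1 ht).1, fun h => hxK (h ▸ ht)⟩, ⟨hy, hxy.ne'⟩, ⟨hz, hxz.ne'⟩]
  have cx : Ctx G {x} (K ∪ {y, z}) := (ctx.single).sub hsub
  have hs' : Std G {x} (K ∪ {y, z}) (rmA G x (φ x) L) {y, z} := by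
    rintro t (ht | ht) htX
    · have h5 := (hs t (hK.1 ht).1 (hX t ht)).2 (hB t ht)
      by_cases ha : G.Adj x t
      · rw [rmA_adj _ ha]
        exact ⟨card_sdiff_ge _ _ _ 1 (by omega) (by simp), fun hh => (hh ⟨x, rfl, ha⟩).elim⟩
      · rw [rmA_nadj _ ha]; exact ⟨by omega, fun _ => h5⟩
    · exact (htX ht).elim
  have c1 := hφ.2 x ⟨hx, hxK⟩ y ⟨hy, hyK⟩ hxy
  have c2 := hφ.2 x ⟨hx, hxK⟩ z ⟨hz, hzK⟩ hxz
  obtain ⟨χ, hχ, e1, e2⟩ := th2 cx (p1 := y) (p2 := z) (by simp) (by simp) ⟨x, rfl, hxy⟩ ⟨x, rfl, hxz⟩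
    hyz hs' (c1 := φ y) (c2 := φ z)
    (by rw [rmA_adj _ hxy]; simp [hφ.1 y ⟨hy, hyK⟩, c1.symm])
    (by rw [rmA_adj _ hxz]; simp [hφ.1 z ⟨hz, hzK⟩, c2.symm])
    (hφ.2 y ⟨hy, hyK⟩ z ⟨hz, hzK⟩ hyz)
  have e : (K ∪ {x, y, z}) \ {x} = K ∪ {y, z} := by
    ext t; simp only [mem_sdiff, mem_union, mem_insert_iff, mem_singleton_iff]
    constructor
    · tauto
    · rintro (h | rfl | rfl)
      · exact ⟨.inl h, fun h' => hxK (h' ▸ h)⟩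
      · exact ⟨by simp, hxy.ne'⟩
      · exact ⟨by simp, hxz.ne'⟩
  obtain ⟨χ', hχ', f1, f2⟩ := ext_rmA (W := K ∪ {x, y, z}) (v := x) (by rwa [e]) (hφ.1 x ⟨hx, hxK⟩)
  obtain ⟨ψ, hψ, g1, _⟩ := glue hK hφ hχ' (by
    rintro e (rfl | rfl | rfl) _
    · exact f1
    · rw [f2 _ hxy.ne', e1]
    · rw [f2 _ hxz.ne', e2])
  exact ⟨ψ, hψ, g1⟩

/-- Drop a vertex of small degree. -/
lemma dropDeg (M : Finset α) (hM : ∀ u ∈ W, G.Adj v u → u ∈ M)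
    (hc : M.card < (L v).card) (hφ : Col G (W \ {v}) L φ) :
    ∃ ψ, Col G W L ψ ∧ ∀ x, x ≠ v → ψ x = φ x := by
  classical
  obtain ⟨c, hcL, hcM⟩ := Finset.exists_mem_notMem_of_card_lt_card
    (lt_of_le_of_lt (Finset.card_image_le (s := M) (f := φ)) hc)
  refine ⟨update φ v c, hφ.upd (fun _ _ => subset_rfl) hcL ?_,
    fun u hu => update_of_ne hu _ _⟩
  rintro u hu hvu rfl
  exact hcM (Finset.mem_image_of_mem _ (hM u hu hvu))

/-- Planarity lemma: no component attached to all three vertices of a boundary triangle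
and to the boundary. -/
lemma pl2 {t : α} (ctx : Ctx G A W) (hx : x ∈ W) (ht : t ∈ W) (hu : u ∈ W)
    (bx : Bd G A x) (bt : Bd G A t) (bu : Bd G A u)
    (hxt : G.Adj x t) (hxu : G.Adj x u) (htu : G.Adj t u) {C : Set α} (hC : C ⊆ W \ {x, t, u})
    (hcon : Conn G C) (ax : Adjs G {x} C) (at' : Adjs G {t} C) (au : Adjs G {u} C)
    (hq : ∃ q ∈ C, Bd G A q) : False := by
  obtain ⟨q, hq, bq⟩ := hq
  have hA := ctx.disj
  have n1 := hxt.ne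
  have n2 := hxu.ne
  have n3 := htu.ne
  have hC' : ∀ c ∈ C, c ≠ x ∧ c ≠ t ∧ c ≠ u ∧ c ∉ A := by
    intro c hc
    have h := hC hc
    simp only [mem_sdiff, mem_insert_iff, mem_singleton_iff, not_or] at h
    exact ⟨h.2.1, h.2.2.1, h.2.2.2, fun hcA => hA c hcA h.1⟩
  refine ctx.nm.k5' (a := A) (b := {x}) (c := {t}) (d := {u}) (e := C) ctx.ne ⟨x, rfl⟩ ⟨t, rfl⟩
    ⟨u, rfl⟩ ⟨q, hq⟩ ctx.conn conn_single conn_single conn_single hcon ?_ ?_ ?_ ?_ ?_ ?_ ?_ ?_ ?_ ?_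
    (bx.adjs rfl) (bt.adjs rfl) (bu.adjs rfl) (bq.adjs hq) (.of hxt rfl rfl) (.of hxu rfl rfl) ax
    (.of htu rfl rfl) at' au
  all_goals (rw [Set.disjoint_left]; (try simp only [mem_singleton_iff]); grind)

/-! ## Sets of pairs -/

def Rel (r s : ℕ × ℕ) : Prop := r ≠ s ∧ (r.1 = s.1 ∨ r.2 = s.2 ∨ (r.1 = s.2 ∧ r.2 = s.1))

def Gov2 (S : Set (ℕ × ℕ)) : Prop := ∃ r ∈ S, ∃ s ∈ S, Rel r s

def Conf4 (S : Set (ℕ × ℕ)) : Prop := ∃ r ∈ S, ∃ s ∈ S, ∃ t ∈ S, ∃ u ∈ S, Rel r s ∧ Rel t u ∧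
  t ≠ r ∧ t ≠ s ∧ ¬ (r.1 = s.1 ∧ r.1 = t.1 ∧ r.1 = u.1) ∧ ¬ (r.2 = s.2 ∧ r.2 = t.2 ∧ r.2 = u.2)

section
lemma eq_three {U : Finset ℕ} {a b c : ℕ} (hU : 3 ≤ U.card)
    (hx : ∀ x ∈ U, x ≠ a → x ≠ b → x = c) : U = {a, b, c} := by
  refine Finset.eq_of_subset_of_card_le (fun x hxU => ?_) (Finset.card_le_three.trans hU)
  have := hx x hxU
  simp only [Finset.mem_insert, Finset.mem_singleton]; tauto

variable {P Q : Set (ℕ × ℕ)} {a b c d e a' b' e' : ℕ}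

lemma Conf4.mono (h : Conf4 P) (hs : P ⊆ Q) : Conf4 Q := by
  obtain ⟨r, hr, s, hs', t, ht, u, hu, h⟩ := h
  exact ⟨r, hs hr, s, hs hs', t, hs ht, u, hs hu, h⟩

lemma Gov2.mono (h : Gov2 P) (hs : P ⊆ Q) : Gov2 Q := by
  obtain ⟨r, hr, s, hs', h⟩ := h
  exact ⟨r, hs hr, s, hs hs', h⟩

lemma Conf4.gov (h : Conf4 P) : Gov2 P := by
  obtain ⟨r, hr, s, hs', t, ht, u, hu, h, _⟩ := h
  exact ⟨r, hr, s, hs', h⟩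

lemma Rel.swap {r s : ℕ × ℕ} (h : Rel r s) : Rel r.swap s.swap := by
  obtain ⟨a, b⟩ := r; obtain ⟨c, d⟩ := s
  simp only [Rel, Prod.swap, ne_eq, Prod.mk.injEq] at *; tauto

lemma Conf4.swap (h : Conf4 P) : Conf4 {c | c.swap ∈ P} := by
  obtain ⟨r, hr, s, hs', t, ht, u, hu, h1, h2, h3, h4, h5, h6⟩ := h
  refine ⟨r.swap, by simpa, s.swap, by simpa, t.swap, by simpa, u.swap, by simpa, h1.swap, h2.swap,
    ?_, ?_, h6, h5⟩
  · exact fun h => h3 (Prod.swap_injective h)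
  · exact fun h => h4 (Prod.swap_injective h)

lemma Gov2.swap (h : Gov2 P) : Gov2 {c | c.swap ∈ P} := by
  obtain ⟨r, hr, s, hs', h1⟩ := h
  exact ⟨r.swap, by simpa, s.swap, by simpa, h1.swap⟩

lemma conf_L (h1 : (a, e) ∈ P) (h2 : (a, e') ∈ P) (h3 : (a', e) ∈ P) (ha : a ≠ a') (he : e ≠ e') :
    Conf4 P := by
  refine ⟨(a, e), h1, (a, e'), h2, (a', e), h3, (a, e), h1, ?_, ?_, ?_, ?_, ?_, ?_⟩ <;>
    simp [Rel] <;> grind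

lemma conf_DR (h1 : (a', a) ∈ P) (h2 : (a, a') ∈ P) (h3 : (a, b) ∈ P) (ha : a ≠ a') (hb : b ≠ a') :
    Conf4 P := by
  refine ⟨(a', a), h1, (a, a'), h2, (a, b), h3, (a, a'), h2, ?_, ?_, ?_, ?_, ?_, ?_⟩ <;>
    simp [Rel] <;> grind

lemma conf_DC (h1 : (a', a) ∈ P) (h2 : (a, a') ∈ P) (h3 : (b, a) ∈ P) (ha : a ≠ a') (hb : b ≠ a') :
    Conf4 P := by
  refine ⟨(a', a), h1, (a, a'), h2, (b, a), h3, (a', a), h1, ?_, ?_, ?_, ?_, ?_, ?_⟩ <;>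
    simp [Rel] <;> grind

lemma F2 (A D : Finset ℕ) (hA : 2 ≤ A.card) (hD : 2 ≤ D.card) (h : ¬ (A = D ∧ A.card = 2)) :
    Conf4 {c : ℕ × ℕ | c.1 ∈ A ∧ c.2 ∈ D ∧ c.1 ≠ c.2} := by
  have key : ∀ (A D : Finset ℕ), 2 ≤ A.card → 2 ≤ D.card → (∃ a ∈ A, a ∉ D) →
      Conf4 {c : ℕ × ℕ | c.1 ∈ A ∧ c.2 ∈ D ∧ c.1 ≠ c.2} := by
    intro A D hA hD ⟨a, ha, haD⟩
    obtain ⟨a', ha', hne⟩ := Finset.exists_mem_ne (s := A) (by omega) a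
    obtain ⟨e, he, hee⟩ := Finset.exists_mem_ne (s := D) (by omega) a'
    obtain ⟨e', he', hee'⟩ := Finset.exists_mem_ne (s := D) (by omega) e
    refine conf_L (a := a) (e := e) (e' := e') (a' := a') ?_ ?_ ?_ hne.symm hee'.symm <;>
      simp only [mem_ofPred_eq] <;> grind
  by_cases h1 : ∃ a ∈ A, a ∉ D
  · exact key A D hA hD h1
  by_cases h2 : ∃ a ∈ D, a ∉ A
  · refine (key D A hD hA h2).swap.mono ?_
    rintro ⟨a, b⟩ ⟨h1, h2, h3⟩
    exact ⟨h2, h1, h3.symm⟩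
  · have hAD : A = D := by
      apply Finset.ext; intro a; constructor
      · intro ha; by_contra hc; exact h1 ⟨a, ha, hc⟩
      · intro ha; by_contra hc; exact h2 ⟨a, ha, hc⟩
    subst hAD
    obtain ⟨x, hx, y, hy, z, hz, hxy, hxz, hyz⟩ := Finset.two_lt_card.1 (show 2 < A.card by
      have : A.card ≠ 2 := fun hh => h ⟨rfl, hh⟩
      omega)
    refine conf_L (a := x) (e := y) (e' := z) (a' := z) ?_ ?_ ?_ hxz hyz <;>
      simp only [mem_ofPred_eq] <;> grind

lemma exists_avoid2 (U : Finset ℕ) (h : 3 ≤ U.card) (a b : ℕ) : ∃ e ∈ U, e ≠ a ∧ e ≠ b := by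
  obtain ⟨e, he, hh⟩ := Finset.exists_mem_notMem_of_card_lt_card
    (s := {a, b}) (t := U) (lt_of_le_of_lt Finset.card_le_two (by omega))
  simp at hh
  exact ⟨e, he, hh.1, hh.2⟩

/-- the finite lemma for a triangle -/
lemma F3 (C : Set (ℕ × ℕ)) (U : Finset ℕ) (hU : 3 ≤ U.card) (hC : Conf4 C)
    (hp : ∀ c ∈ C, c.1 ≠ c.2) :
    Conf4 {c : ℕ × ℕ | ∃ b, (c.1, b) ∈ C ∧ c.2 ∈ U ∧ c.2 ≠ c.1 ∧ c.2 ≠ b} := by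
  set S := {c : ℕ × ℕ | ∃ b, (c.1, b) ∈ C ∧ c.2 ∈ U ∧ c.2 ≠ c.1 ∧ c.2 ≠ b} with hS
  have mk : ∀ a b e, (a, b) ∈ C → e ∈ U → e ≠ a → e ≠ b → (a, e) ∈ S :=
    fun a b e h1 h2 h3 h4 => ⟨b, h1, h2, h3, h4⟩
  by_cases h1 : ∃ a b b', b ≠ b' ∧ (a, b) ∈ C ∧ (a, b') ∈ C
  · obtain ⟨a, b, b', hbb, hb, hb'⟩ := h1
    have row : ∀ e ∈ U, e ≠ a → (a, e) ∈ S := by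
      intro e he hea
      by_cases h : e = b
      · exact mk a b' e hb' he hea (h ▸ hbb)
      · exact mk a b e hb he hea h
    obtain ⟨t, ht, hta⟩ : ∃ t ∈ C, t.1 ≠ a := by
      obtain ⟨r, hr, s, hs', t, ht, u, hu, _, _, _, _, h5, _⟩ := hC
      by_contra hc
      push Not at hc
      exact h5 ⟨by rw [hc r hr, hc s hs'], by rw [hc r hr, hc t ht], by rw [hc r hr, hc u hu]⟩
    obtain ⟨a', d⟩ := t
    simp only at hta
    obtain ⟨e, he, hea', hed⟩ := exists_avoid2 U hU a' d
    have h1 := mk a' d e ht he hea' hed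
    by_cases hea : e = a
    · subst hea
      by_cases hx : ∃ x ∈ U, x ≠ a' ∧ x ≠ d ∧ x ≠ e
      · obtain ⟨x, hxU, hxa, hxd, hxe⟩ := hx
        obtain ⟨y, hyU, hy1, hy2⟩ := exists_avoid2 U hU x e
        exact conf_L (row x hxU hxe) (row y hyU hy2) (mk a' d x ht hxU hxa hxd) hta.symm hy1.symm
      · push Not at hx
        have hUeq := eq_three hU hx
        have ha'U : a' ∈ U := by simp [hUeq]
        have hdU : d ∈ U := by simp [hUeq]
        exact conf_DR h1 (row a' ha'U hta) (row d hdU hed.symm) hea' (hp _ ht).symm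
    · obtain ⟨y, hyU, hy1, hy2⟩ := exists_avoid2 U hU e a
      exact conf_L (row e he hea) (row y hyU hy2) h1 hta.symm hy1.symm
  · push Not at h1
    have rows : ∀ a b b', (a, b) ∈ C → (a, b') ∈ C → b = b' := by
      intro a b b' hb hb'
      by_contra hc
      exact h1 a b b' hc hb hb'
    have col : ∀ a1 a2 a3 d b3, (a1, d) ∈ C → (a2, d) ∈ C → (a3, b3) ∈ C → a1 ≠ a2 → a3 ≠ a1 →
        a3 ≠ a2 → Conf4 S := by
      intro a1 a2 a3 d b3 m1 m2 m3 n12 n31 n32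
      have p1 : a1 ≠ d := hp _ m1
      have p2 : a2 ≠ d := hp _ m2
      by_cases hx : ∃ e ∈ U, e ≠ a1 ∧ e ≠ a2 ∧ e ≠ d
      · obtain ⟨e, he, e1, e2, ed⟩ := hx
        obtain ⟨y, hyU, hy1, hy2⟩ := exists_avoid2 U hU e d
        by_cases hya : y = a1
        · refine conf_L (a := a2) (e := e) (e' := y) (a' := a1) (mk _ d _ m2 he e2 ed)
            (mk _ d _ m2 hyU (by rw [hya]; exact n12) hy2) (mk _ d _ m1 he e1 ed) n12.symm hy1.symm
        · refine conf_L (a := a1) (e := e) (e' := y) (a' := a2) (mk _ d _ m1 he e1 ed)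
            (mk _ d _ m1 hyU hya hy2) (mk _ d _ m2 he e2 ed) n12 hy1.symm
      · push Not at hx
        have hUeq := eq_three hU hx
        have h1U : a1 ∈ U := by simp [hUeq]
        have h2U : a2 ∈ U := by simp [hUeq]
        have d1 := mk a1 d a2 m1 h2U n12.symm p2
        have d2 := mk a2 d a1 m2 h1U n12 p1
        by_cases hb : b3 = a1
        · exact conf_DC d1 d2 (mk a3 b3 a2 m3 h2U n32.symm (hb ▸ n12.symm)) n12.symm n31
        · exact conf_DC d2 d1 (mk a3 b3 a1 m3 h1U n31.symm (Ne.symm hb)) n12 n32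
    obtain ⟨r, hr, s, hs', t, ht, u, hu, hrs, htu, n1, n2, _, _⟩ := hC
    obtain ⟨r1, r2⟩ := r
    obtain ⟨s1, s2⟩ := s
    obtain ⟨t1, t2⟩ := t
    obtain ⟨u1, u2⟩ := u
    have x1 : r1 ≠ s1 := by
      rintro rfl; exact hrs.1 (by rw [rows _ _ _ hr hs'])
    have x2 : t1 ≠ r1 := by
      rintro rfl; exact n1 (by rw [rows _ _ _ ht hr])
    have x3 : t1 ≠ s1 := by
      rintro rfl; exact n2 (by rw [rows _ _ _ ht hs'])
    have x4 : t1 ≠ u1 := by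
      rintro rfl; exact htu.1 (by rw [rows _ _ _ ht hu])
    rcases hrs.2 with h | h | ⟨h, h'⟩ <;> simp only at *
    · exact (x1 h).elim
    · subst h; exact col r1 s1 t1 r2 t2 hr hs' ht x1 x2 x3
    subst h; subst h'
    rcases htu.2 with h | h | ⟨h, h'⟩ <;> simp only at *
    · exact (x4 h).elim
    · subst h
      by_cases h5 : r1 = u1
      · exact col t1 u1 r2 t2 r1 ht hu hs' x4 x3.symm (h5 ▸ x1.symm)
      · exact col t1 u1 r1 t2 r2 ht hu hr x4 x2.symm h5
    · subst h; subst h'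
      have y1 : t2 ≠ r1 := by
        intro hh; rw [hh] at hu; exact x3 (rows _ _ _ hu hr)
      have y2 : t2 ≠ r2 := by
        intro hh; rw [hh] at hu; exact x2 (rows _ _ _ hu hs')
      obtain ⟨e, he, e1, e2⟩ := exists_avoid2 U hU r1 r2
      by_cases hx : ∃ e' ∈ U, e' ≠ r1 ∧ e' ≠ r2 ∧ e' ≠ e
      · obtain ⟨e', he', e1', e2', e3'⟩ := hx
        exact conf_L (mk _ _ _ hr he e1 e2) (mk _ _ _ hr he' e1' e2') (mk _ _ _ hs' he e2 e1) x1
          e3'.symm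
      · push Not at hx
        have hUeq := eq_three hU hx
        have h1U : r1 ∈ U := by simp [hUeq]
        have h2U : r2 ∈ U := by simp [hUeq]
        exact conf_L (mk _ _ _ ht h1U x2.symm y1.symm) (mk _ _ _ ht h2U x3.symm y2.symm)
          (mk _ _ _ hu h1U y1.symm x2.symm) x4 x1

end

/-! ## Abstract harmonicas -/

/-- sources -/
inductive Src (α : Type u) : Type u
  | dict (z : α) (c : ℕ)
  | dem (p1 p2 : α) (L0 : Finset ℕ)

open Classical in
/-- abstract chains of triangles -/
inductive CH (G : SimpleGraph α) (K : Set α) (q1 q2 : α) :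
    (α → Finset ℕ) → Set α → Src α → Prop
  | d_end (L : α → Finset ℕ) (W : Set α) (z : α) (c : ℕ) (hz : z = q1 ∨ z = q2)
      (m1 : q1 ∈ W) (m2 : q2 ∈ W) :
      CH G K q1 q2 L W (.dict z c)
  | d_tri (L : α → Finset ℕ) (W W' : Set α) (z u1 u2 : α) (c : ℕ) (L0 : Finset ℕ)
      (hu1 : u1 ∈ W') (hu2 : u2 ∈ W')
      (h1 : G.Adj z u1) (h2 : G.Adj z u2) (h12 : G.Adj u1 u2) (hL0 : L0.card = 2) (hc : c ∉ L0)
      (hL1 : L u1 = L0 ∪ {c}) (hL2 : L u2 = L0 ∪ {c}) (hW : W' ⊆ W \ {z})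
      (hK : ∀ v ∈ W', v ∈ K → G.Adj z v → v = u1 ∨ v = u2)
      (hrec : CH G K q1 q2 L W' (.dem u1 u2 L0)) : CH G K q1 q2 L W (.dict z c)
  | m_end (L : α → Finset ℕ) (W : Set α) (p1 p2 : α) (L0 : Finset ℕ)
      (hq : (q1 = p1 ∧ q2 = p2) ∨ (q1 = p2 ∧ q2 = p1)) (m1 : q1 ∈ W) (m2 : q2 ∈ W) :
      CH G K q1 q2 L W (.dem p1 p2 L0)
  | m_step1 (L : α → Finset ℕ) (W : Set α) (p1 p2 u : α) (c : ℕ) (L0 : Finset ℕ)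
      (hu : u ∈ W) (h1 : G.Adj u p1) (h2 : G.Adj u p2) (hL : L u = L0 ∪ {c}) (hc : c ∉ L0)
      (hrec : CH G K q1 q2 (update L p2 (L0 ∪ {c})) (W \ {p1}) (.dict u c)) :
      CH G K q1 q2 L W (.dem p1 p2 L0)
  | m_step2 (L : α → Finset ℕ) (W : Set α) (p1 p2 u : α) (c : ℕ) (L0 : Finset ℕ)
      (hu : u ∈ W) (h1 : G.Adj u p1) (h2 : G.Adj u p2) (hL : L u = L0 ∪ {c}) (hc : c ∉ L0)
      (hrec : CH G K q1 q2 (update L p1 (L0 ∪ {c})) (W \ {p2}) (.dict u c)) :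
      CH G K q1 q2 L W (.dem p1 p2 L0)

lemma CH.mono {s : Src α} (h : CH G K q1 q2 L W s) (hW : W ⊆ W') : CH G K q1 q2 L W' s := by
  induction h generalizing W' with
  | d_end L W z c hz m1 m2 => exact .d_end _ _ _ _ hz (hW m1) (hW m2)
  | d_tri L W W1 z u1 u2 c L0 hu1 hu2 h1 h2 h12 hL0 hc hL1 hL2 hW1 hK hrec ih =>
    exact .d_tri L W' W1 z u1 u2 c L0 hu1 hu2 h1 h2 h12 hL0 hc hL1 hL2
      (hW1.trans (sdiff_subset_sdiff_left hW)) hK hrec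
  | m_end L W p1 p2 L0 hq m1 m2 => exact .m_end _ _ _ _ _ hq (hW m1) (hW m2)
  | m_step1 L W p1 p2 u c L0 hu h1 h2 hL hc hrec ih =>
    exact .m_step1 L W' p1 p2 u c L0 (hW hu) h1 h2 hL hc (ih (sdiff_subset_sdiff_left hW))
  | m_step2 L W p1 p2 u c L0 hu h1 h2 hL hc hrec ih =>
    exact .m_step2 L W' p1 p2 u c L0 (hW hu) h1 h2 hL hc (ih (sdiff_subset_sdiff_left hW))

/-- the source vertices -/
def Src.vs : Src α → Set α
  | .dict z _ => {z}
  | .dem p1 p2 _ => {p1, p2}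

/-- democracies have two-element lists -/
def Src.ok : Src α → Prop
  | .dict _ _ => True
  | .dem _ _ L0 => L0.card = 2

lemma card3 {L0 : Finset ℕ} {c : ℕ} (h : L0.card = 2) (hc : c ∉ L0) : (L0 ∪ {c}).card = 3 := by
  rw [Finset.card_union_of_disjoint (by simpa), h]; rfl

lemma CH.congr {s : Src α} (h : CH G K q1 q2 L W s) (ok : s.ok)
    (hL : ∀ v ∈ W, v ∉ s.vs → (L v).card = 3 → L' v = L v) : CH G K q1 q2 L' W s := by
  classical
  induction h generalizing L' with
  | d_end L W z c hz m1 m2 => exact .d_end _ _ _ _ hz m1 m2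
  | d_tri L W W1 z u1 u2 c L0 hu1 hu2 h1 h2 h12 hL0 hc hL1 hL2 hW1 hK hrec ih =>
    have e1 : L' u1 = L u1 := hL u1 (hW1 hu1).1 (hW1 hu1).2 (by rw [hL1]; exact card3 hL0 hc)
    have e2 : L' u2 = L u2 := hL u2 (hW1 hu2).1 (hW1 hu2).2 (by rw [hL2]; exact card3 hL0 hc)
    refine .d_tri L' W W1 z u1 u2 c L0 hu1 hu2 h1 h2 h12 hL0 hc (e1 ▸ hL1) (e2 ▸ hL2) hW1 hK
      (ih hL0 ?_)
    intro v hv _ h3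
    exact hL v (hW1 hv).1 (hW1 hv).2 h3
  | m_end L W p1 p2 L0 hq m1 m2 => exact .m_end _ _ _ _ _ hq m1 m2
  | m_step1 L W p1 p2 u c L0 hu h1 h2 hLu hc hrec ih =>
    have e1 : L' u = L u := hL u hu (by
      simp only [Src.vs, mem_insert_iff, mem_singleton_iff, not_or]; exact ⟨h1.ne, h2.ne⟩)
      (by rw [hLu]; exact card3 ok hc)
    refine .m_step1 L' W p1 p2 u c L0 hu h1 h2 (e1 ▸ hLu) hc (ih trivial ?_)
    intro v hv _ h3
    by_cases hvp : v = p2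
    · subst hvp; simp
    · rw [update_of_ne hvp] at h3 ⊢
      rw [update_of_ne hvp]
      refine hL v hv.1 ?_ h3
      simp only [Src.vs, mem_insert_iff, mem_singleton_iff, not_or]; exact ⟨hv.2, hvp⟩
  | m_step2 L W p1 p2 u c L0 hu h1 h2 hLu hc hrec ih =>
    have e1 : L' u = L u := hL u hu (by
      simp only [Src.vs, mem_insert_iff, mem_singleton_iff, not_or]; exact ⟨h1.ne, h2.ne⟩)
      (by rw [hLu]; exact card3 ok hc)
    refine .m_step2 L' W p1 p2 u c L0 hu h1 h2 (e1 ▸ hLu) hc (ih trivial ?_)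
    intro v hv _ h3
    by_cases hvp : v = p1
    · subst hvp; simp
    · rw [update_of_ne hvp] at h3 ⊢
      rw [update_of_ne hvp]
      refine hL v hv.1 ?_ h3
      simp only [Src.vs, mem_insert_iff, mem_singleton_iff, not_or]; exact ⟨hvp, hv.2⟩

lemma CH.dict_inv {c : ℕ} (h : CH G K q1 q2 L W (.dict z c)) : (z = q1 ∨ z = q2) ∨
    ∃ u1 u2 L0, u1 ∈ W ∧ u2 ∈ W ∧ G.Adj z u1 ∧ G.Adj z u2 ∧ G.Adj u1 u2 ∧ Finset.card L0 = 2 ∧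
      c ∉ L0 ∧ L u1 = L0 ∪ {c} ∧ L u2 = L0 ∪ {c} := by
  cases h with
  | d_end _ _ _ _ hz _ _ => exact .inl hz
  | d_tri _ _ W1 _ u1 u2 _ L0 hu1 hu2 h1 h2 h12 hL0 hc hL1 hL2 hW1 hK hrec =>
    exact .inr ⟨u1, u2, L0, (hW1 hu1).1, (hW1 hu2).1, h1, h2, h12, hL0, hc, hL1, hL2⟩

lemma CH.dem_inv {p1 p2 : α} {L0 : Finset ℕ} (h : CH G K q1 q2 L W (.dem p1 p2 L0)) :
    ((q1 = p1 ∧ q2 = p2) ∨ (q1 = p2 ∧ q2 = p1)) ∨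
    ∃ u c, u ∈ W ∧ G.Adj u p1 ∧ G.Adj u p2 ∧ c ∉ L0 ∧ L u = L0 ∪ {c} := by
  cases h with
  | m_end _ _ _ _ _ hq _ _ => exact .inl hq
  | m_step1 _ _ _ _ u c _ hu h1 h2 hLu hc hrec => exact .inr ⟨u, c, hu, h1, h2, hc, hLu⟩
  | m_step2 _ _ _ _ u c _ hu h1 h2 hLu hc hrec => exact .inr ⟨u, c, hu, h1, h2, hc, hLu⟩

/-! ## The claims -/

/-- a boundary edge (both ends on the boundary) -/
structure Tg (G : SimpleGraph α) (A W : Set α) (q1 q2 : α) : Prop where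
  m1 : q1 ∈ W
  m2 : q2 ∈ W
  b1 : Bd G A q1
  b2 : Bd G A q2
  adj : G.Adj q1 q2

lemma Tg.symm (h : Tg G A W q1 q2) : Tg G A W q2 q1 := ⟨h.m2, h.m1, h.b2, h.b1, h.adj.symm⟩

lemma Tg.sub (h : Tg G A W q1 q2) (h1 : q1 ∈ W') (h2 : q2 ∈ W') : Tg G A W' q1 q2 :=
  ⟨h1, h2, h.b1, h.b2, h.adj⟩

lemma Tg.del (h : Tg G A W q1 q2) (h1 : q1 ≠ v) (h2 : q2 ≠ v) :
    Tg G (insert v A) (W \ {v}) q1 q2 :=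
  ⟨⟨h.m1, h1⟩, ⟨h.m2, h2⟩, h.b1.ins, h.b2.ins, h.adj⟩

lemma Tg.nb (h : Tg G A W q1 q2) : Nb G A W q1 q2 := ⟨h.m2, h.b2, h.adj⟩

def Sq (G : SimpleGraph α) (W : Set α) (L : α → Finset ℕ) (q1 q2 : α) : Set (ℕ × ℕ) :=
  {c | ∃ φ, Col G W L φ ∧ φ q1 = c.1 ∧ φ q2 = c.2}

def Sc (G : SimpleGraph α) (W : Set α) (L : α → Finset ℕ) (C : Set (ℕ × ℕ)) (p1 p2 q1 q2 : α) :
    Set (ℕ × ℕ) := {c | ∃ φ, Col G W L φ ∧ (φ p1, φ p2) ∈ C ∧ φ q1 = c.1 ∧ φ q2 = c.2}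

def DP (G : SimpleGraph α) (W : Set α) : Prop :=
  ∀ (A K : Set α) (L : α → Finset ℕ) (z q1 q2 : α) (c : ℕ), Ctx G A W → Tg G A W q1 q2 → z ∈ W →
    Bd G A z → L z = {c} → Std G A W L {z} → (∀ v ∈ K, v ∈ W → Bd G A v) →
    Conf4 (Sq G W L q1 q2) ∨ (CH G K q1 q2 L W (.dict z c) ∧ Gov2 (Sq G W L q1 q2))

def MP (G : SimpleGraph α) (W : Set α) : Prop :=
  ∀ (A K : Set α) (L : α → Finset ℕ) (p1 p2 q1 q2 : α) (L0 : Finset ℕ), Ctx G A W →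
    Tg G A W q1 q2 → Tg G A W p1 p2 → L p1 = L0 → L p2 = L0 → L0.card = 2 →
    Std G A W L {p1, p2} → (∀ v ∈ K, v ∈ W → Bd G A v) →
    Conf4 (Sq G W L q1 q2) ∨ (CH G K q1 q2 L W (.dem p1 p2 L0) ∧ Gov2 (Sq G W L q1 q2))

def CP (G : SimpleGraph α) (W : Set α) : Prop :=
  ∀ (A : Set α) (L : α → Finset ℕ) (C : Set (ℕ × ℕ)) (p1 p2 q1 q2 : α), Ctx G A W →
    Tg G A W q1 q2 → Tg G A W p1 p2 → Std G A W L {p1, p2} → Conf4 C →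
    (∀ c ∈ C, c.1 ∈ L p1 ∧ c.2 ∈ L p2 ∧ c.1 ≠ c.2) → Conf4 (Sc G W L C p1 p2 q1 q2)

def TP (G : SimpleGraph α) (W : Set α) : Prop :=
  ∀ (A : Set α) (L : α → Finset ℕ) (r q1 q2 : α), Ctx G A W →
    Tg G A W q1 q2 → r ∈ W → Bd G A r → Std G A W L {r} → 2 ≤ (L r).card →
    Conf4 (Sq G W L q1 q2)

lemma conf_sq_swap (h : Conf4 (Sq G W L q2 q1)) : Conf4 (Sq G W L q1 q2) :=
  h.swap.mono (by rintro ⟨a, b⟩ ⟨φ, h1, h2, h3⟩; exact ⟨φ, h1, h3, h2⟩)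

lemma gov_sq_swap (h : Gov2 (Sq G W L q2 q1)) : Gov2 (Sq G W L q1 q2) :=
  h.swap.mono (by rintro ⟨a, b⟩ ⟨φ, h1, h2, h3⟩; exact ⟨φ, h1, h3, h2⟩)

lemma conf_sc_swap {C : Set (ℕ × ℕ)} {p1 p2 : α} (h : Conf4 (Sc G W L C p1 p2 q2 q1)) :
    Conf4 (Sc G W L C p1 p2 q1 q2) :=
  h.swap.mono (by rintro ⟨a, b⟩ ⟨φ, h1, h2, h3, h4⟩; exact ⟨φ, h1, h2, h4, h3⟩)

lemma conf_sc_swapP {C : Set (ℕ × ℕ)} {p1 p2 : α}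
    (h : Conf4 (Sc G W L {c | c.swap ∈ C} p2 p1 q1 q2)) :
    Conf4 (Sc G W L C p1 p2 q1 q2) :=
  h.mono (by rintro ⟨a, b⟩ ⟨φ, h1, h2, h3, h4⟩; exact ⟨φ, h1, h2, h3, h4⟩)

/-- if extension preserves everything outside `K`, then transfer -/
lemma sq_mono (hext : ∀ φ, Col G W' L' φ → ∃ ψ, Col G W L ψ ∧ ψ q1 = φ q1 ∧ ψ q2 = φ q2) :
    Sq G W' L' q1 q2 ⊆ Sq G W L q1 q2 := by
  rintro ⟨a, b⟩ ⟨φ, h1, h2, h3⟩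
  obtain ⟨ψ, g1, g2, g3⟩ := hext φ h1
  exact ⟨ψ, g1, g2.trans h2, g3.trans h3⟩

lemma th_allpairs (ctx : Ctx G A W) (tg : Tg G A W q1 q2) (hs : Std G A W L ∅) :
    Conf4 (Sq G W L q1 q2) := by
  have h1 := (hs q1 tg.m1 (by simp)).1
  have h2 := (hs q2 tg.m2 (by simp)).1
  refine (F2 (L q1) (L q2) (by omega) (by omega) (by omega)).mono ?_
  rintro ⟨a, b⟩ ⟨ha, hb, hab⟩
  exact th2 ctx tg.m1 tg.m2 tg.b1 tg.b2 tg.adj (hs.mono (by simp)) ha hb hab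

lemma stepT (h2 : CP G W) : TP G W := by
  intro A L r q1 q2 ctx tg hr bR hs hc
  by_cases hw : ∃ w, Nb G A W r w
  · obtain ⟨w, hw⟩ := hw
    have h3 := (hs w hw.1 (by simpa using hw.2.2.ne')).1
    refine (h2 A L {c | c.1 ∈ L r ∧ c.2 ∈ L w ∧ c.1 ≠ c.2} r w q1 q2 ctx tg
      ⟨hr, hw.1, bR, hw.2.1, hw.2.2⟩ (hs.mono (by simp))
      (F2 _ _ hc (by omega) (by rintro ⟨h, h'⟩; rw [h] at h'; omega)) (fun c hc => hc)).mono ?_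
    rintro ⟨a, b⟩ ⟨φ, h1, h2, h3⟩
    exact ⟨φ, h1, h3⟩
  · push Not at hw
    obtain ⟨c, hc'⟩ : (L r).Nonempty := Finset.card_pos.1 (by omega)
    have n1 : q1 ≠ r := by rintro rfl; exact hw _ tg.nb
    have n2 : q2 ≠ r := by rintro rfl; exact hw _ tg.symm.nb
    have hs' : Std G (insert r A) (W \ {r}) (rmA G r c L) ∅ :=
      hs.rmA r c (fun u hu _ _ => (hw u hu).elim) (by simp)
    refine (th_allpairs (ctx.del bR) (tg.del n1 n2) hs').mono (sq_mono fun φ hφ => ?_)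
    obtain ⟨ψ, g1, g2, g3⟩ := ext_rmA hφ hc'
    exact ⟨ψ, g1, g3 _ n1, g3 _ n2⟩

/-! ## Claim 2 -/

/-- a boundary edge separates the graph -/
def Spl (G : SimpleGraph α) (A W : Set α) : Prop := ∃ u v K, Tg G A W u v ∧
  Clo G (W \ {u, v}) K ∧ K.Nonempty ∧ ((W \ {u, v}) \ K).Nonempty

lemma spl_of_H3 (ctx : Ctx G A W) (hv : v ∈ W) (bv : Bd G A v) (h : H3 G A W v) : Spl G A W := by
  obtain ⟨m, K, hm, hK, h1, h2⟩ := tri_split ctx hv bv h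
  exact ⟨v, m, K, ⟨hv, hm.1, bv, hm.2.1, hm.2.2⟩, hK, h1, h2⟩

/-- an adjacent pair meeting a closed set lies in the closed set together with the cut -/
lemma clo_pair {u v : α} (hK : Clo G (W \ {u, v}) K) (h1 : q1 ∈ W) (h2 : q2 ∈ W)
    (hq : G.Adj q1 q2) (h : q1 ∈ K ∨ q2 ∈ K) : q1 ∈ K ∪ {u, v} ∧ q2 ∈ K ∪ {u, v} := by
  have := hK.2
  simp only [mem_union, mem_insert_iff, mem_singleton_iff]
  rcases h with h | h
  · refine ⟨.inl h, ?_⟩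
    by_contra hc
    exact hc (.inl (this _ h _ ⟨h2, fun h' => hc (.inr h')⟩ hq))
  · refine ⟨?_, .inl h⟩
    by_contra hc
    exact hc (.inl (this _ h _ ⟨h1, fun h' => hc (.inr h')⟩ hq.symm))

lemma clo_sub {u v : α} (hK : Clo G (W \ {u, v}) K) : K ⊆ W := fun _ h => (hK.1 h).1

/-- compose a confederacy across a separating boundary edge, general form -/
lemma composeC {C : Set (ℕ × ℕ)} (hC : CP G (K ∪ {u, v})) (ctx : Ctx G A W) (tu : Tg G A W u v)
    (tq : Tg G A W q1 q2) (mp1 : p1 ∈ W) (mp2 : p2 ∈ W) (n1 : p1 ∉ K) (n2 : p2 ∉ K)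
    (hK : Clo G (W \ {u, v}) K) (hs : Std G A K L ∅) (m : q1 ∈ K ∨ q2 ∈ K)
    (c1 : Conf4 (Sc G (W \ K) L C p1 p2 u v)) : Conf4 (Sc G W L C p1 p2 q1 q2) := by
  obtain ⟨m1, m2⟩ := clo_pair hK tq.m1 tq.m2 tq.adj m
  have hKW := clo_sub hK
  have huK : u ∉ K := fun h => (hK.1 h).2 (by simp)
  have hvK : v ∉ K := fun h => (hK.1 h).2 (by simp)
  have hsub : K ∪ {u, v} ⊆ W := union_subset hKW (by
    rintro x (rfl | rfl); exacts [tu.m1, tu.m2])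
  have c2 := hC A L _ u v q1 q2 (ctx.sub hsub)
    (tq.sub m1 m2) (tu.sub (by simp) (by simp)) (by
      intro x hx hxn
      rcases hx with hx | hx
      · exact hs x hx (by simp)
      · exact (hxn hx).elim) c1 (by
      rintro ⟨a, b⟩ ⟨φ, hφ, _, h1, h2⟩
      simp only at h1 h2 ⊢
      rw [← h1, ← h2]
      exact ⟨hφ.1 _ ⟨tu.m1, huK⟩, hφ.1 _ ⟨tu.m2, hvK⟩,
        hφ.2 _ ⟨tu.m1, huK⟩ _ ⟨tu.m2, hvK⟩ tu.adj⟩)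
  refine c2.mono ?_
  rintro ⟨a, b⟩ ⟨χ, hχ, ⟨φ, hφ, hφC, h1, h2⟩, h3, h4⟩
  simp only at h1 h2 h3 h4
  obtain ⟨ψ, g1, g2, g3⟩ := glue hK hφ hχ (by
    rintro e (rfl | rfl) _; exacts [h1.symm, h2.symm])
  have key : ∀ q ∈ K ∪ {u, v}, ψ q = χ q := by
    rintro q (hq | rfl | rfl)
    · exact g3 _ hq
    · rw [g2 _ tu.m1 huK, h1]
    · rw [g2 _ tu.m2 hvK, h2]
  refine ⟨ψ, g1, ?_, (key _ m1).trans h3, (key _ m2).trans h4⟩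
  rw [g2 _ mp1 n1, g2 _ mp2 n2]; exact hφC

lemma cp_spl (ih : ∀ W', W' ⊂ W → CP G W') (ctx : Ctx G A W) (tq : Tg G A W q1 q2)
    (tp : Tg G A W p1 p2) (hs : Std G A W L {p1, p2}) {C : Set (ℕ × ℕ)} (hC : Conf4 C)
    (hCL : ∀ c ∈ C, c.1 ∈ L p1 ∧ c.2 ∈ L p2 ∧ c.1 ≠ c.2) (h : Spl G A W) :
    Conf4 (Sc G W L C p1 p2 q1 q2) := by
  obtain ⟨u, v, K0, tu, hK0, hn0, hr0⟩ := h
  obtain ⟨K, hK, hn, hr, n1, n2⟩ := hK0.avoid hn0 hr0 (.inr tp.adj)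
  have hKW := clo_sub hK
  have huK : u ∉ K := fun h => (hK.1 h).2 (by simp)
  have hvK : v ∉ K := fun h => (hK.1 h).2 (by simp)
  have i1 := ih _ (sdiff_ssub hKW hn) A L C p1 p2
  by_cases hq : q1 ∈ K ∨ q2 ∈ K
  · have c1 := i1 u v (ctx.sub sdiff_subset) (tu.sub ⟨tu.m1, huK⟩ ⟨tu.m2, hvK⟩)
      (tp.sub ⟨tp.m1, n1⟩ ⟨tp.m2, n2⟩) (hs.sub sdiff_subset) hC hCL
    refine composeC (ih _ (clo_union_ssub hK tu.m1 tu.m2 hr)) ctx tu tq tp.m1 tp.m2 n1 n2 hK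
      (fun x hx _ => hs x (hKW hx) ?_) hq c1
    rintro (rfl | rfl)
    exacts [n1 hx, n2 hx]
  · push Not at hq
    refine (i1 q1 q2 (ctx.sub sdiff_subset) (tq.sub ⟨tq.m1, hq.1⟩ ⟨tq.m2, hq.2⟩)
      (tp.sub ⟨tp.m1, n1⟩ ⟨tp.m2, n2⟩) (hs.sub sdiff_subset) hC hCL).mono ?_
    rintro ⟨a, b⟩ ⟨φ, hφ, hφC, h1, h2⟩
    obtain ⟨ψ, g1, g2⟩ := drop ctx hs tu.m1 tu.m2 tu.b1 tu.b2 tu.adj hK (by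
      rintro k hk (rfl | rfl); exacts [n1 hk, n2 hk]) hφ
    refine ⟨ψ, g1, ?_, (g2 _ tq.m1 hq.1).trans h1, (g2 _ tq.m2 hq.2).trans h2⟩
    rw [g2 _ tp.m1 n1, g2 _ tp.m2 n2]; exact hφC

lemma bd_of_card3 (hs : Std G A W L X) (hv : v ∈ W) (hX : v ∉ X) (h : (L v).card = 3) :
    Bd G A v := by
  by_contra hb
  have := (hs v hv hX).2 hb
  omega

/-- a dictatorship inside `C` -/
lemma cp_dict (hD : DP G W) (ctx : Ctx G A W) (tq : Tg G A W q1 q2)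
    (tp : Tg G A W p1 p2) (hs : Std G A W L {p1, p2}) {C : Set (ℕ × ℕ)}
    (hCL : ∀ c ∈ C, c.1 ∈ L p1 ∧ c.2 ∈ L p2 ∧ c.1 ≠ c.2)
    (h3 : ¬ H3 G A W p1) (hN : ∀ u, ¬ (Nb G A W p1 u ∧ Nb G A W p2 u))
    (hg : ¬ Conf4 (Sc G W L C p1 p2 q1 q2)) {a b b' : ℕ} (h1 : (a, b) ∈ C) (h2 : (a, b') ∈ C)
    (hb : b ≠ b') : p1 = q1 ∨ p1 = q2 := by
  classical
  obtain ⟨l1, l2, l3⟩ := hCL _ h1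
  obtain ⟨-, l2', l3'⟩ := hCL _ h2
  simp only at l1 l2 l3 l2' l3'
  set L1 := update (update L p1 {a}) p2 {a, b, b'} with hL1
  have e1 : L1 p1 = {a} := by
    rw [hL1, update_of_ne tp.adj.ne, update_self]
  have e2 : L1 p2 = {a, b, b'} := by rw [hL1, update_self]
  have e3 : ∀ v, v ≠ p1 → v ≠ p2 → L1 v = L v := fun v h h' => by
    rw [hL1, update_of_ne h', update_of_ne h]
  have hs1 : Std G A W L1 {p1} := by
    intro v hv hv1
    by_cases hv2 : v = p2
    · subst hv2
      refine ⟨?_, fun h => (h tp.b2).elim⟩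
      rw [e2, Finset.card_insert_of_notMem (by simp; exact ⟨l3, l3'⟩), Finset.card_pair hb]
    · rw [e3 v hv1 hv2]
      exact hs v hv (by simp only [mem_insert_iff]; rintro (h | h); exacts [hv1 h, hv2 h])
  rcases hD A ∅ L1 p1 q1 q2 a ctx tq tp.m1 tp.b1 e1 hs1 (by simp) with hc | ⟨hc, -⟩
  · refine (hg (hc.mono ?_)).elim
    rintro ⟨c, d⟩ ⟨φ, hφ, h5, h6⟩
    have f1 : φ p1 = a := by have := hφ.1 _ tp.m1; rw [e1] at this; simpa using this
    have f2 : φ p2 = b ∨ φ p2 = b' := by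
      have := hφ.1 _ tp.m2; rw [e2] at this
      have h' := hφ.2 _ tp.m1 _ tp.m2 tp.adj
      simp only [Finset.mem_insert, Finset.mem_singleton] at this
      rcases this with h | h
      · omega
      · exact h
    refine ⟨φ, ⟨fun v hv => ?_, hφ.2⟩, ?_, h5, h6⟩
    · by_cases hv1 : v = p1
      · rw [hv1, f1]; exact l1
      by_cases hv2 : v = p2
      · rw [hv2]; rcases f2 with h | h <;> rw [h] <;> assumption
      rw [← e3 v hv1 hv2]; exact hφ.1 v hv
    · rw [f1]; rcases f2 with h | h <;> rw [h] <;> assumption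
  · rcases hc.dict_inv with h | ⟨u1, u2, L0, m1, m2, a1, a2, a12, hL0, hcL, k1, k2⟩
    · exact h
    · exfalso
      have b1 : Nb G A W p1 u1 := ⟨m1, bd_of_card3 hs1 m1 a1.ne' (k1 ▸ card3 hL0 hcL), a1⟩
      have b2 : Nb G A W p1 u2 := ⟨m2, bd_of_card3 hs1 m2 a2.ne' (k2 ▸ card3 hL0 hcL), a2⟩
      have n1 : p2 ≠ u1 := by rintro rfl; exact hN _ ⟨b2, b2.1, b2.2.1, a12⟩
      have n2 : p2 ≠ u2 := by rintro rfl; exact hN _ ⟨b1, b1.1, b1.2.1, a12.symm⟩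
      exact h3 ⟨p2, u1, u2, tp.nb, b1, b2, n1, n2, a12.ne⟩

/-- a democracy inside `C` -/
lemma cp_dem (hM : MP G W) (ctx : Ctx G A W) (tq : Tg G A W q1 q2)
    (tp : Tg G A W p1 p2) (hs : Std G A W L {p1, p2}) {C : Set (ℕ × ℕ)}
    (hCL : ∀ c ∈ C, c.1 ∈ L p1 ∧ c.2 ∈ L p2 ∧ c.1 ≠ c.2)
    (hN : ∀ u, ¬ (Nb G A W p1 u ∧ Nb G A W p2 u))
    (hg : ¬ Conf4 (Sc G W L C p1 p2 q1 q2)) {a b : ℕ} (h1 : (a, b) ∈ C) (h2 : (b, a) ∈ C) :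
    (q1 = p1 ∧ q2 = p2) ∨ (q1 = p2 ∧ q2 = p1) := by
  classical
  obtain ⟨l1, l2, l3⟩ := hCL _ h1
  obtain ⟨l1', l2', -⟩ := hCL _ h2
  simp only at l1 l2 l3 l1' l2'
  set L1 := update (update L p1 {a, b}) p2 {a, b} with hL1
  have e1 : L1 p1 = {a, b} := by
    rw [hL1, update_of_ne tp.adj.ne, update_self]
  have e2 : L1 p2 = {a, b} := by rw [hL1, update_self]
  have e3 : ∀ v, v ≠ p1 → v ≠ p2 → L1 v = L v := fun v h h' => by
    rw [hL1, update_of_ne h', update_of_ne h]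
  have hs1 : Std G A W L1 {p1, p2} := hs.congr fun v hv hvX => by
    simp only [mem_insert_iff, mem_singleton_iff, not_or] at hvX
    exact e3 v hvX.1 hvX.2
  have hc2 := Finset.card_pair l3
  rcases hM A ∅ L1 p1 p2 q1 q2 {a, b} ctx tq tp e1 e2 hc2 hs1 (by simp) with hc | ⟨hc, -⟩
  · refine (hg (hc.mono ?_)).elim
    rintro ⟨c, d⟩ ⟨φ, hφ, h5, h6⟩
    have f1 : φ p1 = a ∨ φ p1 = b := by have := hφ.1 _ tp.m1; rw [e1] at this; simpa using this
    have f2 : φ p2 = a ∨ φ p2 = b := by have := hφ.1 _ tp.m2; rw [e2] at this; simpa using this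
    have h' := hφ.2 _ tp.m1 _ tp.m2 tp.adj
    refine ⟨φ, ⟨fun v hv => ?_, hφ.2⟩, ?_, h5, h6⟩
    · by_cases hv1 : v = p1
      · rw [hv1]; rcases f1 with h | h <;> rw [h] <;> assumption
      by_cases hv2 : v = p2
      · rw [hv2]; rcases f2 with h | h <;> rw [h] <;> assumption
      rw [← e3 v hv1 hv2]; exact hφ.1 v hv
    · rcases f1 with h | h <;> rcases f2 with h6 | h6
      · omega
      · rw [h, h6]; exact h1
      · rw [h, h6]; exact h2
      · omega
  · rcases hc.dem_inv with h | ⟨u, c, m, a1, a2, hcL, k⟩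
    · exact h
    · exfalso
      have bu := bd_of_card3 hs1 m (by
        simp only [mem_insert_iff, mem_singleton_iff, not_or]; exact ⟨a1.ne, a2.ne⟩)
        (k ▸ card3 hc2 hcL)
      exact hN u ⟨⟨m, bu, a1.symm⟩, ⟨m, bu, a2.symm⟩⟩

/-- two dictatorships at `p1`, and `P' = {p1, q2}` -/
lemma cp_two (ctx : Ctx G A W) (tq : Tg G A W p1 q2)
    (tp : Tg G A W p1 p2) (hs : Std G A W L {p1, p2}) {C : Set (ℕ × ℕ)}
    (hCL : ∀ c ∈ C, c.1 ∈ L p1 ∧ c.2 ∈ L p2 ∧ c.1 ≠ c.2) (hq : q2 ≠ p2)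
    {a b b' a1 d d' : ℕ} (h1 : (a, b) ∈ C) (h2 : (a, b') ∈ C)
    (hb : b ≠ b') (g1 : (a1, d) ∈ C) (g2 : (a1, d') ∈ C) (hd : d ≠ d') (ha : a ≠ a1) :
    Conf4 (Sc G W L C p1 p2 p1 q2) := by
  classical
  have key : ∀ a b b' e, (a, b) ∈ C → (a, b') ∈ C → b ≠ b' → e ∈ L q2 → e ≠ a →
      (a, e) ∈ Sc G W L C p1 p2 p1 q2 := by
    intro a b b' e h1 h2 hb he hea
    obtain ⟨l1, l2, l3⟩ := hCL _ h1
    obtain ⟨-, l2', l3'⟩ := hCL _ h2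
    simp only at l1 l2 l3 l2' l3'
    obtain ⟨φ, hφ, f1, f2⟩ := th2 (L := update L p2 {a, b, b'}) ctx tq.m1 tq.m2 tq.b1
      tq.b2 tq.adj (by
        intro v hv hvX
        simp only [mem_insert_iff, mem_singleton_iff, not_or] at hvX
        by_cases hv2 : v = p2
        · subst hv2
          refine ⟨?_, fun h => (h tp.b2).elim⟩
          rw [update_self, Finset.card_insert_of_notMem (by simp; exact ⟨l3, l3'⟩),
            Finset.card_pair hb]
        · rw [update_of_ne hv2]
          exact hs v hv (by simp only [mem_insert_iff]; rintro (h | h); exacts [hvX.1 h, hv2 h]))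
      (c1 := a) (c2 := e) (by rw [update_of_ne tp.adj.ne]; exact l1)
      (by rw [update_of_ne hq]; exact he) hea.symm
    have f3 : φ p2 = b ∨ φ p2 = b' := by
      have := hφ.1 _ tp.m2; rw [update_self] at this
      have h' := hφ.2 _ tp.m1 _ tp.m2 tp.adj
      simp only [Finset.mem_insert, Finset.mem_singleton] at this
      rcases this with h | h
      · omega
      · exact h
    refine ⟨φ, ⟨fun v hv => ?_, hφ.2⟩, ?_, f1, f2⟩
    · by_cases hv2 : v = p2
      · rw [hv2]; rcases f3 with h | h <;> rw [h] <;> assumption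
      have := hφ.1 v hv
      rwa [update_of_ne hv2] at this
    · rw [f1]; rcases f3 with h | h <;> rw [h] <;> assumption
  have hc := (hs q2 tq.m2 (by
    simp only [mem_insert_iff, mem_singleton_iff, not_or]; exact ⟨tq.adj.ne', hq⟩)).1
  obtain ⟨e, he, hea, hea1⟩ := exists_avoid2 _ hc a a1
  obtain ⟨e', he', hea', hee⟩ := exists_avoid2 _ hc a e
  exact conf_L (key _ _ _ _ h1 h2 hb he hea) (key _ _ _ _ h1 h2 hb he' hea')
    (key _ _ _ _ g1 g2 hd he hea1) ha hee.symm

/-- in a triangle of boundary vertices without splits there are no further boundary vertices -/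
lemma tri_nobd (ctx : Ctx G A W) (hS : ¬ Spl G A W) (tp : Tg G A W p1 p2)
    (h1 : Nb G A W p1 u) (h2 : Nb G A W p2 u) : ∀ k ∈ W \ {p1, p2, u}, ¬ Bd G A k := by
  intro k hk bk
  have hsub : comp G (W \ {p1, p2, u}) k ⊆ W \ {p1, p2, u} := comp_sub
  have key : ∀ x y z, Tg G A W x y → z ∈ W → z ≠ x → z ≠ y → ({x, y, z} : Set α) = {p1, p2, u} →
      Adjs G {z} (comp G (W \ {p1, p2, u}) k) := by
    intro x y z txy hz hzx hzy hset
    by_contra hno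
    refine hS ⟨x, y, comp G (W \ {p1, p2, u}) k, txy, ⟨?_, ?_⟩, comp_nonempty hk,
      z, ⟨hz, ?_⟩, fun h => ?_⟩
    · intro v hv
      have := hsub hv
      rw [← hset] at this
      exact ⟨this.1, fun h => this.2 (by
        rcases h with h | h
        exacts [.inl h, .inr (.inl h)])⟩
    · intro v hv w hw hvw
      by_cases hwz : w = z
      · subst hwz; exact (hno ⟨w, rfl, v, hv, hvw.symm⟩).elim
      · refine comp_closed hv ⟨hw.1, ?_⟩ hvw
        rw [← hset]
        rintro (h | h | h)
        exacts [hw.2 (.inl h), hw.2 (.inr h), hwz h]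
    · simp only [mem_insert_iff, mem_singleton_iff, not_or]; exact ⟨hzx, hzy⟩
    · exact (hsub h).2 (by rw [← hset]; simp)
  have t1 : Tg G A W p1 u := ⟨tp.m1, h1.1, tp.b1, h1.2.1, h1.2.2⟩
  have t2 : Tg G A W p2 u := ⟨tp.m2, h1.1, tp.b2, h1.2.1, h2.2.2⟩
  exact pl2 ctx tp.m1 tp.m2 h1.1 tp.b1 tp.b2 h1.2.1 tp.adj h1.2.2 h2.2.2 hsub comp_conn
    (key p2 u p1 t2 tp.m1 tp.adj.ne t1.adj.ne (by ext; simp; tauto))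
    (key p1 u p2 t1 tp.m2 tp.adj.ne' t2.adj.ne (by ext; simp; tauto))
    (key p1 p2 u tp h1.1 t1.adj.ne' t2.adj.ne' rfl) ⟨k, mem_comp hk, bk⟩

lemma cp_tri (ctx : Ctx G A W) (tp : Tg G A W p1 p2) (hs : Std G A W L {p1, p2})
    {C : Set (ℕ × ℕ)} (hC : Conf4 C)
    (hCL : ∀ c ∈ C, c.1 ∈ L p1 ∧ c.2 ∈ L p2 ∧ c.1 ≠ c.2)
    (h1 : Nb G A W p1 u) (h2 : Nb G A W p2 u) (hb : ∀ k ∈ W \ {p1, p2, u}, ¬ Bd G A k) :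
    Conf4 (Sc G W L C p1 p2 p1 u) := by
  classical
  have hc := (hs u h1.1 (by
    simp only [mem_insert_iff, mem_singleton_iff, not_or]; exact ⟨h1.2.2.ne', h2.2.2.ne'⟩)).1
  refine (F3 C (L u) hc hC (fun c hc => (hCL c hc).2.2)).mono ?_
  rintro ⟨a, e⟩ ⟨b, hab, he, hea, heb⟩
  simp only at hab he hea heb
  obtain ⟨l1, l2, l3⟩ := hCL _ hab
  simp only at l1 l2 l3
  have n1 := tp.adj.ne
  have n2 := h1.2.2.ne
  have n3 := h2.2.2.ne
  obtain ⟨ψ, g1, g2⟩ := dropTri (K := W \ {p1, p2, u})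
      (φ := fun v => if v = p1 then a else if v = p2 then b else e)
      ctx hs tp.m1 tp.m2 h1.1 tp.adj h1.2.2 h2.2.2
    ⟨subset_rfl, fun _ _ w hw _ => hw⟩ (fun k hk h => hk.2 (by
      rcases h with h | h <;> simp_all)) hb (by
      constructor
      · rintro v ⟨hv, hv'⟩
        by_cases hv1 : v = p1
        · simp [hv1, l1]
        by_cases hv2 : v = p2
        · simp [hv2, n1.symm, l2]
        · have : v = u := by by_contra h; exact hv' ⟨hv, by simp [*]⟩
          simp [this, n2.symm, n3.symm, he]
      · rintro v ⟨hv, hv'⟩ w ⟨hw, hw'⟩ hvw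
        have hv3 : v = p1 ∨ v = p2 ∨ v = u := by by_contra h; exact hv' ⟨hv, h⟩
        have hw3 : w = p1 ∨ w = p2 ∨ w = u := by by_contra h; exact hw' ⟨hw, h⟩
        have := hvw.ne
        grind)
  have k : ∀ v, v = p1 ∨ v = p2 ∨ v = u → v ∉ W \ {p1, p2, u} := fun v hv h => h.2 hv
  refine ⟨ψ, g1, ?_, ?_, ?_⟩
  · rw [g2 _ tp.m1 (k _ (by simp)), g2 _ tp.m2 (k _ (by simp))]
    simpa [n1.symm] using hab
  · rw [g2 _ tp.m1 (k _ (by simp))]; simp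
  · rw [g2 _ h1.1 (k _ (by simp))]; simp [n2.symm, n3.symm]

lemma stepC (ih : ∀ W', W' ⊂ W → CP G W') (hD : DP G W) (hM : MP G W) : CP G W := by
  intro A L C p1 p2 q1 q2 ctx tq tp hs hC hCL
  have hC' := hC.swap
  have hCL' : ∀ c ∈ {c | Prod.swap c ∈ C}, c.1 ∈ L p2 ∧ c.2 ∈ L p1 ∧ c.1 ≠ c.2 := by
    rintro ⟨a, b⟩ h
    have := hCL _ h
    simp only [Prod.swap] at this
    exact ⟨this.2.1, this.1, this.2.2.symm⟩
  have hs' : Std G A W L {p2, p1} := by rw [pair_comm]; exact hs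
  have eqcase : ∀ {c d}, (c, d) ∈ C → ∃ φ, Col G W L φ ∧ φ p1 = c ∧ φ p2 = d := fun h =>
    th2 ctx tp.m1 tp.m2 tp.b1 tp.b2 tp.adj hs (hCL _ h).1 (hCL _ h).2.1 (hCL _ h).2.2
  by_cases hq : q1 = p1 ∧ q2 = p2
  · obtain ⟨rfl, rfl⟩ := hq
    refine hC.mono ?_
    rintro ⟨c, d⟩ h
    obtain ⟨φ, h1, h2, h3⟩ := eqcase h
    exact ⟨φ, h1, by rw [h2, h3]; exact h, h2, h3⟩
  by_cases hq' : q1 = p2 ∧ q2 = p1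
  · obtain ⟨rfl, rfl⟩ := hq'
    apply conf_sc_swap
    refine hC.mono ?_
    rintro ⟨c, d⟩ h
    obtain ⟨φ, h1, h2, h3⟩ := eqcase h
    exact ⟨φ, h1, by rw [h2, h3]; exact h, h2, h3⟩
  by_cases hS : Spl G A W
  · exact cp_spl ih ctx tq tp hs hC hCL hS
  by_cases hN : ∃ u, Nb G A W p1 u ∧ Nb G A W p2 u
  · obtain ⟨u, h1, h2⟩ := hN
    have hb := tri_nobd ctx hS tp h1 h2
    have m1 : q1 = p1 ∨ q1 = p2 ∨ q1 = u := by by_contra h; exact hb _ ⟨tq.m1, h⟩ tq.b1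
    have m2 : q2 = p1 ∨ q2 = p2 ∨ q2 = u := by by_contra h; exact hb _ ⟨tq.m2, h⟩ tq.b2
    have hb' : ∀ k ∈ W \ {p2, p1, u}, ¬ Bd G A k := by rw [insert_comm]; exact hb
    have r1 := cp_tri ctx tp hs hC hCL h1 h2 hb
    have r2 := conf_sc_swapP (cp_tri ctx tp.symm hs' hC' hCL' h2 h1 hb')
    have := tq.adj.ne
    rcases m1 with rfl | rfl | rfl <;> rcases m2 with rfl | rfl | rfl
    all_goals first
      | exact r1 | exact r2 | exact conf_sc_swap r1 | exact conf_sc_swap r2 | simp_all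
  push Not at hN
  have hN1 : ∀ u, ¬ (Nb G A W p1 u ∧ Nb G A W p2 u) := fun u h => hN u h.1 h.2
  have hN2 : ∀ u, ¬ (Nb G A W p2 u ∧ Nb G A W p1 u) := fun u h => hN u h.2 h.1
  have t1 : ¬ H3 G A W p1 := fun h => hS (spl_of_H3 ctx tp.m1 tp.b1 h)
  have t2 : ¬ H3 G A W p2 := fun h => hS (spl_of_H3 ctx tp.m2 tp.b2 h)
  by_contra hg
  have hg' : ¬ Conf4 (Sc G W L {c | Prod.swap c ∈ C} p2 p1 q1 q2) := fun h => hg (conf_sc_swapP h)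
  have key : ∀ r ∈ C, ∀ s ∈ C, Rel r s → (r.1 = s.1 ∧ r.2 ≠ s.2 ∧ (p1 = q1 ∨ p1 = q2)) ∨
      (r.2 = s.2 ∧ r.1 ≠ s.1 ∧ (p2 = q1 ∨ p2 = q2)) := by
    rintro ⟨a, b⟩ hr ⟨a', b'⟩ hs2 ⟨hne, h⟩
    simp only at h
    rcases h with rfl | rfl | ⟨rfl, rfl⟩
    · have hb : b ≠ b' := by rintro rfl; exact hne rfl
      exact .inl ⟨rfl, hb, cp_dict hD ctx tq tp hs hCL t1 hN1 hg hr hs2 hb⟩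
    · have hb : a ≠ a' := by rintro rfl; exact hne rfl
      exact .inr ⟨rfl, hb, cp_dict hD ctx tq tp.symm hs' hCL' t2 hN2 hg' hr hs2 hb⟩
    · exfalso
      rcases cp_dem hM ctx tq tp hs hCL hN1 hg hr hs2 with h | h
      exacts [hq h, hq' h]
  obtain ⟨r, hr, s, hs2, t, ht, u, hu, hrs, htu, -, -, n1, n2⟩ := hC
  have both : ¬ ((p1 = q1 ∨ p1 = q2) ∧ (p2 = q1 ∨ p2 = q2)) := by
    have := tp.adj.ne
    grind
  obtain ⟨r1, r2⟩ := r
  obtain ⟨s1, s2⟩ := s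
  obtain ⟨t1', t2'⟩ := t
  obtain ⟨u1, u2⟩ := u
  rcases key _ hr _ hs2 hrs with ⟨k1, k2, k3⟩ | ⟨k1, k2, k3⟩ <;>
    rcases key _ ht _ hu htu with ⟨k1', k2', k3'⟩ | ⟨k1', k2', k3'⟩
  · simp only at k1 k2 k1' k2' n1
    subst k1 k1'
    have ne : r1 ≠ t1' := fun h => n1 ⟨rfl, h, h⟩
    rcases k3 with rfl | rfl
    · exact hg (cp_two ctx tq tp hs hCL (fun h => hq ⟨rfl, h⟩) hr hs2 k2 ht hu k2' ne)
    · exact hg (conf_sc_swap (cp_two ctx tq.symm tp hs hCL (fun h => hq' ⟨h, rfl⟩) hr hs2 k2 ht hu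
        k2' ne))
  · exact both ⟨k3, k3'⟩
  · exact both ⟨k3', k3⟩
  · simp only at k1 k2 k1' k2' n2
    subst k1 k1'
    have ne : r2 ≠ t2' := fun h => n2 ⟨rfl, h, h⟩
    rcases k3 with rfl | rfl
    · exact hg' (cp_two ctx tq tp.symm hs' hCL' (fun h => hq' ⟨rfl, h⟩) hr hs2 k2 ht hu k2' ne)
    · exact hg' (conf_sc_swap (cp_two ctx tq.symm tp.symm hs' hCL' (fun h => hq ⟨h, rfl⟩) hr hs2 k2
        ht hu k2' ne))

section
variable {f : ℤ → α} {a b i j k k' : ℤ}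

/-! ## Deleting sets of boundary vertices -/

open Classical in
/-- reserve the colours `D` from the interior neighbours of the set `R` -/
noncomputable def rmS (G : SimpleGraph α) (A R : Set α) (D : Finset ℕ) (L : α → Finset ℕ) :
    α → Finset ℕ := fun u => if ¬ Bd G A u ∧ ∃ r ∈ R, G.Adj r u then L u \ D else L u

lemma rmS_bd (D : Finset ℕ) (h : Bd G A u) : rmS G A R D L u = L u := by
  simp [rmS, h]

lemma rmS_sub (D : Finset ℕ) : rmS G A R D L u ⊆ L u := by
  unfold rmS; split_ifs
  · exact Finset.sdiff_subset
  · exact subset_rfl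

lemma rmS_adj (D : Finset ℕ) (h : ¬ Bd G A u) (hv : v ∈ R) (ha : G.Adj v u) :
    rmS G A R D L u = L u \ D := by
  unfold rmS; rw [if_pos ⟨h, v, hv, ha⟩]

lemma conn_of_center (h : ∀ v ∈ S, Rch G S u v) : Conn G S :=
  fun v hv w hw => (h v hv).symm.trans (h w hw)

lemma Ctx.delS (h : Ctx G A W) (hR : ∀ r ∈ R, Bd G A r) : Ctx G (A ∪ R) (W \ R) := by
  obtain ⟨a0, ha0⟩ := h.ne
  refine ⟨h.nm, ?_, ⟨a0, .inl ha0⟩, ?_, h.fin.subset sdiff_subset⟩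
  · apply conn_of_center (u := a0)
    have key : ∀ v ∈ A, Rch G (A ∪ R) a0 v := fun v hv =>
      (h.conn a0 ha0 v hv).mono subset_union_left
    rintro v (hv | hv)
    · exact key v hv
    · obtain ⟨a, ha, hav⟩ := hR v hv
      exact (key a ha).trans (Rch.of_adj hav (.inl ha) (.inr hv))
  · rintro a (ha | ha) hw
    · exact h.disj a ha hw.1
    · exact hw.2 ha

lemma Bd.insS (h : Bd G A u) : Bd G (A ∪ R) u := h.mono subset_union_left

lemma Tg.delS (h : Tg G A W q1 q2) (h1 : q1 ∉ R) (h2 : q2 ∉ R) : Tg G (A ∪ R) (W \ R) q1 q2 :=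
  ⟨⟨h.m1, h1⟩, ⟨h.m2, h2⟩, h.b1.insS, h.b2.insS, h.adj⟩

lemma Std.rmS (h : Std G A W L X) (R : Set α) (D : Finset ℕ) (hD : D.card ≤ 2) :
    Std G (A ∪ R) (W \ R) (rmS G A R D L) X := by
  intro v hv hX
  obtain ⟨h1, h2⟩ := h v hv.1 hX
  by_cases hb : Bd G A v
  · rw [rmS_bd D hb]; exact ⟨h1, fun h => (h hb.insS).elim⟩
  · have h5 := h2 hb
    by_cases hr : ∃ r ∈ R, G.Adj r v
    · obtain ⟨r, hr, ha⟩ := hr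
      rw [rmS_adj D hb hr ha]
      exact ⟨card_sdiff_ge _ _ 3 2 h5 hD, fun h => (h ⟨r, .inr hr, ha⟩).elim⟩
    · have : GE.rmS G A R D L v = L v := by
        unfold GE.rmS; rw [if_neg]; exact fun h => hr h.2
      rw [this]; exact ⟨h1, fun _ => h5⟩

lemma ext_rmS {D : Finset ℕ} (h : Col G (W \ R) (rmS G A R D L) φ)
    (hκ : ∀ r ∈ R, κ r ∈ L r ∧ κ r ∈ D) (hp : ∀ r ∈ R, ∀ s ∈ R, G.Adj r s → κ r ≠ κ s)
    (hN : ∀ r ∈ R, ∀ u, Nb G A W r u → u ∉ R → φ u ≠ κ r) :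
    ∃ ψ, Col G W L ψ ∧ (∀ r ∈ R, ψ r = κ r) ∧ ∀ u, u ∉ R → ψ u = φ u := by
  classical
  have aux : ∀ r ∈ R, ∀ u ∈ W, u ∉ R → G.Adj r u → φ u ≠ κ r := by
    intro r hr u hu huR ha
    by_cases hb : Bd G A u
    · exact hN r hr u ⟨hu, hb, ha⟩ huR
    · intro he
      have := h.1 u ⟨hu, huR⟩
      rw [rmS_adj D hb hr ha, he] at this
      exact (Finset.mem_sdiff.1 this).2 (hκ r hr).2
  refine ⟨fun v => if v ∈ R then κ v else φ v, ⟨?_, ?_⟩, fun r hr => by simp [hr],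
    fun u hu => by simp [hu]⟩
  · intro v hv
    by_cases hr : v ∈ R
    · simp only [hr, if_true]; exact (hκ v hr).1
    · simp only [hr, if_false]; exact rmS_sub _ (h.1 v ⟨hv, hr⟩)
  · intro u hu v hv ha
    by_cases h1 : u ∈ R <;> by_cases h2 : v ∈ R <;> simp only [h1, h2, if_true, if_false]
    · exact hp u h1 v h2 ha
    · exact (aux u h1 v hv h2 ha).symm
    · exact aux v h2 u hu h1 ha.symm
    · exact h.2 u ⟨hu, h1⟩ v ⟨hv, h2⟩ ha

/-! ## Paths indexed by integers -/

lemma path_conn (hf : ∀ k, i ≤ k → k < j → G.Adj (f k) (f (k + 1))) : Conn G (f '' Icc i j) := by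
  apply conn_of_center (u := f i)
  rintro _ ⟨k, ⟨h1, h2⟩, rfl⟩
  revert h2
  induction k, h1 using Int.leInduction with
  | base => intro _; exact .refl
  | succ k hk ih =>
    intro h2
    exact (ih (by omega)).trans (Rch.of_adj (hf k hk (by omega)) ⟨k, ⟨hk, by omega⟩, rfl⟩
      ⟨k + 1, ⟨by omega, h2⟩, rfl⟩)

/-- a long cycle of boundary vertices leaves no room for further boundary vertices -/
lemma cyc_no (ctx : Ctx G A W) (hS : ¬ Spl G A W) (hab : a + 3 ≤ b)
    (inj : InjOn f (Icc a b)) (hW : ∀ k ∈ Icc a b, f k ∈ W) (hB : ∀ k ∈ Icc a b, Bd G A (f k))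
    (hf : ∀ k, a ≤ k → k < b → G.Adj (f k) (f (k + 1))) (hc : G.Adj (f a) (f b))
    {q : α} (hq : q ∈ W) (bq : Bd G A q) (hqR : q ∉ f '' Icc a b) : False := by
  set R := f '' Icc a b with hR
  set C := comp G (W \ R) q with hC
  have hqC : q ∈ C := mem_comp ⟨hq, hqR⟩
  have hCs : C ⊆ W \ R := comp_sub
  have ne : ∀ k ∈ Icc a b, ∀ l ∈ Icc a b, k ≠ l → f k ≠ f l := fun k hk l hl h h' =>
    h (inj hk hl h')
  have notA : ∀ k ∈ Icc a b, f k ∉ A := fun k hk h => ctx.disj _ h (hW k hk)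
  have sub1 : ∀ i ∈ Icc a b, ∀ j ∈ Icc a b, G.Adj (f i) (f j) →
      ∃ m ∈ Icc a b, m ≠ i ∧ m ≠ j ∧ Adjs G {f m} C := by
    intro i hi j hj hadj
    by_contra hno
    push Not at hno
    obtain ⟨k, hk, hki, hkj⟩ : ∃ k ∈ Icc a b, k ≠ i ∧ k ≠ j := by
      by_cases h1 : a ≠ i ∧ a ≠ j
      · exact ⟨a, ⟨le_rfl, by omega⟩, h1⟩
      by_cases h2 : a + 1 ≠ i ∧ a + 1 ≠ j
      · exact ⟨a + 1, ⟨by omega, by omega⟩, h2⟩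
      · exact ⟨a + 2, ⟨by omega, by omega⟩, by omega, by omega⟩
    refine hS ⟨f i, f j, C, ⟨hW i hi, hW j hj, hB i hi, hB j hj, hadj⟩, ⟨?_, ?_⟩, ⟨q, hqC⟩,
      f k, ⟨hW k hk, ?_⟩, ?_⟩
    · intro v hv
      refine ⟨(hCs hv).1, ?_⟩
      rintro (rfl | rfl)
      exacts [(hCs hv).2 ⟨i, hi, rfl⟩, (hCs hv).2 ⟨j, hj, rfl⟩]
    · intro v hv w hw ha
      by_cases hwR : w ∈ R
      · obtain ⟨m, hm, rfl⟩ := hwR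
        refine (hno m hm ?_ ?_ ⟨_, rfl, v, hv, ha.symm⟩).elim
        · rintro rfl; exact hw.2 (.inl rfl)
        · rintro rfl; exact hw.2 (.inr rfl)
      · exact comp_closed hv ⟨hw.1, hwR⟩ ha
    · rintro (h | h)
      exacts [ne k hk i hi hki h, ne k hk j hj hkj h]
    · intro h; exact (hCs h).2 ⟨k, hk, rfl⟩
  have sub2 : ∀ i j, a ≤ i → i + 2 ≤ j → j ≤ b → (i ≠ a ∨ j ≠ b) → Adjs G {f i} C →
      Adjs G {f j} C → False := by
    intro i j hi hij hj hne ai aj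
    have mi : i ∈ Icc a b := ⟨hi, by omega⟩
    have mj : j ∈ Icc a b := ⟨by omega, hj⟩
    have hcon : Conn G (f '' Icc a (i - 1) ∪ f '' Icc (j + 1) b) := by
      have c1 : Conn G (f '' Icc a (i - 1)) := path_conn fun k h1 h2 => hf k h1 (by omega)
      have c2 : Conn G (f '' Icc (j + 1) b) := path_conn fun k h1 h2 => hf k (by omega) h2
      by_cases h1 : i = a
      · rw [Icc_eq_empty (by omega), image_empty, empty_union]; exact c2
      by_cases h2 : j = b
      · rw [Icc_eq_empty (a := j + 1) (by omega), image_empty, union_empty]; exact c1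
      exact conn_union c1 c2 (.of hc ⟨a, ⟨le_rfl, by omega⟩, rfl⟩ ⟨b, ⟨by omega, le_rfl⟩, rfl⟩)
    have hM' : ∀ v ∈ f '' Icc a (i - 1) ∪ f '' Icc (j + 1) b, ∃ k ∈ Icc a b, f k = v ∧
        (k < i ∨ j < k) := by
      rintro v (⟨k, ⟨h1, h2⟩, rfl⟩ | ⟨k, ⟨h1, h2⟩, rfl⟩)
      · exact ⟨k, ⟨h1, by omega⟩, rfl, by omega⟩
      · exact ⟨k, ⟨by omega, h2⟩, rfl, by omega⟩
    have hM : ∀ v ∈ f '' Icc (i + 1) (j - 1), ∃ k ∈ Icc a b, f k = v ∧ (i < k ∧ k < j) := by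
      rintro v ⟨k, ⟨h1, h2⟩, rfl⟩
      exact ⟨k, ⟨by omega, by omega⟩, rfl, by omega, by omega⟩
    have eM' : ∃ k ∈ Icc a b, f k ∈ f '' Icc a (i - 1) ∪ f '' Icc (j + 1) b := by
      rcases hne with h | h
      · exact ⟨a, ⟨le_rfl, by omega⟩, .inl ⟨a, ⟨le_rfl, by omega⟩, rfl⟩⟩
      · exact ⟨b, ⟨by omega, le_rfl⟩, .inr ⟨b, ⟨by omega, le_rfl⟩, rfl⟩⟩
    obtain ⟨k', hk', hk'M⟩ := eM'
    have eM : f (i + 1) ∈ f '' Icc (i + 1) (j - 1) := ⟨i + 1, ⟨le_rfl, by omega⟩, rfl⟩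
    have eM2 : f (j - 1) ∈ f '' Icc (i + 1) (j - 1) := ⟨j - 1, ⟨by omega, le_rfl⟩, rfl⟩
    refine ctx.nm.k33' (a := {f i}) (b := {f j}) (c := A) (x := f '' Icc (i + 1) (j - 1))
      (y := f '' Icc a (i - 1) ∪ f '' Icc (j + 1) b) (z := C) ⟨_, rfl⟩ ⟨_, rfl⟩ ctx.ne ⟨_, eM⟩
      ⟨_, hk'M⟩ ⟨q, hqC⟩ conn_single conn_single ctx.conn
      (path_conn fun k h1 h2 => hf k (by omega) (by omega)) hcon comp_conn
      ?_ ?_ ?_ ?_ ?_ ?_ ?_ ?_ ?_ ?_ ?_ ?_ ?_ ?_ ?_ ?_ ?_ ai ?_ ?_ aj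
      ((hB _ ⟨by omega, by omega⟩).adjs eM) ((hB _ hk').adjs hk'M) (bq.adjs hqC)
    · simpa using ne i mi j mj (by omega)
    · simpa using notA i mi
    · simpa using notA j mj
    · rw [Set.disjoint_left]; intro v h1 h2
      obtain ⟨k, hk, rfl, h3⟩ := hM _ h1
      obtain ⟨l, hl, h4, h5⟩ := hM' _ h2
      have := inj hl hk h4; omega
    · rw [Set.disjoint_left]; intro v h1 h2
      obtain ⟨k, hk, rfl, h3⟩ := hM _ h1
      exact (hCs h2).2 ⟨k, hk, rfl⟩
    · rw [Set.disjoint_left]; intro v h1 h2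
      obtain ⟨k, hk, rfl, h3⟩ := hM' _ h1
      exact (hCs h2).2 ⟨k, hk, rfl⟩
    · rw [disjoint_singleton_left]; intro h
      obtain ⟨k, hk, h3, h4⟩ := hM _ h
      have := inj hk mi h3; omega
    · rw [disjoint_singleton_left]; intro h
      obtain ⟨k, hk, h3, h4⟩ := hM' _ h
      have := inj hk mi h3; omega
    · rw [disjoint_singleton_left]; intro h
      exact (hCs h).2 ⟨i, mi, rfl⟩
    · rw [disjoint_singleton_left]; intro h
      obtain ⟨k, hk, h3, h4⟩ := hM _ h
      have := inj hk mj h3; omega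
    · rw [disjoint_singleton_left]; intro h
      obtain ⟨k, hk, h3, h4⟩ := hM' _ h
      have := inj hk mj h3; omega
    · rw [disjoint_singleton_left]; intro h
      exact (hCs h).2 ⟨j, mj, rfl⟩
    · rw [Set.disjoint_left]; intro v h1 h2
      obtain ⟨k, hk, rfl, h3⟩ := hM _ h2
      exact notA k hk h1
    · rw [Set.disjoint_left]; intro v h1 h2
      obtain ⟨k, hk, rfl, h3⟩ := hM' _ h2
      exact notA k hk h1
    · rw [Set.disjoint_left]; intro v h1 h2
      exact ctx.disj v h1 (hCs h2).1
    · exact .of (hf i hi (by omega)) rfl eM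
    · by_cases h : i = a
      · subst h
        exact .of hc rfl (.inr ⟨b, ⟨by omega, le_rfl⟩, rfl⟩)
      · have := hf (i - 1) (by omega) (by omega)
        rw [sub_add_cancel] at this
        exact .of this.symm rfl (.inl ⟨i - 1, ⟨by omega, le_rfl⟩, rfl⟩)
    · have := hf (j - 1) (by omega) (by omega)
      rw [sub_add_cancel] at this
      exact .of this.symm rfl eM2
    · by_cases h : j = b
      · subst h
        exact .of hc.symm rfl (.inl ⟨a, ⟨le_rfl, by omega⟩, rfl⟩)
      · exact .of (hf j (by omega) (by omega)) rfl (.inr ⟨j + 1, ⟨le_rfl, by omega⟩, rfl⟩)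
  obtain ⟨m1, ⟨hm1, hm1'⟩, n1, n2, at1⟩ := sub1 a ⟨le_rfl, by omega⟩ b ⟨by omega, le_rfl⟩ hc
  obtain ⟨m2, ⟨hm2, hm2'⟩, n3, n4, at2⟩ := sub1 m1 ⟨hm1, hm1'⟩ (m1 + 1) ⟨by omega, by omega⟩
    (hf m1 hm1 (by omega))
  by_cases h : m1 + 2 ≤ m2
  · exact sub2 m1 m2 hm1 h hm2' (.inl n1) at1 at2
  by_cases h' : m2 + 2 ≤ m1
  · exact sub2 m2 m1 hm2 h' hm1' (.inr n2) at2 at1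
  have : m2 = m1 - 1 := by omega
  subst this
  have := hf (m1 - 1) (by omega) (by omega)
  rw [sub_add_cancel] at this
  obtain ⟨m3, ⟨hm3, hm3'⟩, n5, n6, at3⟩ := sub1 (m1 - 1) ⟨hm2, hm2'⟩ m1 ⟨hm1, hm1'⟩ this
  by_cases h2 : m3 = m1 + 1
  · subst h2; exact sub2 (m1 - 1) (m1 + 1) hm2 (by omega) hm3' (by omega) at2 at3
  by_cases h3 : m1 + 2 ≤ m3
  · exact sub2 m1 m3 hm1 h3 hm3' (.inl n1) at1 at3
  · exact sub2 m3 m1 hm3 (by omega) hm1' (.inr n2) at3 at1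

/-! ## Democracies without a common boundary neighbour -/

structure MPath (G : SimpleGraph α) (A W : Set α) (L : α → Finset ℕ) (L0 : Finset ℕ)
    (q1 q2 p1 p2 : α) (f : ℤ → α) (a b : ℤ) : Prop where
  ha : a ≤ 0
  hb : 1 ≤ b
  f0 : f 0 = p1
  f1 : f 1 = p2
  inj : InjOn f (Icc a b)
  mem : ∀ k ∈ Icc a b, f k ∈ W
  bd : ∀ k ∈ Icc a b, Bd G A (f k)
  lst : ∀ k ∈ Icc a b, L0 ⊆ L (f k)
  av : ∀ k ∈ Icc a b, k ≠ 0 → k ≠ 1 → f k ≠ q1 ∧ f k ≠ q2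
  adj : ∀ k, a ≤ k → k < b → G.Adj (f k) (f (k + 1))

/-- global hypotheses for the paths -/
structure MHyp (G : SimpleGraph α) (A W : Set α) (q1 q2 p1 p2 : α) : Prop where
  ctx : Ctx G A W
  spl : ¬ Spl G A W
  tq : Tg G A W q1 q2
  tp : Tg G A W p1 p2
  nc : ∀ u, ¬ (Nb G A W p1 u ∧ Nb G A W p2 u)
  n1 : ¬ (q1 = p1 ∧ q2 = p2)
  n2 : ¬ (q1 = p2 ∧ q2 = p1)

lemma MHyp.h3 (h : MHyp G A W q1 q2 p1 p2) (hv : v ∈ W) (bv : Bd G A v) : ¬ H3 G A W v :=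
  fun h' => h.spl (spl_of_H3 h.ctx hv bv h')

lemma mpath_max (hfin : W.Finite) (h0 : ∃ f, MPath G A W L L0 q1 q2 p1 p2 f 0 1) :
    ∃ f a b, MPath G A W L L0 q1 q2 p1 p2 f a b ∧
      ∀ f' a' b', MPath G A W L L0 q1 q2 p1 p2 f' a' b' → b' - a' ≤ b - a := by
  by_contra hno
  push Not at hno
  have key : ∀ n : ℕ, ∃ f a b, MPath G A W L L0 q1 q2 p1 p2 f a b ∧ (n : ℤ) ≤ b - a := by
    intro n
    induction n with
    | zero => obtain ⟨f, hf⟩ := h0; exact ⟨f, 0, 1, hf, by simp⟩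
    | succ n ih =>
      obtain ⟨f, a, b, h1, h2⟩ := ih
      obtain ⟨f', a', b', h3, h4⟩ := hno f a b h1
      exact ⟨f', a', b', h3, by push_cast; omega⟩
  obtain ⟨f, a, b, h1, h2⟩ := key W.ncard
  have h3 : (f '' Icc a b).ncard ≤ W.ncard := Set.ncard_le_ncard (by
    rintro _ ⟨k, hk, rfl⟩; exact h1.mem k hk) hfin
  rw [Set.ncard_image_of_injOn h1.inj] at h3
  have h4 : (Icc a b).ncard = (b + 1 - a).toNat := by
    rw [← Finset.coe_Icc, Set.ncard_coe_finset, Int.card_Icc]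
  omega

lemma mpath_base (hp : MHyp G A W q1 q2 p1 p2) (h1 : L0 ⊆ L p1) (h2 : L0 ⊆ L p2) :
    ∃ f, MPath G A W L L0 q1 q2 p1 p2 f 0 1 := by
  have tp := hp.tp
  have hk : ∀ k ∈ Icc (0 : ℤ) 1, k = 0 ∨ k = 1 := fun k hk => by have := hk.1; have := hk.2; omega
  refine ⟨fun k => if k = 0 then p1 else p2, le_rfl, le_rfl, by simp, by simp, ?_, ?_, ?_, ?_, ?_,
    ?_⟩
  · intro k h1 l h2 h
    have := tp.adj.ne
    rcases hk k h1 with rfl | rfl <;> rcases hk l h2 with rfl | rfl <;> simp_all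
  · intro k h; rcases hk k h with rfl | rfl
    · simpa using tp.m1
    · simpa using tp.m2
  · intro k h; rcases hk k h with rfl | rfl
    · simpa using tp.b1
    · simpa using tp.b2
  · intro k h; rcases hk k h with rfl | rfl
    · simpa using h1
    · simpa using h2
  · intro k h; rcases hk k h with rfl | rfl <;> simp
  · intro k h h'
    have : k = 0 := by omega
    subst this; simpa using tp.adj

lemma MPath.nb_next (h : MPath G A W L L0 q1 q2 p1 p2 f a b) (h1 : a ≤ k) (h2 : k < b) : Nb G A W (f k) (f (k + 1)) :=
  ⟨h.mem _ ⟨by omega, by omega⟩, h.bd _ ⟨by omega, by omega⟩, h.adj k h1 h2⟩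

lemma MPath.nb_prev (h : MPath G A W L L0 q1 q2 p1 p2 f a b) (h1 : a < k) (h2 : k ≤ b) : Nb G A W (f k) (f (k - 1)) := by
  have := h.adj (k - 1) (by omega) (by omega)
  rw [sub_add_cancel] at this
  exact ⟨h.mem _ ⟨by omega, by omega⟩, h.bd _ ⟨by omega, by omega⟩, this.symm⟩

lemma MPath.ne (h : MPath G A W L L0 q1 q2 p1 p2 f a b) (hi : i ∈ Icc a b) (hj : j ∈ Icc a b) (hij : i ≠ j) : f i ≠ f j :=
  fun h' => hij (h.inj hi hj h')

lemma MPath.qout (hp : MHyp G A W q1 q2 p1 p2)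
    (h : MPath G A W L L0 q1 q2 p1 p2 f a b) : ∃ q ∈ W, Bd G A q ∧ q ∉ f '' Icc a b := by
  have h01 := hp.tq.adj.ne
  have n1 := hp.n1
  have n2 := hp.n2
  have key : ∀ q, q = q1 ∨ q = q2 → q ∈ f '' Icc a b → q = p1 ∨ q = p2 := by
    rintro q hq ⟨k, hk, rfl⟩
    by_contra hc
    have := h.av k hk (by rintro rfl; exact hc (.inl h.f0)) (by rintro rfl; exact hc (.inr h.f1))
    tauto
  by_cases hq1 : q1 ∈ f '' Icc a b
  · by_cases hq2 : q2 ∈ f '' Icc a b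
    · have := key q1 (by simp) hq1
      have := key q2 (by simp) hq2
      grind
    · exact ⟨q2, hp.tq.m2, hp.tq.b2, hq2⟩
  · exact ⟨q1, hp.tq.m1, hp.tq.b1, hq1⟩

lemma MPath.chord (hp : MHyp G A W q1 q2 p1 p2)
    (h : MPath G A W L L0 q1 q2 p1 p2 f a b) (hi : a ≤ i) (hij : i < j) (hj : j ≤ b) (ha : G.Adj (f i) (f j)) :
    j = i + 1 := by
  by_contra hne
  have mi : i ∈ Icc a b := ⟨hi, by omega⟩
  have mj : j ∈ Icc a b := ⟨by omega, hj⟩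
  have ea : i = a := by
    by_contra hia
    refine hp.h3 (h.mem i mi) (h.bd i mi) ⟨_, _, _, h.nb_prev (by omega) mi.2,
      h.nb_next mi.1 (by omega), ⟨h.mem j mj, h.bd j mj, ha⟩,
      h.ne ⟨by omega, by omega⟩ ⟨by omega, by omega⟩ (by omega),
      h.ne ⟨by omega, by omega⟩ mj (by omega), h.ne ⟨by omega, by omega⟩ mj (by omega)⟩
  have eb : j = b := by
    by_contra hib
    refine hp.h3 (h.mem j mj) (h.bd j mj) ⟨_, _, _, h.nb_prev (by omega) mj.2,
      h.nb_next mj.1 (by omega), ⟨h.mem i mi, h.bd i mi, ha.symm⟩,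
      h.ne ⟨by omega, by omega⟩ ⟨by omega, by omega⟩ (by omega),
      h.ne ⟨by omega, by omega⟩ mi (by omega), h.ne ⟨by omega, by omega⟩ mi (by omega)⟩
  subst ea eb
  by_cases h3 : i + 3 ≤ j
  · obtain ⟨q, hq, bq, hqR⟩ := h.qout hp
    exact cyc_no hp.ctx hp.spl h3 h.inj h.mem h.bd h.adj ha hq bq hqR
  have e2 : j = i + 2 := by omega
  subst e2
  have := h.ha
  have := h.hb
  rcases (by omega : i = 0 ∨ i = -1) with rfl | rfl
  · have h1 := h.nb_next (k := 1) (by omega) (by omega)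
    rw [h.f1] at h1
    rw [h.f0] at ha
    exact hp.nc _ ⟨⟨h1.1, h1.2.1, ha⟩, h1⟩
  · have h1 := h.nb_prev (k := 0) (by omega) (by omega)
    rw [h.f0] at h1
    norm_num at ha h1
    rw [h.f1] at ha
    exact hp.nc _ ⟨h1, ⟨h1.1, h1.2.1, ha.symm⟩⟩

lemma MPath.out_end (hp : MHyp G A W q1 q2 p1 p2)
    (h : MPath G A W L L0 q1 q2 p1 p2 f a b) (hk : k ∈ Icc a b) (hu : Nb G A W (f k) u) (hR : u ∉ f '' Icc a b) :
    k = a ∨ k = b := by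
  by_contra hc
  have h1 := hk.1
  have h2 := hk.2
  have m1 : k - 1 ∈ Icc a b := ⟨by omega, by omega⟩
  have m2 : k + 1 ∈ Icc a b := ⟨by omega, by omega⟩
  refine hp.h3 (h.mem k hk) (h.bd k hk) ⟨_, _, _, h.nb_prev (by omega) hk.2,
      h.nb_next hk.1 (by omega), hu, h.ne m1 m2 (by omega), ?_, ?_⟩
  · rintro rfl; exact hR ⟨_, m1, rfl⟩
  · rintro rfl; exact hR ⟨_, m2, rfl⟩

lemma MPath.out_uniq (hp : MHyp G A W q1 q2 p1 p2)
    (h : MPath G A W L L0 q1 q2 p1 p2 f a b) (hk : k = a ∨ k = b) (hu : Nb G A W (f k) u) (hR : u ∉ f '' Icc a b)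
    (hv : Nb G A W (f k) v) (hRv : v ∉ f '' Icc a b) : u = v := by
  by_contra hc
  have h1 := h.ha
  have h2 := h.hb
  obtain ⟨l, hl, hn⟩ : ∃ l ∈ Icc a b, Nb G A W (f k) (f l) := by
    rcases hk with rfl | rfl
    · exact ⟨_, ⟨by omega, by omega⟩, h.nb_next le_rfl (by omega)⟩
    · exact ⟨_, ⟨by omega, by omega⟩, h.nb_prev (by omega) le_rfl⟩
  have hk : k ∈ Icc a b := by rcases hk with rfl | rfl <;> exact ⟨by omega, by omega⟩
  refine hp.h3 (h.mem k hk) (h.bd k hk) ⟨_, _, _, hn, hu, hv, ?_, ?_, hc⟩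
  · rintro rfl; exact hR ⟨_, hl, rfl⟩
  · rintro rfl; exact hRv ⟨_, hl, rfl⟩

/-- extending alternately along the path -/
lemma MPath.ext (hp : MHyp G A W q1 q2 p1 p2)
    (h : MPath G A W L L0 q1 q2 p1 p2 f a b) {c d : ℕ} (hcd : c ≠ d) (hL0 : L0 = {c, d})
    (hφ : Col G (W \ (f '' Icc a b)) (rmS G A (f '' Icc a b) L0 L) φ)
    (hNa : ∀ u, Nb G A W (f a) u → u ∉ f '' Icc a b → φ u ≠ if Even a then c else d)
    (hNb : ∀ u, Nb G A W (f b) u → u ∉ f '' Icc a b → φ u ≠ if Even b then c else d) :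
    ∃ ψ, Col G W L ψ ∧ (∀ k ∈ Icc a b, ψ (f k) = if Even k then c else d) ∧
      ∀ u, u ∉ f '' Icc a b → ψ u = φ u := by
  classical
  set κ : α → ℕ := fun v => if Even (Function.invFunOn f (Icc a b) v) then c else d with hκ
  have hκf : ∀ k ∈ Icc a b, κ (f k) = if Even k then c else d := by
    intro k hk
    have : Function.invFunOn f (Icc a b) (f k) = k := h.inj.leftInvOn_invFunOn hk
    simp only [hκ, this]
  obtain ⟨ψ, g1, g2, g3⟩ := ext_rmS (κ := κ) hφ (by
    rintro _ ⟨k, hk, rfl⟩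
    have : κ (f k) ∈ L0 := by rw [hκf k hk, hL0]; split_ifs <;> simp
    exact ⟨h.lst k hk this, this⟩) (by
    have key : ∀ k ∈ Icc a b, ∀ l ∈ Icc a b, k < l → G.Adj (f k) (f l) → κ (f k) ≠ κ (f l) := by
      intro k hk l hl hkl ha
      have := h.chord hp hk.1 hkl hl.2 ha
      subst this
      rw [hκf _ hk, hκf _ hl]
      by_cases he : Even k
      · have : ¬ Even (k + 1) := by rw [Int.even_add_one]; simpa using he
        simp [he, this, hcd]
      · have : Even (k + 1) := by rw [Int.even_add_one]; exact he
        simp [he, this, hcd.symm]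
    rintro _ ⟨k, hk, rfl⟩ _ ⟨l, hl, rfl⟩ ha
    rcases lt_trichotomy k l with h' | rfl | h'
    · exact key k hk l hl h' ha
    · exact (ha.ne rfl).elim
    · exact (key l hl k hk h' ha.symm).symm) (by
    rintro _ ⟨k, hk, rfl⟩ u hu huR
    rw [hκf k hk]
    rcases h.out_end hp hk hu huR with rfl | rfl
    · exact hNa u hu huR
    · exact hNb u hu huR)
  exact ⟨ψ, g1, fun k hk => (g2 _ ⟨k, hk, rfl⟩).trans (hκf k hk), g3⟩

lemma MPath.out_card (h : MPath G A W L L0 q1 q2 p1 p2 f a b) (hs : Std G A W L {p1, p2}) :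
    ∀ v ∈ W, v ∉ f '' Icc a b → 3 ≤ (L v).card := by
  have ha := h.ha
  have hb := h.hb
  intro v hv hR
  refine (hs v hv ?_).1
  rintro (rfl | rfl)
  · exact hR ⟨0, ⟨ha, by omega⟩, h.f0⟩
  · exact hR ⟨1, ⟨by omega, hb⟩, h.f1⟩

/-- extend the path by one vertex at one of the ends -/
lemma MPath.ext1 {m a' b' : ℤ} (h : MPath G A W L L0 q1 q2 p1 p2 f a b)
    (hm : (m = a - 1 ∧ a' = a - 1 ∧ b' = b) ∨ (m = b + 1 ∧ a' = a ∧ b' = b + 1))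
    (hua : m = a - 1 → Nb G A W (f a) u) (hub : m = b + 1 → Nb G A W (f b) u)
    (hR : u ∉ f '' Icc a b) (hL : L0 ⊆ L u) (h1 : u ≠ q1) (h2 : u ≠ q2) :
    MPath G A W L L0 q1 q2 p1 p2 (update f m u) a' b' := by
  have ha := h.ha
  have hb := h.hb
  have hu : u ∈ W ∧ Bd G A u := by
    rcases hm with hm | hm
    exacts [⟨(hua hm.1).1, (hua hm.1).2.1⟩, ⟨(hub hm.1).1, (hub hm.1).2.1⟩]
  have hcase : ∀ k ∈ Icc a' b', k = m ∨ k ∈ Icc a b := fun k hk => by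
    have := hk.1; have := hk.2
    by_cases h : k = m
    · exact .inl h
    · exact .inr ⟨by omega, by omega⟩
  have e : ∀ k ∈ Icc a b, update f m u k = f k := fun k hk =>
    update_of_ne (by have := hk.1; have := hk.2; omega) _ _
  have e' : update f m u m = u := update_self _ _ _
  refine ⟨by omega, by omega, ?_, ?_, ?_, ?_, ?_, ?_, ?_, ?_⟩
  · rw [e 0 ⟨ha, by omega⟩, h.f0]
  · rw [e 1 ⟨by omega, hb⟩, h.f1]
  · intro k hk l hl hkl
    rcases hcase k hk with rfl | hk <;> rcases hcase l hl with rfl | hl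
    · rfl
    · rw [e', e l hl] at hkl; exact (hR ⟨l, hl, hkl.symm⟩).elim
    · rw [e', e k hk] at hkl; exact (hR ⟨k, hk, hkl⟩).elim
    · rw [e k hk, e l hl] at hkl; exact h.inj hk hl hkl
  iterate 4
    intro k hk; rcases hcase k hk with rfl | hk
    · rw [e']; first | exact hu.1 | exact hu.2 | exact hL | exact fun _ _ => ⟨h1, h2⟩
    · rw [e k hk]; first | exact h.mem k hk | exact h.bd k hk | exact h.lst k hk | exact h.av k hk
  · intro k hk1 hk2
    by_cases hk : k = m
    · subst hk
      obtain rfl : a = k + 1 := by omega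
      rw [e', e _ ⟨le_rfl, by omega⟩]; exact (hua (by omega)).2.2.symm
    by_cases hk' : k + 1 = m
    · obtain rfl : k = b := by omega
      rw [hk', e', e k ⟨by omega, le_rfl⟩]; exact (hub (by omega)).2.2
    · rw [e k ⟨by omega, by omega⟩, e (k + 1) ⟨by omega, by omega⟩]
      exact h.adj k (by omega) (by omega)

lemma conf_fst {T' : Set (ℕ × ℕ)} (h : Conf4 T') : ∃ c ∈ T', ∃ d ∈ T', c.1 ≠ d.1 := by
  obtain ⟨r, hr, s, hs, t, ht, u, hu, -, -, -, -, h1, -⟩ := h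
  by_contra hc
  push Not at hc
  exact h1 ⟨hc r hr s hs, hc r hr t ht, hc r hr u hu⟩

/-- a two-list vertex forces two colours at any other boundary vertex -/
lemma tp_vertex (hT : TP G W) (ctx : Ctx G A W) (hr : r ∈ W) (br : Bd G A r) (hy : y ∈ W)
    (by' : Bd G A y) (hne : y ≠ r) (hs : Std G A W L {r}) (h2 : 2 ≤ (L r).card) :
    ∃ e e', e ≠ e' ∧ (∃ φ, Col G W L φ ∧ φ y = e) ∧ ∃ φ, Col G W L φ ∧ φ y = e' := by
  by_cases hN : ∃ w, Nb G A W y w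
  · obtain ⟨w, hw⟩ := hN
    obtain ⟨c, ⟨φ, h1, h2, -⟩, d, ⟨φ', h3, h4, -⟩, hcd⟩ :=
      conf_fst (hT A L r y w ctx ⟨hy, hw.1, by', hw.2.1, hw.2.2⟩ hr br hs h2)
    exact ⟨c.1, d.1, hcd, ⟨φ, h1, h2⟩, φ', h3, h4⟩
  · have key : ∀ e ∈ L y, ∃ φ, Col G W L φ ∧ φ y = e := by
      intro e he
      have hry : ¬ G.Adj y r := fun h => hN ⟨r, hr, br, h⟩
      obtain ⟨c, hc⟩ : (L r).Nonempty := Finset.card_pos.1 (by omega)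
      obtain ⟨φ, h1, h2⟩ := th1 (p := r) (c := c) (ctx.del by') ⟨hr, fun h => hne h.symm⟩ br.ins
        (hs.rmA (Y := {r}) y e (fun u hu => (hN ⟨u, hu⟩).elim) (subset_insert _ _))
        (by rw [rmA_nadj e hry]; exact hc)
      obtain ⟨ψ, h3, h4, -⟩ := ext_rmA h1 he
      exact ⟨ψ, h3, h4⟩
    obtain ⟨a, ha, b, hb, hab⟩ := pick2 (L y) (by have := (hs y hy hne).1; omega)
    exact ⟨a, b, hab, key a ha, key b hb⟩

lemma two_set (h : L0.card = 2) {c : ℕ} (hc : c ∈ L0) : ∃ d, c ≠ d ∧ L0 = {c, d} := by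
  obtain ⟨a, b, hab, rfl⟩ := Finset.card_eq_two.1 h
  rcases Finset.mem_insert.1 hc with rfl | hc
  · exact ⟨b, hab, rfl⟩
  · rw [Finset.mem_singleton] at hc; subst hc
    exact ⟨a, hab.symm, Finset.pair_comm _ _⟩

/-- colour the removed path so that one end gets colour `c`, the neighbours of the other end
avoiding `L0` -/
lemma MPath.extE (hp : MHyp G A W q1 q2 p1 p2) (h : MPath G A W L L0 q1 q2 p1 p2 f a b)
    (h0 : L0.card = 2) (hk : (k = a ∧ k' = b) ∨ (k = b ∧ k' = a))
    (hφ : Col G (W \ (f '' Icc a b)) (rmS G A (f '' Icc a b) L0 L) φ)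
    (hN : ∀ u, Nb G A W (f k) u → u ∉ f '' Icc a b → φ u ∉ L0) {c : ℕ} (hc : c ∈ L0)
    (hN' : ∀ u, Nb G A W (f k') u → u ∉ f '' Icc a b → φ u ≠ c) :
    ∃ ψ, Col G W L ψ ∧ ψ (f k') = c ∧ ∀ u, u ∉ f '' Icc a b → ψ u = φ u := by
  obtain ⟨d, hcd, hL⟩ := two_set h0 hc
  obtain ⟨α, β, hαβ, hL', hc'⟩ : ∃ α β, α ≠ β ∧ L0 = {α, β} ∧ (if Even k' then α else β) = c := by
    by_cases hev : Even k'
    · exact ⟨c, d, hcd, hL, by simp [hev]⟩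
    · exact ⟨d, c, hcd.symm, by rw [hL, Finset.pair_comm], by simp [hev]⟩
  have hin : ∀ l : ℤ, (if Even l then α else β) ∈ L0 := by intro l; rw [hL']; split_ifs <;> simp
  have ha := h.ha
  have hb := h.hb
  have hk'm : k' ∈ Icc a b := by rcases hk with ⟨_, rfl⟩ | ⟨_, rfl⟩ <;> exact ⟨by omega, by omega⟩
  obtain ⟨ψ, h1, h2, h3⟩ := h.ext hp hαβ hL' hφ (by
      intro u hu hR
      rcases hk with ⟨rfl, rfl⟩ | ⟨rfl, rfl⟩
      · intro he; exact hN u hu hR (he ▸ hin _)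
      · rw [hc']; exact hN' u hu hR) (by
      intro u hu hR
      rcases hk with ⟨rfl, rfl⟩ | ⟨rfl, rfl⟩
      · rw [hc']; exact hN' u hu hR
      · intro he; exact hN u hu hR (he ▸ hin _))
  exact ⟨ψ, h1, by rw [h2 k' hk'm, hc'], h3⟩

lemma MPath.extE' (hp : MHyp G A W q1 q2 p1 p2) (h : MPath G A W L L0 q1 q2 p1 p2 f a b)
    (h0 : L0.card = 2) (hk : k = a ∨ k = b)
    (hφ : Col G (W \ (f '' Icc a b)) (rmS G A (f '' Icc a b) L0 L) φ)
    (hN : ∀ u, Nb G A W (f k) u → u ∉ f '' Icc a b → φ u ∉ L0) :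
    ∃ ψ, Col G W L ψ ∧ ∀ u, u ∉ f '' Icc a b → ψ u = φ u := by
  obtain ⟨k', hk'⟩ : ∃ k', (k = a ∧ k' = b) ∨ (k = b ∧ k' = a) := by
    rcases hk with rfl | rfl
    · exact ⟨b, .inl ⟨rfl, rfl⟩⟩
    · exact ⟨a, .inr ⟨rfl, rfl⟩⟩
  have hk2 : k' = a ∨ k' = b := by tauto
  obtain ⟨c, hc, hc'⟩ : ∃ c ∈ L0, ∀ u, Nb G A W (f k') u → u ∉ f '' Icc a b → φ u ≠ c := by
    obtain ⟨c, hc, d, hd, hcd⟩ := pick2 L0 (by omega)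
    by_cases hex : ∃ u, Nb G A W (f k') u ∧ u ∉ f '' Icc a b
    · obtain ⟨u, hu, huR⟩ := hex
      by_cases hφu : φ u = c
      · refine ⟨d, hd, fun v hv hvR => ?_⟩
        rw [← h.out_uniq hp hk2 hu huR hv hvR, hφu]; exact hcd
      · refine ⟨c, hc, fun v hv hvR => ?_⟩
        rw [← h.out_uniq hp hk2 hu huR hv hvR]; exact hφu
    · exact ⟨c, hc, fun u hu huR => (hex ⟨u, hu, huR⟩).elim⟩
  obtain ⟨ψ, h1, -, h3⟩ := h.extE hp h0 hk' hφ hN hc hc'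
  exact ⟨ψ, h1, h3⟩

lemma MPath.bdR (h : MPath G A W L L0 q1 q2 p1 p2 f a b) : ∀ r ∈ f '' Icc a b, Bd G A r := by
  rintro _ ⟨k, hk, rfl⟩; exact h.bd k hk

lemma MPath.std (h : MPath G A W L L0 q1 q2 p1 p2 f a b) (h0 : L0.card = 2)
    (hs : Std G A W L {p1, p2}) :
    Std G (A ∪ f '' Icc a b) (W \ (f '' Icc a b)) (rmS G A (f '' Icc a b) L0 L) ∅ := by
  intro v hv _
  have ha := h.ha
  have hb := h.hb
  refine hs.rmS (f '' Icc a b) L0 h0.le v hv ?_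
  rintro (rfl | rfl)
  · exact hv.2 ⟨0, ⟨ha, by omega⟩, h.f0⟩
  · exact hv.2 ⟨1, ⟨by omega, hb⟩, h.f1⟩

lemma card_nsub {U : Finset ℕ} (h0 : L0.card = 2) (h : ¬ L0 ⊆ U) (hU : 3 ≤ U.card) :
    2 ≤ (U \ L0).card := by
  have h1 : (U ∩ L0).card < L0.card := by
    refine Finset.card_lt_card ⟨Finset.inter_subset_right, fun h2 => h (h2.trans Finset.inter_subset_left)⟩
  have h2 := Finset.card_sdiff_add_card_inter U L0
  omega

/-- all outside neighbours of the ends are targets -/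
lemma mp_two (hp : MHyp G A W q1 q2 p1 p2) (h : MPath G A W L L0 q1 q2 p1 p2 f a b)
    (h0 : L0.card = 2) (hs : Std G A W L {p1, p2}) (hk : (k = a ∧ k' = b) ∨ (k = b ∧ k' = a))
    (hq1 : q1 ∉ f '' Icc a b) (hq2 : q2 ∉ f '' Icc a b) (n1 : Nb G A W (f k) q1)
    (n2 : Nb G A W (f k') q2) : Conf4 (Sq G W L q1 q2) := by
  have hk1 : k = a ∨ k = b := by tauto
  have hk2 : k' = a ∨ k' = b := by tauto
  have ha := h.ha
  have hb := h.hb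
  have hP := h.out_card hs
  have key : ∀ e g, e ∈ L q1 → g ∈ L q2 → e ≠ g → (e ∉ L0 ∨ g ∉ L0) → (e, g) ∈ Sq G W L q1 q2 := by
    intro e g he hg heg hor
    obtain ⟨φ, h1, h2, h3⟩ := th2 (c1 := e) (c2 := g) (hp.ctx.delS h.bdR) (hp.tq.delS hq1 hq2).m1
      (hp.tq.delS hq1 hq2).m2 (hp.tq.delS hq1 hq2).b1 (hp.tq.delS hq1 hq2).b2 hp.tq.adj
      ((h.std h0 hs).mono (empty_subset _)) (by rw [rmS_bd _ hp.tq.b1]; exact he)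
      (by rw [rmS_bd _ hp.tq.b2]; exact hg) heg
    obtain ⟨ψ, h4, h5⟩ : ∃ ψ, Col G W L ψ ∧ ∀ u, u ∉ f '' Icc a b → ψ u = φ u := by
      rcases hor with ho | ho
      · refine h.extE' hp h0 hk1 h1 fun u hu hR => ?_
        rw [← h.out_uniq hp hk1 n1 hq1 hu hR, h2]; exact ho
      · refine h.extE' hp h0 hk2 h1 fun u hu hR => ?_
        rw [← h.out_uniq hp hk2 n2 hq2 hu hR, h3]; exact ho
    exact ⟨ψ, h4, by rw [h5 _ hq1, h2], by rw [h5 _ hq2, h3]⟩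
  have c1 := hP q1 hp.tq.m1 hq1
  have c2 := hP q2 hp.tq.m2 hq2
  obtain ⟨e0, he0, he0'⟩ : ∃ e ∈ L q1, e ∉ L0 := by
    by_contra hc; push Not at hc; have := Finset.card_le_card hc; omega
  obtain ⟨g0, hg0, hg0'⟩ : ∃ e ∈ L q2, e ∉ L0 := by
    by_contra hc; push Not at hc; have := Finset.card_le_card hc; omega
  obtain ⟨e1, he1, h11, h12⟩ := exists_avoid2 _ c1 e0 g0
  obtain ⟨e2, he2, h21, h22⟩ := exists_avoid2 _ c1 e1 g0
  obtain ⟨g1, hg1, g2, hg2, hgg, hg1', hg2'⟩ := pick2ne _ c2 e0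
  refine ⟨(e0, g1), key _ _ he0 hg1 hg1'.symm (.inl he0'), (e0, g2),
    key _ _ he0 hg2 hg2'.symm (.inl he0'), (e1, g0), key _ _ he1 hg0 h12 (.inr hg0'), (e2, g0),
    key _ _ he2 hg0 h22 (.inr hg0'), ⟨by simp [hgg], .inl rfl⟩, ⟨by simp [h21.symm], .inr (.inl rfl)⟩,
    by simp [h11], by simp [h11], ?_, ?_⟩
  · rintro ⟨_, h, _⟩; exact h11 h.symm
  · rintro ⟨h, _, _⟩; exact hgg h

def MMax (G : SimpleGraph α) (A W : Set α) (L : α → Finset ℕ) (L0 : Finset ℕ)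
    (q1 q2 p1 p2 : α) (a b : ℤ) : Prop :=
  ∀ f' a' b', MPath G A W L L0 q1 q2 p1 p2 f' a' b' → b' - a' ≤ b - a

lemma MPath.nsub (hp : MHyp G A W q1 q2 p1 p2) (h : MPath G A W L L0 q1 q2 p1 p2 f a b)
    (hm : MMax G A W L L0 q1 q2 p1 p2 a b) (hk : k = a ∨ k = b) (hu : Nb G A W (f k) u)
    (hR : u ∉ f '' Icc a b) (h1 : u ≠ q1) (h2 : u ≠ q2) : ¬ L0 ⊆ L u := by
  intro hL
  rcases hk with rfl | rfl
  · have := hm _ _ _ (h.ext1 (.inl ⟨rfl, rfl, rfl⟩) (fun _ => hu)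
      (fun e => by have := h.ha; have := h.hb; omega) hR hL h1 h2); omega
  · have := hm _ _ _ (h.ext1 (.inr ⟨rfl, rfl, rfl⟩)
      (fun e => by have := h.ha; have := h.hb; omega) (fun _ => hu) hR hL h1 h2); omega

lemma MPath.std_upd (h : MPath G A W L L0 q1 q2 p1 p2 f a b) (h0 : L0.card = 2)
    (hs : Std G A W L {p1, p2}) [DecidableEq α] (D : Finset ℕ) :
    Std G (A ∪ f '' Icc a b) (W \ (f '' Icc a b))
      (update (rmS G A (f '' Icc a b) L0 L) u D) {u} :=
  ((h.std h0 hs).mono (empty_subset _)).congr fun v _ hvu => update_of_ne hvu _ _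

lemma upd_sub [DecidableEq α] {D : Finset ℕ} (hD : D ⊆ L u) :
    update L u D v ⊆ L v := by
  by_cases h : v = u
  · subst h; simpa using hD
  · rw [update_of_ne h]

/-- disjoint source and target -/
lemma mp_disj (ih : ∀ W', W' ⊂ W → TP G W') (hp : MHyp G A W q1 q2 p1 p2)
    (h : MPath G A W L L0 q1 q2 p1 p2 f a b)
    (hm : MMax G A W L L0 q1 q2 p1 p2 a b)
    (h0 : L0.card = 2) (hs : Std G A W L {p1, p2})
    (d1 : p1 ≠ q1) (d2 : p1 ≠ q2) (d3 : p2 ≠ q1) (d4 : p2 ≠ q2) : Conf4 (Sq G W L q1 q2) := by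
  classical
  have ha := h.ha
  have hb := h.hb
  have hq : ∀ k ∈ Icc a b, f k ≠ q1 ∧ f k ≠ q2 := by
    intro k hk
    by_cases k0 : k = 0
    · subst k0; rw [h.f0]; exact ⟨d1, d2⟩
    by_cases k1 : k = 1
    · subst k1; rw [h.f1]; exact ⟨d3, d4⟩
    exact h.av k hk k0 k1
  have hq1 : q1 ∉ f '' Icc a b := by rintro ⟨k, hk, e⟩; exact (hq k hk).1 e
  have hq2 : q2 ∉ f '' Icc a b := by rintro ⟨k, hk, e⟩; exact (hq k hk).2 e
  have hsub : W \ (f '' Icc a b) ⊂ W := sdiff_ssub (by rintro _ ⟨k, hk, rfl⟩; exact h.mem k hk)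
    ⟨f 0, 0, ⟨ha, by omega⟩, rfl⟩
  have hP := h.out_card hs
  -- an end without outside neighbour
  have e0 : ∀ k, (k = a ∨ k = b) → (∀ u, Nb G A W (f k) u → u ∈ f '' Icc a b) →
      Conf4 (Sq G W L q1 q2) := by
    intro k hk hno
    refine (th_allpairs (hp.ctx.delS h.bdR) (hp.tq.delS hq1 hq2) (h.std h0 hs)).mono
      (sq_mono fun φ hφ => ?_)
    obtain ⟨ψ, h1, h2⟩ := h.extE' hp h0 hk hφ fun u hu hR => (hR (hno u hu)).elim
    exact ⟨ψ, h1, h2 _ hq1, h2 _ hq2⟩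
  have e1 : ∀ k, (k = a ∨ k = b) → ∀ u, Nb G A W (f k) u → u ∉ f '' Icc a b → u ≠ q1 → u ≠ q2 →
      Conf4 (Sq G W L q1 q2) := by
    intro k hk u hu hR h1 h2
    have hns := h.nsub hp hm hk hu hR h1 h2
    have c2 := card_nsub h0 hns (hP u hu.1 hR)
    have hD : L u \ L0 ⊆ rmS G A (f '' Icc a b) L0 L u := by
      rw [rmS_bd _ hu.2.1]; exact Finset.sdiff_subset
    refine (ih _ hsub (A ∪ f '' Icc a b) _ u q1 q2 (hp.ctx.delS h.bdR) (hp.tq.delS hq1 hq2)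
      ⟨hu.1, hR⟩ hu.2.1.insS (h.std_upd h0 hs (L u \ L0)) (by simpa using c2)).mono
      (sq_mono fun φ hφ => ?_)
    have hφu : φ u ∈ L u \ L0 := by simpa using hφ.1 u ⟨hu.1, hR⟩
    obtain ⟨ψ, h1, h2⟩ := h.extE' hp h0 hk (hφ.lists fun v _ => upd_sub hD) fun v hv hvR => by
      rw [← h.out_uniq hp hk hu hR hv hvR]; exact (Finset.mem_sdiff.1 hφu).2
    exact ⟨ψ, h1, h2 _ hq1, h2 _ hq2⟩
  by_cases ea : ∀ u, Nb G A W (f a) u → u ∈ f '' Icc a b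
  · exact e0 a (.inl rfl) ea
  by_cases eb : ∀ u, Nb G A W (f b) u → u ∈ f '' Icc a b
  · exact e0 b (.inr rfl) eb
  push Not at ea eb
  obtain ⟨x, hx, hxR⟩ := ea
  obtain ⟨y, hy, hyR⟩ := eb
  have na : ∀ q, Nb G A W (f a) q → Nb G A W q (f a) := fun q hq =>
    ⟨h.mem a ⟨le_rfl, by omega⟩, h.bd a ⟨le_rfl, by omega⟩, hq.2.2.symm⟩
  have nb : ∀ q, Nb G A W (f b) q → Nb G A W q (f b) := fun q hq =>
    ⟨h.mem b ⟨by omega, le_rfl⟩, h.bd b ⟨by omega, le_rfl⟩, hq.2.2.symm⟩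
  have hab : f a ≠ f b := h.ne ⟨le_rfl, by omega⟩ ⟨by omega, le_rfl⟩ (by omega)
  have ma := hq a ⟨le_rfl, by omega⟩
  have mb := hq b ⟨by omega, le_rfl⟩
  by_cases x1 : x = q1
  · subst x1
    by_cases y1 : y = x
    · subst y1
      exact (hp.h3 hp.tq.m1 hp.tq.b1 ⟨_, _, _, na _ hx, nb _ hy, hp.tq.nb, hab, ma.2, mb.2⟩).elim
    by_cases y2 : y = q2
    · subst y2; exact mp_two hp h h0 hs (.inl ⟨rfl, rfl⟩) hq1 hq2 hx hy
    · exact e1 b (.inr rfl) y hy hyR y1 y2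
  by_cases x2 : x = q2
  · subst x2
    by_cases y1 : y = x
    · subst y1
      exact (hp.h3 hp.tq.m2 hp.tq.b2 ⟨_, _, _, na _ hx, nb _ hy, hp.tq.symm.nb, hab, ma.1, mb.1⟩).elim
    by_cases y2 : y = q1
    · subst y2; exact mp_two hp h h0 hs (.inr ⟨rfl, rfl⟩) hq1 hq2 hy hx
    · exact e1 b (.inr rfl) y hy hyR y2 y1
  exact e1 a (.inl rfl) x hx hxR x1 x2

/-- target containing `p2` -/
lemma mp_touch (ih : ∀ W', W' ⊂ W → TP G W') (hp : MHyp G A W p2 q2 p1 p2)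
    (h : MPath G A W L L0 p2 q2 p1 p2 f a b)
    (hm : MMax G A W L L0 p2 q2 p1 p2 a b) (hL2 : L p2 = L0)
    (h0 : L0.card = 2) (hs : Std G A W L {p1, p2}) : Conf4 (Sq G W L p2 q2) := by
  classical
  have ha := h.ha
  have hb := h.hb
  have hq1 : q2 ≠ p1 := fun e => hp.n2 ⟨rfl, e⟩
  have hq2 : q2 ≠ p2 := hp.tq.adj.ne'
  obtain rfl : b = 1 := by
    by_contra hne
    have m2 : (2 : ℤ) ∈ Icc a b := ⟨by omega, by omega⟩
    have n0 := h.nb_prev (k := 1) (by omega) hb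
    have n2 := h.nb_next (k := 1) (by omega) (by omega)
    norm_num at n0 n2
    rw [h.f1] at n0 n2
    refine hp.h3 hp.tq.m1 hp.tq.b1 ⟨_, _, _, n0, n2, hp.tq.nb, ?_, ?_, ?_⟩
    · exact h.ne ⟨ha, by omega⟩ m2 (by omega)
    · rw [h.f0]; exact hq1.symm
    · exact (h.av 2 m2 (by omega) (by omega)).2
  have hyR : ∀ a', a' ∈ Icc a 0 → q2 ∉ f '' Icc a' 1 := by
    rintro a' ha' ⟨k, hk, e⟩
    by_cases k0 : k = 0
    · subst k0; exact hq1 (e ▸ h.f0)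
    by_cases k1 : k = 1
    · subst k1; exact hq2 (e ▸ h.f1)
    exact (h.av k ⟨ha'.1.trans hk.1, hk.2⟩ k0 k1).2 e
  have hy := hyR a ⟨le_rfl, ha⟩
  have ny : Nb G A W (f 1) q2 := by rw [h.f1]; exact hp.tq.nb
  have hc2 : 3 ≤ (L q2).card := (hs q2 hp.tq.m2 (by rintro (e | e); exacts [hq1 e, hq2 e])).1
  have hP : ∀ v ∈ W, v ∉ f '' Icc a 1 → 3 ≤ (L v).card := by
    intro v hv hR
    refine (hs v hv ?_).1
    rintro (rfl | rfl)
    · exact hR ⟨0, ⟨ha, by omega⟩, h.f0⟩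
    · exact hR ⟨1, ⟨by omega, hb⟩, h.f1⟩
  have hsub : W \ (f '' Icc a 1) ⊂ W := sdiff_ssub (by rintro _ ⟨k, hk, rfl⟩; exact h.mem k hk)
    ⟨f 0, 0, ⟨ha, by omega⟩, rfl⟩
  -- extension with prescribed colour at `p2`
  have ext : ∀ a' φ c, a' ∈ Icc a 0 → Col G (W \ (f '' Icc a' 1)) (rmS G A (f '' Icc a' 1) L0 L) φ →
      (∀ u, Nb G A W (f a') u → u ∉ f '' Icc a' 1 → φ u ∉ L0) → c ∈ L0 → c ≠ φ q2 →
      (c, φ q2) ∈ Sq G W L p2 q2 := by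
    intro a' φ c ha' hφ hN hc hcq
    have h' : MPath G A W L L0 p2 q2 p1 p2 f a' 1 := by
      have hI : ∀ k ∈ Icc a' 1, k ∈ Icc a 1 := fun k hk => ⟨ha'.1.trans hk.1, hk.2⟩
      exact ⟨ha'.2, le_rfl, h.f0, h.f1, h.inj.mono hI, fun k hk => h.mem k (hI k hk),
        fun k hk => h.bd k (hI k hk), fun k hk => h.lst k (hI k hk), fun k hk => h.av k (hI k hk),
        fun k hk => h.adj k (ha'.1.trans hk)⟩
    obtain ⟨ψ, h1, h2, h3⟩ := h'.extE hp h0 (.inl ⟨rfl, rfl⟩) hφ hN hc (by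
      intro u hu hR
      rw [← h'.out_uniq hp (.inr rfl) ny (hyR a' ha') hu hR]; exact hcq.symm)
    exact ⟨ψ, h1, by rw [← h.f1]; exact h2, h3 _ (hyR a' ha')⟩
  have ext2 : ∀ φ, Col G (W \ (f '' Icc a 1)) (rmS G A (f '' Icc a 1) L0 L) φ → φ q2 ∉ L0 →
      ∃ c ∈ L0, (c, φ q2) ∈ Sq G W L p2 q2 := by
    intro φ hφ hq
    obtain ⟨ψ, h1, h2⟩ := h.extE' hp h0 (.inr rfl) hφ (by
      intro u hu hR
      rw [← h.out_uniq hp (.inr rfl) ny hy hu hR]; exact hq)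
    exact ⟨ψ p2, hL2 ▸ h1.1 p2 hp.tp.m2, ψ, h1, rfl, h2 _ hy⟩
  have all : (∀ e ∈ L q2, ∀ c ∈ L0, c ≠ e → (c, e) ∈ Sq G W L p2 q2) → Conf4 (Sq G W L p2 q2) := by
    intro H
    refine (F2 L0 (L q2) h0.ge (by omega) ?_).mono fun c hc => H c.2 hc.2.1 c.1 hc.1 hc.2.2
    rintro ⟨e, -⟩; rw [← e] at hc2; omega
  have col1 : ∀ e ∈ L q2, ∃ φ, Col G (W \ (f '' Icc a 1)) (rmS G A (f '' Icc a 1) L0 L) φ ∧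
      φ q2 = e := fun e he =>
    th1 (hp.ctx.delS h.bdR) ⟨hp.tq.m2, hy⟩ hp.tq.b2.insS ((h.std h0 hs).mono (empty_subset _))
      (by rw [rmS_bd _ hp.tq.b2]; exact he)
  by_cases ea : ∀ u, Nb G A W (f a) u → u ∈ f '' Icc a 1
  · refine all fun e he c hc hce => ?_
    obtain ⟨φ, h1, rfl⟩ := col1 e he
    exact ext a φ c ⟨le_rfl, ha⟩ h1 (fun u hu hR => (hR (ea u hu)).elim) hc hce
  push Not at ea
  obtain ⟨x, hx, hxR⟩ := ea
  by_cases hxy : x = q2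
  · subst hxy
    have ha0 : a ≠ 0 := by
      rintro rfl; rw [h.f0] at hx; exact hp.nc x ⟨hx, hp.tq.nb⟩
    refine all fun e he c hc hce => ?_
    by_cases heL : e ∈ L0
    · have hfa : f a ∉ f '' Icc (a + 1) 1 := by
        rintro ⟨k, hk, e⟩
        have : k = a := h.inj ⟨by have := hk.1; omega, hk.2⟩ ⟨le_rfl, by omega⟩ e
        have := hk.1; omega
      have hma : a ∈ Icc a 1 := ⟨le_rfl, by omega⟩
      obtain ⟨τ, hτ, hτ'⟩ : ∃ e ∈ L (f a), e ∉ L0 := by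
        have : 3 ≤ (L (f a)).card := by
          refine (hs _ (h.mem a hma) ?_).1
          rintro (e | e)
          · exact h.ne hma ⟨ha, by omega⟩ ha0 (e.trans h.f0.symm)
          · exact h.ne hma ⟨by omega, le_rfl⟩ (by omega) (e.trans h.f1.symm)
        by_contra hc; push Not at hc; have := Finset.card_le_card hc; omega
      have ha' : a + 1 ∈ Icc a 0 := ⟨by omega, by omega⟩
      have h' : MPath G A W L L0 p2 x p1 p2 f (a + 1) 1 := by
        have hI : ∀ k ∈ Icc (a + 1) 1, k ∈ Icc a 1 := fun k hk => ⟨by have := hk.1; omega, hk.2⟩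
        exact ⟨ha'.2, le_rfl, h.f0, h.f1, h.inj.mono hI, fun k hk => h.mem k (hI k hk),
          fun k hk => h.bd k (hI k hk), fun k hk => h.lst k (hI k hk), fun k hk => h.av k (hI k hk),
          fun k hk => h.adj k (by omega)⟩
      obtain ⟨φ, h1, h2, h3⟩ := th2 (p1 := f a) (p2 := x) (c1 := τ) (c2 := e)
        (hp.ctx.delS h'.bdR) ⟨h.mem a hma, hfa⟩ ⟨hp.tq.m2, hyR _ ha'⟩ (h.bd a hma).insS
        hp.tq.b2.insS hx.2.2 ((h'.std h0 hs).mono (empty_subset _))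
        (by rw [rmS_bd _ (h.bd a hma)]; exact hτ) (by rw [rmS_bd _ hp.tq.b2]; exact he)
        (fun e' => hτ' (e' ▸ heL))
      rw [← h3]
      refine ext (a + 1) φ c ha' h1 (fun u hu hR => ?_) hc (h3 ▸ hce)
      have n1 := h.nb_prev (k := a + 1) (by omega) (by omega)
      rw [add_sub_cancel_right] at n1
      rw [← h'.out_uniq hp (.inl rfl) n1 hfa hu hR, h2]; exact hτ'
    · obtain ⟨φ, h1, rfl⟩ := col1 e he
      refine ext a φ c ⟨le_rfl, ha⟩ h1 (fun u hu hR => ?_) hc hce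
      rw [← h.out_uniq hp (.inl rfl) hx hxR hu hR]; exact heL
  · have x1 : x ≠ p2 := by rintro rfl; exact hxR ⟨1, ⟨by omega, le_rfl⟩, h.f1⟩
    have c2 := card_nsub h0 (h.nsub hp hm (.inl rfl) hx hxR x1 hxy) (hP x hx.1 hxR)
    have hD : L x \ L0 ⊆ rmS G A (f '' Icc a 1) L0 L x := by
      rw [rmS_bd _ hx.2.1]; exact Finset.sdiff_subset
    obtain ⟨e, e', hee, ⟨φ, hφ, he⟩, φ', hφ', he'⟩ := tp_vertex (ih _ hsub) (hp.ctx.delS h.bdR)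
      ⟨hx.1, hxR⟩ hx.2.1.insS ⟨hp.tq.m2, hy⟩ hp.tq.b2.insS (Ne.symm hxy)
      (h.std_upd h0 hs (L x \ L0)) (by simpa using c2)
    have real : ∀ φ, Col G (W \ (f '' Icc a 1)) (update (rmS G A (f '' Icc a 1) L0 L) x
        (L x \ L0)) φ → ∀ c ∈ L0, c ≠ φ q2 → (c, φ q2) ∈ Sq G W L p2 q2 := by
      intro φ hφ c hc hcq
      have hφx : φ x ∈ L x \ L0 := by simpa using hφ.1 x ⟨hx.1, hxR⟩
      refine ext a φ c ⟨le_rfl, ha⟩ (hφ.lists fun v _ => upd_sub hD) (fun u hu hR => ?_) hc hcq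
      rw [← h.out_uniq hp (.inl rfl) hx hxR hu hR]; exact (Finset.mem_sdiff.1 hφx).2
    have r1 := real φ hφ
    have r2 := real φ' hφ'
    rw [he] at r1
    rw [he'] at r2
    have one : ∀ e e' : ℕ, e ≠ e' → (∀ c ∈ L0, c ≠ e → (c, e) ∈ Sq G W L p2 q2) →
        (∀ c ∈ L0, c ≠ e' → (c, e') ∈ Sq G W L p2 q2) → e ∉ L0 → Conf4 (Sq G W L p2 q2) := by
      intro e e' hee r1 r2 he
      obtain ⟨c, hc, hce⟩ : ∃ c ∈ L0, c ≠ e' := by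
        obtain ⟨c, hc, d, hd, hcd⟩ := pick2 L0 h0.ge
        by_cases h : c = e'
        · exact ⟨d, hd, fun h' => hcd (h.trans h'.symm)⟩
        · exact ⟨c, hc, h⟩
      obtain ⟨d, hcd, hL⟩ := two_set h0 hc
      have hd : d ∈ L0 := by rw [hL]; simp
      exact conf_L (r1 c hc fun h => he (h ▸ hc)) (r2 c hc hce) (r1 d hd fun h => he (h ▸ hd)) hcd hee
    by_cases h1 : e ∈ L0
    swap
    · exact one e e' hee r1 r2 h1
    by_cases h2 : e' ∈ L0
    swap
    · exact one e' e hee.symm r2 r1 h2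
    obtain ⟨d, hd, hd'⟩ : ∃ e ∈ L q2, e ∉ L0 := by
      by_contra hc; push Not at hc; have := Finset.card_le_card hc; omega
    obtain ⟨χ, hχ, hχd⟩ := col1 d hd
    obtain ⟨c, hc, hcS⟩ := ext2 χ hχ (hχd ▸ hd')
    rw [hχd] at hcS
    obtain ⟨e2, hne2, hL⟩ := two_set h0 h1
    have : e' = e2 := by
      rw [hL] at h2; simp at h2; rcases h2 with h2 | h2
      · exact (hee h2.symm).elim
      · exact h2
    subst this
    have m1 := r1 e' h2 hee.symm
    have m2 := r2 e h1 hee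
    rw [hL] at hc; simp at hc
    rcases hc with rfl | rfl
    · exact conf_DR m1 m2 hcS hee fun h => hd' (h ▸ h2)
    · exact conf_DR m2 m1 hcS hee.symm fun h => hd' (h ▸ h1)

lemma MHyp.swapP (hp : MHyp G A W q1 q2 p1 p2) : MHyp G A W q1 q2 p2 p1 :=
  ⟨hp.ctx, hp.spl, hp.tq, hp.tp.symm, fun u h => hp.nc u ⟨h.2, h.1⟩, hp.n2, hp.n1⟩
lemma MHyp.swapQ (hp : MHyp G A W q1 q2 p1 p2) : MHyp G A W q2 q1 p1 p2 :=
  ⟨hp.ctx, hp.spl, hp.tq.symm, hp.tp, hp.nc, fun h => hp.n2 ⟨h.2, h.1⟩, fun h => hp.n1 ⟨h.2, h.1⟩⟩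

lemma mp_star (ih : ∀ W', W' ⊂ W → TP G W') (hp : MHyp G A W q1 q2 p1 p2)
    (h1 : L p1 = L0) (h2 : L p2 = L0) (h0 : L0.card = 2) (hs : Std G A W L {p1, p2}) :
    Conf4 (Sq G W L q1 q2) := by
  have t : ∀ q2 p1 p2, MHyp G A W p2 q2 p1 p2 → L p1 = L0 → L p2 = L0 → Std G A W L {p1, p2} →
      Conf4 (Sq G W L p2 q2) := by
    intro q2 p1 p2 hp h1 h2 hs
    obtain ⟨f, a, b, hf, hm⟩ := mpath_max hp.ctx.fin (mpath_base (L := L) (L0 := L0) hp h1.ge h2.ge)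
    exact mp_touch ih hp hf hm h2 h0 hs
  by_cases d1 : p1 = q1
  · subst d1; exact t _ _ _ hp.swapP h2 h1 (by rwa [pair_comm])
  by_cases d2 : p1 = q2
  · subst d2; exact conf_sq_swap (t _ _ _ hp.swapP.swapQ h2 h1 (by rwa [pair_comm]))
  by_cases d3 : p2 = q1
  · subst d3; exact t _ _ _ hp h1 h2 hs
  by_cases d4 : p2 = q2
  · subst d4; exact conf_sq_swap (t _ _ _ hp.swapQ h1 h2 hs)
  obtain ⟨f, a, b, hf, hm⟩ := mpath_max hp.ctx.fin (mpath_base (L := L) (L0 := L0) hp h1.ge h2.ge)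
  exact mp_disj ih hp hf hm h0 hs d1 d2 d3 d4

end

/-- outcome of a government propagation -/
def Res (G : SimpleGraph α) (K : Set α) (q1 q2 : α) (L : α → Finset ℕ) (W : Set α) (s : Src α) :
    Prop := Conf4 (Sq G W L q1 q2) ∨ (CH G K q1 q2 L W s ∧ Gov2 (Sq G W L q1 q2))

lemma Res.mono {s : Src α} (h : Res G K q1 q2 L W' s) (hW : W' ⊆ W)
    (hext : ∀ φ, Col G W' L φ → ∃ ψ, Col G W L ψ ∧ ψ q1 = φ q1 ∧ ψ q2 = φ q2) :
    Res G K q1 q2 L W s := by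
  rcases h with h | ⟨h1, h2⟩
  · exact .inl (h.mono (sq_mono hext))
  · exact .inr ⟨h1.mono hW, h2.mono (sq_mono hext)⟩

lemma CH.swap_dem {p1 p2 : α} (h : CH G K q1 q2 L W (.dem p1 p2 L0)) :
    CH G K q1 q2 L W (.dem p2 p1 L0) := by
  cases h with
  | m_end _ _ _ _ _ hq m1 m2 => exact .m_end _ _ _ _ _ hq.symm m1 m2
  | m_step1 _ _ _ _ u c _ hu h1 h2 hL hc hrec => exact .m_step2 _ _ _ _ u c _ hu h2 h1 hL hc hrec
  | m_step2 _ _ _ _ u c _ hu h1 h2 hL hc hrec => exact .m_step1 _ _ _ _ u c _ hu h2 h1 hL hc hrec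

/-- compose a confederacy across a separating boundary edge -/
lemma compose (hC : CP G (K ∪ {u, v})) (ctx : Ctx G A W) (tu : Tg G A W u v)
    (tq : Tg G A W q1 q2) (hK : Clo G (W \ {u, v}) K) (hs : Std G A K L ∅) (m : q1 ∈ K ∨ q2 ∈ K)
    (c1 : Conf4 (Sq G (W \ K) L u v)) : Conf4 (Sq G W L q1 q2) :=
  (composeC (C := univ) hC ctx tu tq tu.m1 tu.m2 (fun h => (hK.1 h).2 (by simp))
    (fun h => (hK.1 h).2 (by simp)) hK hs m (c1.mono fun _ ⟨φ, h, e⟩ => ⟨φ, h, trivial, e⟩)).mono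
    fun _ ⟨φ, h, _, e⟩ => ⟨φ, h, e⟩

/-- colourings extend over a component attached to a boundary triangle -/
lemma dropT (ctx : Ctx G A W) (hs : Std G A W L X) (txt : Tg G A W x t) (h1 : Nb G A W x u)
    (h2 : Nb G A W t u) {C : Set α} (hC : Clo G (W \ {x, t, u}) C) (hcon : Conn G C)
    (hX : ∀ k ∈ C, k ∉ X) (hφ : Col G (W \ C) L φ) :
    ∃ ψ, Col G W L ψ ∧ ∀ v ∈ W, v ∉ C → ψ v = φ v := by
  by_cases hB : ∀ k ∈ C, ¬ Bd G A k
  · exact dropTri ctx hs txt.m1 txt.m2 h1.1 txt.adj h1.2.2 h2.2.2 hC hX hB hφ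
  push Not at hB
  have nadj : ∀ {s : α}, ¬ Adjs G {s} C → ∀ k ∈ C, ¬ G.Adj k s := fun hn k hk ha =>
    hn ⟨_, rfl, k, hk, ha.symm⟩
  by_cases ax : Adjs G {x} C
  swap
  · refine drop ctx hs txt.m2 h1.1 txt.b2 h1.2.1 h2.2.2 (K := C) ⟨fun k hk => ?_, fun k hk w hw ha => ?_⟩
      hX hφ
    · have := hC.1 hk; exact ⟨this.1, fun h => this.2 (by simp at h ⊢; tauto)⟩
    · by_cases hwx : w = x
      · subst hwx; exact (nadj ax k hk ha).elim
      · exact hC.2 k hk w ⟨hw.1, fun h => hw.2 (by simp at h ⊢; tauto)⟩ ha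
  by_cases at' : Adjs G {t} C
  swap
  · refine drop ctx hs txt.m1 h1.1 txt.b1 h1.2.1 h1.2.2 (K := C) ⟨fun k hk => ?_, fun k hk w hw ha => ?_⟩
      hX hφ
    · have := hC.1 hk; exact ⟨this.1, fun h => this.2 (by simp at h ⊢; tauto)⟩
    · by_cases hwx : w = t
      · subst hwx; exact (nadj at' k hk ha).elim
      · exact hC.2 k hk w ⟨hw.1, fun h => hw.2 (by simp at h ⊢; tauto)⟩ ha
  by_cases au : Adjs G {u} C
  swap
  · refine drop ctx hs txt.m1 txt.m2 txt.b1 txt.b2 txt.adj (K := C)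
      ⟨fun k hk => ?_, fun k hk w hw ha => ?_⟩ hX hφ
    · have := hC.1 hk; exact ⟨this.1, fun h => this.2 (by simp at h ⊢; tauto)⟩
    · by_cases hwx : w = u
      · subst hwx; exact (nadj au k hk ha).elim
      · exact hC.2 k hk w ⟨hw.1, fun h => hw.2 (by simp at h ⊢; tauto)⟩ ha
  exact (pl2 ctx txt.m1 txt.m2 h1.1 txt.b1 txt.b2 h1.2.1 txt.adj h1.2.2 h2.2.2 hC.1 hcon ax at' au
    hB).elim

/-- triangle case when `p2` can be removed -/
lemma mp_triA (hD : ∀ W', W' ⊂ W → DP G W') (hC : ∀ W', W' ⊂ W → CP G W') (ctx : Ctx G A W)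
    (tq : Tg G A W q1 q2)
    (tp : Tg G A W p1 p2) (l1 : L p1 = L0) (l2 : L p2 = L0) (h0 : L0.card = 2)
    (hs : Std G A W L {p1, p2}) (hK : ∀ v ∈ K, v ∈ W → Bd G A v)
    (h1 : Nb G A W p1 u) (h2 : Nb G A W p2 u) (hq1 : q1 ≠ p2) (hq2 : q2 ≠ p2)
    (hN : ∀ w ∈ W, G.Adj p2 w → w = p1 ∨ w = u) : Res G K q1 q2 L W (.dem p1 p2 L0) := by
  classical
  have u1 : u ≠ p1 := h1.2.2.ne'
  have u2 : u ≠ p2 := h2.2.2.ne'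
  have p12 : p1 ≠ p2 := tp.adj.ne
  have hsub : W \ {p2} ⊂ W := ssub_del tp.m2
  have cu : 3 ≤ (L u).card := (hs u h1.1 (by rintro (e | e); exacts [u1 e, u2 e])).1
  have ext : ∀ L' φ, Col G (W \ {p2}) L' φ → (∀ v ∈ W \ {p2}, v ≠ p1 → L' v ⊆ L v) →
      φ u ∉ L0 → φ p1 ∈ L0 → ∃ ψ, Col G W L ψ ∧ ψ q1 = φ q1 ∧ ψ q2 = φ q2 := by
    intro L' φ hφ hL' hu hp
    obtain ⟨d, hd, hL⟩ := two_set h0 hp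
    have hd0 : d ∈ L0 := by rw [hL]; simp
    refine ⟨update φ p2 d, Col.upd (L' := update L' p1 L0) ⟨fun v hv => ?_, hφ.2⟩ ?_
      (l2 ▸ hd0) ?_, update_of_ne hq1 _ _, update_of_ne hq2 _ _⟩
    · by_cases hv1 : v = p1
      · subst hv1; simpa using hp
      · rw [update_of_ne hv1]; exact hφ.1 v hv
    · intro v hv
      by_cases hv1 : v = p1
      · subst hv1; simp [l1]
      · rw [update_of_ne hv1]; exact hL' v hv hv1
    · intro w hw ha
      rcases hN w hw ha with rfl | rfl
      · exact hd
      · rintro rfl; exact hu hd0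
  have tq' : Tg G A (W \ {p2}) q1 q2 := tq.sub ⟨tq.m1, hq1⟩ ⟨tq.m2, hq2⟩
  have hu' : u ∈ W \ {p2} := ⟨h1.1, u2⟩
  have hp1' : p1 ∈ W \ {p2} := ⟨tp.m1, p12⟩
  have ctx' := ctx.sub (S := W \ {p2}) sdiff_subset
  by_cases hc : 2 ≤ (L u \ L0).card
  · left
    refine (hC _ hsub A L {c : ℕ × ℕ | c.1 ∈ L u \ L0 ∧ c.2 ∈ L0 ∧ c.1 ≠ c.2} u p1 q1 q2 ctx' tq'
      ⟨hu', hp1', h1.2.1, tp.b1, h1.2.2.symm⟩ ?_ (F2 _ _ hc h0.ge ?_) ?_).mono ?_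
    · intro v hv hvn
      refine hs v hv.1 ?_
      rintro (e | e)
      · exact hvn (.inr e)
      · exact hv.2 e
    · rintro ⟨e, -⟩
      obtain ⟨a, ha⟩ := Finset.card_pos.1 (by omega : 0 < L0.card)
      have := e ▸ ha
      exact (Finset.mem_sdiff.1 this).2 ha
    · rintro c ⟨h3, h4, h5⟩
      exact ⟨(Finset.mem_sdiff.1 h3).1, l1 ▸ h4, h5⟩
    · rintro c ⟨φ, hφ, ⟨h3, h4, -⟩, h5, h6⟩
      obtain ⟨ψ, g1, g2, g3⟩ := ext L φ hφ (fun _ _ _ => subset_rfl) (Finset.mem_sdiff.1 h3).2 h4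
      exact ⟨ψ, g1, g2.trans h5, g3.trans h6⟩
  · have hsplit := Finset.card_sdiff_add_card_inter (L u) L0
    have hle := Finset.card_le_card (Finset.inter_subset_right (s₁ := L u) (s₂ := L0))
    have hL0u : L0 ⊆ L u := by
      have : L u ∩ L0 = L0 := Finset.eq_of_subset_of_card_le Finset.inter_subset_right (by omega)
      rw [← this]; exact Finset.inter_subset_left
    obtain ⟨c, hc1⟩ := Finset.card_eq_one.1 (by omega : (L u \ L0).card = 1)
    have hcu : c ∈ L u \ L0 := by rw [hc1]; simp
    have hc0 := (Finset.mem_sdiff.1 hcu).2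
    have hLu : L u = L0 ∪ {c} := by
      rw [← hc1, Finset.union_sdiff_of_subset hL0u]
    set L1 := update (update L u {c}) p1 (L0 ∪ {c}) with hL1
    have L1u : L1 u = {c} := by rw [hL1, update_of_ne u1]; simp
    have L1p : L1 p1 = L0 ∪ {c} := by rw [hL1]; simp
    have L1o : ∀ v, v ≠ u → v ≠ p1 → L1 v = L v := fun v h h' => by
      rw [hL1, update_of_ne h', update_of_ne h]
    have ext1 : ∀ φ, Col G (W \ {p2}) L1 φ → ∃ ψ, Col G W L ψ ∧ ψ q1 = φ q1 ∧ ψ q2 = φ q2 := by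
      intro φ hφ
      have e1 : φ u = c := by have := hφ.1 u hu'; rw [L1u] at this; simpa using this
      have e2 : φ p1 ∈ L0 := by
        have := hφ.1 p1 hp1'; rw [L1p] at this
        rcases Finset.mem_union.1 this with h | h
        · exact h
        · have := hφ.2 p1 hp1' u hu' h1.2.2
          rw [e1] at this
          exact (this (by simpa using h)).elim
      refine ext L1 φ hφ (fun v hv hv1 => ?_) (e1 ▸ hc0) e2
      by_cases hvu : v = u
      · subst hvu; rw [L1u]; simpa using (Finset.mem_sdiff.1 hcu).1
      · rw [L1o v hvu hv1]
    have std1 : Std G A (W \ {p2}) L1 {u} := by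
      intro v hv hvu
      by_cases hv1 : v = p1
      · subst hv1; rw [L1p, card3 h0 hc0]; exact ⟨le_rfl, fun h => (h tp.b1).elim⟩
      · rw [L1o v hvu hv1]
        refine hs v hv.1 ?_
        rintro (e | e); exacts [hv1 e, hv.2 e]
    rcases hD _ hsub A K L1 u q1 q2 c ctx' tq' hu' h1.2.1 L1u std1 (fun v hv hvW => hK v hv hvW.1)
      with hr | ⟨hr1, hr2⟩
    · exact .inl (hr.mono (sq_mono ext1))
    · refine .inr ⟨.m_step2 _ _ _ _ u c _ h1.1 h1.2.2.symm h2.2.2.symm hLu hc0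
        (hr1.congr trivial fun v hv hvu _ => ?_), hr2.mono (sq_mono ext1)⟩
      by_cases hv1 : v = p1
      · subst hv1; rw [L1p]; simp
      · rw [update_of_ne hv1, L1o v hvu hv1]

lemma mp_tri (hD : ∀ W', W' ⊂ W → DP G W') (hC : ∀ W', W' ⊂ W → CP G W')
    (hM : ∀ W', W' ⊂ W → MP G W') (ctx : Ctx G A W)
    (tq : Tg G A W q1 q2)
    (tp : Tg G A W p1 p2) (l1 : L p1 = L0) (l2 : L p2 = L0) (h0 : L0.card = 2)
    (hs : Std G A W L {p1, p2}) (hK : ∀ v ∈ K, v ∈ W → Bd G A v)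
    (n1 : ¬ (q1 = p1 ∧ q2 = p2)) (n2 : ¬ (q1 = p2 ∧ q2 = p1))
    (h1 : Nb G A W p1 u) (h2 : Nb G A W p2 u) : Res G K q1 q2 L W (.dem p1 p2 L0) := by
  have u1 : u ≠ p1 := h1.2.2.ne'
  have u2 : u ≠ p2 := h2.2.2.ne'
  have q12 : q1 ≠ q2 := tq.adj.ne
  by_cases hcomp : ∃ w ∈ W \ {p1, p2, u}, q1 ∉ comp G (W \ {p1, p2, u}) w ∧
      q2 ∉ comp G (W \ {p1, p2, u}) w
  · obtain ⟨w, hw, hq1, hq2⟩ := hcomp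
    set C := comp G (W \ {p1, p2, u}) w
    have hCs : C ⊆ W \ {p1, p2, u} := comp_sub
    have hp1 : p1 ∉ C := fun h => (hCs h).2 (by simp)
    have hp2 : p2 ∉ C := fun h => (hCs h).2 (by simp)
    refine Res.mono (W' := W \ C) (hM _ (sdiff_ssub (hCs.trans sdiff_subset) ⟨w, mem_comp hw⟩) A K L p1 p2
      q1 q2 L0 (ctx.sub sdiff_subset) (tq.sub ⟨tq.m1, hq1⟩ ⟨tq.m2, hq2⟩)
      (tp.sub ⟨tp.m1, hp1⟩ ⟨tp.m2, hp2⟩) l1 l2 h0 (hs.sub sdiff_subset)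
      (fun v hv hvW => hK v hv hvW.1)) sdiff_subset fun φ hφ => ?_
    obtain ⟨ψ, g1, g2⟩ := dropT ctx hs tp h1 h2 clo_comp comp_conn (C := C) (by
      rintro k hk (rfl | rfl); exacts [hp1 hk, hp2 hk]) hφ
    exact ⟨ψ, g1, g2 _ tq.m1 hq1, g2 _ tq.m2 hq2⟩
  push Not at hcomp
  by_cases c2 : (∀ w ∈ W, G.Adj p2 w → w = p1 ∨ w = u) ∧ q1 ≠ p2 ∧ q2 ≠ p2
  · exact mp_triA hD hC ctx tq tp l1 l2 h0 hs hK h1 h2 c2.2.1 c2.2.2 c2.1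
  by_cases c1 : (∀ w ∈ W, G.Adj p1 w → w = p2 ∨ w = u) ∧ q1 ≠ p1 ∧ q2 ≠ p1
  · rcases mp_triA hD hC ctx tq tp.symm l2 l1 h0 (by rwa [pair_comm]) hK h2 h1 c1.2.1 c1.2.2 c1.1
      with h | ⟨h, h'⟩
    · exact .inl h
    · exact .inr ⟨h.swap_dem, h'⟩
  have ne : (W \ {p1, p2, u}).Nonempty := by
    by_contra hne
    rw [not_nonempty_iff_eq_empty] at hne
    have hall : ∀ w ∈ W, w = p1 ∨ w = p2 ∨ w = u := by
      intro w hw; by_contra hc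
      have : w ∈ W \ {p1, p2, u} := ⟨hw, hc⟩
      rw [hne] at this; exact this
    have e1 := hall q1 tq.m1
    have e2 := hall q2 tq.m2
    have a2 : ∀ w ∈ W, G.Adj p2 w → w = p1 ∨ w = u := fun w hw ha => by
      rcases hall w hw with h | h | h
      · exact .inl h
      · subst h; exact (G.irrefl ha).elim
      · exact .inr h
    have a1 : ∀ w ∈ W, G.Adj p1 w → w = p2 ∨ w = u := fun w hw ha => by
      rcases hall w hw with h | h | h
      · subst h; exact (G.irrefl ha).elim
      · exact .inl h
      · exact .inr h
    have b1 : q1 = p2 ∨ q2 = p2 := by by_contra hc; push Not at hc; exact c2 ⟨a2, hc⟩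
    have b2 : q1 = p1 ∨ q2 = p1 := by by_contra hc; push Not at hc; exact c1 ⟨a1, hc⟩
    have p12 : p1 ≠ p2 := tp.adj.ne
    rcases b1 with b1 | b1 <;> rcases b2 with b2 | b2
    · exact p12 (b2.symm.trans b1)
    · exact n2 ⟨b1, b2⟩
    · exact n1 ⟨b2, b1⟩
    · exact p12 (b2.symm.trans b1)
  obtain ⟨w0, hw0⟩ := ne
  have hqC : ∀ w ∈ W \ {p1, p2, u}, ∃ q, (q = q1 ∨ q = q2) ∧ q ∈ comp G (W \ {p1, p2, u}) w := by
    intro w hw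
    by_cases h : q1 ∈ comp G (W \ {p1, p2, u}) w
    · exact ⟨q1, .inl rfl, h⟩
    · exact ⟨q2, .inr rfl, hcomp w hw h⟩
  set C := comp G (W \ {p1, p2, u}) w0 with hCdef
  have hCs : C ⊆ W \ {p1, p2, u} := comp_sub
  obtain ⟨q, hq, hqC0⟩ := hqC w0 hw0
  have hall : ∀ w ∈ W \ {p1, p2, u}, w ∈ C := by
    intro w hw
    obtain ⟨q', hq', hqC'⟩ := hqC w hw
    have hq'C : q' ∈ C := by
      rcases hq with rfl | rfl <;> rcases hq' with rfl | rfl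
      · exact hqC0
      · exact comp_closed hqC0 (comp_sub hqC') tq.adj
      · exact comp_closed hqC0 (comp_sub hqC') tq.adj.symm
      · exact hqC0
    have e1 := comp_eq_of_mem hqC'
    have e2 := comp_eq_of_mem hq'C
    have : w ∈ comp G (W \ {p1, p2, u}) w := mem_comp hw
    rw [← e1, e2] at this
    exact this
  -- a vertex of `T` in `P'` is adjacent to `C`
  have hqT : ∀ s, s ∈ ({p1, p2, u} : Set α) → (q1 = s ∨ q2 = s) → Adjs G {s} C := by
    intro s hs' hsq
    have hsC : s ∉ C := fun h => (hCs h).2 hs'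
    have hqs : q ≠ s := fun e => hsC (e ▸ hqC0)
    refine ⟨s, rfl, q, hqC0, ?_⟩
    rcases hq with rfl | rfl <;> rcases hsq with rfl | rfl
    · exact (hqs rfl).elim
    · exact tq.adj.symm
    · exact tq.adj
    · exact (hqs rfl).elim
  have ad2 : Adjs G {p2} C := by
    by_contra hno
    refine c2 ⟨fun w hw ha => ?_, fun e => hno (hqT p2 (by simp) (.inl e)),
      fun e => hno (hqT p2 (by simp) (.inr e))⟩
    by_contra hc; push Not at hc
    exact hno ⟨p2, rfl, w, hall w ⟨hw, by
      rintro (h | h | h)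
      exacts [hc.1 h, G.irrefl (h ▸ ha), hc.2 h]⟩, ha⟩
  have ad1 : Adjs G {p1} C := by
    by_contra hno
    refine c1 ⟨fun w hw ha => ?_, fun e => hno (hqT p1 (by simp) (.inl e)),
      fun e => hno (hqT p1 (by simp) (.inr e))⟩
    by_contra hc; push Not at hc
    exact hno ⟨p1, rfl, w, hall w ⟨hw, by
      rintro (h | h | h)
      exacts [G.irrefl (h ▸ ha), hc.1 h, hc.2 h]⟩, ha⟩
  have adu : ¬ Adjs G {u} C := fun h => pl2 ctx tp.m1 tp.m2 h1.1 tp.b1 tp.b2 h1.2.1 tp.adj h1.2.2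
    h2.2.2 hCs comp_conn ad1 ad2 h ⟨q, hqC0, by rcases hq with rfl | rfl; exacts [tq.b1, tq.b2]⟩
  have hq1 : q1 ∉ ({u} : Set α) := fun e => adu (hqT u (by simp) (.inl e))
  have hq2 : q2 ∉ ({u} : Set α) := fun e => adu (hqT u (by simp) (.inr e))
  refine Res.mono (W' := W \ {u}) (hM _ (ssub_del h1.1) A K L p1 p2 q1 q2 L0 (ctx.sub sdiff_subset)
    (tq.sub ⟨tq.m1, hq1⟩ ⟨tq.m2, hq2⟩) (tp.sub ⟨tp.m1, u1.symm⟩ ⟨tp.m2, u2.symm⟩) l1 l2 h0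
    (hs.sub sdiff_subset) (fun v hv hvW => hK v hv hvW.1)) sdiff_subset fun φ hφ => ?_
  obtain ⟨ψ, g1, g2⟩ := drop ctx hs tp.m1 tp.m2 tp.b1 tp.b2 tp.adj (K := {u}) ⟨by
      rintro _ rfl; exact ⟨h1.1, by rintro (h | h); exacts [u1 h, u2 h]⟩, by
      rintro _ rfl w hw ha
      by_contra hwu
      refine adu ⟨_, rfl, w, hall w ⟨hw.1, ?_⟩, ha⟩
      rintro (h | h | h)
      exacts [hw.2 (.inl h), hw.2 (.inr h), hwu h]⟩ (by
      rintro _ rfl (h | h); exacts [u1 h, u2 h]) hφ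
  exact ⟨ψ, g1, g2 _ tq.m1 hq1, g2 _ tq.m2 hq2⟩

lemma stepM (hD : ∀ W', W' ⊂ W → DP G W') (hM : ∀ W', W' ⊂ W → MP G W')
    (hC : ∀ W', W' ⊂ W → CP G W') (hT : ∀ W', W' ⊂ W → TP G W') : MP G W := by
  intro A K L p1 p2 q1 q2 L0 ctx tq tp l1 l2 h0 hs hK
  change Res G K q1 q2 L W _
  by_cases he : (q1 = p1 ∧ q2 = p2) ∨ (q1 = p2 ∧ q2 = p1)
  · refine .inr ⟨.m_end _ _ _ _ _ he tq.m1 tq.m2, ?_⟩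
    obtain ⟨a, b, hab, rfl⟩ := Finset.card_eq_two.1 h0
    have key : Gov2 (Sq G W L p1 p2) := by
      obtain ⟨φ, f1, f2, f3⟩ := th2 ctx tp.m1 tp.m2 tp.b1 tp.b2 tp.adj hs (c1 := a) (c2 := b)
        (by simp [l1]) (by simp [l2]) hab
      obtain ⟨ψ, g1, g2, g3⟩ := th2 ctx tp.m1 tp.m2 tp.b1 tp.b2 tp.adj hs (c1 := b) (c2 := a)
        (by simp [l1]) (by simp [l2]) hab.symm
      exact ⟨(a, b), ⟨φ, f1, f2, f3⟩, (b, a), ⟨ψ, g1, g2, g3⟩, by simp [hab], .inr (.inr ⟨rfl, rfl⟩)⟩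
    rcases he with ⟨rfl, rfl⟩ | ⟨rfl, rfl⟩
    · exact key
    · exact gov_sq_swap key
  push Not at he
  have n1 : ¬ (q1 = p1 ∧ q2 = p2) := fun h => he.1 h.1 h.2
  have n2 : ¬ (q1 = p2 ∧ q2 = p1) := fun h => he.2 h.1 h.2
  by_cases hN : ∃ u, Nb G A W p1 u ∧ Nb G A W p2 u
  · obtain ⟨u, h1, h2⟩ := hN
    exact mp_tri hD hC hM ctx tq tp l1 l2 h0 hs hK n1 n2 h1 h2
  push Not at hN
  have hN' : ∀ u, ¬ (Nb G A W p1 u ∧ Nb G A W p2 u) := fun u h => hN u h.1 h.2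
  -- dropping
  have dr : ∀ u v K', Tg G A W u v → Clo G (W \ {u, v}) K' → K'.Nonempty → p1 ∉ K' → p2 ∉ K' →
      q1 ∉ K' → q2 ∉ K' → Res G K q1 q2 L W (.dem p1 p2 L0) := by
    intro u v K' tu hK' hne m1 m2 m3 m4
    refine Res.mono (W' := W \ K') (hM _ (sdiff_ssub (clo_sub hK') hne) A K L p1 p2 q1 q2 L0
      (ctx.sub sdiff_subset) (tq.sub ⟨tq.m1, m3⟩ ⟨tq.m2, m4⟩) (tp.sub ⟨tp.m1, m1⟩ ⟨tp.m2, m2⟩) l1 l2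
      h0 (hs.sub sdiff_subset) (fun v hv hvW => hK v hv hvW.1)) sdiff_subset fun φ hφ => ?_
    obtain ⟨ψ, g1, g2⟩ := drop ctx hs tu.m1 tu.m2 tu.b1 tu.b2 tu.adj hK' (by
      rintro k hk (rfl | rfl); exacts [m1 hk, m2 hk]) hφ
    exact ⟨ψ, g1, g2 _ tq.m1 m3, g2 _ tq.m2 m4⟩
  by_cases hS : Spl G A W
  · obtain ⟨u, v, K0, tu, hK0, hn0, hr0⟩ := hS
    by_cases hP : (u = p1 ∧ v = p2) ∨ (u = p2 ∧ v = p1)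
    · obtain ⟨K', hK', hn, hr, m3, m4⟩ := hK0.avoid hn0 hr0 (.inr tq.adj)
      have huK : u ∉ K' := fun h => (hK'.1 h).2 (by simp)
      have hvK : v ∉ K' := fun h => (hK'.1 h).2 (by simp)
      refine dr u v K' tu hK' hn ?_ ?_ m3 m4
      · rcases hP with ⟨rfl, rfl⟩ | ⟨rfl, rfl⟩ <;> assumption
      · rcases hP with ⟨rfl, rfl⟩ | ⟨rfl, rfl⟩ <;> assumption
    · obtain ⟨K', hK', hn, hr, m1, m2⟩ := hK0.avoid hn0 hr0 (.inr tp.adj)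
      have huK : u ∉ K' := fun h => (hK'.1 h).2 (by simp)
      have hvK : v ∉ K' := fun h => (hK'.1 h).2 (by simp)
      by_cases hq : q1 ∈ K' ∨ q2 ∈ K'
      · have r := hM _ (sdiff_ssub (clo_sub hK') hn) A ∅ L p1 p2 u v L0
          (ctx.sub sdiff_subset) (tu.sub ⟨tu.m1, huK⟩ ⟨tu.m2, hvK⟩)
          (tp.sub ⟨tp.m1, m1⟩ ⟨tp.m2, m2⟩) l1 l2 h0 (hs.sub sdiff_subset) (fun v hv => hv.elim)
        rcases r with r | ⟨r, -⟩
        · refine .inl (compose (hC _ (clo_union_ssub hK' tu.m1 tu.m2 hr)) ctx tu tq hK' ?_ hq r)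
          intro x hx _
          refine hs x (clo_sub hK' hx) ?_
          rintro (rfl | rfl); exacts [m1 hx, m2 hx]
        · rcases r.dem_inv with r | ⟨w, c, hw, a1, a2, hc, hL⟩
          · exact (hP r).elim
          · have w1 : w ≠ p1 := a1.ne
            have w2 : w ≠ p2 := a2.ne
            have bw := bd_of_card3 hs hw.1 (by rintro (e | e); exacts [w1 e, w2 e])
              (by rw [hL, card3 h0 hc])
            exact (hN' w ⟨⟨hw.1, bw, a1.symm⟩, hw.1, bw, a2.symm⟩).elim
      · push Not at hq
        exact dr u v K' tu hK' hn m1 m2 hq.1 hq.2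
  · exact .inl (mp_star hT ⟨ctx, hS, tq, tp, hN', n1, n2⟩ l1 l2 h0 hs)

/-- the state of a source: democracy (`Ys = Y0`) or dictatorship -/
def St (Y0 Ys : Finset ℕ) : Prop := Y0.card = 2 ∧ (Ys = Y0 ∨ ∃ d, d ∉ Y0 ∧ Ys = {d})

def Adv (Y0 Ys : Finset ℕ) (e : ℕ) (Us : Finset ℕ) : Prop :=
  (Ys = Y0 ∧ Us = {e}) ∨ (Ys = {e} ∧ Us = Y0)

lemma Adv.st {e : ℕ} (h : Adv Y0 Ys e Us) (h0 : Y0.card = 2) (he : e ∉ Y0) : St Y0 Us := by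
  rcases h with ⟨-, rfl⟩ | ⟨-, rfl⟩
  · exact ⟨h0, .inr ⟨e, he, rfl⟩⟩
  · exact ⟨h0, .inl rfl⟩

lemma St.col (st : St Y0 Ys) {a b : ℕ} (ha : a ∈ Ys) (hb : b ∈ Y0 ∪ Ys) (hab : a ≠ b) :
    b ∈ Y0 := by
  rcases st.2 with rfl | ⟨d, hd, rfl⟩
  · simpa using hb
  · simp only [Finset.mem_singleton] at ha
    subst ha
    rcases Finset.mem_union.1 hb with h | h
    · exact h
    · exact (hab (Finset.mem_singleton.1 h).symm).elim

lemma sideDM (hD : DP G W) (hM : MP G W) (ctx : Ctx G A W) (tq : Tg G A W q1 q2)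
    (ty : Tg G A W y t) (st : St Y0 Ys) (ly : L y = Ys) (lt : L t = Y0 ∪ Ys)
    (hs : Std G A W L {y, t}) :
    Conf4 (Sq G W L q1 q2) ∨ (Gov2 (Sq G W L q1 q2) ∧
      (((q1 = y ∧ q2 = t) ∨ (q1 = t ∧ q2 = y)) ∨ (Ys ≠ Y0 ∧ (y = q1 ∨ y = q2)) ∨
      (∃ u e Us, Nb G A W y u ∧ Nb G A W t u ∧ e ∉ Y0 ∧ L u = Y0 ∪ {e} ∧ Adv Y0 Ys e Us) ∨
      ∃ u1 u2, Nb G A W y u1 ∧ Nb G A W y u2 ∧ G.Adj u1 u2 ∧ u1 ≠ t ∧ u2 ≠ t)) := by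
  obtain ⟨h0, rfl | ⟨d, hd, rfl⟩⟩ := st
  · rcases hM A ∅ L y t q1 q2 Ys ctx tq ty ly (by simpa using lt) h0 hs (fun v hv => hv.elim)
      with h | ⟨h, h'⟩
    · exact .inl h
    refine .inr ⟨h', ?_⟩
    rcases h.dem_inv with h | ⟨w, c, hw, a1, a2, hc, hL⟩
    · exact .inl h
    have w1 : w ≠ y := a1.ne
    have w2 : w ≠ t := a2.ne
    have bw := bd_of_card3 hs hw (by rintro (e | e); exacts [w1 e, w2 e])
      (by rw [hL, card3 h0 hc])
    exact .inr (.inr (.inl ⟨w, c, {c}, ⟨hw, bw, a1.symm⟩, ⟨hw, bw, a2.symm⟩, hc, hL,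
      .inl ⟨rfl, rfl⟩⟩))
  · have hs' : Std G A W L {y} := by
      intro v hv hvn
      by_cases h : v = t
      · subst h
        rw [lt, card3 h0 hd]
        exact ⟨le_rfl, fun h => (h ty.b2).elim⟩
      · exact hs v hv (by rintro (e | e); exacts [hvn e, h e])
    rcases hD A ∅ L y q1 q2 d ctx tq ty.m1 ty.b1 ly hs' (fun v hv => hv.elim) with h | ⟨h, h'⟩
    · exact .inl h
    refine .inr ⟨h', .inr ?_⟩
    rcases h.dict_inv with h | ⟨u1, u2, L1, m1, m2, a1, a2, a12, h1, hc, l1, l2⟩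
    · refine .inl ⟨fun e => ?_, h⟩
      exact hd (e ▸ Finset.mem_singleton_self d)
    have n1 : u1 ≠ y := a1.ne'
    have n2 : u2 ≠ y := a2.ne'
    have b1 := bd_of_card3 hs' m1 n1 (by rw [l1, card3 h1 hc])
    have b2 := bd_of_card3 hs' m2 n2 (by rw [l2, card3 h1 hc])
    have key : ∀ a b, Nb G A W y b → G.Adj a b → L a = L1 ∪ {d} → L b = L1 ∪ {d} → a = t →
      ∃ u e Us, Nb G A W y u ∧ Nb G A W t u ∧ e ∉ Y0 ∧ L u = Y0 ∪ {e} ∧ Adv Y0 {d} e Us := by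
      rintro a b hb hab la lb rfl
      exact ⟨b, d, Y0, hb, ⟨hb.1, hb.2.1, hab⟩, hd, by rw [lb, ← la, lt], .inr ⟨rfl, rfl⟩⟩
    by_cases e1 : u1 = t
    · exact .inr (.inl (key u1 u2 ⟨m2, b2, a2⟩ a12 l1 l2 e1))
    by_cases e2 : u2 = t
    · exact .inr (.inl (key u2 u1 ⟨m1, b1, a1⟩ a12.symm l2 l1 e2))
    exact .inr (.inr ⟨u1, u2, ⟨m1, b1, a1⟩, ⟨m2, b2, a2⟩, a12, e1, e2⟩)

/-- exact propagation across a triangle -/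
lemma adv_ext (hD : DP G W) (hM : MP G W) (ctx : Ctx G A W)
    (ty : Tg G A W y t) (st : St Y0 Ys) (ly : L y = Ys) (lt : L t = Y0 ∪ Ys)
    (hs : Std G A W L {y, t}) {e : ℕ} (nu : Nb G A W y u) (nt : Nb G A W t u) (he : e ∉ Y0)
    (lu : L u = Y0 ∪ {e}) (ha : Adv Y0 Ys e Us) {a τ : ℕ} (ha' : a ∈ Us) (hτ : τ ∈ Y0)
    (hne : a ≠ τ) : ∃ φ, Col G W L φ ∧ φ u = a ∧ φ t = τ := by
  have tq : Tg G A W u t := ⟨nu.1, ty.m2, nu.2.1, ty.b2, nt.2.2.symm⟩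
  have g : Gov2 (Sq G W L u t) := by
    rcases sideDM hD hM ctx tq ty st ly lt hs with h | h
    exacts [h.gov, h.1]
  obtain ⟨⟨r1, r2⟩, ⟨φ, hφ, f1, f2⟩, ⟨s1, s2⟩, ⟨χ, hχ, g1, g2⟩, hne', hrel⟩ := g
  simp only at f1 f2 g1 g2 hrel
  have key : ∀ φ, Col G W L φ → φ t ∈ Y0 ∧ φ y ∈ Ys ∧ φ y ≠ φ u ∧ φ u ≠ φ t ∧ φ u ∈ Y0 ∪ {e} ∧
      φ y ≠ φ t := by
    intro φ h
    have h1 := h.1 y ty.m1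
    have h2 := h.1 t ty.m2
    have h3 := h.1 u nu.1
    rw [ly] at h1; rw [lt] at h2; rw [lu] at h3
    have h4 := h.2 _ ty.m1 _ ty.m2 ty.adj
    exact ⟨st.col h1 h2 h4, h1, h.2 _ ty.m1 _ nu.1 nu.2.2, (h.2 _ ty.m2 _ nu.1 nt.2.2).symm, h3, h4⟩
  have k1 := key φ hφ
  have k2 := key χ hχ
  obtain ⟨b, hb, rfl⟩ := two_set st.1 hτ
  rcases ha with ⟨rfl, rfl⟩ | ⟨rfl, rfl⟩
  · by_cases h : φ u = a ∧ φ t = τ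
    · exact ⟨φ, hφ, h⟩
    refine ⟨χ, hχ, ?_⟩
    simp only [Finset.mem_insert, Finset.mem_singleton, Finset.mem_union] at *
    grind
  · by_cases h : φ u = a ∧ φ t = τ
    · exact ⟨φ, hφ, h⟩
    refine ⟨χ, hχ, ?_⟩
    simp only [Finset.mem_insert, Finset.mem_singleton, Finset.mem_union] at *
    grind

def EP (G : SimpleGraph α) (W : Set α) : Prop :=
  ∀ (A : Set α) (L : α → Finset ℕ) (y t v : α) (Y0 Ys : Finset ℕ), Ctx G A W →
    Tg G A W y t → Tg G A W v t → v ≠ y → St Y0 Ys → L y = Ys → L t = Y0 ∪ Ys → ¬ Y0 ⊆ L v →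
    Std G A W L {y, t} → ∃ τ ∈ Y0, ∃ a b, a ≠ b ∧ (a, τ) ∈ Sq G W L v t ∧ (b, τ) ∈ Sq G W L v t

/-- reduction at a boundary triangle -/
lemma tri_key (ctx : Ctx G A W) (ty : Tg G A W y t) {u1 u2 : α} (n1 : Nb G A W y u1)
    (n2 : Nb G A W y u2) (e1 : u1 ≠ t) (e2 : u2 ≠ t) (a12 : G.Adj u1 u2) {P : Prop}
    (H : ∀ u1 K, Tg G A W y u1 → Clo G (W \ {y, u1}) K → K.Nonempty → y ∉ K → t ∉ K →
      (∀ v, G.Adj v t → v ∉ K) → P) : P := by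
  have yt := ty.adj.ne
  have key : ∀ u1 u2, Nb G A W y u1 → Nb G A W y u2 → u1 ≠ t → u2 ≠ t → u1 ≠ u2 →
      ¬ Rch G (W \ {y, u1}) t u2 → P := by
    intro u1 u2 n1 n2 e1 e2 e12 h
    have d2 : u2 ≠ y := n2.2.2.ne'
    have ht : t ∈ W \ {y, u1} := ⟨ty.m2, by rintro (e | e); exacts [yt e.symm, e1 e.symm]⟩
    obtain ⟨hK, hy, hvK⟩ := sep_clo (fun hh => h hh.symm)
      ⟨n2.1, by rintro (e | e); exacts [d2 e, e12 e.symm]⟩ ht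
    exact H u1 _ ⟨ty.m1, n1.1, ty.b1, n1.2.1, n1.2.2⟩ hK ⟨_, hy⟩ (fun h => (hK.1 h).2 (by simp))
      hvK fun v ha hv' => hvK (hK.2 _ hv' _ ht ha)
  rcases tri_sep ctx ty.m1 ty.b1 ty.nb n1 n2 e1.symm e2.symm a12.ne with h | h | h
  · exact key u1 u2 n1 n2 e1 e2 a12.ne h
  · exact key u2 u1 n2 n1 e2 e1 a12.ne' (fun hh => h hh.symm)
  · refine (h (Rch.of_adj a12.symm ⟨n2.1, ?_⟩ ⟨n1.1, ?_⟩)).elim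
    · rintro (e | e)
      exacts [G.irrefl (e ▸ n2.2.2), e2 e]
    · rintro (e | e)
      exacts [G.irrefl (e ▸ n1.2.2), e1 e]

lemma stepE (ih : ∀ W', W' ⊂ W → EP G W') (hD : ∀ W', W' ⊆ W → DP G W')
    (hM : ∀ W', W' ⊆ W → MP G W') : EP G W := by
  classical
  intro A L y t v Y0 Ys ctx ty tv hvy st ly lt hv hs
  have yt : y ≠ t := ty.adj.ne
  have vt : v ≠ t := tv.adj.ne
  -- dropping
  have dr : ∀ a b K', Tg G A W a b → Clo G (W \ {a, b}) K' → K'.Nonempty → y ∉ K' → t ∉ K' →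
      v ∉ K' → ∃ τ ∈ Y0, ∃ a b, a ≠ b ∧ (a, τ) ∈ Sq G W L v t ∧ (b, τ) ∈ Sq G W L v t := by
    intro a b K' tu hK' hne m1 m2 m3
    obtain ⟨τ, hτ, c, d, hcd, h1, h2⟩ := ih _ (sdiff_ssub (clo_sub hK') hne) A L y t v Y0 Ys
      (ctx.sub sdiff_subset) (ty.sub ⟨ty.m1, m1⟩ ⟨ty.m2, m2⟩) (tv.sub ⟨tv.m1, m3⟩ ⟨tv.m2, m2⟩)
      hvy st ly lt hv (hs.sub sdiff_subset)
    have hsub : Sq G (W \ K') L v t ⊆ Sq G W L v t := sq_mono fun φ hφ => by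
      obtain ⟨ψ, g1, g2⟩ := drop ctx hs tu.m1 tu.m2 tu.b1 tu.b2 tu.adj hK' (by
        rintro k hk (rfl | rfl); exacts [m1 hk, m2 hk]) hφ
      exact ⟨ψ, g1, g2 _ tv.m1 m3, g2 _ tv.m2 m2⟩
    exact ⟨τ, hτ, c, d, hcd, hsub h1, hsub h2⟩
  rcases sideDM (hD _ subset_rfl) (hM _ subset_rfl) ctx tv ty st ly lt hs with h | ⟨-, h⟩
  · -- pigeonhole
    obtain ⟨r, hr, s, hs', w, hw, u, hu, rel, -, n1, n2, -⟩ := h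
    have key : ∀ r ∈ Sq G W L v t, r.2 ∈ Y0 := by
      rintro ⟨a, b⟩ ⟨φ, hφ, h1, h2⟩
      simp only at h1 h2 ⊢
      subst h2
      have h1 := hφ.1 y ty.m1
      have h2 := hφ.1 t ty.m2
      rw [ly] at h1; rw [lt] at h2
      exact st.col h1 h2 (hφ.2 _ ty.m1 _ ty.m2 ty.adj)
    have k1 := key r hr
    have k2 := key s hs'
    have k3 := key w hw
    have pr : ∀ r ∈ Sq G W L v t, ∀ s ∈ Sq G W L v t, r ≠ s → r.2 = s.2 → ∃ τ ∈ Y0, ∃ a b, a ≠ b ∧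
        (a, τ) ∈ Sq G W L v t ∧ (b, τ) ∈ Sq G W L v t := by
      rintro ⟨a, b⟩ hr ⟨c, d⟩ hs hne h
      simp only at h
      subst h
      exact ⟨b, key _ hr, a, c, fun e => hne (by rw [e]), hr, hs⟩
    by_cases e1 : r.2 = s.2
    · exact pr r hr s hs' rel.1 e1
    by_cases e2 : w.2 = r.2
    · exact pr w hw r hr n1 e2
    refine pr w hw s hs' n2 ?_
    obtain ⟨b, hb, rfl⟩ := two_set st.1 k1
    simp only [Finset.mem_insert, Finset.mem_singleton] at k2 k3
    rcases k2 with k2 | k2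
    · exact (e1 k2.symm).elim
    rcases k3 with k3 | k3
    · exact (e2 k3).elim
    rw [k2, k3]
  rcases h with h | ⟨-, h⟩ | ⟨u, e, Us, nu, nt, he, lu, ha⟩ | ⟨u1, u2, n1, n2, a12, e1, e2⟩
  · rcases h with ⟨h, -⟩ | ⟨h, -⟩
    exacts [(hvy h).elim, (vt h).elim]
  · rcases h with h | h
    exacts [(hvy h.symm).elim, (yt h).elim]
  · -- advance
    have uv : u ≠ v := by
      rintro rfl; exact hv (by rw [lu]; exact Finset.subset_union_left)
    have uy : u ≠ y := nu.2.2.ne'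
    have ut : u ≠ t := nt.2.2.ne'
    have tut : Tg G A W t u := ⟨ty.m2, nu.1, ty.b2, nu.2.1, nt.2.2⟩
    rcases tri_sep ctx ty.m2 ty.b2 ty.symm.nb nt tv.symm.nb uy.symm hvy.symm uv with h | h | h
    · -- `{t,u}` separates `y` from `v`
      obtain ⟨hK, hy, hvK⟩ := sep_clo h ⟨ty.m1, by rintro (e | e); exacts [yt e, uy e.symm]⟩
        ⟨tv.m1, by rintro (e | e); exacts [vt e, uv e.symm]⟩
      set K := comp G (W \ {t, u}) y
      have tK : t ∉ K := fun h => (hK.1 h).2 (by simp)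
      have uK : u ∉ K := fun h => (hK.1 h).2 (by simp)
      have hKs : K ∪ {t, u} ⊆ W := union_subset (clo_sub hK) (by
        rintro x (rfl | rfl); exacts [ty.m2, nu.1])
      set L1 := update (update L u Us) t (Y0 ∪ Us) with hL1
      have l1t : L1 t = Y0 ∪ Us := by simp [L1]
      have l1u : L1 u = Us := by simp [L1, ut]
      have l1o : ∀ x, x ≠ u → x ≠ t → L1 x = L x := by intro x h1 h2; simp [L1, h1, h2]
      obtain ⟨τ, hτ, c, d, hcd, h1, h2⟩ := ih (W \ K) (sdiff_ssub (clo_sub hK) ⟨y, hy⟩) A L1 u t v Y0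
        Us (ctx.sub sdiff_subset) ⟨⟨nu.1, uK⟩, ⟨ty.m2, tK⟩, nu.2.1, ty.b2, nt.2.2.symm⟩
        (tv.sub ⟨tv.m1, hvK⟩ ⟨tv.m2, tK⟩) uv.symm (ha.st st.1 he) l1u l1t
        (by rw [l1o v uv.symm vt]; exact hv)
        (by
          intro x hx hxn
          rw [l1o x (fun e => hxn (.inl e)) (fun e => hxn (.inr e))]
          refine hs x hx.1 ?_
          rintro (rfl | rfl); exacts [hx.2 hy, hxn (.inr rfl)])
      have ext : Sq G (W \ K) L1 v t ⊆ Sq G W L v t := by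
        refine sq_mono fun φ hφ => ?_
        have k1 := hφ.1 u ⟨nu.1, uK⟩
        have k2 := hφ.1 t ⟨ty.m2, tK⟩
        have k3 := hφ.2 u ⟨nu.1, uK⟩ t ⟨ty.m2, tK⟩ nt.2.2.symm
        rw [l1u] at k1; rw [l1t] at k2
        have k4 := (ha.st st.1 he).col k1 k2 k3
        obtain ⟨χ, hχ, c1, c2⟩ := adv_ext (hD _ hKs) (hM _ hKs) (ctx.sub hKs)
          (ty.sub (.inl hy) (by simp)) st ly lt (hs.sub hKs)
          (u := u) (e := e) (Us := Us) (a := φ u) (τ := φ t)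
          ⟨by simp, nu.2⟩ ⟨by simp, nt.2⟩ he lu ha k1 k4 k3
        have hφ' : Col G (W \ K) L φ := by
          refine ⟨fun x hx => ?_, hφ.2⟩
          by_cases e1 : x = t
          · subst e1; rw [lt]; exact Finset.mem_union_left _ k4
          by_cases e2 : x = u
          · subst e2; rw [lu]
            rcases ha with ⟨-, rfl⟩ | ⟨-, rfl⟩
            · exact Finset.mem_union_right _ k1
            · exact Finset.mem_union_left _ k1
          rw [← l1o x e2 e1]; exact hφ.1 x hx
        obtain ⟨ψ, g1, g2, g3⟩ := glue hK hφ' hχ (by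
          rintro x (rfl | rfl) _; exacts [c2, c1])
        exact ⟨ψ, g1, g2 _ tv.m1 hvK, g2 _ ty.m2 tK⟩
      exact ⟨τ, hτ, c, d, hcd, ext h1, ext h2⟩
    · exact (h (Rch.of_adj nu.2.2.symm ⟨nu.1, by rintro (e | e); exacts [ut e, uv e]⟩
        ⟨ty.m1, by rintro (e | e); exacts [yt e, hvy e.symm]⟩)).elim
    · have h' : ¬ Rch G (W \ {t, y}) u v := fun hh => h hh.symm
      obtain ⟨hK, hy, hvK⟩ := sep_clo h' ⟨nu.1, by rintro (e | e); exacts [ut e, uy e]⟩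
        ⟨tv.m1, by rintro (e | e); exacts [vt e, hvy e]⟩
      exact dr t y _ ty.symm hK ⟨_, hy⟩ (fun h => (hK.1 h).2 (by simp))
        (fun h => (hK.1 h).2 (by simp)) hvK
  · -- triangle at `y` away from `t`
    exact tri_key ctx ty n1 n2 e1 e2 a12 fun u1 K tg hK hn hy hvK hv =>
      dr y u1 K tg hK hn hy hvK (hv _ tv.adj)

variable {a b c d d' e : ℕ}

structure WH (G : SimpleGraph α) (A W : Set α) (L : α → Finset ℕ) (q1 q2 x t y : α)
    (X0 Xs Y0 Ys : Finset ℕ) (d d' : ℕ) : Prop where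
  ctx : Ctx G A W
  tq : Tg G A W q1 q2
  tx : Tg G A W x t
  ty : Tg G A W y t
  xy : x ≠ y
  sx : St X0 Xs
  sy : St Y0 Ys
  dj : Disjoint X0 Y0
  lx : L x = X0 ∪ {d}
  ly : L y = Y0 ∪ {d'}
  lt : L t = X0 ∪ Y0
  hd : d ∉ X0
  hd' : d' ∉ Y0
  xs : Xs ⊆ X0 ∪ {d}
  ys : Ys ⊆ Y0 ∪ {d'}
  std : Std G A W L ∅

def SW (G : SimpleGraph α) (W : Set α) (L : α → Finset ℕ) (q1 q2 x t y : α)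
    (X0 Xs Y0 Ys : Finset ℕ) : Set (ℕ × ℕ) :=
  {c | ∃ φ, Col G W L φ ∧ ((φ t ∈ X0 → φ x ∈ Xs) ∧ (φ t ∈ Y0 → φ y ∈ Ys)) ∧ φ q1 = c.1 ∧ φ q2 = c.2}

def WP (G : SimpleGraph α) (W : Set α) : Prop :=
  ∀ (A : Set α) (L : α → Finset ℕ) (q1 q2 x t y : α) (X0 Xs Y0 Ys : Finset ℕ) (d d' : ℕ),
    WH G A W L q1 q2 x t y X0 Xs Y0 Ys d d' → Conf4 (SW G W L q1 q2 x t y X0 Xs Y0 Ys)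

lemma WH.swap (h : WH G A W L q1 q2 x t y X0 Xs Y0 Ys d d') :
    WH G A W L q1 q2 y t x Y0 Ys X0 Xs d' d :=
  ⟨h.ctx, h.tq, h.ty, h.tx, h.xy.symm, h.sy, h.sx, h.dj.symm, h.ly, h.lx,
    by rw [h.lt, Finset.union_comm], h.hd', h.hd, h.ys, h.xs, h.std⟩

lemma SW.swap (h : Conf4 (SW G W L q1 q2 y t x Y0 Ys X0 Xs)) :
    Conf4 (SW G W L q1 q2 x t y X0 Xs Y0 Ys) :=
  h.mono (by rintro c ⟨φ, h1, h2, h3⟩; exact ⟨φ, h1, h2.symm, h3⟩)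

lemma SW.swapQ (h : Conf4 (SW G W L q2 q1 x t y X0 Xs Y0 Ys)) :
    Conf4 (SW G W L q1 q2 x t y X0 Xs Y0 Ys) :=
  h.swap.mono (by rintro ⟨a, b⟩ ⟨φ, h1, h2, h3, h4⟩; exact ⟨φ, h1, h2, h4, h3⟩)

lemma WH.swapQ (h : WH G A W L q1 q2 x t y X0 Xs Y0 Ys d d') :
    WH G A W L q2 q1 x t y X0 Xs Y0 Ys d d' := { h with tq := h.tq.symm }

lemma w_mono {x' : α} {Xs' X0' : Finset ℕ}
    (hext : ∀ φ, Col G W' L' φ → ((φ t ∈ X0' → φ x' ∈ Xs') ∧ (φ t ∈ Y0 → φ y ∈ Ys)) →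
      ∃ ψ, Col G W L ψ ∧ ((ψ t ∈ X0 → ψ x ∈ Xs) ∧ (ψ t ∈ Y0 → ψ y ∈ Ys)) ∧ ψ q1 = φ q1 ∧ ψ q2 = φ q2) :
    SW G W' L' q1 q2 x' t y X0' Xs' Y0 Ys ⊆ SW G W L q1 q2 x t y X0 Xs Y0 Ys := by
  rintro c ⟨φ, h1, h2, h3, h4⟩
  obtain ⟨ψ, g1, g2, g3, g4⟩ := hext φ h1 h2
  exact ⟨ψ, g1, g2, g3.trans h3, g4.trans h4⟩

lemma WH.red (h : WH G A W L q1 q2 x t y X0 Xs Y0 Ys d d') (ih : ∀ W', W' ⊂ W → WP G W')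
    (hC : ∀ W', W' ⊆ W → CP G W') {a b : α} (tu : Tg G A W a b) (hK : Clo G (W \ {a, b}) K)
    (hne : K.Nonempty) (hx : x ∉ K) (ht : t ∉ K) (hy : y ∉ K) :
    Conf4 (SW G W L q1 q2 x t y X0 Xs Y0 Ys) := by
  have aK : a ∉ K := fun h => (hK.1 h).2 (by simp)
  have bK : b ∉ K := fun h => (hK.1 h).2 (by simp)
  have hw : ∀ q1 q2, Tg G A W q1 q2 → q1 ∉ K → q2 ∉ K →
      Conf4 (SW G (W \ K) L q1 q2 x t y X0 Xs Y0 Ys) := fun q1 q2 tq m1 m2 =>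
    ih _ (sdiff_ssub (clo_sub hK) hne) A L q1 q2 x t y X0 Xs Y0 Ys d d'
      { h with ctx := h.ctx.sub sdiff_subset, tq := tq.sub ⟨tq.m1, m1⟩ ⟨tq.m2, m2⟩
               tx := h.tx.sub ⟨h.tx.m1, hx⟩ ⟨h.tx.m2, ht⟩
               ty := h.ty.sub ⟨h.ty.m1, hy⟩ ⟨h.ty.m2, ht⟩
               std := h.std.sub sdiff_subset }
  by_cases m : q1 ∈ K ∨ q2 ∈ K
  · obtain ⟨m1, m2⟩ := clo_pair hK h.tq.m1 h.tq.m2 h.tq.adj m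
    have hsub : K ∪ {a, b} ⊆ W := union_subset (clo_sub hK) (by
      rintro x (rfl | rfl); exacts [tu.m1, tu.m2])
    have c1 := hw a b tu aK bK
    have c2 := hC _ hsub A L _ a b q1 q2 (h.ctx.sub hsub) (h.tq.sub m1 m2)
      (tu.sub (by simp) (by simp)) ((h.std.sub hsub).mono (by simp)) c1 (by
        rintro ⟨c, d⟩ ⟨φ, hφ, -, h1, h2⟩
        simp only at h1 h2 ⊢
        rw [← h1, ← h2]
        exact ⟨hφ.1 _ ⟨tu.m1, aK⟩, hφ.1 _ ⟨tu.m2, bK⟩,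
          hφ.2 _ ⟨tu.m1, aK⟩ _ ⟨tu.m2, bK⟩ tu.adj⟩)
    refine c2.mono ?_
    rintro ⟨c, d⟩ ⟨χ, hχ, ⟨φ, hφ, hQ, h1, h2⟩, h3, h4⟩
    simp only at h1 h2 h3 h4
    obtain ⟨ψ, g1, g2, g3⟩ := glue hK hφ hχ (by
      rintro e (rfl | rfl) _; exacts [h1.symm, h2.symm])
    have key : ∀ q ∈ K ∪ {a, b}, ψ q = χ q := by
      rintro q (hq | rfl | rfl)
      · exact g3 _ hq
      · rw [g2 _ tu.m1 aK, h1]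
      · rw [g2 _ tu.m2 bK, h2]
    refine ⟨ψ, g1, ?_, (key _ m1).trans h3, (key _ m2).trans h4⟩
    rw [g2 _ h.tx.m2 ht, g2 _ h.tx.m1 hx, g2 _ h.ty.m1 hy]
    exact hQ
  · push Not at m
    refine (hw q1 q2 h.tq m.1 m.2).mono (w_mono fun φ hφ hQ => ?_)
    obtain ⟨ψ, g1, g2⟩ := drop h.ctx h.std tu.m1 tu.m2 tu.b1 tu.b2 tu.adj hK (by simp) hφ
    refine ⟨ψ, g1, ?_, g2 _ h.tq.m1 m.1, g2 _ h.tq.m2 m.2⟩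
    rw [g2 _ h.tx.m2 ht, g2 _ h.tx.m1 hx, g2 _ h.ty.m1 hy]
    exact hQ

open Classical in
/-- the lists for one side -/
noncomputable def sideL (L : α → Finset ℕ) (x t : α) (X0 Xs : Finset ℕ) : α → Finset ℕ :=
  update (update L x Xs) t (X0 ∪ Xs)

lemma sideL_t : sideL L x t X0 Xs t = X0 ∪ Xs := by simp [sideL]
lemma sideL_x (h : x ≠ t) : sideL L x t X0 Xs x = Xs := by simp [sideL, h]
lemma sideL_o (h : v ≠ x) (h' : v ≠ t) : sideL L x t X0 Xs v = L v := by simp [sideL, h, h']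

lemma WH.xt (h : WH G A W L q1 q2 x t y X0 Xs Y0 Ys d d') : x ≠ t :=
  h.tx.adj.ne

lemma WH.col (h : WH G A W L q1 q2 x t y X0 Xs Y0 Ys d d') (hS : S ⊆ W) (hx : x ∈ S) (ht : t ∈ S)
    (hφ : Col G S (sideL L x t X0 Xs) φ) : Col G S L φ ∧ φ t ∈ X0 ∧ φ x ∈ Xs := by
  have h1 := hφ.1 x hx
  have h2 := hφ.1 t ht
  rw [sideL_x h.xt] at h1
  rw [sideL_t] at h2
  have h3 := h.sx.col h1 h2 (hφ.2 _ hx _ ht h.tx.adj)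
  refine ⟨⟨fun v hv => ?_, hφ.2⟩, h3, h1⟩
  by_cases e1 : v = t
  · subst e1; rw [h.lt]; exact Finset.mem_union_left _ h3
  by_cases e2 : v = x
  · subst e2; rw [h.lx]; exact h.xs h1
  have := hφ.1 v hv
  rwa [sideL_o e2 e1] at this

lemma WH.sideStd (h : WH G A W L q1 q2 x t y X0 Xs Y0 Ys d d') :
    Std G A W (sideL L x t X0 Xs) {x, t} :=
  (h.std.mono (by simp)).congr fun _ _ hv => sideL_o (fun e => hv (.inl e)) (fun e => hv (.inr e))

lemma WH.adv (h : WH G A W L q1 q2 x t y X0 Xs Y0 Ys d d') (ih : ∀ W', W' ⊂ W → WP G W')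
    (hD : ∀ W', W' ⊆ W → DP G W') (hM : ∀ W', W' ⊆ W → MP G W') (hC : ∀ W', W' ⊆ W → CP G W')
    (nx : ¬ ((q1 = x ∧ q2 = t) ∨ (q1 = t ∧ q2 = x)))
    (nu : Nb G A W x u) (nt : Nb G A W t u) (he : e ∉ X0) (lu : L u = X0 ∪ {e})
    (ha : Adv X0 Xs e Us) (uy : u ≠ y) : Conf4 (SW G W L q1 q2 x t y X0 Xs Y0 Ys) ∨
      (((q1 = x ∧ q2 = u) ∨ (q1 = u ∧ q2 = x))) := by
  have xt := h.xt
  have yt := h.swap.xt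
  have ux : u ≠ x := nu.2.2.ne'
  have ut : u ≠ t := nt.2.2.ne'
  have tut : Tg G A W t u := ⟨h.tx.m2, nu.1, h.tx.b2, nu.2.1, nt.2.2⟩
  rcases tri_sep h.ctx h.tx.m2 h.tx.b2 h.tx.symm.nb nt h.ty.symm.nb ux.symm h.xy uy with hh | hh | hh
  · obtain ⟨hK, hx, hyK⟩ := sep_clo hh ⟨h.tx.m1, by rintro (e | e); exacts [xt e, ux e.symm]⟩
      ⟨h.ty.m1, by rintro (e | e); exacts [yt e, uy e.symm]⟩
    have hKc : ∀ v ∈ comp G (W \ {t, u}) x, Rch G (W \ {t, u}) x v := fun v hv => hv.2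
    set K := comp G (W \ {t, u}) x
    have tK : t ∉ K := fun h => (hK.1 h).2 (by simp)
    have uK : u ∉ K := fun h => (hK.1 h).2 (by simp)
    have hKs : K ∪ {t, u} ⊆ W := union_subset (clo_sub hK) (by
      rintro x (rfl | rfl); exacts [h.tx.m2, nu.1])
    by_cases m : q1 ∈ K ∨ q2 ∈ K
    · -- the target meets `K`
      have key : ∀ q, q ∈ K → Bd G A q → q ≠ x → Conf4 (SW G W L q1 q2 x t y X0 Xs Y0 Ys) := by
        intro q hq bq hqx
        have hqW : q ∈ W \ {x, t, u} := ⟨clo_sub hK hq, by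
          rintro (e | e | e); exacts [hqx e, tK (e ▸ hq), uK (e ▸ hq)]⟩
        have hC1 := comp_sub (G := G) (S := W \ {x, t, u}) (u := q)
        have hC2 := mem_comp (G := G) hqW
        have hCcl := clo_comp (G := G) (S := W \ {x, t, u}) (u := q)
        have hCcon := comp_conn (G := G) (S := W \ {x, t, u}) (u := q)
        set C := comp G (W \ {x, t, u}) q
        have hCK : C ⊆ K := by
          have hcl : Clo G (W \ {x, t, u}) (K \ {x}) := by
            refine ⟨fun v hv => ⟨clo_sub hK hv.1, ?_⟩, fun k hk w hw ha => ⟨hK.2 k hk.1 w ⟨hw.1, ?_⟩ ha, ?_⟩⟩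
            · rintro (e | e | e); exacts [hv.2 e, tK (e ▸ hv.1), uK (e ▸ hv.1)]
            · rintro (e | e); exacts [hw.2 (.inr (.inl e)), hw.2 (.inr (.inr e))]
            · exact fun e => hw.2 (.inl e)
          intro v hv
          exact (Rch.closed hv.2 (X := K \ {x}) ⟨hq, hqx⟩ hcl.2).1
        have xC : x ∉ C := fun h => (hC1 h).2 (by simp)
        have tC : t ∉ C := fun h => (hC1 h).2 (by simp)
        have uC : u ∉ C := fun h => (hC1 h).2 (by simp)
        have yC : y ∉ C := fun h => hyK (hCK h)
        by_cases c1 : Adjs G {t} C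
        · by_cases c2 : Adjs G {u} C
          · have c3 : Adjs G {x} C := by
              by_contra c3
              have : x ∈ C := Rch.closed (hKc q hq).symm hC2 (fun a ha b hb hab => hCcl.2 a ha b
                ⟨hb.1, by
                  rintro (e | e | e)
                  · exact c3 ⟨x, rfl, a, ha, (e ▸ hab).symm⟩
                  · exact hb.2 (.inl e)
                  · exact hb.2 (.inr e)⟩ hab)
              exact xC this
            exact (pl2 h.ctx h.tx.m1 h.tx.m2 nu.1 h.tx.b1 h.tx.b2 nu.2.1 h.tx.adj nu.2.2 nt.2.2
              hC1 hCcon c3 c1 c2 ⟨q, hC2, bq⟩).elim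
          · refine h.red ih hC h.tx (K := C) ⟨fun v hv => ⟨(hC1 hv).1, fun hm => (hC1 hv).2 ?_⟩,
              fun a ha b hb hab => hCcl.2 a ha b ⟨hb.1, ?_⟩ hab⟩ ⟨q, hC2⟩ xC tC yC
            · rcases hm with hm | hm
              exacts [.inl hm, .inr (.inl hm)]
            · rintro (e | e | e)
              · exact hb.2 (.inl e)
              · exact hb.2 (.inr e)
              · exact c2 ⟨u, rfl, a, ha, (e ▸ hab).symm⟩
        · refine h.red ih hC (a := x) (b := u) ⟨h.tx.m1, nu.1, h.tx.b1, nu.2.1, nu.2.2⟩ (K := C)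
            ⟨fun v hv => ⟨(hC1 hv).1, fun hm => (hC1 hv).2 ?_⟩,
              fun a ha b hb hab => hCcl.2 a ha b ⟨hb.1, ?_⟩ hab⟩ ⟨q, hC2⟩ xC tC yC
          · rcases hm with hm | hm
            exacts [.inl hm, .inr (.inr hm)]
          · rintro (e | e | e)
            · exact hb.2 (.inl e)
            · exact c1 ⟨t, rfl, a, ha, (e ▸ hab).symm⟩
            · exact hb.2 (.inr e)
      have key2 : ∀ q q', Tg G A W q q' → ¬ (q = x ∧ q' = t) → q ∈ K →
          Conf4 (SW G W L q1 q2 x t y X0 Xs Y0 Ys) ∨ (q = x ∧ q' = u) := by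
        intro q q' tq hn hq
        by_cases e1 : q = x
        · by_cases e2 : q' = u
          · exact .inr ⟨e1, e2⟩
          have e3 : q' ≠ t := fun e => hn ⟨e1, e⟩
          refine .inl (key q' (hK.2 q hq q' ⟨tq.m2, ?_⟩ tq.adj) tq.b2 ?_)
          · rintro (e | e); exacts [e3 e, e2 e]
          · rintro rfl; exact G.irrefl (e1 ▸ tq.adj)
        · exact .inl (key q hq tq.b1 e1)
      rcases m with m | m
      · rcases key2 q1 q2 h.tq (fun e => nx (.inl e)) m with h | h
        exacts [.inl h, .inr (.inl h)]
      · rcases key2 q2 q1 h.tq.symm (fun e => nx (.inr e.symm)) m with h | h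
        exacts [.inl h, .inr (.inr h.symm)]
    · push Not at m
      left
      have w1 := ih (W \ K) (sdiff_ssub (clo_sub hK) ⟨x, hx⟩) A L q1 q2 u t y X0 Us Y0 Ys e d'
        { h with ctx := h.ctx.sub sdiff_subset, tq := h.tq.sub ⟨h.tq.m1, m.1⟩ ⟨h.tq.m2, m.2⟩
                 tx := tut.symm.sub ⟨nu.1, uK⟩ ⟨h.tx.m2, tK⟩
                 ty := h.ty.sub ⟨h.ty.m1, hyK⟩ ⟨h.tx.m2, tK⟩
                 xy := uy
                 sx := ha.st h.sx.1 he
                 lx := lu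
                 hd := he
                 xs := by
                  rcases ha with ⟨-, rfl⟩ | ⟨-, rfl⟩
                  exacts [Finset.subset_union_right, Finset.subset_union_left]
                 std := h.std.sub sdiff_subset }
      refine w1.mono (w_mono fun φ hφ hQ => ?_)
      have k3 := hφ.2 u ⟨nu.1, uK⟩ t ⟨h.tx.m2, tK⟩ nt.2.2.symm
      obtain ⟨χ, hχ, c1, c2, c3⟩ : ∃ χ, Col G (K ∪ {t, u}) L χ ∧ χ t = φ t ∧ χ u = φ u ∧
          (φ t ∈ X0 → χ x ∈ Xs) := by
        by_cases ht : φ t ∈ X0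
        · obtain ⟨χ, hχ, c1, c2⟩ := adv_ext (hD _ hKs) (hM _ hKs) (h.ctx.sub hKs)
            (h.tx.sub (.inl hx) (by simp)) h.sx (sideL_x (L := L) xt) sideL_t (h.sideStd.sub hKs)
            (u := u) (e := e) (Us := Us) (a := φ u) (τ := φ t)
            ⟨by simp, nu.2⟩ ⟨by simp, nt.2⟩ he (by rw [sideL_o ux ut, lu]) ha (hQ.1 ht) ht k3
          have := h.col hKs (.inl hx) (by simp) hχ
          exact ⟨χ, this.1, c2, c1, fun _ => this.2.2⟩
        · obtain ⟨χ, hχ, c1, c2⟩ := th2 (h.ctx.sub hKs) (p1 := t) (p2 := u) (c1 := φ t) (c2 := φ u)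
            (by simp) (by simp) tut.b1 tut.b2 tut.adj ((h.std.sub hKs).mono (by simp))
            (hφ.1 t ⟨h.tx.m2, tK⟩) (hφ.1 u ⟨nu.1, uK⟩) k3.symm
          exact ⟨χ, hχ, c1, c2, fun h => (ht h).elim⟩
      obtain ⟨ψ, g1, g2, g3⟩ := glue hK hφ hχ (by
        rintro x (rfl | rfl) _; exacts [c1, c2])
      refine ⟨ψ, g1, ?_, g2 _ h.tq.m1 m.1, g2 _ h.tq.m2 m.2⟩
      rw [g2 _ h.tx.m2 tK, g2 _ h.ty.m1 hyK, g3 _ hx]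
      exact ⟨c3, hQ.2⟩
  · exact (hh (Rch.of_adj nu.2.2.symm ⟨nu.1, by rintro (e | e); exacts [ut e, uy e]⟩
      ⟨h.tx.m1, by rintro (e | e); exacts [xt e, h.xy e]⟩)).elim
  · have h' : ¬ Rch G (W \ {t, x}) u y := fun hh' => hh hh'.symm
    obtain ⟨hK, hy, hvK⟩ := sep_clo h' ⟨nu.1, by rintro (e | e); exacts [ut e, ux e]⟩
      ⟨h.ty.m1, by rintro (e | e); exacts [yt e, h.xy e.symm]⟩
    exact .inl (h.red ih hC h.tx.symm hK ⟨_, hy⟩ (fun h => (hK.1 h).2 (by simp))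
      (fun h => (hK.1 h).2 (by simp)) hvK)

lemma nsub_disj (h : Disjoint X0 Y0) (h2 : X0.card = 2) : ¬ X0 ⊆ Y0 ∪ {d} := by
  intro hs
  have : X0 ⊆ {d} := fun a ha => by
    rcases Finset.mem_union.1 (hs ha) with h' | h'
    · exact (Finset.disjoint_left.1 h ha h').elim
    · exact h'
  have := Finset.card_le_card this
  simp at this; omega

lemma WH.side (h : WH G A W L q1 q2 x t y X0 Xs Y0 Ys d d') (ih : ∀ W', W' ⊂ W → WP G W')
    (hD : ∀ W', W' ⊆ W → DP G W') (hM : ∀ W', W' ⊆ W → MP G W') (hC : ∀ W', W' ⊆ W → CP G W')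
    (nx : ¬ ((q1 = x ∧ q2 = t) ∨ (q1 = t ∧ q2 = x))) :
    Conf4 (SW G W L q1 q2 x t y X0 Xs Y0 Ys) ∨ (Xs ≠ X0 ∧ (x = q1 ∨ x = q2)) ∨
      ∃ u, u ≠ y ∧ X0 ⊆ L u ∧ ((q1 = x ∧ q2 = u) ∨ (q1 = u ∧ q2 = x)) := by
  have xt := h.xt
  have yt := h.swap.xt
  have tx := h.tx
  have ty := h.ty
  rcases sideDM (hD _ subset_rfl) (hM _ subset_rfl) h.ctx h.tq h.tx h.sx (sideL_x (L := L) xt) sideL_t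
    h.sideStd with hh | ⟨-, hh⟩
  · refine .inl (hh.mono ?_)
    rintro c ⟨φ, hφ, h1, h2⟩
    obtain ⟨k1, k2, k3⟩ := h.col subset_rfl tx.m1 tx.m2 hφ
    exact ⟨φ, k1, ⟨fun _ => k3, fun h' => (Finset.disjoint_left.1 h.dj k2 h').elim⟩, h1, h2⟩
  rcases hh with hh | hh | ⟨u, e, Us, nu, nt, he, lu, ha⟩ | ⟨u1, u2, n1, n2, a12, e1, e2⟩
  · exact (nx hh).elim
  · exact .inr (.inl hh)
  · have ux : u ≠ x := nu.2.2.ne'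
    have ut : u ≠ t := nt.2.2.ne'
    rw [sideL_o ux ut] at lu
    have uy : u ≠ y := by
      rintro rfl
      refine nsub_disj (d := d') h.dj h.sx.1 ?_
      rw [← h.ly, lu]; exact Finset.subset_union_left
    rcases h.adv ih hD hM hC nx nu nt he lu ha uy with hh | hh
    · exact .inl hh
    · exact .inr (.inr ⟨u, uy, by rw [lu]; exact Finset.subset_union_left, hh⟩)
  · left
    exact tri_key h.ctx tx n1 n2 e1 e2 a12 fun u1 K tg hK hn hy hvK hv =>
      h.red ih hC tg hK hn hy hvK (hv _ ty.adj)

/-- target `x t` -/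
lemma WH.wa (h : WH G A W L x t x t y X0 Xs Y0 Ys d d') (hE : EP G W) :
    Conf4 (SW G W L x t x t y X0 Xs Y0 Ys) := by
  have tx := h.tx
  have ty := h.ty
  have xt := h.xt
  have yt := h.swap.xt
  have dj := Finset.disjoint_left.1 h.dj
  -- Thomassen pairs
  have key : ∀ a ∈ Xs, ∀ b ∈ X0, a ≠ b → (a, b) ∈ SW G W L x t x t y X0 Xs Y0 Ys := by
    intro a ha b hb hab
    obtain ⟨φ, hφ, h1, h2⟩ := th2 h.ctx tx.m1 tx.m2 tx.b1 tx.b2 tx.adj (h.std.mono (by simp))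
      (c1 := a) (c2 := b) (by rw [h.lx]; exact h.xs ha)
      (by rw [h.lt]; exact Finset.mem_union_left _ hb) hab
    refine ⟨φ, hφ, ⟨fun _ => h1 ▸ ha, fun h' => (dj hb (h2 ▸ h')).elim⟩, h1, h2⟩
  obtain ⟨τ, hτ, a, b, hab, k1, k2⟩ := hE A (sideL L y t Y0 Ys) y t x Y0 Ys h.ctx ty tx h.xy h.sy
    (sideL_x yt) sideL_t (by
      rw [sideL_o h.xy xt, h.lx]; exact nsub_disj h.dj.symm h.sy.1) h.swap.sideStd
  have hsub : ∀ a, (a, τ) ∈ Sq G W (sideL L y t Y0 Ys) x t →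
      (a, τ) ∈ SW G W L x t x t y X0 Xs Y0 Ys := by
    rintro a ⟨φ, hφ, h1, h2⟩
    obtain ⟨k1, k2, k3⟩ := h.swap.col subset_rfl ty.m1 ty.m2 hφ
    exact ⟨φ, k1, ⟨fun h' => (dj h' k2).elim, fun _ => k3⟩, h1, h2⟩
  have j1 := hsub _ k1
  have j2 := hsub _ k2
  obtain ⟨h0, rfl | ⟨c, hc, rfl⟩⟩ := h.sx
  · obtain ⟨m, n, hmn, rfl⟩ := Finset.card_eq_two.1 h0
    have n1 : m ≠ τ := fun e => dj (by simp) (e ▸ hτ)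
    have n2 : n ≠ τ := fun e => dj (by simp) (e ▸ hτ)
    refine ⟨_, key m (by simp) n (by simp) hmn, _, key n (by simp) m (by simp) hmn.symm, _, j1, _, j2,
      ⟨by simp [hmn], by simp⟩, ⟨by simp [hab], by simp⟩, by simp [n2.symm], by simp [n1.symm], ?_, ?_⟩
    · simp; grind
    · simp; grind
  · obtain ⟨m, n, hmn, rfl⟩ := Finset.card_eq_two.1 h0
    have n1 : m ≠ τ := fun e => dj (by simp) (e ▸ hτ)
    have n2 : n ≠ τ := fun e => dj (by simp) (e ▸ hτ)
    have c1 : c ≠ m := fun e => hc (by simp [e])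
    have c2 : c ≠ n := fun e => hc (by simp [e])
    refine ⟨_, key c (by simp) m (by simp) c1, _, key c (by simp) n (by simp) c2, _, j1, _, j2,
      ⟨by simp [hmn], by simp⟩, ⟨by simp [hab], by simp⟩, by simp [n1.symm], by simp [n2.symm], ?_, ?_⟩
    · simp; grind
    · simp; grind

/-- target `x y` with two dictators -/
lemma WH.wxy (h : WH G A W L x y x t y X0 Xs Y0 Ys d d') (hx : Xs ≠ X0) (hy : Ys ≠ Y0) :
    Conf4 (SW G W L x y x t y X0 Xs Y0 Ys) := by
  classical
  have key : ∀ {q1 q2 x y X0 Xs Y0 Ys d d'}, WH G A W L q1 q2 x t y X0 Xs Y0 Ys d d' →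
      G.Adj x y → Xs ≠ X0 →
      ∀ e ∈ L y, e ≠ d → (d, e) ∈ SW G W L x y x t y X0 Xs Y0 Ys := by
    intro q1 q2 x y X0 Xs Y0 Ys d d' h adj hx e he hed
    have hXs : Xs = {d} := by
      rcases h.sx.2 with hh | ⟨c, hc, rfl⟩
      · exact (hx hh).elim
      have := h.xs (Finset.mem_singleton_self c)
      rcases Finset.mem_union.1 this with h' | h'
      · exact (hc h').elim
      · rw [Finset.mem_singleton.1 h']
    have xt := h.xt
    have yt := h.swap.xt
    obtain ⟨φ, hφ, h1, h2⟩ := th2 (L := update L t (X0 ∪ {d, e})) h.ctx h.tx.m1 h.ty.m1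
      h.tx.b1 h.ty.b1 adj (c1 := d) (c2 := e) (by
        intro v hv _
        by_cases e' : v = t
        · subst e'
          simp only [update_self]
          refine ⟨?_, fun hb => (hb h.tx.b2).elim⟩
          rw [← card3 h.sx.1 h.hd]
          exact Finset.card_le_card (Finset.union_subset_union_right (by simp))
        · rw [update_of_ne e']; exact h.std v hv (by simp))
      (by rw [update_of_ne xt, h.lx]; simp) (by rwa [update_of_ne yt]) hed.symm
    have ht := hφ.1 t h.tx.m2
    rw [update_self] at ht
    have t1 := hφ.2 _ h.tx.m1 _ h.tx.m2 h.tx.adj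
    have t2 := hφ.2 _ h.ty.m1 _ h.tx.m2 h.ty.adj
    have ht' : φ t ∈ X0 := by
      simp only [Finset.mem_union, Finset.mem_insert, Finset.mem_singleton] at ht
      rcases ht with ht | ht | ht
      · exact ht
      · exact (t1 (h1.trans ht.symm)).elim
      · exact (t2 (h2.trans ht.symm)).elim
    refine ⟨φ, ⟨fun v hv => ?_, hφ.2⟩, ⟨fun _ => by rw [h1, hXs]; simp, fun h' =>
      (Finset.disjoint_left.1 h.dj ht' h').elim⟩, h1, h2⟩
    by_cases e' : v = t
    · subst e'; rw [h.lt]; exact Finset.mem_union_left _ ht'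
    · have := hφ.1 v hv
      rwa [update_of_ne e'] at this
  have k1 := key h h.tq.adj hx
  have k2 := key h.swap h.tq.adj.symm hy
  have k2' : ∀ f ∈ L x, f ≠ d' → (f, d') ∈ SW G W L x y x t y X0 Xs Y0 Ys := by
    intro f hf hfd
    obtain ⟨φ, h1, h2, h3, h4⟩ := k2 f hf hfd
    exact ⟨φ, h1, h2.symm, h4, h3⟩
  obtain ⟨e1, m1, e2, m2, e12, n1, n2⟩ := pick2ne (L y) (h.std y h.ty.m1 (by simp)).1 d
  obtain ⟨f1, l1, f2, l2, f12, o1, o2⟩ := pick2ne (L x) (h.std x h.tx.m1 (by simp)).1 d'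
  by_cases hf : f1 = d
  · have hf2 : f2 ≠ d := fun e => f12 (hf.trans e.symm)
    refine ⟨_, k1 e1 m1 n1, _, k1 e2 m2 n2, _, k2' f2 l2 o2, _, k2' f1 l1 o1,
      ⟨by simp [e12], by simp⟩, ⟨by simp [f12.symm], by simp⟩, by simp [hf2], by simp [hf2], ?_, ?_⟩
    · simp; grind
    · simp [e12]
  · refine ⟨_, k1 e1 m1 n1, _, k1 e2 m2 n2, _, k2' f1 l1 o1, _, k2' f2 l2 o2,
      ⟨by simp [e12], by simp⟩, ⟨by simp [f12], by simp⟩, by simp [hf], by simp [hf], ?_, ?_⟩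
    · simp; grind
    · simp [e12]

lemma stepW (ih : ∀ W', W' ⊂ W → WP G W') (hD : ∀ W', W' ⊆ W → DP G W')
    (hM : ∀ W', W' ⊆ W → MP G W') (hC : ∀ W', W' ⊆ W → CP G W') (hE : EP G W) : WP G W := by
  intro A L q1 q2 x t y X0 Xs Y0 Ys d d' h
  by_cases nx : (q1 = x ∧ q2 = t) ∨ (q1 = t ∧ q2 = x)
  · rcases nx with ⟨rfl, rfl⟩ | ⟨rfl, rfl⟩
    · exact h.wa hE
    · exact SW.swapQ (h.swapQ.wa hE)
  by_cases ny : (q1 = y ∧ q2 = t) ∨ (q1 = t ∧ q2 = y)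
  · rcases ny with ⟨rfl, rfl⟩ | ⟨rfl, rfl⟩
    · exact SW.swap (h.swap.wa hE)
    · exact SW.swap (SW.swapQ (h.swap.swapQ.wa hE))
  have hny : ¬ X0 ⊆ L y := by rw [h.ly]; exact nsub_disj h.dj h.sx.1
  have hnx : ¬ Y0 ⊆ L x := by rw [h.lx]; exact nsub_disj h.dj.symm h.sy.1
  have xy := h.xy
  rcases h.side ih hD hM hC nx with hh | ⟨sx, hx⟩ | ⟨u, uy, hu, hq⟩
  · exact hh
  · rcases h.swap.side ih hD hM hC ny with hh | ⟨sy, hy⟩ | ⟨u, uy, hu, hq⟩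
    · exact SW.swap hh
    · rcases hx with rfl | rfl <;> rcases hy with rfl | rfl
      · exact (xy rfl).elim
      · exact h.wxy sx sy
      · exact SW.swapQ (h.swapQ.wxy sx sy)
      · exact (xy rfl).elim
    · exfalso
      rcases hx with rfl | rfl <;> rcases hq with ⟨a, b⟩ | ⟨a, b⟩
      exacts [xy a, uy a.symm, uy b.symm, xy b]
  · rcases h.swap.side ih hD hM hC ny with hh | ⟨sy, hy⟩ | ⟨u', uy', hu', hq'⟩
    · exact SW.swap hh
    · exfalso
      rcases hy with rfl | rfl <;> rcases hq with ⟨a, b⟩ | ⟨a, b⟩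
      exacts [xy a.symm, uy a.symm, uy b.symm, xy b.symm]
    · exfalso
      rcases hq with ⟨a, b⟩ | ⟨a, b⟩ <;> rcases hq' with ⟨a2, b2⟩ | ⟨a2, b2⟩
      · exact xy (a.symm.trans a2)
      · exact uy (b.symm.trans b2)
      · exact uy (a.symm.trans a2)
      · exact xy (b.symm.trans b2)

/-- the main situation for a dictatorship: the two outer neighbours of `z` are not adjacent -/
structure DH (G : SimpleGraph α) (A W : Set α) (L : α → Finset ℕ) (q1 q2 z x y : α) (c : ℕ) :
    Prop where
  ctx : Ctx G A W
  tq : Tg G A W q1 q2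
  nx : Nb G A W z x
  ny : Nb G A W z y
  hz : z ∈ W
  bz : Bd G A z
  xy : ¬ G.Adj x y
  xny : x ≠ y
  only : ∀ u, Nb G A W z u → u = x ∨ u = y
  z1 : z ≠ q1
  z2 : z ≠ q2
  lz : L z = {c}
  std : Std G A W L {z}
  hS : ¬ Spl G A W
  noTri : ∀ a b d K, a ∈ W → b ∈ W → d ∈ W → G.Adj a b → G.Adj a d → G.Adj b d →
    Clo G (W \ {a, b, d}) K → (∀ k ∈ K, ¬ Bd G A k) → K.Nonempty → False
  deg : ∀ v ∈ W, v ≠ z → v ≠ q1 → v ≠ q2 → ∀ M : Finset α, (∀ u ∈ W, G.Adj v u → u ∈ M) →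
    (L v).card ≤ M.card

lemma DH.swap (h : DH G A W L q1 q2 z x y c) : DH G A W L q1 q2 z y x c :=
  ⟨h.ctx, h.tq, h.ny, h.nx, h.hz, h.bz, fun e => h.xy e.symm, h.xny.symm, fun u hu => (h.only u hu).symm,
    h.z1, h.z2, h.lz, h.std, h.hS, h.noTri, h.deg⟩

lemma clo_less (hK : Clo G (W \ T) K) (hT : S ⊆ T)
    (h : ∀ w ∈ W, w ∈ T → w ∉ S → ¬ Adjs G {w} K) : Clo G (W \ S) K := by
  refine ⟨fun k hk => ⟨(hK.1 hk).1, fun h' => (hK.1 hk).2 (hT h')⟩, fun k hk w hw ha => ?_⟩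
  by_cases hwT : w ∈ T
  · exact (h w hw.1 hwT hw.2 ⟨w, rfl, k, hk, ha.symm⟩).elim
  · exact hK.2 k hk w ⟨hw.1, hwT⟩ ha

lemma adjs_s (h : G.Adj x y) : Adjs G {x} {y} := ⟨x, rfl, y, rfl, h⟩

lemma k33a {a b c d : α} {C D : Set α} (nm : NM G) (nD : D.Nonempty) (nC : C.Nonempty)
    (cD : Conn G D) (cC : Conn G C) (ab : a ≠ b) (cd : c ≠ d) (ac : a ≠ c) (ad : a ≠ d) (bc : b ≠ c)
    (bd : b ≠ d) (hD : ∀ v ∈ D, v ≠ a ∧ v ≠ b ∧ v ≠ c ∧ v ≠ d ∧ v ∉ C)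
    (hC : ∀ v ∈ C, v ≠ a ∧ v ≠ b ∧ v ≠ c ∧ v ≠ d) (h1 : G.Adj a c) (h2 : G.Adj a d)
    (h3 : Adjs G {a} C) (h4 : G.Adj b c) (h5 : G.Adj b d) (h6 : Adjs G {b} C) (h7 : Adjs G D {c})
    (h8 : Adjs G D {d}) (h9 : Adjs G D C) : False := by
  refine nm.k33' (a := {a}) (b := {b}) (c := D) (x := {c}) (y := {d}) (z := C)
    (singleton_nonempty _) (singleton_nonempty _) nD (singleton_nonempty _)
    (singleton_nonempty _) nC conn_single conn_single cD conn_single conn_single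
    cC ?_ ?_ ?_ ?_ ?_ ?_ ?_ ?_ ?_ ?_ ?_ ?_ ?_ ?_ ?_ (adjs_s h1) (adjs_s h2) h3
    (adjs_s h4) (adjs_s h5) h6 h7 h8 h9
  all_goals (clear h3 h6 h7 h8 h9 cD cC nm; rw [Set.disjoint_left]; (try simp only [mem_singleton_iff]); grind)

lemma pick_col (h3 : ¬ H3 G A W x) (hz : Nb G A W x z) (h2 : X0.card = 2) (φ : α → ℕ) :
    ∃ a ∈ X0, ∀ u, Nb G A W x u → u ≠ z → φ u ≠ a := by
  by_cases hr : ∃ r, Nb G A W x r ∧ r ≠ z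
  · obtain ⟨r, hr, hrz⟩ := hr
    obtain ⟨a, ha, ha'⟩ := Finset.exists_mem_ne (by omega : 1 < X0.card) (φ r)
    refine ⟨a, ha, fun u hu huz => ?_⟩
    rcases not_H3 h3 hz hr hrz.symm hu with rfl | rfl
    exacts [(huz rfl).elim, ha'.symm]
  · push Not at hr
    obtain ⟨a, ha⟩ := Finset.card_pos.1 (by omega : 0 < X0.card)
    exact ⟨a, ha, fun u hu huz => (huz (hr u hu)).elim⟩

lemma DH.h3 (h : DH G A W L q1 q2 z x y c) (hv : v ∈ W) (bv : Bd G A v) : ¬ H3 G A W v :=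
  fun h3 => h.hS (spl_of_H3 h.ctx hv bv h3)

/-- in a K4 `x z u1 u2` with `u1` interior, `u1` sees the outer face -/
lemma DH.out (h : DH G A W L q1 q2 z x y c) {u1 u2 : α} (m1 : u1 ∈ W) (m2 : u2 ∈ W)
    (b1 : ¬ Bd G A u1) (a2 : G.Adj z u2) (c2 : G.Adj x u2) (a12 : G.Adj u1 u2) :
    ∃ w ∈ W \ {x, z, u1, u2}, G.Adj u1 w ∧ ∃ q ∈ comp G (W \ {x, z, u1, u2}) w, Bd G A q := by
  by_contra hno
  push Not at hno
  set T := W \ {x, z, u1, u2} with hT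
  have n1x : u1 ≠ x := fun e => b1 (e ▸ h.nx.2.1)
  have n1z : u1 ≠ z := fun e => b1 (e ▸ h.bz)
  refine h.noTri x z u2 ({u1} ∪ {w | w ∈ T ∧ ∀ q ∈ comp G T w, ¬ Bd G A q}) h.nx.1 h.hz m2
    h.nx.2.2.symm c2 a2 ⟨?_, ?_⟩ ?_ ⟨u1, .inl rfl⟩
  · rintro k (rfl | ⟨hk, -⟩)
    · refine ⟨m1, ?_⟩
      rintro (e | e | e); exacts [n1x e, n1z e, a12.ne e]
    · refine ⟨hk.1, fun e => hk.2 ?_⟩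
      rcases e with e | e | e
      exacts [.inl e, .inr (.inl e), .inr (.inr (.inr e))]
  · intro k hk w hw ha
    by_cases hw1 : w = u1
    · exact .inl hw1
    have hwT : w ∈ T := by
      refine ⟨hw.1, ?_⟩
      rintro (e | e | e | e)
      exacts [hw.2 (.inl e), hw.2 (.inr (.inl e)), hw1 e, hw.2 (.inr (.inr e))]
    refine .inr ⟨hwT, ?_⟩
    rcases hk with rfl | ⟨hk, hk'⟩
    · exact hno w hwT ha
    · rwa [comp_eq_of_mem (comp_closed (mem_comp hk) hwT ha)]
  · rintro k (rfl | ⟨hk, hk'⟩)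
    exacts [b1, hk' k (mem_comp hk)]

lemma DH.k4 (h : DH G A W L q1 q2 z x y c) {u1 u2 : α} (m1 : u1 ∈ W) (m2 : u2 ∈ W)
    (b1 : ¬ Bd G A u1) (b2 : ¬ Bd G A u2) (a1 : G.Adj z u1) (a2 : G.Adj z u2) (c1 : G.Adj x u1)
    (c2 : G.Adj x u2) (a12 : G.Adj u1 u2) : False := by
  obtain ⟨w1, hw1, e1, r1, hr1, br1⟩ := h.out m1 m2 b1 a2 c2 a12
  obtain ⟨w2, hw2, e2, r2, hr2, br2⟩ := h.out m2 m1 b2 a1 c1 a12.symm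
  rw [show ({x, z, u2, u1} : Set α) = {x, z, u1, u2} by rw [pair_comm]] at hw2 hr2
  set T := W \ {x, z, u1, u2} with hT
  have s1 : comp G T w1 ⊆ T := comp_sub
  have s2 : comp G T w2 ⊆ T := comp_sub
  have cn : Conn G (A ∪ comp G T w1 ∪ comp G T w2) :=
    conn_union (conn_union h.ctx.conn comp_conn (br1.adjs hr1)) comp_conn
      ((br2.adjs hr2).mono (fun _ h => .inl h) subset_rfl)
  have hA : A ⊆ A ∪ comp G T w1 ∪ comp G T w2 := fun _ h => .inl (.inl h)
  have dj : ∀ v ∈ W, v ∉ T → v ∉ A ∪ comp G T w1 ∪ comp G T w2 := by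
    rintro v hv hvT ((h' | h') | h')
    exacts [h.ctx.disj v h' hv, hvT (s1 h'), hvT (s2 h')]
  have dj' : ∀ v ∈ W, v ∉ T → Disjoint {v} (A ∪ comp G T w1 ∪ comp G T w2) := fun v hv hvT =>
    disjoint_singleton_left.2 (dj v hv hvT)
  have bx := h.nx
  refine h.ctx.nm.k5' (a := {x}) (b := {z}) (c := {u1}) (d := {u2})
    (e := A ∪ comp G T w1 ∪ comp G T w2) (singleton_nonempty _)
    (singleton_nonempty _) (singleton_nonempty _) (singleton_nonempty _) (h.ctx.ne.mono hA)
    conn_single conn_single conn_single conn_single cn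
    (disjoint_singleton.2 bx.2.2.ne') (disjoint_singleton.2 c1.ne) (disjoint_singleton.2 c2.ne)
    (dj' x bx.1 fun h => h.2 (by simp)) (disjoint_singleton.2 a1.ne) (disjoint_singleton.2 a2.ne)
    (dj' z h.hz fun h => h.2 (by simp)) (disjoint_singleton.2 a12.ne)
    (dj' u1 m1 fun h => h.2 (by simp)) (dj' u2 m2 fun h => h.2 (by simp))
    (adjs_s bx.2.2.symm) (adjs_s c1) (adjs_s c2) ((bx.2.1.adjs (mem_singleton x)).symm.mono subset_rfl hA)
    (adjs_s a1) (adjs_s a2) ((h.bz.adjs (mem_singleton z)).symm.mono subset_rfl hA) (adjs_s a12)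
    ⟨u1, rfl, w1, .inl (.inr (mem_comp hw1)), e1⟩ ⟨u2, rfl, w2, .inr (mem_comp hw2), e2⟩

/-- the configuration with the interior vertex `t` -/
structure DT (G : SimpleGraph α) (A W : Set α) (L : α → Finset ℕ) (q1 q2 z x y : α) (c : ℕ)
    (t : α) (X0 Y0 : Finset ℕ) : Prop extends DH G A W L q1 q2 z x y c where
  mt : t ∈ W
  bt : ¬ Bd G A t
  tx : G.Adj t x
  ty : G.Adj t y
  tz : G.Adj t z
  x2 : X0.card = 2
  y2 : Y0.card = 2
  lx : X0 ⊆ L x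
  ly : Y0 ⊆ L y
  cx : c ∉ X0
  cy : c ∉ Y0
  dj : Disjoint X0 Y0
  lt : L t = X0 ∪ Y0 ∪ {c}

lemma DT.swap (h : DT G A W L q1 q2 z x y c t X0 Y0) : DT G A W L q1 q2 z y x c t Y0 X0 :=
  ⟨h.toDH.swap, h.mt, h.bt, h.ty, h.tx, h.tz, h.y2, h.x2, h.ly, h.lx, h.cy, h.cx, h.dj.symm,
    by rw [h.lt, Finset.union_comm X0]⟩

lemma DH.first (h : DH G A W L q1 q2 z x y c) (hD : ∀ W', W' ⊂ W → DP G W')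
    (hx1 : x ≠ q1) (hx2 : x ≠ q2) (x2 : X0.card = 2) (lx : X0 ⊆ L x) (cx : c ∉ X0) :
    Conf4 (Sq G W L q1 q2) ∨ ∃ t Y0, L y = Y0 ∪ {c} ∧ DT G A W L q1 q2 z x y c t X0 Y0 := by
  have zx : z ≠ x := h.nx.2.2.ne
  rcases hD _ (ssub_del h.nx.1) (insert x A) ∅ (rmI G A x X0 L) z q1 q2 c (h.ctx.del h.nx.2.1)
    (h.tq.del hx1.symm hx2.symm) ⟨h.hz, zx⟩ h.bz.ins (by rw [rmI_bd _ h.bz, h.lz])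
    (h.std.rmI x X0 x2.le) (fun v hv => hv.elim) with hr | ⟨hr, -⟩
  · refine .inl (hr.mono (sq_mono fun φ hφ => ?_))
    have nz : Nb G A W x z := ⟨h.hz, h.bz, h.nx.2.2.symm⟩
    obtain ⟨a, ha, hN⟩ := pick_col (h.h3 h.nx.1 h.nx.2.1) nz x2 φ
    obtain ⟨ψ, g1, -, g2⟩ := ext_rmI hφ (lx ha) ha (fun u hu => by
      by_cases e : u = z
      · subst e
        have := hφ.1 u ⟨h.hz, zx⟩
        rw [rmI_bd _ h.bz, h.lz, Finset.mem_singleton] at this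
        rw [this]; rintro rfl; exact cx ha
      · exact hN u hu e)
    exact ⟨ψ, g1, g2 _ hx1.symm, g2 _ hx2.symm⟩
  · right
    rcases hr.dict_inv with (e | e) | ⟨u1, u2, L0, m1, m2, a1, a2, a12, hL0, hc, l1, l2⟩
    · exact (h.z1 e).elim
    · exact (h.z2 e).elim
    have adjx : ∀ u ∈ W \ {x}, G.Adj z u → rmI G A x X0 L u = L0 ∪ {c} → ¬ Bd G A u →
        G.Adj x u := by
      intro u hu ha hl hb
      by_contra hno
      rw [rmI_nadj _ hno] at hl
      exact hb (bd_of_card3 h.std hu.1 (ha.ne') (by rw [hl, card3 hL0 hc]))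
    have isy : ∀ u ∈ W \ {x}, G.Adj z u → Bd G A u → u = y := fun u hu ha hb =>
      (h.only u ⟨hu.1, hb, ha⟩).resolve_left hu.2
    have fin : ∀ t ∈ W \ {x}, ¬ Bd G A t → G.Adj z t → G.Adj y t → rmI G A x X0 L y = L0 ∪ {c} →
        rmI G A x X0 L t = L0 ∪ {c} →
        ∃ t Y0, L y = Y0 ∪ {c} ∧ DT G A W L q1 q2 z x y c t X0 Y0 := by
      intro t mt bt at' ayt ly lt
      have hxt := adjx t mt at' lt bt
      rw [rmI_adj _ hxt bt] at lt
      rw [rmI_bd _ h.ny.2.1] at ly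
      have c5 : 5 ≤ (L t).card := (h.std t mt.1 (at'.ne')).2 bt
      have hcd := Finset.card_sdiff_add_card_inter (L t) X0
      have hle := Finset.card_le_card (Finset.inter_subset_right (s₁ := L t) (s₂ := X0))
      have h3 : (L t \ X0).card = 3 := by rw [lt, card3 hL0 hc]
      have hsub : X0 ⊆ L t := by
        have : L t ∩ X0 = X0 := Finset.eq_of_subset_of_card_le Finset.inter_subset_right (by omega)
        rw [← this]; exact Finset.inter_subset_left
      refine ⟨t, L0, ly, h, mt.1, bt, hxt.symm, ayt.symm, at'.symm, x2, hL0, lx, ?_, cx, hc, ?_, ?_⟩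
      · rw [ly]; exact Finset.subset_union_left
      · rw [Finset.disjoint_left]
        intro a ha hb
        have : a ∈ L t \ X0 := by rw [lt]; exact Finset.mem_union_left _ hb
        exact (Finset.mem_sdiff.1 this).2 ha
      · rw [Finset.union_assoc, ← lt, Finset.union_sdiff_of_subset hsub]
    by_cases b1 : Bd G A u1 <;> by_cases b2 : Bd G A u2
    · exact (a12.ne ((isy u1 m1 a1 b1).trans (isy u2 m2 a2 b2).symm)).elim
    · obtain rfl := isy u1 m1 a1 b1
      exact fin u2 m2 b2 a2 a12 l1 l2
    · obtain rfl := isy u2 m2 a2 b2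
      exact fin u1 m1 b1 a1 a12.symm l2 l1
    · exact (h.k4 m1.1 m2.1 b1 b2 a1 a2 (adjx u1 m1 a1 l1 b1) (adjx u2 m2 a2 l2 b2) a12).elim

lemma DT.f1aux (h : DT G A W L q1 q2 z x y c t X0 Y0) (hs : s ∈ W \ {z, x, y, t})
    (hx : ¬ Adjs G {x} (comp G (W \ {z, x, y, t}) s))
    (az : Adjs G {z} (comp G (W \ {z, x, y, t}) s)) : False := by
  set C := comp G (W \ {z, x, y, t}) s with hC
  have sC : C ⊆ W \ {z, x, y, t} := comp_sub
  have cl : Clo G (W \ {z, x, y, t}) C := clo_comp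
  by_cases hb : ∃ q ∈ C, Bd G A q
  · obtain ⟨q, hq, bq⟩ := hb
    by_cases ht : Adjs G {t} C
    · exact k33a h.ctx.nm h.ctx.ne ⟨q, hq⟩ h.ctx.conn comp_conn h.tz.ne' h.xny h.nx.2.2.ne
        h.ny.2.2.ne h.tx.ne h.ty.ne
        (fun v hv => by
          have := h.ctx.disj v hv
          refine ⟨?_, ?_, ?_, ?_, fun hc => this (sC hc).1⟩ <;> rintro rfl
          exacts [this h.hz, this h.mt, this h.nx.1, this h.ny.1])
        (fun v hv => by
          have := (sC hv).2
          refine ⟨?_, ?_, ?_, ?_⟩ <;> rintro rfl <;> simp at this)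
        h.nx.2.2 h.ny.2.2 az h.tx h.ty ht (h.nx.2.1.adjs rfl) (h.ny.2.1.adjs rfl) (bq.adjs hq)
    · refine h.hS ⟨z, y, C, ⟨h.hz, h.ny.1, h.bz, h.ny.2.1, h.ny.2.2⟩, clo_less cl ?_ ?_, ⟨q, hq⟩, x,
        ⟨h.nx.1, ?_⟩, fun e => (sC e).2 (by simp)⟩
      · rintro v (e | e); exacts [.inl e, .inr (.inr (.inl e))]
      · rintro w - (rfl | rfl | rfl | rfl) hn
        exacts [(hn (by simp)).elim, hx, (hn (by simp)).elim, ht]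
      · rintro (e | e); exacts [h.nx.2.2.ne' e, h.xny e]
  · push Not at hb
    refine h.noTri z y t C h.hz h.ny.1 h.mt h.ny.2.2 h.tz.symm h.ty.symm (clo_less cl ?_ ?_) hb
      ⟨s, mem_comp hs⟩
    · rintro v (e | e | e); exacts [.inl e, .inr (.inr (.inl e)), .inr (.inr (.inr e))]
    · rintro w - (rfl | rfl | rfl | rfl) hn
      exacts [(hn (by simp)).elim, hx, (hn (by simp)).elim, (hn (by simp)).elim]

lemma DT.nz (h : DT G A W L q1 q2 z x y c t X0 Y0) (hs : s ∈ W) (hzs : G.Adj z s) :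
    s = x ∨ s = y ∨ s = t := by
  by_contra hno
  have hs' : s ∈ W \ {z, x, y, t} := by
    refine ⟨hs, ?_⟩
    rintro (e | e); exacts [hzs.ne' e, hno e]
  have az : Adjs G {z} (comp G (W \ {z, x, y, t}) s) := ⟨z, rfl, s, mem_comp hs', hzs⟩
  by_cases hx : Adjs G {x} (comp G (W \ {z, x, y, t}) s)
  · by_cases hy : Adjs G {y} (comp G (W \ {z, x, y, t}) s)
    · obtain ⟨C, hC⟩ : ∃ C, C = comp G (W \ {z, x, y, t}) s := ⟨_, rfl⟩
      have sC : ∀ v ∈ C, v ∈ W ∧ v ≠ z ∧ v ≠ x ∧ v ≠ y ∧ v ≠ t := by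
        intro v hv
        rw [hC] at hv
        have := comp_sub hv
        refine ⟨this.1, ?_⟩
        simpa using this.2
      have nC : C.Nonempty := hC ▸ comp_nonempty hs'
      have cC : Conn G C := hC ▸ comp_conn
      rw [← hC] at hx hy az
      have n1 := h.ny.2.2.ne; have n2 := h.nx.2.2.ne; have n3 := h.tx.ne; have n4 := h.ty.ne
      have n5 := h.tz.ne; have n6 := h.xny
      have dA := h.ctx.disj; have w1 := h.nx.1; have w2 := h.ny.1; have w3 := h.hz; have w4 := h.mt
      refine h.ctx.nm.k33' (a := {x}) (b := {y}) (c := {z}) (x := {t}) (y := A)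
        (z := C)
        (singleton_nonempty _) (singleton_nonempty _) (singleton_nonempty _) (singleton_nonempty _)
        h.ctx.ne nC conn_single conn_single conn_single conn_single h.ctx.conn
        cC ?_ ?_ ?_ ?_ ?_ ?_ ?_ ?_ ?_ ?_ ?_ ?_ ?_ ?_ ?_ (adjs_s h.tx.symm)
        (h.nx.2.1.adjs (mem_singleton _)).symm hx (adjs_s h.ty.symm) (h.ny.2.1.adjs (mem_singleton _)).symm hy
        (adjs_s h.tz.symm) (h.bz.adjs (mem_singleton _)).symm az
      all_goals
        clear hx hy az hC hs' cC h
        rw [Set.disjoint_left]; (try simp only [mem_singleton_iff]); grind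
    · rw [show ({z, x, y, t} : Set α) = {z, y, x, t} by ext; simp; tauto] at hs' hy az
      exact h.swap.f1aux hs' hy az
  · exact h.f1aux hs' hx az

/-- extension over `x`, `y`, `z` -/
lemma DT.ext (h : DT G A W L q1 q2 z x y c t X0 Y0) (hφ : Col G (W \ {z, x, y}) L' φ)
    (hsub : ∀ v ∈ W \ {z, x, y}, L' v ⊆ L v) (ha : a ∈ X0) (hb : b ∈ Y0) (htc : φ t ≠ c)
    (hax : ∀ u ∈ W, G.Adj x u → u ≠ z → φ u ≠ a) (hby : ∀ u ∈ W, G.Adj y u → u ≠ z → φ u ≠ b) :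
    ∃ ψ, Col G W L ψ ∧ ψ x = a ∧ ψ y = b ∧ ∀ v, v ≠ z → v ≠ x → v ≠ y → ψ v = φ v := by
  have zx := h.nx.2.2.ne
  have zy := h.ny.2.2.ne
  have xy := h.xny
  have hc1 : c ≠ a := by rintro rfl; exact h.cx ha
  have hc2 : c ≠ b := by rintro rfl; exact h.cy hb
  classical
  have e1 : Col G ((W \ {z, x}) \ {y}) L' φ := hφ.mono fun v hv => ⟨hv.1.1, by
    rintro (e | e | e); exacts [hv.1.2 (.inl e), hv.1.2 (.inr e), hv.2 e]⟩
  have s2 := e1.upd (c := b) (L := L) (fun u hu => hsub u ⟨hu.1.1, by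
    rintro (e | e | e); exacts [hu.1.2 (.inl e), hu.1.2 (.inr e), hu.2 e]⟩) (h.ly hb)
    (fun u hu hyu => hby u hu.1 hyu fun e => hu.2 (.inl e))
  have e3 : Col G ((W \ {z}) \ {x}) L (update φ y b) := s2.mono fun v hv =>
    ⟨hv.1.1, by rintro (e | e); exacts [hv.1.2 e, hv.2 e]⟩
  have s4 := e3.upd (c := a) (fun u hu => subset_rfl) (h.lx ha) (fun u hu hxu => by
    have hne : u ≠ y := by rintro rfl; exact h.xy hxu
    rw [update_of_ne hne]; exact hax u hu.1 hxu hu.2)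
  have s5 := s4.upd (c := c) (fun u hu => subset_rfl) (by rw [h.lz]; simp) (fun u hu hzu => by
    rcases h.nz hu hzu with rfl | rfl | rfl
    · rw [update_self]; exact hc1.symm
    · rw [update_of_ne h.xny.symm, update_self]; exact hc2.symm
    · rw [update_of_ne h.tx.ne, update_of_ne h.ty.ne]; exact htc)
  refine ⟨_, s5, ?_, ?_, ?_⟩
  · rw [update_of_ne zx.symm, update_self]
  · rw [update_of_ne zy.symm, update_of_ne xy.symm, update_self]
  · intro v h1 h2 h3
    rw [update_of_ne h1, update_of_ne h2, update_of_ne h3]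

lemma DT.nt (h : DT G A W L q1 q2 z x y c t X0 Y0) (hu : u ∈ W) (uz : u ≠ z) (uy : G.Adj u y)
    (ut : G.Adj u t) (ux : G.Adj u x) : False := by
  have n6 : u ≠ x := ux.ne
  have tz' : t ≠ z := h.tz.ne
  classical
  have hd := h.deg t h.mt tz' (fun e => h.bt (e ▸ h.tq.b1)) (fun e => h.bt (e ▸ h.tq.b2))
    {x, y, z, u} ?_
  · have h5 := (h.std t h.mt tz').2 h.bt
    have := Finset.card_le_four (a := x) (b := y) (c := z) (d := u)
    omega
  intro s hs hts
  by_contra hno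
  simp only [Finset.mem_insert, Finset.mem_singleton, not_or] at hno
  obtain ⟨sx, sy, sz, su⟩ := hno
  have hs' : s ∈ W \ {x, y, z, t, u} := by
    refine ⟨hs, ?_⟩
    rintro (e | e | e | e | e); exacts [sx e, sy e, sz e, hts.ne' e, su e]
  obtain ⟨C, hC⟩ : ∃ C, C = comp G (W \ {x, y, z, t, u}) s := ⟨_, rfl⟩
  have sC : ∀ v ∈ C, v ∈ W ∧ v ≠ x ∧ v ≠ y ∧ v ≠ z ∧ v ≠ t ∧ v ≠ u := by
    intro v hv
    rw [hC] at hv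
    have := comp_sub hv
    exact ⟨this.1, by simpa using this.2⟩
  have nC : C.Nonempty := hC ▸ comp_nonempty hs'
  have cC : Conn G C := hC ▸ comp_conn
  have cl : Clo G (W \ {x, y, z, t, u}) C := hC ▸ clo_comp
  have at' : Adjs G {t} C := ⟨t, rfl, s, hC ▸ mem_comp hs', hts⟩
  have az : ¬ Adjs G {z} C := by
    rintro ⟨_, rfl, v, hv, ha⟩
    obtain ⟨m0, m1, m2, m3, m4, m5⟩ := sC v hv
    rcases h.nz m0 ha with e | e | e
    exacts [m1 e, m2 e, m4 e]
  have key : ∀ D : Set α, C ⊆ D → Conn G D → (∀ v ∈ D, v ∈ A ∨ v ∈ C) → Adjs G {x} D →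
      Adjs G {y} D → False := by
    intro D hCD cD hD hx hy
    have hn : ∀ v ∈ D, v ≠ x ∧ v ≠ y ∧ v ≠ z ∧ v ≠ t ∧ v ≠ u := by
      intro v hv
      rcases hD v hv with hv | hv
      · have := h.ctx.disj v hv
        refine ⟨?_, ?_, ?_, ?_, ?_⟩ <;> rintro rfl
        exacts [this h.nx.1, this h.ny.1, this h.hz, this h.mt, this hu]
      · exact (sC v hv).2
    refine k33a (a := x) (b := y) (c := z) (d := u) (D := {t}) (C := D) h.ctx.nm
      (singleton_nonempty _) (nC.mono hCD) conn_single cD h.xny uz.symm h.nx.2.2.ne' n6.symm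
      h.ny.2.2.ne' uy.ne' ?_ ?_ h.nx.2.2.symm ux.symm hx h.ny.2.2.symm uy.symm hy (adjs_s h.tz)
      (adjs_s ut.symm) (at'.mono subset_rfl hCD)
    · rintro v rfl
      exact ⟨h.tx.ne, h.ty.ne, tz', ut.ne', fun h' => (hn _ h').2.2.2.1 rfl⟩
    · intro v hv
      obtain ⟨m1, m2, m3, m4, m5⟩ := hn v hv
      exact ⟨m1, m2, m3, m5⟩
  by_cases hb : ∃ q ∈ C, Bd G A q
  · obtain ⟨q, hq, bq⟩ := hb
    refine key (A ∪ C) (fun _ h => .inr h) (conn_union h.ctx.conn cC (bq.adjs hq)) (fun _ h => h)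
      ((h.nx.2.1.adjs (mem_singleton _)).symm.mono subset_rfl fun _ h => .inl h)
      ((h.ny.2.1.adjs (mem_singleton _)).symm.mono subset_rfl fun _ h => .inl h)
  · push Not at hb
    by_cases hx : Adjs G {x} C
    · by_cases hy : Adjs G {y} C
      · exact key C subset_rfl cC (fun _ h => .inr h) hx hy
      · refine h.noTri x t u C h.nx.1 h.mt hu h.tx.symm ux.symm ut.symm (clo_less cl ?_ ?_) hb nC
        · rintro v (e | e | e) <;> simp [e]
        · rintro w - (rfl | rfl | rfl | rfl | rfl) hn
          exacts [(hn (by simp)).elim, hy, az, (hn (by simp)).elim, (hn (by simp)).elim]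
    · refine h.noTri y t u C h.ny.1 h.mt hu h.ty.symm uy.symm ut.symm (clo_less cl ?_ ?_) hb nC
      · rintro v (e | e | e) <;> simp [e]
      · rintro w - (rfl | rfl | rfl | rfl | rfl) hn
        exacts [hx, (hn (by simp)).elim, az, (hn (by simp)).elim, (hn (by simp)).elim]

lemma DT.n_y (h : DT G A W L q1 q2 z x y c t X0 Y0) (hu : u ∈ W) (uz : u ≠ z) (bu : Bd G A u)
    (uy : G.Adj u y) (ut : G.Adj u t) (hs : s ∈ W) (hys : G.Adj y s) :
    s = z ∨ s = t ∨ s = u := by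
  by_contra hno
  have hs' : s ∈ W \ {y, z, t, u} := by
    refine ⟨hs, ?_⟩
    rintro (e | e); exacts [hys.ne' e, hno e]
  obtain ⟨C, hC⟩ : ∃ C, C = comp G (W \ {y, z, t, u}) s := ⟨_, rfl⟩
  have sC : ∀ v ∈ C, v ∈ W ∧ v ≠ y ∧ v ≠ z ∧ v ≠ t ∧ v ≠ u := by
    intro v hv
    rw [hC] at hv
    have := comp_sub hv
    exact ⟨this.1, by simpa using this.2⟩
  have nC : C.Nonempty := hC ▸ comp_nonempty hs'
  have cC : Conn G C := hC ▸ comp_conn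
  have cl : Clo G (W \ {y, z, t, u}) C := hC ▸ clo_comp
  have ay : Adjs G {y} C := ⟨y, rfl, s, hC ▸ mem_comp hs', hys⟩
  have az : x ∉ C → ¬ Adjs G {z} C := by
    rintro hx ⟨_, rfl, v, hv, ha⟩
    obtain ⟨m0, m1, m2, m3, m4⟩ := sC v hv
    rcases h.nz m0 ha with rfl | e | e
    exacts [hx hv, m1 e, m3 e]
  by_cases ht : Adjs G {t} C
  · by_cases hb : ∃ q ∈ C, Bd G A q
    · obtain ⟨q, hq, bq⟩ := hb
      refine k33a (a := y) (b := t) (c := z) (d := u) h.ctx.nm h.ctx.ne nC h.ctx.conn cC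
        h.ty.ne' uz.symm h.ny.2.2.ne' uy.ne' h.tz.ne ut.ne' ?_ ?_ h.ny.2.2.symm uy.symm ay h.tz
        ut.symm ht (h.bz.adjs rfl) (bu.adjs rfl) (bq.adjs hq)
      · intro v hv
        have := h.ctx.disj v hv
        refine ⟨?_, ?_, ?_, ?_, fun hc => this (sC v hc).1⟩ <;> rintro rfl
        exacts [this h.ny.1, this h.mt, this h.hz, this hu]
      · intro v hv
        obtain ⟨m0, m1, m2, m3, m4⟩ := sC v hv
        exact ⟨m1, m3, m2, m4⟩
    · push Not at hb
      refine h.noTri y t u C h.ny.1 h.mt hu h.ty.symm uy.symm ut.symm (clo_less cl ?_ ?_) hb nC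
      · rintro v (e | e | e) <;> simp [e]
      · rintro w - (rfl | rfl | rfl | rfl) hn
        exacts [(hn (by simp)).elim, az fun hx => hb _ hx h.nx.2.1, (hn (by simp)).elim,
          (hn (by simp)).elim]
  · refine h.hS ⟨y, u, C, ⟨h.ny.1, hu, h.ny.2.1, bu, uy.symm⟩, clo_less cl ?_ ?_, nC, z,
        ⟨h.hz, ?_⟩, fun e => (sC _ e).2.2.1 rfl⟩
    · rintro v (e | e) <;> simp [e]
    · rintro w - (rfl | rfl | rfl | rfl) hn
      exacts [(hn (by simp)).elim, az fun hx => ht ⟨_, rfl, _, hx, h.tx⟩, ht, (hn (by simp)).elim]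
    · rintro (e | e); exacts [h.ny.2.2.ne e, uz e.symm]

lemma DT.side (h : DT G A W L q1 q2 z x y c t X0 Y0) (hM : ∀ W', W' ⊂ W → MP G W')
    (hx1 : x ≠ q1) (hx2 : x ≠ q2) :
    Conf4 (Sq G W L q1 q2) ∨ ∃ u d, Nb G A W y u ∧ G.Adj u t ∧ u ≠ z ∧ ¬ G.Adj u x ∧ d ∉ Y0 ∧
      L u = Y0 ∪ {d} ∧ ∀ s ∈ W, G.Adj y s → s = z ∨ s = t ∨ s = u := by
  classical
  obtain ⟨L1, hL1⟩ : ∃ L1, L1 = update (update (rmI G A x X0 L) y Y0) t Y0 :=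
    ⟨_, rfl⟩
  have L1t : L1 t = Y0 := by simp [hL1]
  have L1y : L1 y = Y0 := by rw [hL1, update_of_ne h.ty.ne']; simp
  have L1o : ∀ v, v ≠ y → v ≠ t → L1 v = rmI G A x X0 L v := fun v h1 h2 => by
    rw [hL1, update_of_ne h2, update_of_ne h1]
  have zx := h.nx.2.2.ne
  have hR : ∀ r ∈ ({z, x} : Set α), Bd G A r := by
    rintro r (rfl | rfl); exacts [h.bz, h.nx.2.1]
  have tW : t ∈ W \ {z, x} := ⟨h.mt, by rintro (e | e); exacts [h.tz.ne e, h.tx.ne e]⟩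
  have yW : y ∈ W \ {z, x} := ⟨h.ny.1, by rintro (e | e); exacts [h.ny.2.2.ne' e, h.xny e.symm]⟩
  have sub1 : ∀ v, L1 v ⊆ L v := by
    intro v
    by_cases h1 : v = t
    · rw [h1, L1t, h.lt]; intro a ha; simp [ha]
    by_cases h2 : v = y
    · rw [h2, L1y]; exact h.ly
    · rw [L1o v h2 h1]; exact rmI_sub _
  have hstd : Std G (A ∪ {z, x}) (W \ {z, x}) L1 {y, t} := by
    intro v hv hvn
    have h1 : v ≠ y := fun e => hvn (.inl e)
    have h2 : v ≠ t := fun e => hvn (.inr e)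
    rw [L1o v h1 h2]
    have := h.std.rmI x X0 h.x2.le v ⟨hv.1, fun e => hv.2 (.inr e)⟩ (fun e => hv.2 (.inl e))
    refine ⟨this.1, fun hb => this.2 fun hb' => hb (hb'.mono ?_)⟩
    rintro r (rfl | hr)
    exacts [.inr (.inr rfl), .inl hr]
  rcases hM (W \ {z, x}) (sdiff_ssub (by rintro v (rfl | rfl); exacts [h.hz, h.nx.1])
    ⟨z, by simp⟩) (A ∪ {z, x}) ∅ L1 y t q1 q2 Y0 (h.ctx.delS hR)
    (h.tq.delS (by rintro (e | e); exacts [h.z1 e.symm, hx1 e.symm])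
      (by rintro (e | e); exacts [h.z2 e.symm, hx2 e.symm]))
    ⟨yW, tW, h.ny.2.1.insS, ⟨z, by simp, h.tz.symm⟩, h.ty.symm⟩ L1y L1t h.y2 hstd
    (fun v hv => hv.elim) with hr | ⟨hr, -⟩
  · refine .inl (hr.mono (sq_mono fun φ hφ => ?_))
    have ty := hφ.1 t tW
    have yy := hφ.1 y yW
    rw [L1t] at ty
    rw [L1y] at yy
    have nz : Nb G A W x z := ⟨h.hz, h.bz, h.nx.2.2.symm⟩
    obtain ⟨a, ha, hN⟩ := pick_col (h.h3 h.nx.1 h.nx.2.1) nz h.x2 φ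
    obtain ⟨ψ, g1, g2, g3, g4⟩ := h.ext (L' := L1) (φ := φ) (a := a) (b := φ y)
      (hφ.mono fun v hv => ⟨hv.1, by
        rintro (e | e); exacts [hv.2 (.inl e), hv.2 (.inr (.inl e))]⟩) (fun v _ => sub1 v) ha yy
      (fun e => h.cy (e ▸ ty)) (fun u hu hxu huz => by
        by_cases bu : Bd G A u
        · exact hN u ⟨hu, bu, hxu⟩ huz
        · have uy : u ≠ y := fun e => bu (e ▸ h.ny.2.1)
          have uW : u ∈ W \ {z, x} := ⟨hu, by rintro (e | e); exacts [huz e, hxu.ne' e]⟩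
          have := hφ.1 u uW
          by_cases ut : u = t
          · subst ut; rintro rfl; exact Finset.disjoint_left.1 h.dj ha ty
          · rw [L1o u uy ut, rmI_adj _ hxu bu] at this
            rintro rfl; exact (Finset.mem_sdiff.1 this).2 ha)
      (fun u hu hyu huz => by
        have ux : u ≠ x := fun e => h.xy (e ▸ hyu.symm)
        exact hφ.2 u ⟨hu, by rintro (e | e); exacts [huz e, ux e]⟩ y yW hyu.symm)
    refine ⟨ψ, g1, ?_, ?_⟩
    · by_cases e : q1 = y
      · rw [e, g3]
      · exact g4 _ h.z1.symm hx1.symm e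
    · by_cases e : q2 = y
      · rw [e, g3]
      · exact g4 _ h.z2.symm hx2.symm e
  · right
    rcases hr.dem_inv with (⟨e, e'⟩ | ⟨e, e'⟩) | ⟨u, d, hu, uy, ut, hd, lu⟩
    · exact (h.bt (e' ▸ h.tq.b2)).elim
    · exact (h.bt (e ▸ h.tq.b1)).elim
    have uz : u ≠ z := fun e => hu.2 (.inl e)
    have ux : ¬ G.Adj u x := fun ux => h.nt hu.1 uz uy ut ux
    rw [L1o u uy.ne ut.ne, rmI_nadj _ fun e => ux e.symm] at lu
    have bu : Bd G A u := bd_of_card3 h.std hu.1 uz (by rw [lu, card3 h.y2 hd])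
    exact ⟨u, d, ⟨hu.1, bu, uy.symm⟩, ut, uz, ux, hd, lu, fun s hs hys =>
      h.n_y hu.1 uz bu uy ut hs hys⟩

lemma DT.finY (h : DT G A W L y u z x y c t X0 Y0) (hE : ∀ W', W' ⊂ W → EP G W')
    (nu : Nb G A W y u) (ut : G.Adj u t) (uz : u ≠ z) (hd : d ∉ Y0)
    (lu : L u = Y0 ∪ {d}) (hN : ∀ s ∈ W, G.Adj y s → s = z ∨ s = t ∨ s = u) :
    Conf4 (Sq G W L y u) := by
  classical
  have ux : u ≠ x := fun e => h.xy (e ▸ nu.2.2.symm)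
  have hR : ∀ r ∈ ({z, y} : Set α), Bd G A r := by
    rintro r (rfl | rfl); exacts [h.bz, h.ny.2.1]
  have tW : t ∈ W \ {z, y} := ⟨h.mt, by rintro (e | e); exacts [h.tz.ne e, h.ty.ne e]⟩
  have xW : x ∈ W \ {z, y} := ⟨h.nx.1, by rintro (e | e); exacts [h.nx.2.2.ne' e, h.xny e]⟩
  have uW : u ∈ W \ {z, y} := ⟨nu.1, by rintro (e | e); exacts [uz e, nu.2.2.ne' e]⟩
  have bt : Bd G (A ∪ {z, y}) t := ⟨z, by simp, h.tz.symm⟩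
  -- the first pair
  have p1 : ∃ a ∈ Y0, ∃ a' ∈ Y0, a ≠ a' ∧ (a', a) ∈ Sq G W L y u := by
    obtain ⟨L1, hL1⟩ : ∃ L1, L1 = update (update L x X0) t X0 := ⟨_, rfl⟩
    have L1t : L1 t = X0 := by simp [hL1]
    have L1x : L1 x = X0 := by rw [hL1, update_of_ne h.tx.ne']; simp
    have L1o : ∀ v, v ≠ x → v ≠ t → L1 v = L v := fun v h1 h2 => by
      rw [hL1, update_of_ne h2, update_of_ne h1]
    have sub1 : ∀ v, L1 v ⊆ L v := by
      intro v
      by_cases h1 : v = t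
      · rw [h1, L1t, h.lt]; intro a ha; simp [ha]
      by_cases h2 : v = x
      · rw [h2, L1x]; exact h.lx
      · rw [L1o v h2 h1]
    obtain ⟨τ, hτ, a, b, hab, ha, hb⟩ := hE (W \ {z, y})
      (sdiff_ssub (by rintro v (rfl | rfl); exacts [h.hz, h.ny.1]) ⟨z, by simp⟩) (A ∪ {z, y}) L1
      x t u X0 X0 (h.ctx.delS hR) ⟨xW, tW, h.nx.2.1.insS, bt, h.tx.symm⟩
      ⟨uW, tW, nu.2.1.insS, bt, ut⟩ ux ⟨h.x2, .inl rfl⟩ L1x (by rw [L1t]; simp)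
      (by rw [L1o u ux ut.ne, lu]; exact nsub_disj h.dj h.x2) (by
        intro v hv hvn
        rw [L1o v (fun e => hvn (.inl e)) (fun e => hvn (.inr e))]
        have := h.std v hv.1 (fun e => hv.2 (.inl e))
        exact ⟨this.1, fun hb => this.2 fun hb' => hb hb'.insS⟩)
    have go : ∀ a ∈ Y0, (a, τ) ∈ Sq G (W \ {z, y}) L1 u t →
        ∃ a ∈ Y0, ∃ a' ∈ Y0, a ≠ a' ∧ (a', a) ∈ Sq G W L y u := by
      rintro a haY ⟨φ, hφ, e1, e2⟩
      obtain ⟨a', ha', haa⟩ := Finset.exists_mem_ne (by have := h.y2; omega : 1 < Y0.card) a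
      refine ⟨a, haY, a', ha', haa.symm, ?_⟩
      have xx := hφ.1 x xW
      rw [L1x] at xx
      simp only at e1 e2
      obtain ⟨ψ, g1, g2, g3, g4⟩ := h.ext (L' := L1) (φ := φ) (a := φ x) (b := a')
        (hφ.mono fun v hv => ⟨hv.1, by
          rintro (e | e); exacts [hv.2 (.inl e), hv.2 (.inr (.inr e))]⟩) (fun v _ => sub1 v) xx
          ha' (fun e => h.cx (by rw [← e, e2]; exact hτ)) (fun s hs hxs hsz =>
            hφ.2 s ⟨hs, by
              rintro (e | e); exacts [hsz e, h.xy (e ▸ hxs)]⟩ x xW hxs.symm)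
          (fun s hs hys hsz => by
            rcases hN s hs hys with rfl | rfl | rfl
            · exact (hsz rfl).elim
            · rw [e2]; rintro rfl; exact Finset.disjoint_left.1 h.dj hτ ha'
            · rw [e1]; exact haa.symm)
      exact ⟨ψ, g1, g3, by rw [g4 u uz ux nu.2.2.ne']; exact e1⟩
    have mem : ∀ a, (a, τ) ∈ Sq G (W \ {z, y}) L1 u t → a ∈ Y0 ∨ a = d := by
      rintro a ⟨φ, hφ, e1, -⟩
      have := hφ.1 u uW
      rw [L1o u ux ut.ne, lu, e1] at this
      rw [Finset.mem_union, Finset.mem_singleton] at this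
      exact this
    rcases mem a ha with h1 | h1
    · exact go a h1 ha
    rcases mem b hb with h2 | h2
    · exact go b h2 hb
    · exact (hab (h1.trans h2.symm)).elim
  have p2 : ∀ γ ∈ Y0, (γ, d) ∈ Sq G W L y u := by
    intro γ hγ
    obtain ⟨δ, hδ, hne⟩ := Finset.exists_mem_ne (by have := h.y2; omega : 1 < Y0.card) γ
    have hR' : ∀ r ∈ ({z, x, y} : Set α), Bd G A r := by
      rintro r (rfl | rfl | rfl); exacts [h.bz, h.nx.2.1, h.ny.2.1]
    have tW' : t ∈ W \ {z, x, y} :=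
      ⟨h.mt, by rintro (e | e | e); exacts [h.tz.ne e, h.tx.ne e, h.ty.ne e]⟩
    have uW' : u ∈ W \ {z, x, y} := ⟨nu.1, by rintro (e | e | e); exacts [uz e, ux e, nu.2.2.ne' e]⟩
    obtain ⟨φ, hφ, e1, e2⟩ := th2 (c1 := δ) (c2 := d) (L := rmI G A x X0 L) (h.ctx.delS hR') tW' uW'
      (⟨z, by simp, h.tz.symm⟩) nu.2.1.insS ut.symm (by
        intro v hv hvn
        have := h.std.rmI x X0 h.x2.le v ⟨hv.1, fun e => hv.2 (.inr (.inl e))⟩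
          (fun e => hv.2 (.inl e))
        refine ⟨this.1, fun hb => this.2 fun hb' => hb (hb'.mono ?_)⟩
        rintro r (rfl | hr)
        exacts [.inr (.inr (.inl rfl)), .inl hr])
      (by
        rw [rmI_adj _ h.tx.symm h.bt, h.lt, Finset.mem_sdiff]
        exact ⟨by simp [hδ], fun e => Finset.disjoint_left.1 h.dj e hδ⟩)
      (by rw [rmI_bd _ nu.2.1, lu]; simp) (by rintro rfl; exact hd hδ)
    have nz : Nb G A W x z := ⟨h.hz, h.bz, h.nx.2.2.symm⟩
    obtain ⟨a, ha, hNx⟩ := pick_col (h.h3 h.nx.1 h.nx.2.1) nz h.x2 φ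
    obtain ⟨ψ, g1, g2, g3, g4⟩ := h.ext hφ (fun v _ => rmI_sub _) ha hγ
      (by rw [e1]; rintro rfl; exact h.cy hδ)
      (fun s hs hxs hsz => by
        by_cases bs : Bd G A s
        · exact hNx s ⟨hs, bs, hxs⟩ hsz
        · have := hφ.1 s ⟨hs, by
            rintro (e | e | e); exacts [hsz e, hxs.ne' e, h.xy (e ▸ hxs)]⟩
          rw [rmI_adj _ hxs bs] at this
          rintro rfl; exact (Finset.mem_sdiff.1 this).2 ha)
      (fun s hs hys hsz => by
        rcases hN s hs hys with rfl | rfl | rfl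
        · exact (hsz rfl).elim
        · rw [e1]; exact hne
        · rw [e2]; rintro rfl; exact hd hγ)
    exact ⟨ψ, g1, g3, by rw [g4 u uz ux nu.2.2.ne']; exact e2⟩
  obtain ⟨a, ha, a', ha', hne, hs⟩ := p1
  exact conf_L (p2 a' ha') hs (p2 a ha) hne.symm (by rintro rfl; exact hd ha)

lemma DH.conf (h : DH G A W L q1 q2 z x y c) (hD : ∀ W', W' ⊂ W → DP G W')
    (hM : ∀ W', W' ⊂ W → MP G W') (hE : ∀ W', W' ⊂ W → EP G W') (hW : ∀ W', W' ⊂ W → WP G W')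
    (hx1 : x ≠ q1) (hx2 : x ≠ q2) : Conf4 (Sq G W L q1 q2) := by
  classical
  obtain ⟨α', m1, β, m2, hab, n1, n2⟩ := pick2ne (L x) (h.std x h.nx.1 h.nx.2.2.ne').1 c
  rcases h.first hD hx1 hx2 (X0 := {α', β}) (Finset.card_pair hab) (by
    intro e he; simp only [Finset.mem_insert, Finset.mem_singleton] at he
    rcases he with rfl | rfl <;> assumption) (by
    simp only [Finset.mem_insert, Finset.mem_singleton]
    rintro (rfl | rfl); exacts [n1 rfl, n2 rfl]) with hc | ⟨t, Y0, hly, T⟩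
  · exact hc
  generalize ({α', β} : Finset ℕ) = X0 at T
  rcases T.side hM hx1 hx2 with hc | ⟨u', d', nu', ut', uz', ux', hd', lu', hN'⟩
  · exact hc
  by_cases hy1 : y = q1
  · have : q2 = u' := by
      rcases hN' q2 h.tq.m2 (hy1 ▸ h.tq.adj) with e | e | e
      exacts [(h.z2 e.symm).elim, (T.bt (e ▸ h.tq.b2)).elim, e]
    subst hy1 this
    exact T.finY hE nu' ut' uz' hd' lu' hN'
  by_cases hy2 : y = q2
  · have : q1 = u' := by
      rcases hN' q1 h.tq.m1 (hy2 ▸ h.tq.adj.symm) with e | e | e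
      exacts [(h.z1 e.symm).elim, (T.bt (e ▸ h.tq.b1)).elim, e]
    subst hy2 this
    apply conf_sq_swap
    have h' : DH G A W L y q1 z x y c :=
      { h with tq := h.tq.symm, z1 := h.z2, z2 := h.z1,
               deg := fun v m a b c => h.deg v m a c b }
    exact DT.finY { T with toDH := h' } hE nu' ut' uz' hd' lu' hN'
  rcases T.swap.side hM hy1 hy2 with hc | ⟨u, d, nu, ut, uz, uy, hd, lu, hN⟩
  · exact hc
  have uu : u ≠ u' := fun e => uy (e ▸ nu'.2.2.symm)
  have u'x : u' ≠ x := fun e => h.xy (e ▸ nu'.2.2.symm)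
  have u_y : u ≠ y := fun e => h.xy (e ▸ nu.2.2)
  have hR' : ∀ r ∈ ({z, x, y} : Set α), Bd G A r := by
    rintro r (rfl | rfl | rfl); exacts [h.bz, h.nx.2.1, h.ny.2.1]
  have tW : t ∈ W \ {z, x, y} :=
    ⟨T.mt, by rintro (e | e | e); exacts [T.tz.ne e, T.tx.ne e, T.ty.ne e]⟩
  have uW' : u' ∈ W \ {z, x, y} :=
    ⟨nu'.1, by rintro (e | e | e); exacts [uz' e, u'x e, nu'.2.2.ne' e]⟩
  have uW : u ∈ W \ {z, x, y} :=
    ⟨nu.1, by rintro (e | e | e); exacts [uz e, nu.2.2.ne' e, u_y e]⟩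
  have bt : Bd G (A ∪ {z, x, y}) t := ⟨z, by simp, T.tz.symm⟩
  obtain ⟨L1, hL1⟩ : ∃ L1, L1 = update L t (X0 ∪ Y0) := ⟨_, rfl⟩
  have L1t : L1 t = X0 ∪ Y0 := by simp [hL1]
  have L1o : ∀ v, v ≠ t → L1 v = L v := fun v h2 => by rw [hL1, update_of_ne h2]
  have sub1 : ∀ v, L1 v ⊆ L v := by
    intro v
    by_cases h1 : v = t
    · rw [h1, L1t, T.lt]; exact Finset.subset_union_left
    · rw [L1o v h1]
  refine (hW (W \ {z, x, y})
      (sdiff_ssub (by rintro v (rfl | rfl | rfl); exacts [h.hz, h.nx.1, h.ny.1]) ⟨z, by simp⟩)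
      (A ∪ {z, x, y}) L1 q1 q2 u t u' X0 {d} Y0 {d'} d d' ⟨h.ctx.delS hR', h.tq.delS ?_ ?_,
      ⟨uW, tW, nu.2.1.insS, bt, ut⟩, ⟨uW', tW, nu'.2.1.insS, bt, ut'⟩, uu, ⟨T.x2, .inr ⟨d, hd, rfl⟩⟩,
      ⟨T.y2, .inr ⟨d', hd', rfl⟩⟩, T.dj, by rw [L1o u ut.ne, lu], by rw [L1o u' ut'.ne, lu'], L1t,
      hd, hd', Finset.subset_union_right, Finset.subset_union_right, ?_⟩).mono ?_
  · rintro (e | e | e); exacts [h.z1 e.symm, hx1 e.symm, hy1 e.symm]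
  · rintro (e | e | e); exacts [h.z2 e.symm, hx2 e.symm, hy2 e.symm]
  · intro v hv _
    by_cases e : v = t
    · subst e
      rw [L1t, Finset.card_union_of_disjoint T.dj, T.x2, T.y2]
      exact ⟨by omega, fun hb => (hb bt).elim⟩
    · rw [L1o v e]
      have := h.std v hv.1 (fun e => hv.2 (.inl e))
      exact ⟨this.1, fun hb => this.2 fun hb' => hb hb'.insS⟩
  · rintro p ⟨φ, hφ, ⟨f1, f2⟩, f3, f4⟩
    have ht := hφ.1 t tW
    rw [L1t] at ht
    have col : ∀ (Z0 : Finset ℕ) (v : α) (dd : ℕ), Z0.card = 2 → dd ∉ Z0 →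
        (φ t ∈ Z0 → φ v ∈ ({dd} : Finset ℕ)) → ∃ a ∈ Z0, φ t ≠ a ∧ φ v ≠ a := by
      intro Z0 v dd h2 hdd hh
      by_cases hm : φ t ∈ Z0
      · obtain ⟨a, ha, hne⟩ := Finset.exists_mem_ne (by omega : 1 < Z0.card) (φ t)
        refine ⟨a, ha, hne.symm, ?_⟩
        rw [Finset.mem_singleton.1 (hh hm)]; rintro rfl; exact hdd ha
      · obtain ⟨a, ha, hne⟩ := Finset.exists_mem_ne (by omega : 1 < Z0.card) (φ v)
        exact ⟨a, ha, by rintro rfl; exact hm ha, hne.symm⟩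
    obtain ⟨a, ha, a1, a2⟩ := col X0 u d T.x2 hd f1
    obtain ⟨b, hb, b1, b2⟩ := col Y0 u' d' T.y2 hd' f2
    obtain ⟨ψ, g1, -, -, g4⟩ := T.ext hφ (fun v _ => sub1 v) ha hb (by
      intro e
      rcases Finset.mem_union.1 ht with e' | e'
      exacts [T.cx (e ▸ e'), T.cy (e ▸ e')])
      (fun s hs hxs hsz => by
        rcases hN s hs hxs with rfl | rfl | rfl
        exacts [(hsz rfl).elim, a1, a2])
      (fun s hs hys hsz => by
        rcases hN' s hs hys with rfl | rfl | rfl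
        exacts [(hsz rfl).elim, b1, b2])
    exact ⟨ψ, g1, (g4 _ h.z1.symm hx1.symm (Ne.symm hy1)).trans f3,
      (g4 _ h.z2.symm hx2.symm (Ne.symm hy2)).trans f4⟩

lemma gov_end (ctx : Ctx G A W) (tq : Tg G A W q1 q2) (lz : L q1 = {c})
    (hs : Std G A W L {q1}) : Gov2 (Sq G W L q1 q2) := by
  obtain ⟨a, ha, b, hb, hab, hac, hbc⟩ := pick2ne (L q2) (hs q2 tq.m2 (tq.adj.ne')).1 c
  have hs' : Std G A W L {q1, q2} := hs.mono (by simp)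
  obtain ⟨φ, f1, f2, f3⟩ := th2 ctx tq.m1 tq.m2 tq.b1 tq.b2 tq.adj hs' (c1 := c) (c2 := a)
    (by simp [lz]) ha hac.symm
  obtain ⟨ψ, g1, g2, g3⟩ := th2 ctx tq.m1 tq.m2 tq.b1 tq.b2 tq.adj hs' (c1 := c) (c2 := b)
    (by simp [lz]) hb hbc.symm
  exact ⟨(c, a), ⟨φ, f1, f2, f3⟩, (c, b), ⟨ψ, g1, g2, g3⟩, by simp [hab], .inl rfl⟩

lemma d_far (hD : ∀ W', W' ⊂ W → DP G W') (hM : ∀ W', W' ⊂ W → MP G W')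
    (hC : ∀ W', W' ⊂ W → CP G W') (hE : ∀ W', W' ⊂ W → EP G W') (hW : ∀ W', W' ⊂ W → WP G W')
    (ctx : Ctx G A W) (tq : Tg G A W q1 q2) (hz : z ∈ W) (bz : Bd G A z) (lz : L z = {c})
    (hs : Std G A W L {z}) (z1 : z ≠ q1) (z2 : z ≠ q2) (nx : Nb G A W z x) (ny : Nb G A W z y)
    (xny : x ≠ y) (xy : ¬ G.Adj x y) (only : ∀ u, Nb G A W z u → u = x ∨ u = y) :
    Conf4 (Sq G W L q1 q2) := by
  have sm : ∀ W' u v, W' ⊂ W → z ∈ W' → Tg G A W' u v → z ≠ u → z ≠ v →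
      Conf4 (Sq G W' L u v) := by
    intro W' u v hW' hzW tu zu zv
    rcases hD W' hW' A ∅ L z u v c (ctx.sub hW'.1) tu hzW bz lz (hs.sub hW'.1)
      (fun v hv => hv.elim) with r | ⟨r, -⟩
    · exact r
    rcases r.dict_inv with (e | e) | ⟨u1, u2, L0, m1, m2, a1, a2, a12, h0, hc, e1, e2⟩
    · exact (zu e).elim
    · exact (zv e).elim
    have n1 : Nb G A W z u1 := ⟨hW'.1 m1, bd_of_card3 hs (hW'.1 m1) a1.ne' (by
      rw [e1, card3 h0 hc]), a1⟩
    have n2 : Nb G A W z u2 := ⟨hW'.1 m2, bd_of_card3 hs (hW'.1 m2) a2.ne' (by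
      rw [e2, card3 h0 hc]), a2⟩
    rcases only _ n1 with rfl | rfl <;> rcases only _ n2 with rfl | rfl
    · exact (G.irrefl a12).elim
    · exact (xy a12).elim
    · exact (xy a12.symm).elim
    · exact (G.irrefl a12).elim
  have dr : ∀ u v K', Tg G A W u v → Clo G (W \ {u, v}) K' → K'.Nonempty → z ∉ K' →
      q1 ∉ K' → q2 ∉ K' → Conf4 (Sq G W L q1 q2) := by
    intro u v K' tu hK' hne m1 m3 m4
    refine (sm (W \ K') q1 q2 (sdiff_ssub (clo_sub hK') hne) ⟨hz, m1⟩
      (tq.sub ⟨tq.m1, m3⟩ ⟨tq.m2, m4⟩) z1 z2).mono (sq_mono fun φ hφ => ?_)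
    obtain ⟨ψ, g1, g2⟩ := drop ctx hs tu.m1 tu.m2 tu.b1 tu.b2 tu.adj hK' (by
      rintro k hk rfl; exact m1 hk) hφ
    exact ⟨ψ, g1, g2 _ tq.m1 m3, g2 _ tq.m2 m4⟩
  by_cases hS : Spl G A W
  · obtain ⟨u, v, K0, tu, hK0, hn0, hr0⟩ := hS
    by_cases hzu : z = u ∨ z = v
    · obtain ⟨K', hK', hn, hr, m3, m4⟩ := hK0.avoid hn0 hr0 (.inr tq.adj)
      exact dr u v K' tu hK' hn (fun h => (hK'.1 h).2 (by
        rcases hzu with rfl | rfl <;> simp)) m3 m4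
    push Not at hzu
    obtain ⟨K', hK', hn, hr, m1, -⟩ := hK0.avoid (p := z) (q := z) hn0 hr0 (.inl rfl)
    have huK : u ∉ K' := fun h => (hK'.1 h).2 (by simp)
    have hvK : v ∉ K' := fun h => (hK'.1 h).2 (by simp)
    by_cases hq : q1 ∈ K' ∨ q2 ∈ K'
    · refine compose (hC _ (clo_union_ssub hK' tu.m1 tu.m2 hr)) ctx tu tq hK' ?_ hq
        (sm _ u v (sdiff_ssub (clo_sub hK') hn) ⟨hz, m1⟩ (tu.sub ⟨tu.m1, huK⟩ ⟨tu.m2, hvK⟩)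
          hzu.1 hzu.2)
      intro x hx _
      refine hs x (clo_sub hK' hx) ?_
      rintro rfl; exact m1 hx
    · push Not at hq
      exact dr u v K' tu hK' hn m1 hq.1 hq.2
  by_contra hno
  have H : DH G A W L q1 q2 z x y c := by
    refine ⟨ctx, tq, nx, ny, hz, bz, xy, xny, only, z1, z2, lz, hs, hS, ?_, ?_⟩
    · intro a b d K' ha hb hd hab had hbd hK' hB hne
      have mz : z ∉ K' := fun h => hB _ h bz
      have m1 : q1 ∉ K' := fun h => hB _ h tq.b1
      have m2 : q2 ∉ K' := fun h => hB _ h tq.b2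
      refine hno ((sm (W \ K') q1 q2 (sdiff_ssub (fun k hk => (hK'.1 hk).1) hne) ⟨hz, mz⟩
        (tq.sub ⟨tq.m1, m1⟩ ⟨tq.m2, m2⟩) z1 z2).mono (sq_mono fun φ hφ => ?_))
      obtain ⟨ψ, g1, g2⟩ := dropTri ctx hs ha hb hd hab had hbd hK' (by
        rintro k hk rfl; exact mz hk) hB hφ
      exact ⟨ψ, g1, g2 _ tq.m1 m1, g2 _ tq.m2 m2⟩
    · intro v hv vz v1 v2 M hM'
      by_contra hlt
      refine hno ((sm (W \ {v}) q1 q2 (ssub_del hv) ⟨hz, vz.symm⟩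
        (tq.sub ⟨tq.m1, v1.symm⟩ ⟨tq.m2, v2.symm⟩) z1 z2).mono (sq_mono fun φ hφ => ?_))
      obtain ⟨ψ, g1, g2⟩ := dropDeg M hM' (not_le.1 hlt) hφ
      exact ⟨ψ, g1, g2 _ v1.symm, g2 _ v2.symm⟩
  by_cases hx : x ≠ q1 ∧ x ≠ q2
  · exact hno (H.conf hD hM hE hW hx.1 hx.2)
  refine hno (H.swap.conf hD hM hE hW ?_ ?_)
  · rintro rfl
    apply hx
    refine ⟨xny, ?_⟩
    rintro rfl
    exact xy tq.adj.symm
  · rintro rfl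
    apply hx
    refine ⟨?_, xny⟩
    rintro rfl
    exact xy tq.adj

lemma stepD (hD : ∀ W', W' ⊂ W → DP G W') (hM : ∀ W', W' ⊂ W → MP G W')
    (hC : ∀ W', W' ⊂ W → CP G W') (hT : ∀ W', W' ⊂ W → TP G W') (hE : ∀ W', W' ⊂ W → EP G W')
    (hW : ∀ W', W' ⊂ W → WP G W') : DP G W := by
  intro A K L z q1 q2 c ctx tq hz bz lz hs hK
  change Res G K q1 q2 L W _
  by_cases z1 : z = q1
  · subst z1
    exact .inr ⟨.d_end _ _ _ _ (.inl rfl) tq.m1 tq.m2, gov_end ctx tq lz hs⟩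
  by_cases z2 : z = q2
  · subst z2
    exact .inr ⟨.d_end _ _ _ _ (.inr rfl) tq.m1 tq.m2, gov_sq_swap (gov_end ctx tq.symm lz hs)⟩
  by_cases h3 : H3 G A W z
  · obtain ⟨m, K0, nm, hK0, hn0, hr0⟩ := tri_split ctx hz bz h3
    obtain ⟨K', hK', hn, hr, m3, m4⟩ := hK0.avoid hn0 hr0 (.inr tq.adj)
    have mz : z ∉ K' := fun h => (hK'.1 h).2 (by simp)
    refine Res.mono (W' := W \ K') (hD _ (sdiff_ssub (clo_sub hK') hn) A K L z q1 q2 c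
      (ctx.sub sdiff_subset) (tq.sub ⟨tq.m1, m3⟩ ⟨tq.m2, m4⟩) ⟨hz, mz⟩ bz lz
      (hs.sub sdiff_subset) (fun v hv hvW => hK v hv hvW.1)) sdiff_subset fun φ hφ => ?_
    obtain ⟨ψ, g1, g2⟩ := drop ctx hs hz nm.1 bz nm.2.1 nm.2.2 hK' (by
      rintro k hk rfl; exact mz hk) hφ
    exact ⟨ψ, g1, g2 _ tq.m1 m3, g2 _ tq.m2 m4⟩
  have ctx1 := ctx.del (v := z) bz
  have tq1 := tq.del (v := z) (Ne.symm z1) (Ne.symm z2)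
  have hsub : W \ {z} ⊂ W := ssub_del hz
  have ext1 : Sq G (W \ {z}) (rmA G z c L) q1 q2 ⊆ Sq G W L q1 q2 := sq_mono fun φ hφ => by
    obtain ⟨ψ, g1, -, g3⟩ := ext_rmA hφ (by simp [lz])
    exact ⟨ψ, g1, g3 _ (Ne.symm z1), g3 _ (Ne.symm z2)⟩
  by_cases h1 : ∃ x, Nb G A W z x
  swap
  · push Not at h1
    exact .inl ((th_allpairs ctx1 tq1 (hs.rmA z c (fun u hu => (h1 u hu).elim) (by simp))).mono
      ext1)
  obtain ⟨x, nx⟩ := h1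
  have xW : x ∈ W \ {z} := ⟨nx.1, nx.2.2.ne'⟩
  have cx : 2 ≤ (L x \ {c}).card :=
    card_sdiff_ge _ _ 2 1 (hs x nx.1 nx.2.2.ne').1 (by simp)
  by_cases h2 : ∃ y, Nb G A W z y ∧ y ≠ x
  swap
  · push Not at h2
    exact .inl ((hT _ hsub _ (rmA G z c L) x q1 q2 ctx1 tq1 xW nx.2.1.ins
      (hs.rmA z c (fun u hu hux => (hux (h2 u hu)).elim) (by simp))
      (by rwa [rmA_adj _ nx.2.2])).mono ext1)
  obtain ⟨y, ny, yx⟩ := h2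
  have only : ∀ u, Nb G A W z u → u = x ∨ u = y := fun u hu => not_H3 h3 nx ny yx.symm hu
  by_cases xy : G.Adj x y
  swap
  · exact .inl (d_far hD hM hC hE hW ctx tq hz bz lz hs z1 z2 nx ny yx.symm xy only)
  have yW : y ∈ W \ {z} := ⟨ny.1, ny.2.2.ne'⟩
  have cy : 2 ≤ (L y \ {c}).card :=
    card_sdiff_ge _ _ 2 1 (hs y ny.1 ny.2.2.ne').1 (by simp)
  have std1 : Std G (insert z A) (W \ {z}) (rmA G z c L) {x, y} :=
    hs.rmA z c (fun u hu hun => (hun (only u hu)).elim) (by simp)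
  have tp1 : Tg G (insert z A) (W \ {z}) x y := ⟨xW, yW, nx.2.1.ins, ny.2.1.ins, xy⟩
  by_cases heq : L x \ {c} = L y \ {c} ∧ (L x \ {c}).card = 2
  · obtain ⟨e, e2⟩ := heq
    have full : ∀ v ∈ W, v ≠ z → L v \ {c} = L x \ {c} → L v = (L x \ {c}) ∪ {c} := by
      intro v hv hvz hh
      have h3 := (hs v hv hvz).1
      have hc : c ∈ L v := by
        by_contra hc
        rw [← hh, Finset.sdiff_eq_self_of_disjoint (Finset.disjoint_singleton_right.2 hc)] at e2
        omega
      rw [← hh]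
      ext t
      simp only [Finset.mem_union, Finset.mem_sdiff, Finset.mem_singleton]
      constructor
      · intro ht
        by_cases e : t = c
        exacts [.inr e, .inl ⟨ht, e⟩]
      · rintro (⟨h, -⟩ | rfl)
        exacts [h, hc]
    rcases hM _ hsub _ K (rmA G z c L) x y q1 q2 (L x \ {c}) ctx1 tq1 tp1 (rmA_adj _ nx.2.2)
      (by rw [rmA_adj _ ny.2.2, e]) e2 std1 (fun v hv hvW => (hK v hv hvW.1).ins) with r | ⟨r, g⟩
    · exact .inl (r.mono ext1)
    refine .inr ⟨.d_tri _ _ (W \ {z}) z x y c (L x \ {c}) xW yW nx.2.2 ny.2.2 xy e2 (by simp)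
      (full x nx.1 nx.2.2.ne' rfl) (full y ny.1 ny.2.2.ne' e.symm) subset_rfl ?_ ?_, g.mono ext1⟩
    · intro v hv hvK hzv
      exact only v ⟨hv.1, hK v hvK hv.1, hzv⟩
    · refine r.congr e2 fun v hv hvn h3' => ?_
      by_cases hzv : G.Adj z v
      · have nb : ¬ Bd G A v := fun hb => hvn (only v ⟨hv.1, hb, hzv⟩)
        have h5 := (hs v hv.1 hv.2).2 nb
        rw [rmA_adj _ hzv] at h3'
        have := card_sdiff_ge _ ({c} : Finset ℕ) 4 1 h5 (by simp)
        omega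
      · rw [rmA_nadj _ hzv]
  · refine .inl ((hC _ hsub _ (rmA G z c L) _ x y q1 q2 ctx1 tq1 tp1 std1
      (F2 _ _ cx cy heq) ?_).mono ?_)
    · rintro p ⟨p1, p2, p3⟩
      rw [rmA_adj _ nx.2.2, rmA_adj _ ny.2.2]
      exact ⟨p1, p2, p3⟩
    · rintro p ⟨φ, hφ, -, f1, f2⟩
      exact ext1 ⟨φ, hφ, f1, f2⟩

/-- everything, for finite vertex sets -/
lemma all_P (W : Set α) (hf : W.Finite) : DP G W ∧ MP G W ∧ CP G W ∧ TP G W ∧ EP G W ∧ WP G W := by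
  refine fin_induction (P := fun W => DP G W ∧ MP G W ∧ CP G W ∧ TP G W ∧ EP G W ∧ WP G W)
    (fun W _ ih => ?_) W hf
  have hD : DP G W := stepD (fun w h => (ih w h).1) (fun w h => (ih w h).2.1)
    (fun w h => (ih w h).2.2.1) (fun w h => (ih w h).2.2.2.1) (fun w h => (ih w h).2.2.2.2.1)
    (fun w h => (ih w h).2.2.2.2.2)
  have hM : MP G W := stepM (fun w h => (ih w h).1) (fun w h => (ih w h).2.1)
    (fun w h => (ih w h).2.2.1) (fun w h => (ih w h).2.2.2.1)
  have hC : CP G W := stepC (fun w h => (ih w h).2.2.1) hD hM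
  have hT : TP G W := stepT hC
  have hD' : ∀ W', W' ⊆ W → DP G W' := fun w h => (eq_or_ssubset_of_subset h).elim
    (fun e => e ▸ hD) fun h => (ih w h).1
  have hM' : ∀ W', W' ⊆ W → MP G W' := fun w h => (eq_or_ssubset_of_subset h).elim
    (fun e => e ▸ hM) fun h => (ih w h).2.1
  have hC' : ∀ W', W' ⊆ W → CP G W' := fun w h => (eq_or_ssubset_of_subset h).elim
    (fun e => e ▸ hC) fun h => (ih w h).2.2.1
  have hE : EP G W := stepE (fun w h => (ih w h).2.2.2.2.1) hD' hM'
  exact ⟨hD, hM, hC, hT, hE, stepW (fun w h => (ih w h).2.2.2.2.2) hD' hM' hC' hE⟩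

end

lemma log_lift {A : Type} [TopologicalSpace A] [SimplyConnectedSpace A]
    [LocallyPathConnectedSpace A] (f : A → ℂ) (hf : Continuous f) (h0 : ∀ a, f a ≠ 0) :
    ∃ l : A → ℂ, Continuous l ∧ ∀ a, Complex.exp (l a) = f a := by
  obtain ⟨a0⟩ : Nonempty A := inferInstance
  obtain ⟨F, ⟨-, h⟩, -⟩ := Complex.isCoveringMapOn_exp.existsUnique_continuousMap_lifts
    (⟨f, hf⟩ : C(A, ℂ)) (a₀ := a0) (e₀ := Complex.log (f a0)) (by simp [Complex.exp_log (h0 a0)])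
    (by simpa using h0)
  exact ⟨F, F.continuous, fun a => congrFun h a⟩

lemma log_diff {A : Type} [TopologicalSpace A] [PreconnectedSpace A] (l l' : A → ℂ)
    (hl : Continuous l) (hl' : Continuous l') (h : ∀ a, Complex.exp (l a) = Complex.exp (l' a))
    (a b : A) : l a - l b = l' a - l' b := by
  have key : ∀ x, ∃ n : ℤ, l x - l' x = n * (2 * Real.pi * Complex.I) := fun x => by
    obtain ⟨n, hn⟩ := Complex.exp_eq_exp_iff_exists_int.1 (h x)
    exact ⟨n, by rw [hn]; ring⟩
  choose n hn using key
  have hc : Continuous fun x => ((n x : ℤ) : ℝ) := by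
    have : (fun x => ((n x : ℤ) : ℝ)) = fun x => ((l x - l' x) / (2 * Real.pi * Complex.I)).re := by
      funext x
      rw [hn x, mul_div_assoc, div_self Complex.two_pi_I_ne_zero]; simp
    rw [this]
    fun_prop
  have hcn : Continuous n := by
    rw [Int.isClosedEmbedding_coe_real.isEmbedding.continuous_iff]
    exact hc
  have := PreconnectedSpace.constant (inferInstance : PreconnectedSpace A) hcn (x := a) (y := b)
  have e1 := hn a
  have e2 := hn b
  rw [this] at e1
  linear_combination e1 - e2

/-- change of logarithm along a curve -/
lemma exists_delta (γ : ℝ → ℂ) (hγ : Continuous γ) (p : ℂ) (hp : ∀ t, γ t ≠ p) :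
    ∃ δ : ℂ, ∀ l : ℝ → ℂ, Continuous l → (∀ t, Complex.exp (l t) = γ t - p) → l 1 - l 0 = δ := by
  obtain ⟨l, hl, h⟩ := log_lift (fun t => γ t - p) (by fun_prop) (fun t => sub_ne_zero.2 (hp t))
  exact ⟨l 1 - l 0, fun l' hl' h' => log_diff l' l hl' hl (fun t => (h' t).trans (h t).symm) 1 0⟩

def ee {n : ℕ} (a b : Fin n) : ℤ := if a < b then 1 else 0

lemma ht_eq {n : ℕ} (E : Fin n → Fin n → Prop) (P : Fin n → ℂ) (γ : Fin n → Fin n → ℝ → ℂ)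
    (hinj : ∀ i j, i ≠ j → P i ≠ P j)
    (hc : ∀ i j, E i j → Continuous (γ i j)) (h0 : ∀ i j, E i j → γ i j 0 = P i)
    (h1 : ∀ i j, E i j → γ i j 1 = P j)
    (hP : ∀ i j u, E i j → u ≠ i → u ≠ j → ∀ t, γ i j t ≠ P u)
    (hd : ∀ a b c d, E a b → E c d → a ≠ c → a ≠ d → b ≠ c → b ≠ d → ∀ s t, γ a b s ≠ γ c d t) :
    ∃ N : Fin n → Fin n → Fin n → ℤ, ∀ a b c d, E a b → E c d → a ≠ c → a ≠ d → b ≠ c → b ≠ d →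
      ee a c + ee b d - ee a d - ee b c + N a c d + N d a b - N c a b - N b c d = 0 := by
  classical
  obtain ⟨l0, hl0⟩ : ∃ l0 : Fin n → Fin n → ℂ, l0 = fun u v =>
    if u < v then Complex.log (P v - P u) else Complex.log (P u - P v) + Real.pi * Complex.I :=
    ⟨_, rfl⟩
  have hl0e : ∀ u v, u ≠ v → Complex.exp (l0 u v) = P v - P u := by
    intro u v huv
    rw [hl0]; dsimp only
    split_ifs
    · rw [Complex.exp_log (sub_ne_zero.2 (hinj v u huv.symm))]
    · rw [Complex.exp_add, Complex.exp_log (sub_ne_zero.2 (hinj u v huv)), Complex.exp_pi_mul_I]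
      ring
  have hl0d : ∀ u v, u ≠ v → l0 v u - l0 u v = Real.pi * Complex.I * (2 * (ee u v : ℂ) - 1) := by
    intro u v huv
    rw [hl0]; dsimp only [ee]
    rcases lt_or_gt_of_ne huv with h | h
    · rw [if_neg h.not_gt, if_pos h]; simp [h]; ring
    · rw [if_neg h.not_gt, if_pos h]; simp [h.not_gt]
  have key : ∀ u i j, ∃ m : ℤ, E i j → u ≠ i → u ≠ j → ∀ l : ℝ → ℂ, Continuous l →
      (∀ t, Complex.exp (l t) = γ i j t - P u) →
      l 1 - l 0 = l0 u j - l0 u i + m * (2 * Real.pi * Complex.I) := by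
    intro u i j
    by_cases h : E i j ∧ u ≠ i ∧ u ≠ j
    · obtain ⟨hE, hi, hj⟩ := h
      obtain ⟨δ, hδ⟩ := exists_delta (γ i j) (hc i j hE) (P u) (hP i j u hE hi hj)
      obtain ⟨l, hl, hle⟩ := log_lift (fun t => γ i j t - P u) (by have := hc i j hE; fun_prop)
        (fun t => sub_ne_zero.2 (hP i j u hE hi hj t))
      have e1 := hδ l hl hle
      have : Complex.exp (l 1 - l 0) = Complex.exp (l0 u j - l0 u i) := by
        rw [Complex.exp_sub, Complex.exp_sub, hle, hle, hl0e u j hj, hl0e u i hi, h0 i j hE,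
          h1 i j hE]
      obtain ⟨m, hm⟩ := Complex.exp_eq_exp_iff_exists_int.1 this
      refine ⟨m, fun _ _ _ l' hl' hle' => ?_⟩
      rw [hδ l' hl' hle', ← e1, hm]
    · exact ⟨0, fun a b c => (h ⟨a, b, c⟩).elim⟩
  choose N hN using key
  refine ⟨N, fun a b c d hab hcd ac ad bc bd => ?_⟩
  obtain ⟨l, hl, hle⟩ := log_lift (fun x : ℝ × ℝ => γ c d x.2 - γ a b x.1)
    (by have := hc a b hab; have := hc c d hcd; fun_prop)
    (fun x => sub_ne_zero.2 (hd a b c d hab hcd ac ad bc bd _ _).symm)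
  have e1 := hN a c d hcd ac ad (fun t => l (0, t)) (by fun_prop) (fun t => by
    rw [hle, h0 a b hab])
  have e2 := hN b c d hcd bc bd (fun t => l (1, t)) (by fun_prop) (fun t => by
    rw [hle, h1 a b hab])
  have e3 := hN c a b hab ac.symm bc.symm (fun t => l (t, 0) + Real.pi * Complex.I) (by fun_prop)
    (fun t => by rw [Complex.exp_add, Complex.exp_pi_mul_I, hle, h0 c d hcd]; ring)
  have e4 := hN d a b hab ad.symm bd.symm (fun t => l (t, 1) + Real.pi * Complex.I) (by fun_prop)
    (fun t => by rw [Complex.exp_add, Complex.exp_pi_mul_I, hle, h1 c d hcd]; ring)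
  have d1 := hl0d a c ac
  have d2 := hl0d a d ad
  have d3 := hl0d b c bc
  have d4 := hl0d b d bd
  have fin : (2 * Real.pi * Complex.I) * ((ee a c + ee b d - ee a d - ee b c + N a c d + N d a b -
      N c a b - N b c d : ℤ) : ℂ) = 0 := by
    push_cast
    linear_combination -e1 - e4 + e2 + e3 - d1 + d2 + d3 - d4
  rcases mul_eq_zero.1 fin with h | h
  · exact (Complex.two_pi_I_ne_zero h).elim
  · exact_mod_cast h

/-- Hanani-Tutte for sets -/
lemma ht_curves {n : ℕ} (E : Fin n → Fin n → Prop) (P : Fin n → ℂ) (S : Fin n → Fin n → Set ℂ)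
    (hj : ∀ i j, E i j → JoinedIn (S i j) (P i) (P j))
    (hd : ∀ a b c d, E a b → E c d → a ≠ c → a ≠ d → b ≠ c → b ≠ d → Disjoint (S a b) (S c d))
    (hE1 : ∀ i j, i ≠ j → ∃ k l, (E i k ∨ E k i) ∧ (E j l ∨ E l j) ∧ i ≠ j ∧ i ≠ l ∧ k ≠ j ∧ k ≠ l)
    (hE2 : ∀ i j u, E i j → u ≠ i → u ≠ j → ∃ v, (E u v ∨ E v u) ∧ v ≠ i ∧ v ≠ j) :
    ∃ N : Fin n → Fin n → Fin n → ℤ, ∀ a b c d, E a b → E c d → a ≠ c → a ≠ d → b ≠ c → b ≠ d →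
      ee a c + ee b d - ee a d - ee b c + N a c d + N d a b - N c a b - N b c d = 0 := by
  classical
  have key : ∀ i j, ∃ γ : ℝ → ℂ, E i j → Continuous γ ∧ γ 0 = P i ∧ γ 1 = P j ∧
      ∀ t, γ t ∈ S i j := by
    intro i j
    by_cases h : E i j
    · obtain ⟨p, hp⟩ := hj i j h
      refine ⟨p.extend, fun _ => ⟨p.continuous_extend, p.extend_zero, p.extend_one, fun t => ?_⟩⟩
      exact hp _
    · exact ⟨fun _ => 0, fun h' => (h h').elim⟩
  choose γ hγ using key
  have memP : ∀ i k, E i k ∨ E k i → ∀ X : Set ℂ, (∀ j l, E j l → (j = i ∧ l = k) ∨ (j = k ∧ l = i) →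
      Disjoint (S j l) X) → P i ∉ X := by
    rintro i k (h | h) X hX hm
    · exact disjoint_left.1 (hX i k h (.inl ⟨rfl, rfl⟩)) (hj i k h).source_mem hm
    · exact disjoint_left.1 (hX k i h (.inr ⟨rfl, rfl⟩)) (hj k i h).target_mem hm
  have hP : ∀ i j u, E i j → u ≠ i → u ≠ j → P u ∉ S i j := by
    intro i j u hE ui uj
    obtain ⟨v, hv, vi, vj⟩ := hE2 i j u hE ui uj
    refine memP u v hv _ fun a b hab h => ?_
    rcases h with ⟨rfl, rfl⟩ | ⟨rfl, rfl⟩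
    · exact hd _ _ _ _ hab hE ui uj vi vj
    · exact hd _ _ _ _ hab hE vi vj ui uj
  refine ht_eq E P γ ?_ (fun i j h => (hγ i j h).1) (fun i j h => (hγ i j h).2.1)
    (fun i j h => (hγ i j h).2.2.1) ?_ ?_
  · intro i j hij hPP
    obtain ⟨k, l, hk, hl, -, h1, h2, h3⟩ := hE1 i j hij
    rcases hl with hl | hl
    · exact hP j l i hl hij h1 (hPP ▸ (hj j l hl).source_mem)
    · exact hP l j i hl h1 hij (hPP ▸ (hj l j hl).target_mem)
  · intro i j u hE ui uj t ht
    exact hP i j u hE ui uj (ht ▸ (hγ i j hE).2.2.2 t)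
  · intro a b c d hab hcd ac ad bc bd s t hst
    exact disjoint_left.1 (hd a b c d hab hcd ac ad bc bd) ((hγ a b hab).2.2.2 s)
      (hst ▸ (hγ c d hcd).2.2.2 t)

lemma ht_k5 (P : Fin 5 → ℂ) (S : Fin 5 → Fin 5 → Set ℂ)
    (hj : ∀ i j, i < j → JoinedIn (S i j) (P i) (P j))
    (hd : ∀ a b c d, a < b → c < d → a ≠ c → a ≠ d → b ≠ c → b ≠ d → Disjoint (S a b) (S c d)) :
    False := by
  obtain ⟨N, hN⟩ := ht_curves (fun i j : Fin 5 => i < j) P S hj hd (by decide) (by decide)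
  have g := fun a b c d (h : a < b ∧ c < d ∧ a ≠ c ∧ a ≠ d ∧ b ≠ c ∧ b ≠ d) =>
    hN a b c d h.1 h.2.1 h.2.2.1 h.2.2.2.1 h.2.2.2.2.1 h.2.2.2.2.2
  have h1 := g 0 1 2 3 (by decide)
  have h2 := g 0 1 2 4 (by decide)
  have h3 := g 0 1 3 4 (by decide)
  have h4 := g 0 2 1 3 (by decide)
  have h5 := g 0 2 1 4 (by decide)
  have h6 := g 0 2 3 4 (by decide)
  have h7 := g 0 3 1 2 (by decide)
  have h8 := g 0 3 1 4 (by decide)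
  have h9 := g 0 3 2 4 (by decide)
  have h10 := g 0 4 1 2 (by decide)
  have h11 := g 0 4 1 3 (by decide)
  have h12 := g 0 4 2 3 (by decide)
  have h13 := g 1 2 3 4 (by decide)
  have h14 := g 1 3 2 4 (by decide)
  have h15 := g 1 4 2 3 (by decide)
  simp [ee] at h1 h2 h3 h4 h5 h6 h7 h8 h9 h10 h11 h12 h13 h14 h15
  omega

lemma ht_k33 (P : Fin 6 → ℂ) (S : Fin 6 → Fin 6 → Set ℂ)
    (hj : ∀ i j, i < 3 ∧ 3 ≤ j → JoinedIn (S i j) (P i) (P j))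
    (hd : ∀ a b c d, a < 3 ∧ 3 ≤ b → c < 3 ∧ 3 ≤ d → a ≠ c → a ≠ d → b ≠ c → b ≠ d →
      Disjoint (S a b) (S c d)) : False := by
  obtain ⟨N, hN⟩ := ht_curves (fun i j : Fin 6 => i < 3 ∧ 3 ≤ j) P S hj hd (by decide) (by decide)
  have g : ∀ a c b d : Fin 6, a < 3 ∧ c < 3 ∧ 3 ≤ b ∧ 3 ≤ d ∧ a ≠ c ∧ b ≠ d →
      ee a c + ee b d - ee a d - ee b c + N a c d + N d a b - N c a b - N b c d = 0 :=
    fun a c b d ⟨ha, hc, hb, hd', hac, hbd⟩ => hN a b c d ⟨ha, hb⟩ ⟨hc, hd'⟩ hac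
      (fun e => absurd (e ▸ ha) hd'.not_gt) (fun e => absurd (e ▸ hc) hb.not_gt) hbd
  have h1 := g 0 1 3 4 (by decide)
  have h2 := g 0 1 3 5 (by decide)
  have h3 := g 0 1 4 5 (by decide)
  have h4 := g 0 1 4 3 (by decide)
  have h5 := g 0 1 5 3 (by decide)
  have h6 := g 0 1 5 4 (by decide)
  have h7 := g 0 2 3 4 (by decide)
  have h8 := g 0 2 3 5 (by decide)
  have h9 := g 0 2 4 5 (by decide)
  have h10 := g 0 2 4 3 (by decide)
  have h11 := g 0 2 5 3 (by decide)
  have h12 := g 0 2 5 4 (by decide)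
  have h13 := g 1 2 3 4 (by decide)
  have h14 := g 1 2 3 5 (by decide)
  have h15 := g 1 2 4 5 (by decide)
  have h16 := g 1 2 4 3 (by decide)
  have h17 := g 1 2 5 3 (by decide)
  have h18 := g 1 2 5 4 (by decide)
  simp [ee] at h1 h2 h3 h4 h5 h6 h7 h8 h9 h10 h11 h12 h13 h14 h15 h16 h17 h18
  omega

lemma no_circle_log (p : ℂ) (R : ℝ) (hR : 0 < R) (l : ℂ → ℂ)
    (hl : ContinuousOn l (Metric.sphere p R))
    (hb : ∀ z ∈ Metric.sphere p R, Complex.exp (l z) = z - p) : False := by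
  let e : ℝ → ℂ := fun t => p + R * Complex.exp (t * (2 * Real.pi * Complex.I))
  have he : Continuous e := by fun_prop
  have hn : ∀ t, e t ∈ Metric.sphere p R := by
    intro t
    rw [mem_sphere_iff_norm]
    simp only [e, add_sub_cancel_left, norm_mul, Complex.norm_real, Real.norm_eq_abs,
          abs_of_pos hR]
    rw [Complex.norm_exp]; simp
  have h1 := log_diff (A := ℝ) (fun t => l (e t))
    (fun t => Complex.log R + t * (2 * Real.pi * Complex.I)) (hl.comp_continuous he hn)
    (by fun_prop) (by
      intro t
      rw [hb _ (hn t), Complex.exp_add, Complex.exp_log (by exact_mod_cast hR.ne')]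
      simp [e]) 1 0
  have e1 : e 1 = e 0 := by simp [e, Complex.exp_two_pi_mul_I]
  simp only [e1, sub_self, Complex.ofReal_one, Complex.ofReal_zero] at h1
  apply Complex.two_pi_I_ne_zero
  linear_combination (-1 : ℂ) * h1

/-- every nonvanishing function has a logarithm -/
def PL {X : Type} [TopologicalSpace X] (K : Set X) : Prop :=
  ∀ g : X → ℂ, ContinuousOn g K → (∀ x ∈ K, g x ≠ 0) →
    ∃ l : X → ℂ, ContinuousOn l K ∧ ∀ x ∈ K, Complex.exp (l x) = g x

lemma compact_arc {X : Type} [TopologicalSpace X] [T2Space X] {f : ℝ → X} {s t : ℝ}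
    (hf : ContinuousOn f (Icc s t)) : IsCompact (f '' Icc s t) :=
  isCompact_Icc.image_of_continuousOn hf

lemma pl_arc {X : Type} [TopologicalSpace X] [T2Space X] {f : ℝ → X} {s t : ℝ} (hst : s ≤ t)
    (hf : ContinuousOn f (Icc s t)) (hi : InjOn f (Icc s t)) : PL (f '' Icc s t) := by
  intro g hg h0
  obtain ⟨l, hl, hle⟩ := log_lift (fun r : ℝ => g (f (projIcc s t hst r)))
    (hg.comp_continuous (hf.comp_continuous (by fun_prop) (fun r => (projIcc s t hst r).2))
      (fun r => ⟨_, (projIcc s t hst r).2, rfl⟩))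
    (fun r => h0 _ ⟨_, (projIcc s t hst r).2, rfl⟩)
  let F : Icc s t → X := fun r => f r
  have hF : Topology.IsClosedEmbedding F :=
    (continuousOn_iff_continuous_domRestrict.1 hf).isClosedEmbedding (fun a b h => by
      exact Subtype.ext (hi a.2 b.2 h))
  have hr : range F = f '' Icc s t := by
    ext x; simp [F]
  let F' := hF.isEmbedding.toHomeomorph
  classical
  refine ⟨fun x => if h : x ∈ range F then l (F'.symm ⟨x, h⟩) else 0, ?_, ?_⟩
  · rw [← hr, continuousOn_iff_continuous_domRestrict]
    have : (range F).domRestrict (fun x => if h : x ∈ range F then l (F'.symm ⟨x, h⟩) else 0) =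
      fun x => l (F'.symm x) := by
      funext x
      rw [domRestrict_apply, dif_pos x.2]
    rw [this]
    fun_prop
  · rintro x hx
    rw [← hr] at hx
    dsimp only
    rw [dif_pos hx, hle, projIcc_val]
    congr 1
    exact congrArg Subtype.val (F'.apply_symm_apply ⟨x, hx⟩)

lemma pl_union {X : Type} [TopologicalSpace X] {A B : Set X} (hA : PL A) (hB : PL B)
    (cA : IsClosed A) (cB : IsClosed B) (p : X) (hp : A ∩ B = {p}) : PL (A ∪ B) := by
  intro g hg h0
  obtain ⟨l, hl, hle⟩ := hA g (hg.mono subset_union_left) (fun x hx => h0 x (.inl hx))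
  obtain ⟨m, hm, hme⟩ := hB g (hg.mono subset_union_right) (fun x hx => h0 x (.inr hx))
  have hpm : p ∈ A ∩ B := by rw [hp]; rfl
  have hc : Complex.exp (l p - m p) = 1 := by
    rw [Complex.exp_sub, hle p hpm.1, hme p hpm.2, div_self (h0 p (.inl hpm.1))]
  classical
  have heq : ∀ x ∈ A ∩ B, l x = m x + (l p - m p) := by
    rw [hp]; rintro x rfl; ring
  refine ⟨fun x => if x ∈ A then l x else m x + (l p - m p), ?_, ?_⟩
  · apply ContinuousOn.union_of_isClosed _ _ cA cB
    · exact hl.congr (fun x hx => if_pos hx)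
    · refine (hm.add (continuousOn_const (c := l p - m p))).congr (fun x hx => ?_)
      split_ifs with h
      · exact heq x ⟨h, hx⟩
      · rfl
  · intro x hx
    dsimp only
    split_ifs with h
    · exact hle x h
    · rw [Complex.exp_add, hc, mul_one, hme x (hx.resolve_left h)]

lemma ext_conn {E : Type} [NormedAddCommGroup E] [NormedSpace ℝ E] (h : 1 < Module.rank ℝ E)
    (R : ℝ) (hR : 0 ≤ R) : IsConnected {x : E | R < ‖x‖} := by
  have h1 := isConnected_compl_singleton_of_one_lt_rank h (0 : E)
  have : {x : E | R < ‖x‖} = (fun z : E => (1 + R / ‖z‖) • z) '' {0}ᶜ := by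
    ext x
    simp only [mem_ofPred_eq, mem_image, mem_compl_iff, mem_singleton_iff]
    constructor
    · intro hx
      have hx0 : 0 < ‖x‖ := hR.trans_lt hx
      have h2 : 0 < 1 - R / ‖x‖ := by
        rw [sub_pos, div_lt_one hx0]; exact hx
      refine ⟨(1 - R / ‖x‖) • x, ?_, ?_⟩
      · rw [smul_eq_zero]; rintro (h | h)
        · exact h2.ne' h
        · simp [h] at hx0
      · rw [norm_smul, smul_smul, Real.norm_eq_abs, abs_of_pos h2]
        have : (1 + R / ((1 - R / ‖x‖) * ‖x‖)) * (1 - R / ‖x‖) = 1 := by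
          have h3 : ‖x‖ - R ≠ 0 := (sub_pos.2 hx).ne'
          have h4 : (1 - R / ‖x‖) * ‖x‖ = ‖x‖ - R := by field_simp
          rw [h4]; field_simp; ring
        rw [this, one_smul]
    · rintro ⟨z, hz, rfl⟩
      have hz0 : 0 < ‖z‖ := norm_pos_iff.2 hz
      rw [norm_smul, Real.norm_eq_abs, abs_of_pos (by positivity), add_mul,
        div_mul_cancel₀ _ hz0.ne']
      linarith
  rw [this]
  refine h1.image _ ?_
  refine ContinuousOn.smul (continuousOn_const.add (continuousOn_const.div
    continuous_norm.continuousOn (fun z hz => ?_))) continuousOn_id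
  exact norm_ne_zero_iff.2 hz

lemma comp_frontier {E : Type} [TopologicalSpace E] {K : Set E} {p x : E}
    (hx : x ∈ closure (connectedComponentIn Kᶜ p)) (hxK : x ∉ K) :
    x ∈ connectedComponentIn Kᶜ p := by
  by_cases hp : p ∈ Kᶜ
  · have h1 : IsPreconnected (insert x (connectedComponentIn Kᶜ p)) :=
      isPreconnected_connectedComponentIn.subset_closure (subset_insert _ _)
        (insert_subset hx subset_closure)
    exact h1.subset_connectedComponentIn (mem_insert_of_mem _ (mem_connectedComponentIn hp))
      (insert_subset hxK (connectedComponentIn_subset _ _)) (mem_insert _ _)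
  · rw [connectedComponentIn_eq_empty hp] at hx
    simp at hx

/-- unbounded components of the complement of a bounded set coincide -/
lemma unb_eq {E : Type} [NormedAddCommGroup E] [NormedSpace ℝ E] (h : 1 < Module.rank ℝ E)
    {K : Set E} (hK : Bornology.IsBounded K) :
    ∃ R : ℝ, 0 ≤ R ∧ K ⊆ Metric.closedBall 0 R ∧ ∀ p,
      ¬ Bornology.IsBounded (connectedComponentIn Kᶜ p) →
      {x : E | R < ‖x‖} ⊆ connectedComponentIn Kᶜ p := by
  obtain ⟨R, hR⟩ := hK.subset_closedBall (0 : E)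
  refine ⟨max R 0, le_max_right _ _, hR.trans (Metric.closedBall_subset_closedBall
    (le_max_left _ _)), fun p hp => ?_⟩
  have hR' : K ⊆ Metric.closedBall 0 (max R 0) := hR.trans (Metric.closedBall_subset_closedBall
    (le_max_left _ _))
  have : ∃ x ∈ connectedComponentIn Kᶜ p, max R 0 < ‖x‖ := by
    by_contra hcon
    push Not at hcon
    exact hp (Metric.isBounded_closedBall.subset (fun x hx => by
      rw [mem_closedBall_zero_iff]; exact hcon x hx))
  obtain ⟨x, hx, hxR⟩ := this
  rw [connectedComponentIn_eq hx]
  refine (ext_conn h (max R 0) (le_max_right _ _)).isPreconnected.subset_connectedComponentIn hxR ?_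
  intro y hy hyK
  have := hR' hyK
  rw [mem_closedBall_zero_iff] at this
  exact absurd this (not_le.2 hy)

lemma ns {K : Set ℂ} (hK : IsCompact K) (hL : PL K) : IsPreconnected Kᶜ := by
  have hr : 1 < Module.rank ℝ ℂ := by rw [Complex.rank_real_complex]; norm_num
  obtain ⟨R, hR0, hR, hE⟩ := unb_eq hr hK.isBounded
  have key : ∀ p ∈ Kᶜ, ¬ Bornology.IsBounded (connectedComponentIn Kᶜ p) := by
    intro p hp hb
    let U := connectedComponentIn Kᶜ p
    have hUo : IsOpen U := hK.isClosed.isOpen_compl.connectedComponentIn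
    have hpU : p ∈ U := mem_connectedComponentIn hp
    obtain ⟨l, hl, hle⟩ := hL (fun z => z - p) (by fun_prop)
      (fun x hx => sub_ne_zero.2 (by rintro rfl; exact hp hx))
    obtain ⟨g, hg⟩ := ContinuousMap.exists_restrict_eq hK.isClosed
      (⟨K.domRestrict l, continuousOn_iff_continuous_domRestrict.1 hl⟩ : C(K, ℂ))
    have hgl : ∀ x ∈ K, g x = l x := fun x hx => congrArg (fun f : C(K, ℂ) => f ⟨x, hx⟩) hg
    classical
    have hc : Continuous (fun z => if z ∈ U then Complex.exp (g z) else z - p) := by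
      refine continuous_if ?_ (by fun_prop) (by fun_prop)
      intro a ha
      have haK : a ∈ K := by
        by_contra h
        have h1 := comp_frontier ha.1 h
        exact ha.2 (by rw [ofPred_mem_eq, hUo.interior_eq]; exact h1)
      rw [hgl a haK, hle a haK]
    obtain ⟨m, hm, hme⟩ := log_lift _ hc (by
      intro z; split_ifs with h
      · exact Complex.exp_ne_zero _
      · exact sub_ne_zero.2 (by rintro rfl; exact h hpU))
    obtain ⟨r, hr⟩ := hb.subset_ball p
    have hr0 : 0 < r := by
      have := hr hpU
      rw [Metric.mem_ball, dist_self] at this; exact this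
    refine no_circle_log p r hr0 m hm.continuousOn (fun z hz => ?_)
    rw [hme, if_neg]
    intro hzU
    exact (Metric.mem_ball.1 (hr hzU)).ne hz
  refine isPreconnected_of_forall_pair (fun x hx y hy => ?_)
  have hx' := hE x (key x hx)
  have hy' := hE y (key y hy)
  obtain ⟨q, hq⟩ := (ext_conn hr R hR0).nonempty
  refine ⟨connectedComponentIn Kᶜ x, connectedComponentIn_subset _ _, mem_connectedComponentIn hx,
    ?_, isPreconnected_connectedComponentIn⟩
  rw [connectedComponentIn_eq (hx' hq), ← connectedComponentIn_eq (hy' hq)]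
  exact mem_connectedComponentIn hy

lemma slit_of_close {x y : ℂ} (hy : y ≠ 0) (h : ‖x - y‖ < ‖y‖) : x / y ∈ Complex.slitPlane := by
  have h1 : x / y = 1 + (x - y) / y := by field_simp; ring
  rw [h1]
  apply Complex.mem_slitPlane_of_norm_lt_one
  rw [norm_div, div_lt_one (norm_pos_iff.2 hy)]; exact h

lemma log_change {a b : ℂ} (γ : Path a b) : ∃ l : ℂ → ℂ, ContinuousOn l (range γ)ᶜ ∧
    ∀ w ∉ range γ, Complex.exp (l w) = (b - w) / (a - w) := by
  have hcl : IsClosed (range γ) := (isCompact_range γ.continuous).isClosed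
  have hre : ∀ t, γ.extend t ∈ range γ := fun t => by rw [← γ.extend_range]; exact mem_range_self t
  have hce : Continuous γ.extend := γ.continuous_extend
  have h1 : ∀ w, ∃ δ : ℂ, w ∉ range γ → ∀ l : ℝ → ℂ, Continuous l →
      (∀ t, Complex.exp (l t) = γ.extend t - w) → l 1 - l 0 = δ := by
    intro w
    by_cases hw : w ∈ range γ
    · exact ⟨0, fun h => (h hw).elim⟩
    · obtain ⟨δ, hδ⟩ := exists_delta γ.extend hce w (fun t ht => hw (ht ▸ hre t))
      exact ⟨δ, fun _ => hδ⟩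
  choose δ hδ using h1
  have hlift : ∀ w ∉ range γ, ∃ l : ℝ → ℂ, Continuous l ∧ ∀ t, Complex.exp (l t) = γ.extend t - w :=
    fun w hw => log_lift (fun t => γ.extend t - w) (by fun_prop)
      (fun t => sub_ne_zero.2 (fun ht => hw (ht ▸ hre t)))
  refine ⟨δ, ?_, ?_⟩
  · intro w hw
    apply ContinuousAt.continuousWithinAt
    obtain ⟨l, hl, hle⟩ := hlift w hw
    obtain ⟨ε, hε, hball⟩ := Metric.isOpen_iff.1 hcl.isOpen_compl w hw
    have hsl : ∀ w' ∈ Metric.ball w ε, ∀ t, (γ.extend t - w') / (γ.extend t - w) ∈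
        Complex.slitPlane := by
      intro w' hw' t
      have hne : γ.extend t - w ≠ 0 := sub_ne_zero.2 (fun ht => hw (ht ▸ hre t))
      apply slit_of_close hne
      have h2 : γ.extend t - w' - (γ.extend t - w) = w - w' := by ring
      rw [h2, ← dist_eq_norm, ← dist_eq_norm, dist_comm]
      refine (Metric.mem_ball.1 hw').trans_le ?_
      by_contra hlt
      exact hball (Metric.mem_ball.2 (not_le.1 hlt)) (hre t)
    have heq : ∀ w' ∈ Metric.ball w ε, δ w' = δ w + Complex.log ((b - w') / (b - w)) -
        Complex.log ((a - w') / (a - w)) := by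
      intro w' hw'
      have h3 := hδ w' (hball hw')
        (fun t => l t + Complex.log ((γ.extend t - w') / (γ.extend t - w)))
        (hl.add (Continuous.clog (Continuous.div (by fun_prop) (by fun_prop)
          (fun t => sub_ne_zero.2 (fun ht => hw (ht ▸ hre t)))) (hsl w' hw')))
        (fun t => by
          have h4 : γ.extend t - w ≠ 0 := sub_ne_zero.2 (fun ht => hw (ht ▸ hre t))
          rw [Complex.exp_add, hle, Complex.exp_log (Complex.slitPlane_ne_zero (hsl w' hw' t))]
          field_simp)
      have h5 := hδ w hw l hl hle
      simp only [Path.extend_one, Path.extend_zero] at h3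
      linear_combination h5 - h3
    have hw0 := Metric.mem_ball_self (x := w) hε
    have s0 := hsl w hw0 0
    have s1 := hsl w hw0 1
    simp only [Path.extend_one, Path.extend_zero] at s0 s1
    have hcont : ContinuousAt (fun w' => δ w + Complex.log ((b - w') / (b - w)) -
        Complex.log ((a - w') / (a - w))) w := by
      refine ContinuousAt.sub (ContinuousAt.add continuousAt_const (ContinuousAt.clog
        (by fun_prop) s1)) (ContinuousAt.clog (by fun_prop) s0)
    exact hcont.congr (Filter.eventually_of_mem (Metric.ball_mem_nhds w hε)
      (fun w' h => (heq w' h).symm))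
  · intro w hw
    obtain ⟨l, hl, hle⟩ := hlift w hw
    rw [← hδ w hw l hl hle, Complex.exp_sub, hle, hle, Path.extend_one, Path.extend_zero]

/-- two paths with common ends, otherwise disjoint, separate the plane -/
lemma j1 {A B : Set ℂ} {a b : ℂ} (hab : a ≠ b) (cA : IsClosed A) (cB : IsClosed B)
    (hA : JoinedIn A a b) (hB : JoinedIn B a b) (hAB : A ∩ B = {a, b}) :
    ¬ IsPreconnected (A ∪ B)ᶜ := by
  intro hcon
  obtain ⟨γ, hγ⟩ := hA
  obtain ⟨η, hη⟩ := hB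
  obtain ⟨l, hl, hle⟩ := log_change γ
  obtain ⟨m, hm, hme⟩ := log_change η
  have sA : range γ ⊆ A := by rintro _ ⟨t, rfl⟩; exact hγ t
  have sB : range η ⊆ B := by rintro _ ⟨t, rfl⟩; exact hη t
  replace hl := hl.mono (compl_subset_compl.2 sA)
  replace hm := hm.mono (compl_subset_compl.2 sB)
  replace hle := fun w (hw : w ∉ A) => hle w (fun h => hw (sA h))
  replace hme := fun w (hw : w ∉ B) => hme w (fun h => hw (sB h))
  have haA : a ∈ A ∩ B := by rw [hAB]; simp
  have hbA : b ∈ A ∩ B := by rw [hAB]; simp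
  have hc : ∃ c : ℂ, Complex.exp c = 1 ∧ ∀ w, w ∉ A → w ∉ B → l w = m w + c := by
    by_cases hne : ((A ∪ B)ᶜ).Nonempty
    · obtain ⟨w0, hw0⟩ := hne
      have hw0A : w0 ∉ A := fun h => hw0 (.inl h)
      have hw0B : w0 ∉ B := fun h => hw0 (.inr h)
      refine ⟨l w0 - m w0, ?_, ?_⟩
      · rw [Complex.exp_sub, hle w0 hw0A, hme w0 hw0B, div_self]
        refine div_ne_zero (sub_ne_zero.2 ?_) (sub_ne_zero.2 ?_)
        · rintro rfl; exact hw0A hbA.1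
        · rintro rfl; exact hw0A haA.1
      · intro w hwA hwB
        have hw : w ∈ (A ∪ B)ᶜ := by rintro (h | h); exacts [hwA h, hwB h]
        have := isPreconnected_iff_preconnectedSpace.1 hcon
        have := log_diff (A := ((A ∪ B)ᶜ : Set ℂ)) (fun x => l x) (fun x => m x)
          (hl.comp_continuous continuous_subtype_val (fun x h => x.2 (.inl h)))
          (hm.comp_continuous continuous_subtype_val (fun x h => x.2 (.inr h)))
          (fun x => by rw [hle _ (fun h => x.2 (.inl h)), hme _ (fun h => x.2 (.inr h))])
          ⟨w, hw⟩ ⟨w0, hw0⟩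
        dsimp only at this
        linear_combination this
    · exact ⟨0, Complex.exp_zero, fun w hA hB => (hne ⟨w, by
        rintro (h | h); exacts [hA h, hB h]⟩).elim⟩
  obtain ⟨c, hc1, hc⟩ := hc
  classical
  let g : ℂ → ℂ := fun w => if w ∈ A then m w + c else l w
  have hg : ContinuousOn g (Aᶜ ∪ Bᶜ) := by
    apply ContinuousOn.union_of_isOpen _ _ cA.isOpen_compl cB.isOpen_compl
    · exact hl.congr (fun x hx => if_neg hx)
    · refine (hm.add (continuousOn_const (c := c))).congr (fun x hx => ?_)
      dsimp only [g]
      split_ifs with h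
      · rfl
      · exact hc x h hx
  have hge : ∀ w ∈ Aᶜ ∪ Bᶜ, Complex.exp (g w) = (b - w) / (a - w) := by
    intro w hw
    dsimp only [g]
    split_ifs with h
    · rw [Complex.exp_add, hc1, mul_one, hme w (hw.resolve_left (fun h' => h' h))]
    · exact hle w h
  have hr0 : 0 < ‖b - a‖ / 2 := half_pos (norm_pos_iff.2 (sub_ne_zero.2 hab.symm))
  have hsph : ∀ w ∈ Metric.sphere b (‖b - a‖ / 2), w ≠ a ∧ w ≠ b ∧
      (w - a) / (b - a) ∈ Complex.slitPlane := by
    intro w hw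
    rw [mem_sphere_iff_norm] at hw
    refine ⟨?_, ?_, ?_⟩
    · rintro rfl; rw [norm_sub_rev] at hw; linarith
    · rintro rfl; simp only [sub_self, norm_zero] at hw; linarith
    · apply slit_of_close (sub_ne_zero.2 hab.symm)
      rw [sub_sub_sub_cancel_right, hw]; linarith
  have hsub : Metric.sphere b (‖b - a‖ / 2) ⊆ Aᶜ ∪ Bᶜ := by
    intro w hw
    rw [← compl_inter, hAB]
    rintro (h | h)
    · exact (hsph w hw).1 h
    · exact (hsph w hw).2.1 h
  refine no_circle_log b (‖b - a‖ / 2) hr0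
    (fun w => g w + Complex.log ((w - a) / (b - a)) + Complex.log (b - a)) ?_ ?_
  · refine ((hg.mono hsub).add (ContinuousOn.clog ?_ (fun w hw => (hsph w hw).2.2))).add
      continuousOn_const
    fun_prop
  · intro w hw
    have h1 : b - a ≠ 0 := sub_ne_zero.2 hab.symm
    have h2 : a - w ≠ 0 := sub_ne_zero.2 (hsph w hw).1.symm
    rw [Complex.exp_add, Complex.exp_add, hge w (hsub hw), Complex.exp_log h1,
      Complex.exp_log (Complex.slitPlane_ne_zero (hsph w hw).2.2)]
    field_simp
    ring

section

/-! ## Transfer to `ℝ × ℝ` -/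

noncomputable abbrev hE : ℂ ≃ₜ ℝ × ℝ := Complex.equivRealProdCLM.toHomeomorph

lemma nsR {K : Set (ℝ × ℝ)} (hK : IsCompact K) (hL : PL K) : IsPreconnected Kᶜ := by
  have h1 : IsPreconnected (hE ⁻¹' K)ᶜ := by
    apply ns (hE.isCompact_preimage.2 hK)
    intro g hg h0
    obtain ⟨l, hl, hle⟩ := hL (fun x => g (hE.symm x))
      (hg.comp (hE.symm.continuous.continuousOn) (fun x hx => by
        simpa only [mem_preimage, Homeomorph.apply_symm_apply] using hx))
      (fun x hx => h0 _ (by simpa only [mem_preimage, Homeomorph.apply_symm_apply] using hx))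
    refine ⟨fun z => l (hE z), hl.comp hE.continuous.continuousOn (fun z hz => hz), fun z hz => ?_⟩
    rw [hle _ hz, Homeomorph.symm_apply_apply]
  rw [← preimage_compl, hE.isPreconnected_preimage] at h1
  exact h1

lemma j1R {A B : Set (ℝ × ℝ)} {a b : ℝ × ℝ} (hab : a ≠ b) (cA : IsClosed A) (cB : IsClosed B)
    (hA : JoinedIn A a b) (hB : JoinedIn B a b) (hAB : A ∩ B = {a, b}) :
    ¬ IsPreconnected (A ∪ B)ᶜ := by
  intro hcon
  have h1 := hA.map (f := hE.symm) hE.symm.continuous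
  have h2 := hB.map (f := hE.symm) hE.symm.continuous
  rw [Homeomorph.image_symm] at h1 h2
  refine j1 (A := hE ⁻¹' A) (B := hE ⁻¹' B) (fun h => hab (hE.symm.injective h))
    (cA.preimage hE.continuous) (cB.preimage hE.continuous) h1 h2 ?_ ?_
  · rw [← preimage_inter, hAB]
    ext x
    simp only [mem_preimage, mem_insert_iff, mem_singleton_iff]
    rw [Homeomorph.eq_symm_apply, Homeomorph.eq_symm_apply]
  · rw [← preimage_union, ← preimage_compl, hE.isPreconnected_preimage]
    exact hcon

lemma j2 {f : ℝ → ℝ × ℝ} {B D : Set (ℝ × ℝ)} (hf : ContinuousOn f (Icc 0 1))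
    (hi : InjOn f (Icc 0 1)) (cB : IsCompact B) (hB : PL B)
    (hfB : f '' Icc 0 1 ∩ B = {f 0, f 1}) (hD : IsOpen D) (hne : D.Nonempty)
    (hDJ : D ⊆ (f '' Icc 0 1 ∪ B)ᶜ) (hDc : closure D ∩ (f '' Icc 0 1 ∪ B)ᶜ ⊆ D)
    {y : ℝ × ℝ} (hy : y ∉ f '' Icc 0 1 ∪ B) (hyD : y ∉ D) : f '' Icc 0 1 ⊆ closure D := by
  have key : f '' Ioo 0 1 ⊆ closure D := by
    rintro _ ⟨s, hs, rfl⟩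
    by_contra hcon
    have hsI : s ∈ Icc (0 : ℝ) 1 := Ioo_subset_Icc_self hs
    have hnh : f ⁻¹' (closure D)ᶜ ∈ nhdsWithin s (Icc 0 1) :=
      (hf s hsI).preimage_mem_nhdsWithin (isClosed_closure.isOpen_compl.mem_nhds hcon)
    rw [nhdsWithin_eq_nhds.2 (Icc_mem_nhds hs.1 hs.2), Metric.mem_nhds_iff] at hnh
    obtain ⟨ε, hε, hball⟩ := hnh
    obtain ⟨s1, hs1, hs1'⟩ := exists_between (max_lt hs.1 (sub_lt_self s hε))
    obtain ⟨s2, hs2, hs2'⟩ := exists_between (lt_min hs.2 (lt_add_of_pos_right s hε))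
    rw [max_lt_iff] at hs1
    rw [lt_min_iff] at hs2'
    have hV : ∀ r, s1 < r → r < s2 → f r ∉ closure D := by
      intro r h1 h2
      apply hball
      rw [Metric.mem_ball, Real.dist_eq, abs_lt]
      constructor <;> linarith
    have sub1 : Icc 0 s1 ⊆ Icc (0 : ℝ) 1 := Icc_subset_Icc le_rfl (by linarith)
    have sub2 : Icc s2 1 ⊆ Icc (0 : ℝ) 1 := Icc_subset_Icc (by linarith) le_rfl
    have z0 : (0 : ℝ) ∈ Icc (0 : ℝ) 1 := by simp
    have z1 : (1 : ℝ) ∈ Icc (0 : ℝ) 1 := by simp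
    have hB0 : f 0 ∈ B := by
      have : f 0 ∈ f '' Icc 0 1 ∩ B := by rw [hfB]; simp
      exact this.2
    have hB1 : f 1 ∈ B := by
      have : f 1 ∈ f '' Icc 0 1 ∩ B := by rw [hfB]; simp
      exact this.2
    have c1 := compact_arc (hf.mono sub1)
    have c2 := compact_arc (hf.mono sub2)
    have i1 : f '' Icc 0 s1 ∩ B = {f 0} := by
      apply Subset.antisymm
      · rintro _ ⟨⟨r, hr, rfl⟩, hrB⟩
        have : f r ∈ f '' Icc 0 1 ∩ B := ⟨⟨r, sub1 hr, rfl⟩, hrB⟩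
        rw [hfB] at this
        rcases this with h | h
        · exact h
        · have := hi (sub1 hr) z1 h
          linarith [hr.2]
      · rintro _ rfl
        exact ⟨⟨0, ⟨le_rfl, hs1.1.le⟩, rfl⟩, hB0⟩
    have i2 : (f '' Icc 0 s1 ∪ B) ∩ f '' Icc s2 1 = {f 1} := by
      apply Subset.antisymm
      · rintro _ ⟨h, ⟨r, hr, rfl⟩⟩
        rcases h with ⟨r', hr', h⟩ | h
        · have := hi (sub1 hr') (sub2 hr) h
          linarith [hr.1, hr'.2]
        · have : f r ∈ f '' Icc 0 1 ∩ B := ⟨⟨r, sub2 hr, rfl⟩, h⟩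
          rw [hfB] at this
          rcases this with h | h
          · have := hi (sub2 hr) z0 h
            linarith [hr.1]
          · exact h
      · rintro _ rfl
        exact ⟨.inr hB1, ⟨1, ⟨by linarith, le_rfl⟩, rfl⟩⟩
    have pl := pl_union (pl_union (pl_arc hs1.1.le (hf.mono sub1) (hi.mono sub1)) hB c1.isClosed
      cB.isClosed _ i1) (pl_arc (by linarith) (hf.mono sub2) (hi.mono sub2))
      (c1.union cB).isClosed c2.isClosed _ i2
    have hpre := nsR ((c1.union cB).union c2) pl
    have hAJ : f '' Icc 0 s1 ∪ B ∪ f '' Icc s2 1 ⊆ f '' Icc 0 1 ∪ B :=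
      union_subset (union_subset ((image_mono sub1).trans subset_union_left) subset_union_right)
        ((image_mono sub2).trans subset_union_left)
    have := hpre.subset_of_closure_inter_subset hD (by
      obtain ⟨d, hd⟩ := hne
      exact ⟨d, fun h => hDJ hd (hAJ h), hd⟩) (by
      rintro x ⟨hx, hxA⟩
      apply hDc ⟨hx, _⟩
      rintro (⟨r, hr, rfl⟩ | h)
      · refine hV r ?_ ?_ hx
        · by_contra h; exact hxA (.inl (.inl ⟨r, ⟨hr.1, not_lt.1 h⟩, rfl⟩))
        · by_contra h; exact hxA (.inr ⟨r, ⟨not_lt.1 h, hr.2⟩, rfl⟩)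
      · exact hxA (.inl (.inr h)))
    exact hyD (this (fun h => hy (hAJ h)))
  have h2 : Icc (0 : ℝ) 1 = closure (Ioo 0 1) := (closure_Ioo (by norm_num)).symm
  rw [h2]
  rw [h2] at hf
  exact hf.image_closure.trans (closure_minimal key isClosed_closure)

/-! ## Plane graphs -/

variable {V : Type u} (G : PlaneGraph V)

lemma adj_mem' {u v : V} (h : G.Adj u v) : v ∈ G.verts := G.adj_mem v u (G.adj_symm u v h)

lemma arc_comm (u v : V) : G.arc s(u, v) = G.arc s(v, u) := by rw [Sym2.eq_swap]

lemma arc_data {u v : V} (h : G.Adj u v) : IsCompact (G.arc s(u, v)) ∧ PL (G.arc s(u, v)) ∧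
    JoinedIn (G.arc s(u, v)) (G.pos u) (G.pos v) ∧ G.pos u ∈ G.arc s(u, v) ∧
    G.pos v ∈ G.arc s(u, v) := by
  obtain ⟨f, hf, hi, he, h0, h1⟩ := G.arc_arc u v h
  rw [← he, ← h0, ← h1]
  have z0 : (0 : ℝ) ∈ Icc (0 : ℝ) 1 := by simp
  have z1 : (1 : ℝ) ∈ Icc (0 : ℝ) 1 := by simp
  refine ⟨compact_arc hf, pl_arc (by norm_num) hf hi, ?_, ⟨0, z0, rfl⟩, ⟨1, z1, rfl⟩⟩
  exact JoinedIn.map_continuousOn (((convex_Icc (0 : ℝ) 1).isPathConnected ⟨0, z0⟩).joinedIn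
    0 z0 1 z1) hf

lemma arc_sub_image {u v : V} (h : G.Adj u v) : G.arc s(u, v) ⊆ G.image := by
  intro x hx
  refine .inr ?_
  simp only [mem_iUnion]
  exact ⟨u, v, h, hx⟩

lemma image_cases {x : ℝ × ℝ} (h : x ∈ G.image) : (∃ v ∈ G.verts, G.pos v = x) ∨
    ∃ u v, G.Adj u v ∧ x ∈ G.arc s(u, v) := by
  rcases h with ⟨v, hv, h⟩ | h
  · exact .inl ⟨v, hv, h⟩
  · simp only [mem_iUnion] at h
    obtain ⟨u, v, h, hx⟩ := h
    exact .inr ⟨u, v, h, hx⟩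

lemma image_compact : IsCompact G.image := by
  have : G.image = G.pos '' G.verts ∪ ⋃ p ∈ {p : V × V | G.Adj p.1 p.2}, G.arc s(p.1, p.2) := by
    ext x; simp [PlaneGraph.image]
  rw [this]
  refine (G.finite_verts.image _).isCompact.union (Set.Finite.isCompact_biUnion ?_ ?_)
  · exact (G.finite_verts.prod G.finite_verts).subset
      (fun p hp => ⟨G.adj_mem _ _ hp, adj_mem' G hp⟩)
  · intro p hp
    exact (arc_data G hp).1

lemma rank2 : 1 < Module.rank ℝ (ℝ × ℝ) := by
  rw [rank_prod']; simp only [Module.rank_self]; norm_num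

lemma outer_eq : ∃ q ∉ G.image, q ∈ G.outerFace ∧
    G.outerFace = connectedComponentIn G.imageᶜ q := by
  obtain ⟨R, hR0, hR, hE⟩ := unb_eq rank2 (image_compact G).isBounded
  have hcon := ext_conn rank2 R hR0
  have hsub : {x : ℝ × ℝ | R < ‖x‖} ⊆ G.imageᶜ := by
    intro y hy hyK
    have := hR hyK
    rw [mem_closedBall_zero_iff] at this
    exact absurd this (not_le.2 hy)
  obtain ⟨q, hq⟩ := hcon.nonempty
  have hqu : ¬ Bornology.IsBounded (connectedComponentIn G.imageᶜ q) := by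
    intro hb
    have hb' := hb.subset (hcon.isPreconnected.subset_connectedComponentIn hq hsub)
    obtain ⟨M, hM⟩ := hb'.subset_closedBall (0 : ℝ × ℝ)
    have : ((max M R + 1, 0) : ℝ × ℝ) ∈ {x : ℝ × ℝ | R < ‖x‖} := by
      have h1 : ‖((max M R + 1, 0) : ℝ × ℝ)‖ ≥ max M R + 1 :=
        (le_abs_self _).trans (norm_fst_le ((max M R + 1, 0) : ℝ × ℝ))
      have := le_max_right M R
      simp only [mem_ofPred_eq]; linarith
    have h2 := hM this
    rw [mem_closedBall_zero_iff] at h2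
    have h1 : ‖((max M R + 1, 0) : ℝ × ℝ)‖ ≥ max M R + 1 :=
        (le_abs_self _).trans (norm_fst_le ((max M R + 1, 0) : ℝ × ℝ))
    have := le_max_left M R
    linarith
  refine ⟨q, hsub hq, ⟨hsub hq, hqu⟩, ?_⟩
  ext p
  constructor
  · rintro ⟨hp, hpu⟩
    rw [← connectedComponentIn_eq (hE p hpu hq)]
    exact mem_connectedComponentIn hp
  · intro hp
    refine ⟨connectedComponentIn_subset _ _ hp, ?_⟩
    rw [← connectedComponentIn_eq hp]; exact hqu

lemma outer_open : IsOpen G.outerFace := by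
  obtain ⟨q, -, -, h⟩ := outer_eq G
  rw [h]
  exact (image_compact G).isClosed.isOpen_compl.connectedComponentIn

lemma outer_conn : IsConnected G.outerFace := by
  obtain ⟨q, hq, hq', h⟩ := outer_eq G
  refine ⟨⟨q, hq'⟩, ?_⟩
  rw [h]
  exact isPreconnected_connectedComponentIn

lemma outer_sub : G.outerFace ⊆ G.imageᶜ := fun _ h => h.1

lemma outer_absorb {S : Set (ℝ × ℝ)} (hS : IsPreconnected S) (hSi : S ⊆ G.imageᶜ)
    {x : ℝ × ℝ} (hx : x ∈ S) (hxo : x ∈ G.outerFace) : S ⊆ G.outerFace := by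
  obtain ⟨q, hq, hq', h⟩ := outer_eq G
  rw [h] at hxo ⊢
  rw [connectedComponentIn_eq hxo]
  exact hS.subset_connectedComponentIn hx hSi

variable {G} in
lemma outer_mono {H : PlaneGraph V} (h : H.image ⊆ G.image) : G.outerFace ⊆ H.outerFace := by
  rintro p ⟨hp, hu⟩
  exact ⟨fun h' => hp (h h'), fun hb => hu (hb.subset
    (connectedComponentIn_mono p (compl_subset_compl.2 h)))⟩

variable {G} in
lemma frontier_mono {H : PlaneGraph V} (h : H.image ⊆ G.image) {x : ℝ × ℝ}
    (hx : x ∈ frontier G.outerFace) (hxH : x ∈ H.image) : x ∈ frontier H.outerFace :=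
  ⟨closure_mono (outer_mono h) hx.1, fun h' => by
    rw [(outer_open H).interior_eq] at h'
    exact h'.1 hxH⟩

lemma pos_mem_image {v : V} (h : v ∈ G.verts) : G.pos v ∈ G.image := .inl ⟨v, h, rfl⟩

variable {G} in
lemma sub_image {H : PlaneGraph V} (h : H.IsSubgraph G) : H.image ⊆ G.image := by
  intro x hx
  rcases image_cases H hx with ⟨v, hv, rfl⟩ | ⟨u, v, huv, hx⟩
  · rw [h.2.2.1 v hv]; exact pos_mem_image G (h.1 hv)
  · rw [h.2.2.2 u v huv] at hx; exact arc_sub_image G (h.2.1 u v huv) hx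

variable {G} in
lemma onOuter_mono {H : PlaneGraph V} (h : H.IsSubgraph G) {v : V} (hv : v ∈ H.verts)
    (ho : G.OnOuter v) : H.OnOuter v := by
  have := frontier_mono (sub_image h) (x := G.pos v) ho (by
    rw [← h.2.2.1 v hv]; exact pos_mem_image H hv)
  rw [← h.2.2.1 v hv] at this
  exact this

variable {G} in
lemma edgeOuter_mono {H : PlaneGraph V} (h : H.IsSubgraph G) {u v : V} (hv : H.Adj u v)
    (ho : G.EdgeOnOuter u v) : H.EdgeOnOuter u v := by
  intro x hx
  refine frontier_mono (sub_image h) (ho ?_) (arc_sub_image H hv hx)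
  rw [← h.2.2.2 u v hv]; exact hx

/-- the triangle curve -/
lemma tri_curve {a b c : V} (hab : G.Adj a b) (hbc : G.Adj b c) (hca : G.Adj c a) :
    ¬ IsPreconnected (G.arc s(a, b) ∪ (G.arc s(b, c) ∪ G.arc s(c, a)))ᶜ ∧
    ∀ D : Set (ℝ × ℝ), IsOpen D → D.Nonempty →
      D ⊆ (G.arc s(a, b) ∪ (G.arc s(b, c) ∪ G.arc s(c, a)))ᶜ →
      closure D ∩ (G.arc s(a, b) ∪ (G.arc s(b, c) ∪ G.arc s(c, a)))ᶜ ⊆ D →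
      (∃ y ∉ G.arc s(a, b) ∪ (G.arc s(b, c) ∪ G.arc s(c, a)), y ∉ D) →
      G.arc s(a, b) ⊆ closure D := by
  have nab : a ≠ b := fun h => G.adj_irrefl b (h ▸ hab)
  have nbc : b ≠ c := fun h => G.adj_irrefl c (h ▸ hbc)
  have nca : c ≠ a := fun h => G.adj_irrefl a (h ▸ hca)
  obtain ⟨k1, l1, r1, m1, m1'⟩ := arc_data G hab
  obtain ⟨k2, l2, r2, m2, m2'⟩ := arc_data G hbc
  obtain ⟨k3, l3, r3, m3, m3'⟩ := arc_data G hca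
  have i23 : G.arc s(b, c) ∩ G.arc s(c, a) = {G.pos c} := by
    apply Subset.antisymm
    · intro x hx
      obtain ⟨w, ⟨hw, hw'⟩, rfl⟩ := G.arc_meet b c c a hbc hca (by
        rw [Ne, Sym2.eq_iff]; rintro (h | h); exacts [nbc h.1, nab h.1.symm]) hx
      have : w = c := by
        rcases hw with rfl | rfl
        · rcases hw' with rfl | rfl
          · rfl
          · exact (nab rfl).elim
        · rfl
      rw [this]; rfl
    · rintro _ rfl; exact ⟨m2', m3⟩
  have i1 : G.arc s(a, b) ∩ (G.arc s(b, c) ∪ G.arc s(c, a)) = {G.pos a, G.pos b} := by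
    apply Subset.antisymm
    · rintro x ⟨hx, hx' | hx'⟩
      · obtain ⟨w, ⟨hw, hw'⟩, rfl⟩ := G.arc_meet a b b c hab hbc (by
          rw [Ne, Sym2.eq_iff]; rintro (h | h); exacts [nab h.1, nca h.1.symm]) ⟨hx, hx'⟩
        rcases hw with rfl | rfl
        · exact .inl rfl
        · exact .inr rfl
      · obtain ⟨w, ⟨hw, hw'⟩, rfl⟩ := G.arc_meet a b c a hab hca (by
          rw [Ne, Sym2.eq_iff]; rintro (h | h); exacts [nab h.2.symm, nbc h.2]) ⟨hx, hx'⟩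
        rcases hw with rfl | rfl
        · exact .inl rfl
        · exact .inr rfl
    · rintro _ (rfl | rfl)
      · exact ⟨m1, .inr m3'⟩
      · exact ⟨m1', .inl m2⟩
  have cB := k2.union k3
  have pB := pl_union l2 l3 k2.isClosed k3.isClosed _ i23
  constructor
  · refine j1R (fun h => nab (G.pos_injOn (G.adj_mem _ _ hab) (adj_mem' G hab) h)) k1.isClosed
      cB.isClosed r1 ?_ i1
    exact ((r2.mono subset_union_left).trans (r3.mono subset_union_right)).symm
  · rintro D hD hne h1 h2 ⟨y, hy, hyD⟩
    obtain ⟨f, hf, hi, he, h0, h1'⟩ := G.arc_arc a b hab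
    rw [← he] at i1 h1 h2 hy ⊢
    rw [← h0, ← h1'] at i1
    exact j2 hf hi cB pB i1 hD hne h1 h2 hy hyD

/-- deleting a vertex of a triangle exposes the opposite edge, if all vertices are outer -/
lemma tri_lemma (hv : ∀ v ∈ G.verts, G.OnOuter v) {z a b : V} (hza : G.Adj z a)
    (hab : G.Adj a b) (hbz : G.Adj b z) : (G.deleteVerts {z}).EdgeOnOuter a b := by
  have nab : a ≠ b := fun h => G.adj_irrefl b (h ▸ hab)
  have nza : z ≠ a := fun h => G.adj_irrefl a (h ▸ hza)
  have nbz : b ≠ z := fun h => G.adj_irrefl z (h ▸ hbz)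
  obtain ⟨J, hJ⟩ : ∃ J, J = G.arc s(a, b) ∪ (G.arc s(b, z) ∪ G.arc s(z, a)) := ⟨_, rfl⟩
  have hJ' : J = G.arc s(z, a) ∪ (G.arc s(a, b) ∪ G.arc s(b, z)) := by
    rw [hJ, ← union_assoc, union_comm]
  obtain ⟨hns, hcl⟩ := tri_curve G hab hbz hza
  obtain ⟨-, hcl2⟩ := tri_curve G hza hab hbz
  rw [← hJ] at hns hcl
  rw [← hJ'] at hcl2
  have hJi : J ⊆ G.image := by
    rw [hJ]
    exact union_subset (arc_sub_image G hab) (union_subset (arc_sub_image G hbz)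
      (arc_sub_image G hza))
  have hJc : IsClosed J := by
    rw [hJ]
    exact ((arc_data G hab).1.union ((arc_data G hbz).1.union (arc_data G hza).1)).isClosed
  have hO := outer_conn G
  obtain ⟨q, hq⟩ := hO.nonempty
  have hOJ : G.outerFace ⊆ Jᶜ := fun x hx hxJ => hx.1 (hJi hxJ)
  have hOD : G.outerFace ⊆ connectedComponentIn Jᶜ q :=
    hO.isPreconnected.subset_connectedComponentIn hq hOJ
  obtain ⟨y, hyJ, hyD⟩ : ∃ y ∈ Jᶜ, y ∉ connectedComponentIn Jᶜ q := by
    by_contra hcon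
    push Not at hcon
    apply hns
    have : connectedComponentIn Jᶜ q = Jᶜ := Subset.antisymm (connectedComponentIn_subset _ _) hcon
    rw [← this]; exact isPreconnected_connectedComponentIn
  have hdisj : ∀ x ∈ connectedComponentIn Jᶜ y, x ∉ connectedComponentIn Jᶜ q := by
    intro x hx hx'
    apply hyD
    rw [connectedComponentIn_eq hx', ← connectedComponentIn_eq hx]
    exact mem_connectedComponentIn hyJ
  -- the drawing outside of `J` lies in the component of the outer face
  have hvert : ∀ v ∈ G.verts, G.pos v ∉ J → G.pos v ∈ connectedComponentIn Jᶜ q :=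
    fun v hv' hJv => comp_frontier (closure_mono hOD (hv v hv').1) hJv
  have hedge : ∀ u v, G.Adj u v → u ≠ z → u ≠ a → u ≠ b → ∀ x ∈ G.arc s(u, v), x ∉ J →
      x ∈ connectedComponentIn Jᶜ q := by
    intro u v huv nuz nua nub x hx hxJ
    obtain ⟨f, hf, hi, he, h0, h1⟩ := G.arc_arc u v huv
    rw [← he] at hx
    obtain ⟨t, ht, rfl⟩ := hx
    by_cases ht1 : t = 1
    · rw [ht1, h1] at hxJ ⊢
      exact hvert v (adj_mem' G huv) hxJ
    have hoff : ∀ r ∈ Icc (0 : ℝ) t, f r ∉ J := by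
      intro r hr hrJ
      have hrI : r ∈ Icc (0 : ℝ) 1 := ⟨hr.1, hr.2.trans ht.2⟩
      have hfr : f r ∈ G.arc s(u, v) := he ▸ ⟨r, hrI, rfl⟩
      have hw : f r = G.pos v := by
        rw [hJ] at hrJ
        rcases hrJ with h | h | h
        · obtain ⟨w, ⟨hw, hw'⟩, e⟩ := G.arc_meet u v a b huv hab (by
            rw [Ne, Sym2.eq_iff]; rintro (h | h); exacts [nua h.1, nub h.1]) ⟨hfr, h⟩
          rcases hw with rfl | rfl
          · rcases hw' with h | h
            exacts [(nua h).elim, (nub h).elim]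
          · exact e.symm
        · obtain ⟨w, ⟨hw, hw'⟩, e⟩ := G.arc_meet u v b z huv hbz (by
            rw [Ne, Sym2.eq_iff]; rintro (h | h); exacts [nub h.1, nuz h.1]) ⟨hfr, h⟩
          rcases hw with rfl | rfl
          · rcases hw' with h | h
            exacts [(nub h).elim, (nuz h).elim]
          · exact e.symm
        · obtain ⟨w, ⟨hw, hw'⟩, e⟩ := G.arc_meet u v z a huv hza (by
            rw [Ne, Sym2.eq_iff]; rintro (h | h); exacts [nuz h.1, nua h.1]) ⟨hfr, h⟩
          rcases hw with rfl | rfl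
          · rcases hw' with h | h
            exacts [(nuz h).elim, (nua h).elim]
          · exact e.symm
      have : r = 1 := hi hrI (by simp) (hw.trans h1.symm)
      exact ht1 (le_antisymm ht.2 (this ▸ hr.2))
    have hpre : IsPreconnected (f '' Icc 0 t) :=
      isPreconnected_Icc.image f (hf.mono (Icc_subset_Icc le_rfl ht.2))
    have h0t : (0 : ℝ) ∈ Icc (0 : ℝ) t := ⟨le_rfl, ht.1⟩
    have hu := hvert u (G.adj_mem _ _ huv) (h0 ▸ hoff 0 h0t)
    rw [connectedComponentIn_eq hu]
    refine hpre.subset_connectedComponentIn ⟨0, h0t, h0⟩ ?_ ⟨t, ⟨ht.1, le_rfl⟩, rfl⟩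
    rintro _ ⟨r, hr, rfl⟩; exact hoff r hr
  have himg : ∀ x ∈ G.image, x ∉ J → x ∈ connectedComponentIn Jᶜ q := by
    intro x hx hxJ
    rcases image_cases G hx with ⟨v, hv', rfl⟩ | ⟨u, v, huv, hx⟩
    · exact hvert v hv' hxJ
    · by_cases h : u ≠ z ∧ u ≠ a ∧ u ≠ b
      · exact hedge u v huv h.1 h.2.1 h.2.2 x hx hxJ
      by_cases h' : v ≠ z ∧ v ≠ a ∧ v ≠ b
      · exact hedge v u (G.adj_symm _ _ huv) h'.1 h'.2.1 h'.2.2 x (arc_comm G u v ▸ hx) hxJ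
      exfalso
      apply hxJ
      rw [hJ]
      have nuv : u ≠ v := fun h => G.adj_irrefl v (h ▸ huv)
      have e1 := arc_comm G a b
      have e2 := arc_comm G b z
      have e3 := arc_comm G z a
      have hu : u = z ∨ u = a ∨ u = b := by tauto
      have hv' : v = z ∨ v = a ∨ v = b := by tauto
      simp only [mem_union]
      rcases hu with rfl | rfl | rfl <;> rcases hv' with rfl | rfl | rfl <;>
        first | exact (nuv rfl).elim | (simp only [e1, e2, e3] at hx ⊢; tauto)
  have hDo : IsOpen (connectedComponentIn Jᶜ y) := hJc.isOpen_compl.connectedComponentIn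
  have hDi : connectedComponentIn Jᶜ y ⊆ G.imageᶜ := fun x hx hxi =>
    hdisj x hx (himg x hxi (connectedComponentIn_subset _ _ hx))
  have hcc : closure (connectedComponentIn Jᶜ y) ∩ Jᶜ ⊆ connectedComponentIn Jᶜ y :=
    fun x hx => comp_frontier hx.1 hx.2
  have hqy : ∃ y' ∉ J, y' ∉ connectedComponentIn Jᶜ y :=
    ⟨q, hOJ hq, fun h => hdisj q h (mem_connectedComponentIn (hOJ hq))⟩
  have c1 := hcl _ hDo ⟨y, mem_connectedComponentIn hyJ⟩ (connectedComponentIn_subset _ _) hcc hqy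
  have c2 := hcl2 _ hDo ⟨y, mem_connectedComponentIn hyJ⟩ (connectedComponentIn_subset _ _) hcc hqy
  have hzD : G.pos z ∈ closure (connectedComponentIn Jᶜ y) := c2 (arc_data G hza).2.2.2.1
  have hzO : G.pos z ∈ closure G.outerFace := (hv z (G.adj_mem _ _ hza)).1
  have hsubi : (G.deleteVerts {z}).image ⊆ G.image := by
    apply sub_image
    exact ⟨fun v h => h.1, fun u v h => h.1, fun v h => rfl, fun u v h => rfl⟩
  have hznot : G.pos z ∉ (G.deleteVerts {z}).image := by
    intro h
    rcases image_cases _ h with ⟨v, hv', e⟩ | ⟨u, v, huv, hx⟩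
    · exact hv'.2 (G.pos_injOn hv'.1 (G.adj_mem _ _ hza) e)
    · rcases G.arc_avoid u v huv.1 z (G.adj_mem _ _ hza) hx with h | h
      · exact huv.2.1 h.symm
      · exact huv.2.2 h.symm
  have p1 : IsPreconnected (insert (G.pos z) (connectedComponentIn Jᶜ y)) :=
    isPreconnected_connectedComponentIn.subset_closure (subset_insert _ _)
      (insert_subset hzD subset_closure)
  have p2 : IsPreconnected (insert (G.pos z) G.outerFace) :=
    hO.isPreconnected.subset_closure (subset_insert _ _) (insert_subset hzO subset_closure)
  have p3 := IsPreconnected.union (G.pos z) (mem_insert _ _) (mem_insert _ _) p1 p2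
  have hfin := outer_absorb (G.deleteVerts {z}) p3 (by
    refine union_subset (insert_subset hznot ?_) (insert_subset hznot ?_)
    · exact hDi.trans (compl_subset_compl.2 hsubi)
    · exact (outer_sub G).trans (compl_subset_compl.2 hsubi)) (.inr (mem_insert_of_mem _ hq))
    (outer_mono hsubi hq)
  intro x hx
  refine ⟨closure_mono (fun w hw => hfin (.inl (mem_insert_of_mem _ hw))) (c1 hx), fun h => ?_⟩
  rw [(outer_open _).interior_eq] at h
  exact h.1 (arc_sub_image (G.deleteVerts {z}) ⟨hab, nza.symm, nbz⟩ hx)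

end

section

variable {V : Type u} (G : PlaneGraph V)

/-! ## The graph with an extra vertex in the outer face has no Kuratowski minor -/

/-- `G` plus a vertex joined to all outer vertices. -/
def HG : SimpleGraph (Option V) where
  Adj a b := (∃ u v, a = some u ∧ b = some v ∧ G.Adj u v) ∨
    (∃ v, ((a = none ∧ b = some v) ∨ (a = some v ∧ b = none)) ∧ v ∈ G.verts ∧ G.OnOuter v)
  symm := ⟨by
    rintro a b (⟨u, v, h1, h2, h⟩ | ⟨v, h1, h⟩)
    · exact .inl ⟨v, u, h2, h1, G.adj_symm _ _ h⟩
    · exact .inr ⟨v, h1.symm.imp And.symm And.symm, h⟩⟩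
  loopless := ⟨by
    rintro a (⟨u, v, h1, h2, h⟩ | ⟨v, h1 | h1, h⟩)
    · obtain rfl : u = v := Option.some.inj (h1.symm.trans h2)
      exact G.adj_irrefl _ h
    · exact absurd (h1.1.symm.trans h1.2) (by simp)
    · exact absurd (h1.2.symm.trans h1.1) (by simp)⟩

variable {G}

lemma hg_some {u v : V} : (HG G).Adj (some u) (some v) ↔ G.Adj u v := by
  simp [HG]

lemma hg_none {v : V} : (HG G).Adj none (some v) ↔ v ∈ G.verts ∧ G.OnOuter v := by
  simp [HG]

/-- valid vertices -/
def Val (G : PlaneGraph V) (a : Option V) : Prop := ∀ v, a = some v → v ∈ G.verts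

lemma val_left {a b : Option V} (h : (HG G).Adj a b) : Val G a := by
  rintro w rfl
  rcases b with _ | v
  · exact (hg_none.1 h.symm).1
  · exact G.adj_mem _ _ (hg_some.1 h)

/-- the part of the plane covered by a set of vertices -/
def Rg (G : PlaneGraph V) (S : Set (Option V)) : Set (ℝ × ℝ) :=
  {x | (∃ v ∈ G.verts, some v ∈ S ∧ G.pos v = x) ∨
    (∃ u v, G.Adj u v ∧ some u ∈ S ∧ some v ∈ S ∧ x ∈ G.arc s(u, v)) ∨
    (none ∈ S ∧ x ∈ G.outerFace)}

lemma rg_mono {S T : Set (Option V)} (h : S ⊆ T) : Rg G S ⊆ Rg G T := by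
  rintro x (⟨v, h1, h2, h3⟩ | ⟨u, v, h1, h2, h3, h4⟩ | ⟨h1, h2⟩)
  · exact .inl ⟨v, h1, h h2, h3⟩
  · exact .inr (.inl ⟨u, v, h1, h h2, h h3, h4⟩)
  · exact .inr (.inr ⟨h h1, h2⟩)

lemma rg_disj {S T : Set (Option V)} (h : Disjoint S T) : Disjoint (Rg G S) (Rg G T) := by
  rw [Set.disjoint_left] at h ⊢
  rintro x (⟨v, h1, h2, rfl⟩ | ⟨u, v, h1, h2, h3, h4⟩ | ⟨h1, h2⟩)
    (⟨v', k1, k2, k3⟩ | ⟨u', v', k1, k2, k3, k4⟩ | ⟨k1, k2⟩)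
  · exact h h2 (G.pos_injOn k1 h1 k3 ▸ k2)
  · rcases G.arc_avoid _ _ k1 _ h1 k4 with rfl | rfl
    exacts [h h2 k2, h h2 k3]
  · exact outer_sub G k2 (pos_mem_image G h1)
  · subst k3
    rcases G.arc_avoid _ _ h1 _ k1 h4 with rfl | rfl
    exacts [h h2 k2, h h3 k2]
  · have hne : s(u, v) ≠ s(u', v') := by
      intro e
      rcases Sym2.eq_iff.1 e with ⟨rfl, rfl⟩ | ⟨rfl, rfl⟩
      exacts [h h2 k2, h h2 k3]
    obtain ⟨w, ⟨e | e, e' | e'⟩, -⟩ := G.arc_meet _ _ _ _ h1 k1 hne ⟨h4, k4⟩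
    · exact h h2 (e.symm.trans e' ▸ k2)
    · exact h h2 (e.symm.trans e' ▸ k3)
    · exact h h3 (e.symm.trans e' ▸ k2)
    · exact h h3 (e.symm.trans e' ▸ k3)
  · exact outer_sub G k2 (arc_sub_image G h1 h4)
  · exact outer_sub G h2 (k3 ▸ pos_mem_image G k1)
  · exact outer_sub G h2 (arc_sub_image G k1 k4)
  · exact h h1 k1

lemma rg_closed {T : Set (Option V)} (h : none ∉ T) : IsClosed (Rg G T) := by
  have e : Rg G T = (⋃ v ∈ {v | v ∈ G.verts ∧ some v ∈ T}, {G.pos v}) ∪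
      ⋃ p ∈ {p : V × V | G.Adj p.1 p.2 ∧ some p.1 ∈ T ∧ some p.2 ∈ T}, G.arc s(p.1, p.2) := by
    ext x
    simp only [Rg, mem_ofPred_eq, mem_union, mem_iUnion, exists_prop, mem_singleton_iff, h,
      false_and, or_false, Prod.exists, and_assoc, eq_comm (a := x)]
  rw [e]
  refine IsClosed.union (Set.Finite.isClosed_biUnion (G.finite_verts.subset fun v hv => hv.1)
    fun v _ => isClosed_singleton) (Set.Finite.isClosed_biUnion
      ((G.finite_verts.prod G.finite_verts).subset fun p hp =>
        ⟨G.adj_mem _ _ hp.1, adj_mem' G hp.1⟩) fun p hp => (arc_data G hp.1).1.isClosed)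

/-- the point of a vertex -/
def pt (G : PlaneGraph V) (o : ℝ × ℝ) (a : Option V) : ℝ × ℝ := a.elim o G.pos

lemma pt_mem {S : Set (Option V)} {o : ℝ × ℝ} (ho : o ∈ G.outerFace) {a : Option V} (ha : a ∈ S)
    (hv : Val G a) : pt G o a ∈ Rg G S := by
  rcases a with _ | v
  · exact .inr (.inr ⟨ha, ho⟩)
  · exact .inl ⟨v, hv v rfl, ha, rfl⟩

lemma rg_join {S : Set (Option V)} {o : ℝ × ℝ} (ho : o ∈ G.outerFace) {a b : Option V}
    (ha : a ∈ S) (hv : Val G a) (h : Rch (HG G) S a b) (hS : none ∉ S) :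
    JoinedIn (Rg G S) (pt G o a) (pt G o b) := by
  induction h with
  | refl => exact JoinedIn.refl (pt_mem ho ha hv)
  | @tail b c h1 h2 ih =>
    refine ih.trans ?_
    rcases b with _ | u
    · exact (hS h2.2.1).elim
    rcases c with _ | v
    · exact (hS h2.2.2).elim
    have := hg_some.1 h2.1
    exact (arc_data G this).2.2.1.mono fun x hx => .inr (.inl ⟨u, v, this, h2.2.1, h2.2.2, hx⟩)

lemma joined_pre {F : Set (ℝ × ℝ)} {x y : ℝ × ℝ} (h : JoinedIn F x y) :
    ∃ T ⊆ F, IsPreconnected T ∧ x ∈ T ∧ y ∈ T :=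
  ⟨range h.somePath, by rintro _ ⟨t, rfl⟩; exact h.somePath_mem t,
    isPreconnected_range h.somePath.continuous, ⟨0, h.somePath.source⟩, ⟨1, h.somePath.target⟩⟩

lemma outer_pre {v : V} (h : G.OnOuter v) :
    IsPreconnected (insert (G.pos v) G.outerFace) :=
  (outer_conn G).isPreconnected.subset_closure (subset_insert _ _)
    (insert_subset (frontier_subset_closure h) subset_closure)

lemma rg_pre {S : Set (Option V)} {o : ℝ × ℝ} (ho : o ∈ G.outerFace) {a b : Option V}
    (ha : a ∈ S) (hv : Val G a) (h : Rch (HG G) S a b) :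
    ∃ T ⊆ Rg G S, IsPreconnected T ∧ pt G o a ∈ T ∧ pt G o b ∈ T := by
  induction h with
  | refl => exact ⟨{pt G o a}, singleton_subset_iff.2 (pt_mem ho ha hv), isPreconnected_singleton,
      rfl, rfl⟩
  | @tail b c h1 h2 ih =>
    obtain ⟨T, hT, hp, ta, tb⟩ := ih
    suffices ∃ T' ⊆ Rg G S, IsPreconnected T' ∧ pt G o b ∈ T' ∧ pt G o c ∈ T' by
      obtain ⟨T', hT', hp', tb', tc⟩ := this
      exact ⟨T ∪ T', union_subset hT hT', hp.union _ tb tb' hp', .inl ta, .inr tc⟩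
    have hf : ∀ v, G.OnOuter v → v ∈ G.verts → none ∈ S → some v ∈ S →
        ∃ T' ⊆ Rg G S, IsPreconnected T' ∧ o ∈ T' ∧ G.pos v ∈ T' := fun v h1 h2 h3 h4 =>
      ⟨_, insert_subset (.inl ⟨v, h2, h4, rfl⟩) fun x hx => .inr (.inr ⟨h3, hx⟩),
        outer_pre h1, .inr ho, .inl rfl⟩
    rcases b with _ | u <;> rcases c with _ | v
    · exact ((HG G).irrefl h2.1).elim
    · have := hg_none.1 h2.1
      exact hf v this.2 this.1 h2.2.1 h2.2.2
    · have := hg_none.1 h2.1.symm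
      obtain ⟨T', a1, a2, a3, a4⟩ := hf u this.2 this.1 h2.2.2 h2.2.1
      exact ⟨T', a1, a2, a4, a3⟩
    · have := hg_some.1 h2.1
      exact joined_pre ((arc_data G this).2.2.1.mono fun x hx =>
        .inr (.inl ⟨u, v, this, h2.2.1, h2.2.2, hx⟩))

lemma pre_joined {T U : Set (ℝ × ℝ)} (hT : IsPreconnected T) (hU : IsOpen U) (h : T ⊆ U)
    {x y : ℝ × ℝ} (hx : x ∈ T) (hy : y ∈ T) : JoinedIn U x y := by
  have h1 : IsConnected (connectedComponentIn U x) :=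
    isConnected_connectedComponentIn_iff.2 (h hx)
  have h2 := (hU.connectedComponentIn.isConnected_iff_isPathConnected).1 h1
  have h3 := hT.subset_connectedComponentIn hx h
  exact (h2.joinedIn _ (h3 hx) _ (h3 hy)).mono (connectedComponentIn_subset _ _)

open Classical in
lemma nm_gen {n : ℕ} (X : Fin n → Set (Option V)) (hd : ∀ i j, i ≠ j → Disjoint (X i) (X j))
    (hc : ∀ i, Conn (HG G) (X i)) (ha : ∀ i, ∃ j, Adjs (HG G) (X i) (X j)) :
    ∃ (P : Fin n → ℂ) (S : Fin n → Fin n → Set ℂ),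
      (∀ i j, Adjs (HG G) (X i) (X j) → JoinedIn (S i j) (P i) (P j)) ∧
      ∀ a b c d, a ≠ c → a ≠ d → b ≠ c → b ≠ d → Disjoint (S a b) (S c d) := by
  obtain ⟨o, ho⟩ := (outer_conn G).nonempty
  have hr : ∀ i, ∃ a ∈ X i, Val G a := fun i => by
    obtain ⟨j, x, hx, y, hy, h⟩ := ha i
    exact ⟨x, hx, val_left h⟩
  choose r hr hv using hr
  set Oth : Fin n → Fin n → Set (Option V) := fun i j => ⋃ k ∈ {k | k ≠ i ∧ k ≠ j}, X k with hO
  set S : Fin n → Fin n → Set (ℝ × ℝ) := fun i j =>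
    if none ∈ X i ∪ X j then (Rg G (Oth i j))ᶜ else Rg G (X i ∪ X j) with hS
  have hdO : ∀ i j, Disjoint (X i ∪ X j) (Oth i j) := fun i j => by
    simp only [hO, Set.disjoint_left, mem_iUnion]
    rintro x (hx | hx) ⟨k, hk, hxk⟩
    · exact Set.disjoint_left.1 (hd _ _ hk.1) hxk hx
    · exact Set.disjoint_left.1 (hd _ _ hk.2) hxk hx
  have hne : ∀ a b c d, a ≠ c → a ≠ d → b ≠ c → b ≠ d → Disjoint (X a ∪ X b) (X c ∪ X d) :=
    fun a b c d h1 h2 h3 h4 => by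
      simp only [disjoint_union_left, disjoint_union_right]
      exact ⟨⟨hd _ _ h1, hd _ _ h3⟩, ⟨hd _ _ h2, hd _ _ h4⟩⟩
  have hsub : ∀ a b c d, a ≠ c → a ≠ d → b ≠ c → b ≠ d → X c ∪ X d ⊆ Oth a b := by
    intro a b c d h1 h2 h3 h4 x hx
    simp only [hO, mem_iUnion]
    rcases hx with hx | hx
    exacts [⟨c, ⟨h1.symm, h3.symm⟩, hx⟩, ⟨d, ⟨h2.symm, h4.symm⟩, hx⟩]
  refine ⟨fun i => hE.symm (pt G o (r i)), fun i j => hE.symm '' S i j, ?_, ?_⟩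
  · intro i j hij
    suffices JoinedIn (S i j) (pt G o (r i)) (pt G o (r j)) from this.map hE.symm.continuous
    have hR := conn_union (hc i) (hc j) hij _ (.inl (hr i)) _ (.inr (hr j))
    simp only [hS]
    split_ifs with hn
    · obtain ⟨T, hT, hp, t1, t2⟩ := rg_pre ho (.inl (hr i)) (hv i) hR
      refine pre_joined hp (rg_closed (Set.disjoint_left.1 (hdO i j) hn)).isOpen_compl
        (fun x hx => ?_) t1 t2
      exact Set.disjoint_left.1 (rg_disj (hdO i j)) (hT hx)
    · exact rg_join ho (.inl (hr i)) (hv i) hR hn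
  · intro a b c d h1 h2 h3 h4
    refine (Set.disjoint_image_iff hE.symm.injective).2 ?_
    have hD := hne a b c d h1 h2 h3 h4
    simp only [hS]
    split_ifs with n1 n2 n2
    · exact (Set.disjoint_left.1 hD n1 n2).elim
    · exact Set.disjoint_left.2 fun x hx hx' => hx (rg_mono (hsub a b c d h1 h2 h3 h4) hx')
    · exact Set.disjoint_left.2 fun x hx hx' =>
        hx' (rg_mono (hsub c d a b h1.symm h3.symm h2.symm h4.symm) hx)
    · exact rg_disj hD

lemma hg_nm : NM (HG G) := by
  constructor
  · intro X _ hc hd ha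
    have ha' : ∀ i j, i ≠ j → Adjs (HG G) (X i) (X j) := fun i j h =>
      (lt_or_gt_of_ne h).elim (ha i j) fun h => (ha j i h).symm
    obtain ⟨P, S, h1, h2⟩ := nm_gen X (fun i j h =>
      (lt_or_gt_of_ne h).elim (hd i j) fun h => (hd j i h).symm) hc
      (fun i => ⟨i + 1, ha' _ _ (by revert i; decide)⟩)
    exact ht_k5 P S (fun i j h => h1 i j (ha i j h)) fun a b c d _ _ => h2 a b c d
  · intro X Y _ _ hcX hcY hX hY hd ha
    have hX' : ∀ i j, i ≠ j → Disjoint (X i) (X j) := fun i j h =>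
      (lt_or_gt_of_ne h).elim (hX i j) fun h => (hX j i h).symm
    have hY' : ∀ i j, i ≠ j → Disjoint (Y i) (Y j) := fun i j h =>
      (lt_or_gt_of_ne h).elim (hY i j) fun h => (hY j i h).symm
    have hA : ∀ i j : Fin 6, i < 3 ∧ 3 ≤ j →
        Adjs (HG G) (Fin.append X Y i) (Fin.append X Y j) := by
      intro i j h
      induction i using Fin.addCases (m := 3) (n := 3) with
      | right i => exact absurd h.1 (by clear h; revert i; decide)
      | left i =>
        induction j using Fin.addCases (m := 3) (n := 3) with
        | left j => exact absurd h.2 (by clear h; revert j; decide)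
        | right j => rw [Fin.append_left, Fin.append_right]; exact ha i j
    obtain ⟨P, S, h1, h2⟩ := nm_gen (n := 6) (Fin.append X Y) (by
        intro i j h
        induction i using Fin.addCases (m := 3) (n := 3) with
        | right i =>
          induction j using Fin.addCases (m := 3) (n := 3) with
          | left j => rw [Fin.append_left, Fin.append_right]; exact (hd j i).symm
          | right j => rw [Fin.append_right, Fin.append_right]; exact hY' i j fun e => h (e ▸ rfl)
        | left i =>
          induction j using Fin.addCases (m := 3) (n := 3) with
          | left j => rw [Fin.append_left, Fin.append_left]; exact hX' i j fun e => h (e ▸ rfl)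
          | right j => rw [Fin.append_left, Fin.append_right]; exact hd i j)
      (by
        intro i
        induction i using Fin.addCases (m := 3) (n := 3) with
        | left i => rw [Fin.append_left]; exact hcX i
        | right i => rw [Fin.append_right]; exact hcY i)
      (fun i => by
        by_cases h : i < 3
        · exact ⟨3, hA i 3 ⟨h, le_rfl⟩⟩
        · exact ⟨0, (hA 0 i ⟨by decide, not_lt.1 h⟩).symm⟩)
    exact ht_k33 P S (fun i j h => h1 i j (hA i j h)) fun a b c d _ _ => h2 a b c d

end

section

variable {V : Type u} (G : PlaneGraph V)

/-! ## Chains of triangles give harmonicas -/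

/-- the plane subgraph with vertices in `S` and edges in `E` -/
def sub (S : Set V) (E : V → V → Prop) : PlaneGraph V where
  verts := G.verts ∩ S
  Adj u v := G.Adj u v ∧ u ∈ S ∧ v ∈ S ∧ (E u v ∨ E v u)
  finite_verts := G.finite_verts.subset inter_subset_left
  adj_symm := fun u v h => ⟨G.adj_symm u v h.1, h.2.2.1, h.2.1, h.2.2.2.symm⟩
  adj_irrefl := fun v h => G.adj_irrefl v h.1
  adj_mem := fun u v h => ⟨G.adj_mem u v h.1, h.2.1⟩
  pos := G.pos
  arc := G.arc
  pos_injOn := G.pos_injOn.mono inter_subset_left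
  arc_arc := fun u v h => G.arc_arc u v h.1
  arc_avoid := fun u v h w hw hm => G.arc_avoid u v h.1 w hw.1 hm
  arc_meet := fun u v x y h h' hne => G.arc_meet u v x y h.1 h'.1 hne

lemma pg_ext {A B : PlaneGraph V} (h1 : A.verts = B.verts) (h2 : A.Adj = B.Adj)
    (h3 : A.pos = B.pos) (h4 : A.arc = B.arc) : A = B := by
  cases A; cases B; dsimp only at h1 h2 h3 h4; subst h1 h2 h3 h4; rfl

variable {G}

lemma sub_sub {S : Set V} {E : V → V → Prop} : (sub G S E).IsSubgraph G :=
  ⟨inter_subset_left, fun _ _ h => h.1, fun _ _ => rfl, fun _ _ _ => rfl⟩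

lemma del_sub {S D : Set V} {E : V → V → Prop} (hD : ∀ v ∈ D, v ∉ S) :
    (sub G (S ∪ D) (fun u v => E u v ∨ u ∈ D)).deleteVerts D = sub G S E := by
  refine pg_ext ?_ ?_ rfl rfl
  · ext v
    have := hD v
    simp only [PlaneGraph.deleteVerts, sub, mem_sdiff, mem_inter_iff, mem_union]; tauto
  · ext u v
    have := hD v
    have := hD u
    simp only [PlaneGraph.deleteVerts, sub, mem_union]; tauto

lemma sub_adj_up {S D : Set V} {E : V → V → Prop} {u v : V} (h : (sub G S E).Adj u v) :
    (sub G (S ∪ D) (fun u v => E u v ∨ u ∈ D)).Adj u v :=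
  ⟨h.1, .inl h.2.1, .inl h.2.2.1, h.2.2.2.imp .inl .inl⟩

lemma edge_comm {H : PlaneGraph V} {u v : V} (h : H.EdgeOnOuter u v) : H.EdgeOnOuter v u := by
  unfold PlaneGraph.EdgeOnOuter at h ⊢; rwa [arc_comm]

lemma tri_out {S : Set V} {E : V → V → Prop} {z a b : V} (hS : ∀ v ∈ S, G.OnOuter v)
    (hz : G.OnOuter z) (hzS : z ∉ S) (hza : G.Adj z a) (hzb : G.Adj z b)
    (h : (sub G S E).Adj a b) : (sub G S E).EdgeOnOuter a b := by
  have key := tri_lemma (sub G (insert z S) fun _ _ => True) (z := z) (a := a) (b := b) (by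
    intro v hv
    refine onOuter_mono sub_sub hv ?_
    rcases hv.2 with rfl | h
    exacts [hz, hS v h])
    ⟨hza, .inl rfl, .inr h.2.1, .inl trivial⟩
    ⟨h.1, .inr h.2.1, .inr h.2.2.1, .inl trivial⟩
    ⟨G.adj_symm _ _ hzb, .inr h.2.2.1, .inl rfl, .inl trivial⟩
  refine edgeOuter_mono (H := sub G S E) (G := (sub G (insert z S) fun _ _ => True).deleteVerts {z})
    ⟨?_, ?_, fun _ _ => rfl, fun _ _ _ => rfl⟩ h key
  · rintro v ⟨h1, h2⟩
    exact ⟨⟨h1, .inr h2⟩, fun e => hzS (e ▸ h2)⟩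
  · rintro u v ⟨h1, h2, h3, _⟩
    exact ⟨⟨h1, .inr h2, .inr h3, .inl trivial⟩, fun e => hzS (e ▸ h2), fun e => hzS (e ▸ h3)⟩

/-- admissible vertex sets -/
def Adm (G : PlaneGraph V) (W : Set (Option V)) (S : Set V) : Prop :=
  ∀ v ∈ S, some v ∈ W ∧ G.OnOuter v

/-- standing assumptions on the current path -/
structure Inv (G : PlaneGraph V) (L : V → Finset ℕ) (W : Set (Option V)) (p1 p2 : V) : Prop where
  m1 : some p1 ∈ W
  m2 : some p2 ∈ W
  o1 : G.OnOuter p1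
  o2 : G.OnOuter p2
  adj : G.Adj p1 p2
  eo : ∀ S E, Adm G W S → (sub G S E).Adj p1 p2 → (sub G S E).EdgeOnOuter p1 p2
  card : ∀ v, some v ∈ W → v ≠ p1 → v ≠ p2 → 3 ≤ (L v).card ∧ (¬ G.OnOuter v → 5 ≤ (L v).card)
  val : ∀ a ∈ W, ∃ v ∈ G.verts, a = some v

variable {L : V → Finset ℕ} {W : Set (Option V)} {p1 p2 q1 q2 : V}

lemma Inv.canvas (h : Inv G L W p1 p2) {S : Set V} {E : V → V → Prop} (hS : Adm G W S)
    (ha : (sub G S E).Adj p1 p2) {d : ℕ × ℕ} (hd : ProperEdgeColoring L p1 p2 d) :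
    IsPathCanvas (sub G S E) p1 p2 L := by
  classical
  have hne : p1 ≠ p2 := fun e => G.adj_irrefl _ (e ▸ h.adj)
  have hv : ∀ v ∈ (sub G S E).verts, (sub G S E).OnOuter v := fun v hv =>
    onOuter_mono sub_sub hv (hS v hv.2).2
  have h1 := (sub G S E).adj_mem _ _ ha
  have h2 := adj_mem' _ ha
  refine ⟨hne, fun u v => Or.symm ∘ Or.imp And.symm And.symm, ?_, ?_, ?_, ?_, ?_, ?_,
    fun v hv' hn => (hn (hv v hv')).elim, ?_,
    fun v => if v = p1 then d.1 else d.2, ?_, ?_⟩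
  · rintro u v (⟨rfl, rfl⟩ | ⟨rfl, rfl⟩)
    exacts [ha, (sub G S E).adj_symm _ _ ha]
  · rintro u v (⟨rfl, rfl⟩ | ⟨rfl, rfl⟩)
    exacts [.inl rfl, .inr rfl]
  · rintro v (rfl | rfl)
    exacts [h1, h2]
  · rintro v (rfl | rfl)
    exacts [hv _ h1, hv _ h2]
  · rintro u v (⟨rfl, rfl⟩ | ⟨rfl, rfl⟩)
    exacts [h.eo _ _ hS ha, edge_comm (h.eo _ _ hS ha)]
  · intro v hv
    by_cases e1 : v = p1
    · exact ⟨d.1, e1 ▸ hd.1⟩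
    by_cases e2 : v = p2
    · exact ⟨d.2, e2 ▸ hd.2.1⟩
    exact Finset.card_pos.1 (by have := (h.card v (hS v hv.2).1 e1 e2).1; omega)
  · intro v hv hn
    exact (h.card v (hS v hv.2).1 (fun e => hn (.inl e)) (fun e => hn (.inr e))).1
  · rintro v (rfl | rfl)
    · simpa using hd.1
    · simpa [hne.symm] using hd.2.1
  · rintro u v (⟨rfl, rfl⟩ | ⟨rfl, rfl⟩)
    · simpa [hne.symm] using hd.2.2
    · simpa [hne.symm] using hd.2.2.symm

/-- the conclusion -/
def Har (G : PlaneGraph V) (L : V → Finset ℕ) (q1 q2 : V) (W : Set (Option V)) (p1 p2 : V)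
    (C : Set (ℕ × ℕ)) : Prop := ∃ S E, Adm G W S ∧ (sub G S E).Adj q1 q2 ∧ (sub G S E).Adj p1 p2 ∧
  IsHarmonica L (sub G S E) p1 p2 q1 q2 C

/-- assumptions for a dictatorship -/
structure DI (G : PlaneGraph V) (L : V → Finset ℕ) (Ls : Option V → Finset ℕ) (W : Set (Option V))
    (z w : V) (c : ℕ) (p1 p2 : V) (C : Set (ℕ × ℕ)) (Cw : Finset ℕ) : Prop where
  inv : Inv G L W p1 p2
  hz : (z = p1 ∧ w = p2 ∧ (∀ d ∈ C, d.1 = c) ∧ sndColors C = (Cw : Set ℕ)) ∨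
    (z = p2 ∧ w = p1 ∧ (∀ d ∈ C, d.2 = c) ∧ fstColors C = (Cw : Set ℕ))
  pr : ∀ d ∈ C, ProperEdgeColoring L p1 p2 d
  dict : IsDictatorship C
  ls : ∀ v, some v ∈ W → v ≠ p1 → v ≠ p2 → Ls (some v) = L v
  lw : Ls (some w) = Cw ∪ {c}

/-- assumptions for a democracy -/
structure MI (G : PlaneGraph V) (L : V → Finset ℕ) (Ls : Option V → Finset ℕ) (W : Set (Option V))
    (p1 p2 : V) (L0 : Finset ℕ) : Prop where
  inv : Inv G L W p1 p2
  l1 : L0 ⊆ L p1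
  l2 : L0 ⊆ L p2
  ls : ∀ v, some v ∈ W → v ≠ p1 → v ≠ p2 → Ls (some v) = L v

/-- the induction claim -/
def Mot (G : PlaneGraph V) (L : V → Finset ℕ) (q1 q2 : V) (Ls : Option V → Finset ℕ)
    (W : Set (Option V)) : Src (Option V) → Prop
  | .dict z c => ∀ z' w p1 p2 C Cw, z = some z' → DI G L Ls W z' w c p1 p2 C Cw →
    Har G L q1 q2 W p1 p2 C
  | .dem a b L0 => ∀ p1 p2 x y, a = some p1 → b = some p2 → x ≠ y → L0 = {x, y} →
    MI G L Ls W p1 p2 L0 → Har G L q1 q2 W p1 p2 {(x, y), (y, x)}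

lemma DI.facts {Ls : Option V → Finset ℕ} {z w : V} {c : ℕ} {C : Set (ℕ × ℕ)} {Cw : Finset ℕ}
    (h : DI G L Ls W z w c p1 p2 C Cw) : Cw ⊆ L w ∧ c ∉ Cw ∧ G.Adj z w ∧ G.OnOuter z ∧
      G.OnOuter w ∧ some z ∈ W ∧ some w ∈ W ∧ (∀ v, v ≠ z → v ≠ w → v ≠ p1 ∧ v ≠ p2) ∧
      (({p1, p2} : Set V) = {z, w}) ∧
      ((z = p1 ∧ ∃ a, ∀ c ∈ C, c.1 = a) ∨ (z = p2 ∧ ∃ a, ∀ c ∈ C, c.2 = a)) := by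
  have I := h.inv
  rcases h.hz with ⟨rfl, rfl, h1, h2⟩ | ⟨rfl, rfl, h1, h2⟩
  · have key : ∀ x ∈ Cw, x ∈ L w ∧ x ≠ c := by
      intro x hx
      obtain ⟨d, hd, rfl⟩ : x ∈ sndColors C := h2 ▸ hx
      exact ⟨(h.pr d hd).2.1, h1 d hd ▸ (h.pr d hd).2.2.symm⟩
    exact ⟨fun x hx => (key x hx).1, fun hc => (key c hc).2 rfl, I.adj, I.o1, I.o2, I.m1, I.m2,
      fun v a b => ⟨a, b⟩, rfl, .inl ⟨rfl, c, h1⟩⟩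
  · have key : ∀ x ∈ Cw, x ∈ L w ∧ x ≠ c := by
      intro x hx
      obtain ⟨d, hd, rfl⟩ : x ∈ fstColors C := h2 ▸ hx
      exact ⟨(h.pr d hd).1, h1 d hd ▸ (h.pr d hd).2.2⟩
    exact ⟨fun x hx => (key x hx).1, fun hc => (key c hc).2 rfl, G.adj_symm _ _ I.adj, I.o2, I.o1,
      I.m2, I.m1, fun v a b => ⟨b, a⟩, pair_comm _ _, .inr ⟨rfl, c, h1⟩⟩

lemma union_c {A B : Finset ℕ} {c : ℕ} (hA : c ∉ A) (hB : c ∉ B) (h : A ∪ {c} = B ∪ {c}) :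
    A = B := by
  ext x
  have := Finset.ext_iff.1 h x
  simp only [Finset.mem_union, Finset.mem_singleton] at this
  by_cases e : x = c
  · subst e; simp [hA, hB]
  · simpa [e] using this

lemma d_end_case {Ls : Option V → Finset ℕ} {z w : V} {c : ℕ} {C : Set (ℕ × ℕ)} {Cw : Finset ℕ}
    (h : DI G L Ls W z w c p1 p2 C Cw) (hq : G.Adj q1 q2) (qo : G.EdgeOnOuter q1 q2)
    (m1 : some q1 ∈ W) (m2 : some q2 ∈ W) (hz : z = q1 ∨ z = q2) : Har G L q1 q2 W p1 p2 C := by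
  have I := h.inv
  obtain ⟨-, -, -, -, -, -, -, -, hP, hzd⟩ := h.facts
  obtain ⟨d, hd, -⟩ := h.dict.1
  have oq1 : G.OnOuter q1 := qo (arc_data G hq).2.2.2.1
  have oq2 : G.OnOuter q2 := qo (arc_data G hq).2.2.2.2
  have qne : q1 ≠ q2 := fun e => G.adj_irrefl _ (e ▸ hq)
  have pne : p1 ≠ p2 := fun e => G.adj_irrefl _ (e ▸ I.adj)
  have hS : Adm G W {p1, p2, q1, q2} := by
    rintro v (rfl | rfl | rfl | rfl)
    exacts [⟨I.m1, I.o1⟩, ⟨I.m2, I.o2⟩, ⟨m1, oq1⟩, ⟨m2, oq2⟩]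
  have aq : (sub G {p1, p2, q1, q2} (fun u v => pathAdj p1 p2 u v ∨ pathAdj q1 q2 u v)).Adj q1 q2 :=
    ⟨hq, by simp, by simp, .inl (.inr (.inl ⟨rfl, rfl⟩))⟩
  have ap : (sub G {p1, p2, q1, q2} (fun u v => pathAdj p1 p2 u v ∨ pathAdj q1 q2 u v)).Adj p1 p2 :=
    ⟨I.adj, by simp, by simp, .inl (.inl (.inl ⟨rfl, rfl⟩))⟩
  have hv : (sub G {p1, p2, q1, q2} (fun u v => pathAdj p1 p2 u v ∨ pathAdj q1 q2 u v)).verts =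
      {p1, p2, q1, q2} := inter_eq_right.2 (by
    rintro v (rfl | rfl | rfl | rfl)
    exacts [G.adj_mem _ _ I.adj, adj_mem' G I.adj, G.adj_mem _ _ hq, adj_mem' G hq])
  have he : ∀ u v, (sub G {p1, p2, q1, q2}
      (fun u v => pathAdj p1 p2 u v ∨ pathAdj q1 q2 u v)).Adj u v →
      pathAdj p1 p2 u v ∨ pathAdj q1 q2 u v := by
    rintro u v ⟨-, -, -, h | h⟩
    · exact h
    · simp only [pathAdj] at h ⊢; tauto
  have hcv := I.canvas hS ap (h.pr d hd)
  refine ⟨_, _, hS, aq, ap, ?_⟩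
  by_cases hs : (q1 = p1 ∧ q2 = p2) ∨ (q1 = p2 ∧ q2 = p1)
  · refine .same _ _ _ _ _ _ hcv h.pr (.inl h.dict) hs ?_ ?_
    · rw [hv]; ext v; rcases hs with ⟨rfl, rfl⟩ | ⟨rfl, rfl⟩ <;> simp <;> tauto
    · intro u v huv
      have := he u v huv
      simp only [pathAdj] at this ⊢
      rcases hs with ⟨rfl, rfl⟩ | ⟨rfl, rfl⟩ <;> tauto
  · refine .cherry _ _ _ _ _ z _ hcv h.pr h.dict qne aq (edgeOuter_mono sub_sub aq qo) hv he ?_ hzd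
    ext v
    simp only [mem_inter_iff, mem_insert_iff, mem_singleton_iff]
    rcases hzd with ⟨e, -⟩ | ⟨e, -⟩ <;> rcases hz with e' | e' <;> subst e <;> subst e' <;> grind

lemma dem_fst {x y : ℕ} : fstColors {(x, y), (y, x)} = ((({x, y} : Finset ℕ)) : Set ℕ) := by
  ext t; simp [fstColors, eq_comm]

lemma dem_snd {x y : ℕ} : sndColors {(x, y), (y, x)} = ((({x, y} : Finset ℕ)) : Set ℕ) := by
  ext t; simp [sndColors, eq_comm, or_comm]

lemma d_tri_case {Ls : Option V → Finset ℕ} {W' : Set (Option V)} {z w u1 u2 : V} {c : ℕ}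
    {C : Set (ℕ × ℕ)} {Cw L0 : Finset ℕ} (h : DI G L Ls W z w c p1 p2 C Cw) (hq : G.Adj q1 q2)
    (qo : G.EdgeOnOuter q1 q2) (hu1 : some u1 ∈ W') (hu2 : some u2 ∈ W') (h1 : G.Adj z u1)
    (h2 : G.Adj z u2) (h12 : G.Adj u1 u2) (hL0 : L0.card = 2) (hc : c ∉ L0)
    (hL1 : Ls (some u1) = L0 ∪ {c}) (hL2 : Ls (some u2) = L0 ∪ {c}) (hW : W' ⊆ W \ {some z})
    (hK : ∀ v, some v ∈ W' → G.OnOuter v → G.Adj z v → v = u1 ∨ v = u2)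
    (hrec : Mot G L q1 q2 Ls W' (.dem (some u1) (some u2) L0)) : Har G L q1 q2 W p1 p2 C := by
  classical
  have I := h.inv
  obtain ⟨cwL, ccw, azw, oz, ow, mz, mw, hoff, hP, hzd⟩ := h.facts
  obtain ⟨d, hd, -⟩ := h.dict.1
  have zW' : some z ∉ W' := fun e => (hW e).2 rfl
  have wW' : some w ∈ W' → w = u1 ∨ w = u2 := fun e => hK w e ow azw
  have cwe : ∀ u, u = w → Ls (some u) = L0 ∪ {c} → Cw = L0 := by
    rintro u rfl e
    exact union_c ccw hc (h.lw.symm.trans e)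
  have hu : ∀ u, some u ∈ W' → Ls (some u) = L0 ∪ {c} → L0 ⊆ L u ∧ G.OnOuter u ∧ u ≠ z ∧
      (u ≠ w → L u = L0 ∪ {c}) := by
    intro u uW' hLu
    have uz : u ≠ z := fun e => zW' (e ▸ uW')
    by_cases e : u = w
    · have := cwe u e hLu
      subst e
      exact ⟨this ▸ cwL, ow, uz, fun e => (e rfl).elim⟩
    · have hp := hoff u uz e
      have e1 := h.ls u (hW uW').1 hp.1 hp.2
      have e2 : L u = L0 ∪ {c} := e1.symm.trans hLu
      refine ⟨e2 ▸ Finset.subset_union_left, ?_, uz, fun _ => e2⟩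
      by_contra ho
      have := (I.card u (hW uW').1 hp.1 hp.2).2 ho
      rw [e2, card3 hL0 hc] at this
      omega
  obtain ⟨a1, o1, uz1, b1⟩ := hu u1 hu1 hL1
  obtain ⟨a2, o2, uz2, b2⟩ := hu u2 hu2 hL2
  have nW' : ∀ v, some v ∈ W' → v ≠ u1 → v ≠ u2 → v ≠ p1 ∧ v ≠ p2 := fun v hv e1 e2 =>
    hoff v (fun e => zW' (e ▸ hv)) (fun e => (wW' (e ▸ hv)).elim (fun e' => e1 (e.trans e'))
      fun e' => e2 (e.trans e'))
  obtain ⟨x, y, xy, rfl⟩ := Finset.card_eq_two.1 hL0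
  obtain ⟨S, E, hS, aq, au, hh⟩ := hrec u1 u2 x y rfl rfl xy rfl
    ⟨⟨hu1, hu2, o1, o2, h12, fun S E hS ha => tri_out (fun v hv => (hS v hv).2) oz
        (fun e => zW' (hS z e).1) h1 h2 ha,
      fun v hv e1 e2 => I.card v (hW hv).1 (nW' v hv e1 e2).1 (nW' v hv e1 e2).2,
      fun a ha => I.val a (hW ha).1⟩, a1, a2,
      fun v hv e1 e2 => h.ls v (hW hv).1 (nW' v hv e1 e2).1 (nW' v hv e1 e2).2⟩
  have hD : ∀ v ∈ ({p1, p2} : Set V) \ {u1, u2}, v ∉ S := by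
    rw [hP]
    rintro v ⟨rfl | rfl, hv⟩ hvS
    · exact zW' (hS v hvS).1
    · exact hv (wW' (hS v hvS).1)
  have pm : ∀ v ∈ ({p1, p2} : Set V), v ∈ S ∪ (({p1, p2} : Set V) \ {u1, u2}) := by
    intro v hv
    by_cases e : v ∈ ({u1, u2} : Set V)
    · rcases e with rfl | rfl
      exacts [.inl au.2.1, .inl au.2.2.1]
    · exact .inr ⟨hv, e⟩
  have zD : z ∈ ({p1, p2} : Set V) \ {u1, u2} :=
    ⟨hP ▸ .inl rfl, by rintro (e | e); exacts [uz1 e.symm, uz2 e.symm]⟩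
  have zadj : ∀ u, G.Adj z u → u ∈ S ∪ (({p1, p2} : Set V) \ {u1, u2}) →
      (sub G (S ∪ (({p1, p2} : Set V) \ {u1, u2}))
      (fun u v => E u v ∨ u ∈ ({p1, p2} : Set V) \ {u1, u2})).Adj z u := fun u a b =>
    ⟨a, .inr zD, b, .inl (.inr zD)⟩
  have ap : (sub G (S ∪ (({p1, p2} : Set V) \ {u1, u2}))
      (fun u v => E u v ∨ u ∈ ({p1, p2} : Set V) \ {u1, u2})).Adj p1 p2 := by
    refine ⟨I.adj, pm _ (.inl rfl), pm _ (.inr rfl), ?_⟩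
    rcases hzd with ⟨e, -⟩ | ⟨e, -⟩
    · exact .inl (.inr (e ▸ zD))
    · exact .inr (.inr (e ▸ zD))
  have hS1 : Adm G W (S ∪ (({p1, p2} : Set V) \ {u1, u2})) := by
    rintro v (hv | ⟨rfl | rfl, -⟩)
    exacts [⟨(hW (hS v hv).1).1, (hS v hv).2⟩, ⟨I.m1, I.o1⟩, ⟨I.m2, I.o2⟩]
  have hPu : ∀ u, u ≠ z → u ∈ ({p1, p2} : Set V) → u = w := fun u uz hu => by
    rw [hP] at hu; exact hu.resolve_left uz
  have hnP : ∀ u, u ∉ ({p1, p2} : Set V) → u ≠ w := fun u hu e => hu (by rw [hP, e]; simp)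
  refine ⟨_, _, hS1, sub_adj_up aq, ap, ?_⟩
  refine .dict _ p1 p2 q1 q2 z w u1 u2 c {x, y} C {(x, y), (y, x)} (I.canvas hS1 ap (h.pr d hd)) h.pr
    h.dict (fun e => G.adj_irrefl _ (e ▸ hq)) (sub_adj_up aq)
    (edgeOuter_mono sub_sub (sub_adj_up aq) qo) ?_ (zadj _ h1 (.inl au.2.1))
    (zadj _ h2 (.inl au.2.2.1)) (sub_adj_up au) hL0 (fun e => b1 (hnP _ e)) (fun e => b2 (hnP _ e))
    (hPu _ uz1) (hPu _ uz2) ⟨x, y, xy, rfl⟩ dem_fst dem_snd (by rw [del_sub hD]; exact hh)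
  rcases h.hz with ⟨e1, e2, e3, e4⟩ | ⟨e1, e2, e3, e4⟩
  · exact .inl ⟨e1, e2, e3, fun e => by rw [e4, cwe _ e hL1], fun e => by rw [e4, cwe _ e hL2]⟩
  · exact .inr ⟨e1, e2, e3, fun e => by rw [e4, cwe _ e hL1], fun e => by rw [e4, cwe _ e hL2]⟩

lemma dem_proper {Ls : Option V → Finset ℕ} {x y : ℕ} (xy : x ≠ y)
    (h : MI G L Ls W p1 p2 {x, y}) : ∀ d ∈ ({(x, y), (y, x)} : Set (ℕ × ℕ)),
      ProperEdgeColoring L p1 p2 d := by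
  rintro d (rfl | rfl)
  · exact ⟨h.l1 (by simp), h.l2 (by simp), xy⟩
  · exact ⟨h.l1 (by simp), h.l2 (by simp), xy.symm⟩

lemma m_end_case {Ls : Option V → Finset ℕ} {x y : ℕ} (xy : x ≠ y)
    (h : MI G L Ls W p1 p2 {x, y}) (hs : (q1 = p1 ∧ q2 = p2) ∨ (q1 = p2 ∧ q2 = p1)) :
    Har G L q1 q2 W p1 p2 {(x, y), (y, x)} := by
  have I := h.inv
  have hS : Adm G W {p1, p2} := by
    rintro v (rfl | rfl)
    exacts [⟨I.m1, I.o1⟩, ⟨I.m2, I.o2⟩]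
  have ap : (sub G {p1, p2} (pathAdj p1 p2)).Adj p1 p2 :=
    ⟨I.adj, .inl rfl, .inr rfl, .inl (.inl ⟨rfl, rfl⟩)⟩
  refine ⟨_, _, hS, ?_, ap, .same _ _ _ _ _ _ (I.canvas hS ap (dem_proper xy h _ (.inl rfl)))
    (dem_proper xy h) (.inr ⟨x, y, xy, rfl⟩) hs (inter_eq_right.2 ?_) ?_⟩
  · rcases hs with ⟨rfl, rfl⟩ | ⟨rfl, rfl⟩
    exacts [ap, PlaneGraph.adj_symm _ _ _ ap]
  · rintro v (rfl | rfl)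
    exacts [G.adj_mem _ _ I.adj, adj_mem' G I.adj]
  · rintro u v ⟨-, -, -, h | h⟩
    · exact h
    · simp only [pathAdj] at h ⊢; tauto

lemma m_step_aux {Ls Ls' : Option V → Finset ℕ} {x y c : ℕ} {u : V} (xy : x ≠ y)
    (h : MI G L Ls W p1 p2 {x, y}) (hu : some u ∈ W) (h1 : G.Adj u p1) (h2 : G.Adj u p2)
    (hL : Ls (some u) = {x, y} ∪ {c}) (hc : c ∉ ({x, y} : Finset ℕ))
    (hl1 : Ls' (some p2) = {x, y} ∪ {c}) (hl2 : ∀ v, v ≠ p2 → Ls' (some v) = Ls (some v))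
    (hrec : Mot G L q1 q2 Ls' (W \ {some p1}) (.dict (some u) c)) :
    L u = {x, y} ∪ {c} ∧ G.OnOuter u ∧
    ∃ S E, Adm G W (S ∪ {p1}) ∧ (∀ v ∈ ({p1} : Set V), v ∉ S) ∧
      (sub G S E).Adj q1 q2 ∧ (sub G S E).Adj u p2 ∧
      IsHarmonica L (sub G S E) u p2 q1 q2 {(c, x), (c, y)} := by
  have I := h.inv
  have n1 : u ≠ p1 := fun e => G.adj_irrefl _ (e ▸ h1)
  have n2 : u ≠ p2 := fun e => G.adj_irrefl _ (e ▸ h2)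
  have n12 : p2 ≠ p1 := fun e => G.adj_irrefl _ (e ▸ I.adj)
  have e2 : L u = {x, y} ∪ {c} := (h.ls u hu n1 n2).symm.trans hL
  have ou : G.OnOuter u := by
    by_contra ho
    have := (I.card u hu n1 n2).2 ho
    rw [e2, card3 (Finset.card_pair xy) hc] at this
    omega
  have ne1 : ∀ v, some v ∈ W \ {some p1} → v ≠ p1 := fun v hv e => hv.2 (by rw [e]; rfl)
  simp only [Finset.mem_insert, Finset.mem_singleton, not_or] at hc
  obtain ⟨S, E, hS, aq, au, hh⟩ := hrec u p2 u p2 {(c, x), (c, y)} {x, y} rfl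
    ⟨⟨⟨hu, by simpa using n1⟩, ⟨I.m2, by simpa using n12⟩, ou, I.o2, h2,
      fun S E hS ha => tri_out (fun v hv => (hS v hv).2) I.o1
        (fun e => (hS p1 e).1.2 rfl) (G.adj_symm _ _ h1) I.adj ha,
      fun v hv e1 e2 => I.card v hv.1 (ne1 v hv) e2,
      fun a ha => I.val a ha.1⟩, .inl ⟨rfl, rfl, by simp, by ext t; simp [sndColors, eq_comm]⟩,
      by
        rintro d (rfl | rfl)
        · exact ⟨by simp [e2], h.l2 (by simp), hc.1⟩
        · exact ⟨by simp [e2], h.l2 (by simp), hc.2⟩,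
      ⟨⟨_, .inl rfl, _, .inr rfl, by simpa using xy⟩, .inl ⟨c, by simp⟩⟩,
      fun v hv e1 e2 => (hl2 v e2).trans (h.ls v hv.1 (ne1 v hv) e2), hl1⟩
  refine ⟨e2, ou, S, E, ?_, ?_, aq, au, hh⟩
  · rintro v (hv | rfl)
    exacts [⟨(hS v hv).1.1, (hS v hv).2⟩, ⟨I.m1, I.o1⟩]
  · rintro v rfl e
    exact (hS v e).1.2 rfl

lemma Inv.swap (h : Inv G L W p1 p2) : Inv G L W p2 p1 :=
  ⟨h.m2, h.m1, h.o2, h.o1, G.adj_symm _ _ h.adj, fun S E hS ha =>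
    edge_comm (h.eo S E hS (PlaneGraph.adj_symm _ _ _ ha)), fun v hv e1 e2 => h.card v hv e2 e1, h.val⟩

lemma ch_har (hq : G.Adj q1 q2) (qo : G.EdgeOnOuter q1 q2) {Ls : Option V → Finset ℕ}
    {s : Src (Option V)}
    (h : CH (HG G) {a | ∃ v, a = some v ∧ G.OnOuter v} (some q1) (some q2) Ls W s) :
    Mot G L q1 q2 Ls W s := by
  classical
  have qne : q1 ≠ q2 := fun e => G.adj_irrefl _ (e ▸ hq)
  induction h with
  | d_end Ls W z c hz m1 m2 =>
    rintro z' w p1 p2 C Cw rfl h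
    exact d_end_case h hq qo m1 m2 (by simpa using hz)
  | d_tri Ls W W' z u1 u2 c L0 hu1 hu2 h1 h2 h12 hL0 hc hL1 hL2 hW hK hrec ih =>
    rintro z' w p1 p2 C Cw rfl h
    obtain ⟨u1, -, rfl⟩ := h.inv.val u1 (hW hu1).1
    obtain ⟨u2, -, rfl⟩ := h.inv.val u2 (hW hu2).1
    exact d_tri_case h hq qo hu1 hu2 (hg_some.1 h1) (hg_some.1 h2) (hg_some.1 h12) hL0 hc hL1 hL2 hW
      (fun v hv ho ha => by simpa using hK (some v) hv ⟨v, rfl, ho⟩ (hg_some.2 ha)) ih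
  | m_end Ls W a b L0 hs m1 m2 =>
    rintro p1 p2 x y rfl rfl xy rfl h
    exact m_end_case xy h (by simpa using hs)
  | m_step1 Ls W a b u c L0 hu h1 h2 hL hc hrec ih =>
    rintro p1 p2 x y rfl rfl xy rfl h
    obtain ⟨u, -, rfl⟩ := h.inv.val u hu
    rw [hg_some] at h1 h2
    obtain ⟨e2, ou, S, E, hS, hD, aq, au, hh⟩ := m_step_aux xy h hu h1 h2 hL hc
      (by simp) (by intro v e; exact dif_neg (by simpa using e)) ih
    have ap : (sub G (S ∪ {p1}) (fun u v => E u v ∨ u ∈ ({p1} : Set V))).Adj p1 p2 :=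
      ⟨h.inv.adj, .inr rfl, .inl au.2.2.1, .inl (.inr rfl)⟩
    exact ⟨_, _, hS, sub_adj_up aq, ap, .demo1 _ p1 p2 q1 q2 u x y c {x, y} _ {(c, x), (c, y)}
      (h.inv.canvas hS ap (dem_proper xy h _ (.inl rfl))) (dem_proper xy h) ⟨x, y, xy, rfl⟩ qne
      (sub_adj_up aq) (edgeOuter_mono sub_sub (sub_adj_up aq) qo)
      ⟨h1, .inl au.2.1, .inr rfl, .inr (.inr rfl)⟩ (sub_adj_up au) e2 dem_fst dem_snd xy
      (by simp) rfl (by rw [del_sub hD]; exact hh)⟩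
  | m_step2 Ls W a b u c L0 hu h1 h2 hL hc hrec ih =>
    rintro p1 p2 x y rfl rfl xy rfl h
    obtain ⟨u, -, rfl⟩ := h.inv.val u hu
    rw [hg_some] at h1 h2
    obtain ⟨e2, ou, S, E, hS, hD, aq, au, hh⟩ := m_step_aux xy
      (⟨h.inv.swap, h.l2, h.l1, fun v hv e1 e2 => h.ls v hv e2 e1⟩ : MI G L Ls W p2 p1 {x, y})
      hu h2 h1 hL hc (by simp) (by intro v e; exact dif_neg (by simpa using e)) ih
    have ap : (sub G (S ∪ {p2}) (fun u v => E u v ∨ u ∈ ({p2} : Set V))).Adj p1 p2 :=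
      ⟨h.inv.adj, .inl au.2.2.1, .inr rfl, .inr (.inr rfl)⟩
    exact ⟨_, _, hS, sub_adj_up aq, ap, .demo2 _ p1 p2 q1 q2 u x y c {x, y} _ {(c, x), (c, y)}
      (h.inv.canvas hS ap (dem_proper xy h _ (.inl rfl))) (dem_proper xy h) ⟨x, y, xy, rfl⟩ qne
      (sub_adj_up aq) (edgeOuter_mono sub_sub (sub_adj_up aq) qo)
      (sub_adj_up au) ⟨h2, .inl au.2.1, .inr rfl, .inr (.inr rfl)⟩ e2 dem_fst dem_snd xy
      (by simp) rfl (by rw [del_sub hD]; exact hh)⟩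

end

/-! ## The main theorem -/

lemma Rel.gov {r s : ℕ × ℕ} (h : Rel r s) : IsGovernment {r, s} := by
  obtain ⟨a, b⟩ := r
  obtain ⟨c, d⟩ := s
  obtain ⟨h, e | e | ⟨e, f⟩⟩ := h <;> dsimp only at e
  · exact .inl ⟨⟨_, .inl rfl, _, .inr rfl, h⟩, .inl ⟨a, by simp [e]⟩⟩
  · exact .inl ⟨⟨_, .inl rfl, _, .inr rfl, h⟩, .inr ⟨b, by simp [e]⟩⟩
  · subst e f
    exact .inr ⟨a, b, fun e => h (by rw [e]), rfl⟩

lemma Gov2.gov {S : Set (ℕ × ℕ)} (h : Gov2 S) : ∃ D ⊆ S, IsGovernment D := by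
  obtain ⟨r, hr, s, hs, h⟩ := h
  exact ⟨{r, s}, by simp [insert_subset_iff, hr, hs], h.gov⟩

lemma Conf4.conf {S : Set (ℕ × ℕ)} (h : Conf4 S) :
    (∃ D ⊆ S, IsGovernment D) ∧ ∃ D ⊆ S, IsConfederacy D := by
  obtain ⟨r, hr, s, hs, t, ht, u, hu, h, h', n1, n2, n3, n4⟩ := h
  refine ⟨Gov2.gov ⟨r, hr, s, hs, h⟩, {r, s} ∪ {t, u}, ?_, ?_, _, _, h.gov, h'.gov, rfl⟩
  · simp [insert_subset_iff, hr, hs, ht, hu]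
  · rintro (⟨-, ⟨a, ha⟩ | ⟨a, ha⟩⟩ | ⟨x, y, -, e⟩)
    · exact n3 (by simp [ha])
    · exact n4 (by simp [ha])
    · have hr : r ∈ ({(x, y), (y, x)} : Set (ℕ × ℕ)) := e ▸ by simp
      have hs : s ∈ ({(x, y), (y, x)} : Set (ℕ × ℕ)) := e ▸ by simp
      have ht : t ∈ ({(x, y), (y, x)} : Set (ℕ × ℕ)) := e ▸ by simp
      have := h.1
      simp only [mem_insert_iff, mem_singleton_iff] at hr hs ht
      grind

lemma gov_rel {C : Set (ℕ × ℕ)} (h : IsGovernment C) :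
    ∀ t ∈ C, ∃ u ∈ C, Rel t u := by
  intro t ht
  rcases h with ⟨⟨c, hc, d, hd, n⟩, ⟨a, ha⟩ | ⟨a, ha⟩⟩ | ⟨x, y, n, rfl⟩
  · by_cases e : t = c
    · exact ⟨d, hd, e ▸ n, .inl (by rw [ha _ ht, ha _ hd])⟩
    · exact ⟨c, hc, e, .inl (by rw [ha _ ht, ha _ hc])⟩
  · by_cases e : t = c
    · exact ⟨d, hd, e ▸ n, .inr (.inl (by rw [ha _ ht, ha _ hd]))⟩
    · exact ⟨c, hc, e, .inr (.inl (by rw [ha _ ht, ha _ hc]))⟩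
  · rcases ht with rfl | rfl
    · exact ⟨_, .inr rfl, by simp [n], .inr (.inr ⟨rfl, rfl⟩)⟩
    · exact ⟨_, .inl rfl, by simp [n.symm], .inr (.inr ⟨rfl, rfl⟩)⟩

lemma gov_fst {C : Set (ℕ × ℕ)} (h : IsGovernment C) {r s : ℕ × ℕ} (hr : r ∈ C) (hs : s ∈ C)
    (n : r ≠ s) : (r.1 = s.1 → ∀ c ∈ C, c.1 = r.1) ∧ (r.2 = s.2 → ∀ c ∈ C, c.2 = r.2) := by
  rcases h with ⟨-, ⟨a, ha⟩ | ⟨a, ha⟩⟩ | ⟨x, y, m, rfl⟩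
  · exact ⟨fun _ c hc => by rw [ha _ hc, ha _ hr],
      fun e => (n (Prod.ext (by rw [ha _ hs, ha _ hr]) e)).elim⟩
  · exact ⟨fun e => (n (Prod.ext e (by rw [ha _ hs, ha _ hr]))).elim,
      fun _ c hc => by rw [ha _ hc, ha _ hr]⟩
  · simp only [mem_insert_iff, mem_singleton_iff] at hr hs
    grind

lemma conf_aux {C1 C2 : Set (ℕ × ℕ)} (h1 : IsGovernment C1) (h2 : IsGovernment C2)
    (h : ¬ IsGovernment (C1 ∪ C2)) (hs : ¬ C2 ⊆ C1) : Conf4 (C1 ∪ C2) := by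
  obtain ⟨t, ht, nt⟩ := not_subset.1 hs
  obtain ⟨u, hu, tu⟩ := gov_rel h2 t ht
  have ne : C1.Nonempty := by
    rcases h1 with ⟨⟨c, hc, -⟩, -⟩ | ⟨x, y, -, rfl⟩
    exacts [⟨c, hc⟩, ⟨_, .inl rfl⟩]
  obtain ⟨r, hr⟩ := ne
  obtain ⟨s, hs, rs⟩ := gov_rel h1 r hr
  have two : ∃ c ∈ C1 ∪ C2, ∃ d ∈ C1 ∪ C2, c ≠ d := ⟨r, .inl hr, s, .inl hs, rs.1⟩
  refine ⟨r, .inl hr, s, .inl hs, t, .inr ht, u, .inr hu, rs, tu, fun e => nt (e ▸ hr),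
    fun e => nt (e ▸ hs), ?_, ?_⟩
  · rintro ⟨e1, e2, e3⟩
    refine h (.inl ⟨two, .inl ⟨r.1, ?_⟩⟩)
    rintro c (hc | hc)
    · exact (gov_fst h1 hr hs rs.1).1 e1 c hc
    · rw [(gov_fst h2 ht hu tu.1).1 (e2.symm.trans e3) c hc, e2]
  · rintro ⟨e1, e2, e3⟩
    refine h (.inl ⟨two, .inr ⟨r.2, ?_⟩⟩)
    rintro c (hc | hc)
    · exact (gov_fst h1 hr hs rs.1).2 e1 c hc
    · rw [(gov_fst h2 ht hu tu.1).2 (e2.symm.trans e3) c hc, e2]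

lemma conf_conf4 {C : Set (ℕ × ℕ)} (h : IsConfederacy C) : Conf4 C := by
  obtain ⟨h, C1, C2, h1, h2, rfl⟩ := h
  by_cases hs : C2 ⊆ C1
  · rw [union_eq_left.2 hs] at h; exact (h h1).elim
  · exact conf_aux h1 h2 h hs

variable {V : Type u} {G : PlaneGraph V} {L : V → Finset ℕ} {p1 p2 q1 q2 : V}

lemma bd_none {v : V} (h : v ∈ G.verts) (ho : G.OnOuter v) : Bd (HG G) {none} (some v) :=
  ⟨none, rfl, hg_none.2 ⟨h, ho⟩⟩

lemma ctx_some : Ctx (HG G) {none} (some '' G.verts) :=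
  ⟨hg_nm, conn_single, ⟨_, rfl⟩, by rintro _ rfl ⟨v, -, ⟨⟩⟩, G.finite_verts.image _⟩

lemma tg_some (h : G.Adj p1 p2) (h1 : G.OnOuter p1) (h2 : G.OnOuter p2) :
    Tg (HG G) {none} (some '' G.verts) (some p1) (some p2) :=
  have m1 := G.adj_mem _ _ h
  have m2 := G.adj_mem _ _ (G.adj_symm _ _ h)
  ⟨⟨_, m1, rfl⟩, ⟨_, m2, rfl⟩, bd_none m1 h1, bd_none m2 h2, hg_some.2 h⟩

lemma k_bd : ∀ a ∈ {a | ∃ v, a = some v ∧ G.OnOuter v}, a ∈ some '' G.verts →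
    Bd (HG G) {none} a := by
  rintro _ ⟨v, rfl, ho⟩ ⟨w, hw, e⟩
  cases e
  exact bd_none hw ho

lemma Inv.mk' (h : IsPathCanvas G p1 p2 L) : Inv G L (some '' G.verts) p1 p2 :=
  ⟨⟨_, h.2.sverts_sub (by simp), rfl⟩, ⟨_, h.2.sverts_sub (by simp), rfl⟩,
    h.2.sverts_outer _ (by simp), h.2.sverts_outer _ (by simp),
    h.2.sadj_sub _ _ (.inl ⟨rfl, rfl⟩),
    fun _ _ _ ha => edgeOuter_mono sub_sub ha (h.2.sedges_outer _ _ (.inl ⟨rfl, rfl⟩)), by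
      rintro v ⟨_, hv, e⟩ e1 e2
      cases e
      exact ⟨h.2.card_outside_S v hv (by simp [e1, e2]), h.2.card_inner v hv⟩, by
      rintro _ ⟨v, hv, rfl⟩; exact ⟨v, hv, rfl⟩⟩

lemma Inv.std (h : Inv G L (some '' G.verts) p1 p2) {Ls : Option V → Finset ℕ}
    (hs : ∀ v, v ≠ p1 → v ≠ p2 → Ls (some v) = L v) :
    Std (HG G) {none} (some '' G.verts) Ls {some p1, some p2} := by
  rintro _ ⟨v, hv, rfl⟩ n
  simp only [mem_insert_iff, mem_singleton_iff, Option.some.injEq, not_or] at n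
  rw [hs v n.1 n.2]
  have := h.card v ⟨v, hv, rfl⟩ n.1 n.2
  exact ⟨this.1, fun nb => this.2 fun ho => nb (bd_none hv ho)⟩

lemma dict_main (hi : Inv G L (some '' G.verts) p1 p2) (hq : G.Adj q1 q2)
    (qo : G.EdgeOnOuter q1 q2) {z w : V} {c : ℕ} {C : Set (ℕ × ℕ)} {Cw : Finset ℕ}
    (pr : ∀ d ∈ C, ProperEdgeColoring L p1 p2 d) (dict : IsDictatorship C)
    (hz : (z = p1 ∧ w = p2 ∧ (∀ d ∈ C, d.1 = c) ∧ sndColors C = (Cw : Set ℕ)) ∨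
      (z = p2 ∧ w = p1 ∧ (∀ d ∈ C, d.2 = c) ∧ fstColors C = (Cw : Set ℕ))) :
    Conf4 (Phi G L p1 p2 q1 q2 C) ∨
      Har G L q1 q2 (some '' G.verts) p1 p2 C ∧ Gov2 (Phi G L p1 p2 q1 q2 C) := by
  classical
  obtain ⟨Ls, lz, lw, ls⟩ : ∃ Ls : Option V → Finset ℕ, Ls (some z) = {c} ∧
      (w ≠ z → Ls (some w) = Cw ∪ {c}) ∧ ∀ v, v ≠ z → v ≠ w → Ls (some v) = L v :=
    ⟨fun a => a.elim ∅ fun v => if v = z then {c} else if v = w then Cw ∪ {c} else L v,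
      by simp, by intro h; simp [h], by intro v h h'; simp [h, h']⟩
  have wz : w ≠ z := by
    have := hi.adj
    rintro rfl
    rcases hz with ⟨e, e', -⟩ | ⟨e, e', -⟩ <;> subst e e' <;> exact G.adj_irrefl _ this
  replace lw := lw wz
  have di : DI G L Ls (some '' G.verts) z w c p1 p2 C Cw := by
    refine ⟨hi, hz, pr, dict, fun v _ e1 e2 => ?_, lw⟩
    rcases hz with ⟨rfl, rfl, -⟩ | ⟨rfl, rfl, -⟩
    exacts [ls v e1 e2, ls v e2 e1]
  obtain ⟨cw, hc, azw, oz, ow, mz, mw, hn, hP, -⟩ := di.facts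
  have c2 : 1 < Cw.card := by
    obtain ⟨⟨d, hd, e, he, de⟩, -⟩ := dict
    rw [Finset.one_lt_card]
    rcases hz with ⟨-, -, h1, h2⟩ | ⟨-, -, h1, h2⟩
    · exact ⟨d.2, Finset.mem_coe.1 (h2 ▸ ⟨d, hd, rfl⟩), e.2, Finset.mem_coe.1 (h2 ▸ ⟨e, he, rfl⟩),
        fun h => de (Prod.ext (by rw [h1 _ hd, h1 _ he]) h)⟩
    · exact ⟨d.1, Finset.mem_coe.1 (h2 ▸ ⟨d, hd, rfl⟩), e.1, Finset.mem_coe.1 (h2 ▸ ⟨e, he, rfl⟩),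
        fun h => de (Prod.ext h (by rw [h1 _ hd, h1 _ he]))⟩
  have cz : c ∈ L z := by
    obtain ⟨⟨d, hd, -⟩, -⟩ := dict
    rcases hz with ⟨rfl, -, h1, -⟩ | ⟨rfl, -, h1, -⟩
    exacts [h1 d hd ▸ (pr d hd).1, h1 d hd ▸ (pr d hd).2.1]
  have hs : Std (HG G) {none} (some '' G.verts) Ls {some z} := by
    rintro a ha n
    by_cases e : a = some w
    · subst e
      have : (Cw ∪ {c}).card = Cw.card + 1 := by
        rw [Finset.card_union_of_disjoint (by simpa using hc), Finset.card_singleton]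
      rw [lw]
      exact ⟨by omega, fun nb => (nb (bd_none (by simpa using mw) ow)).elim⟩
    · refine hi.std (fun v e1 e2 => ?_) a ha ?_
      · have m : v ∉ ({p1, p2} : Set V) := by rintro (h | h); exacts [e1 h, e2 h]
        rw [hP] at m
        exact ls v (fun e => m (.inl e)) fun e => m (.inr e)
      · rw [← image_pair, hP, image_pair]; rintro (e' | e'); exacts [n e', e e']
  have sub : Sq (HG G) (some '' G.verts) Ls (some q1) (some q2) ⊆ Phi G L p1 p2 q1 q2 C := by
    rintro x ⟨φ, ⟨h1, h2⟩, e1, e2⟩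
    have fz : φ (some z) = c := by simpa [lz] using h1 _ mz
    have fw : φ (some w) ∈ Cw := by
      have := h1 _ mw
      have n := h2 _ mw _ mz (hg_some.2 (G.adj_symm _ _ azw))
      rw [lw] at this
      rw [fz] at n
      simpa [n] using this
    refine ⟨fun v => φ (some v), fun v hv => ?_, fun u v h => h2 _ ⟨u, G.adj_mem _ _ h, rfl⟩ _
      ⟨v, G.adj_mem _ _ (G.adj_symm _ _ h), rfl⟩ (hg_some.2 h), ?_, e1, e2⟩
    · by_cases n1 : v = z
      · subst n1; dsimp only; rwa [fz]
      · by_cases n2 : v = w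
        · subst n2; exact cw fw
        · exact ls v n1 n2 ▸ h1 _ ⟨v, hv, rfl⟩
    · rcases hz with ⟨rfl, rfl, h1, h2⟩ | ⟨rfl, rfl, h1, h2⟩
      · obtain ⟨d, hd, e⟩ := h2.symm ▸ Finset.mem_coe.2 fw
        dsimp only; rwa [← e, fz, ← h1 d hd]
      · obtain ⟨d, hd, e⟩ := h2.symm ▸ Finset.mem_coe.2 fw
        dsimp only; rwa [← e, fz, ← h1 d hd]
  have o := (arc_data G hq).2.2.2
  rcases (all_P (G := HG G) (some '' G.verts) (G.finite_verts.image _)).1 {none}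
    {a | ∃ v, a = some v ∧ G.OnOuter v} Ls (some z) (some q1) (some q2) c ctx_some
    (tg_some hq (qo o.1) (qo o.2)) mz (bd_none (by simpa using mz) oz) lz hs k_bd with h | ⟨h, h'⟩
  · exact .inl (h.mono sub)
  · exact .inr ⟨ch_har hq qo h z w p1 p2 C Cw rfl di, h'.mono sub⟩

lemma dem_main (hi : Inv G L (some '' G.verts) p1 p2) (hq : G.Adj q1 q2)
    (qo : G.EdgeOnOuter q1 q2) {x y : ℕ} (xy : x ≠ y)
    (pr : ProperEdgeColoring L p1 p2 (x, y)) (pr' : ProperEdgeColoring L p1 p2 (y, x)) :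
    Conf4 (Phi G L p1 p2 q1 q2 {(x, y), (y, x)}) ∨
      Har G L q1 q2 (some '' G.verts) p1 p2 {(x, y), (y, x)} ∧
        Gov2 (Phi G L p1 p2 q1 q2 {(x, y), (y, x)}) := by
  classical
  obtain ⟨Ls, l1, l2, ls⟩ : ∃ Ls : Option V → Finset ℕ, Ls (some p1) = {x, y} ∧
      Ls (some p2) = {x, y} ∧ ∀ v, v ≠ p1 → v ≠ p2 → Ls (some v) = L v :=
    ⟨fun a => a.elim ∅ fun v => if v = p1 ∨ v = p2 then {x, y} else L v,
      by simp, by simp, by intro v h h'; simp [h, h']⟩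
  have s1 : ({x, y} : Finset ℕ) ⊆ L p1 := by simp [Finset.insert_subset_iff, pr.1, pr'.1]
  have s2 : ({x, y} : Finset ℕ) ⊆ L p2 := by simp [Finset.insert_subset_iff, pr.2.1, pr'.2.1]
  have sub : Sq (HG G) (some '' G.verts) Ls (some q1) (some q2) ⊆
      Phi G L p1 p2 q1 q2 {(x, y), (y, x)} := by
    rintro t ⟨φ, ⟨h1, h2⟩, e1, e2⟩
    have f1 := l1 ▸ h1 _ hi.m1
    have f2 := l2 ▸ h1 _ hi.m2
    refine ⟨fun v => φ (some v), fun v hv => ?_, fun u v h => h2 _ ⟨u, G.adj_mem _ _ h, rfl⟩ _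
      ⟨v, G.adj_mem _ _ (G.adj_symm _ _ h), rfl⟩ (hg_some.2 h), ?_, e1, e2⟩
    · by_cases n1 : v = p1
      · subst n1; exact s1 f1
      · by_cases n2 : v = p2
        · subst n2; exact s2 f2
        · exact ls v n1 n2 ▸ h1 _ ⟨v, hv, rfl⟩
    · have n := h2 _ hi.m1 _ hi.m2 (hg_some.2 hi.adj)
      simp only [Finset.mem_insert, Finset.mem_singleton, mem_insert_iff, mem_singleton_iff,
        Prod.mk.injEq] at f1 f2 ⊢
      grind
  have o := (arc_data G hq).2.2.2
  rcases (all_P (G := HG G) (some '' G.verts) (G.finite_verts.image _)).2.1 {none}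
    {a | ∃ v, a = some v ∧ G.OnOuter v} Ls (some p1) (some p2) (some q1) (some q2) {x, y} ctx_some
    (tg_some hq (qo o.1) (qo o.2)) (tg_some hi.adj hi.o1 hi.o2) l1 l2 (Finset.card_pair xy)
    (hi.std ls) k_bd with h | ⟨h, h'⟩
  · exact .inl (h.mono sub)
  · exact .inr ⟨ch_har hq qo h p1 p2 x y rfl rfl xy rfl ⟨hi, s1, s2, fun v _ => ls v⟩, h'.mono sub⟩

lemma conf_main (hi : Inv G L (some '' G.verts) p1 p2) (hq : G.Adj q1 q2)
    (qo : G.EdgeOnOuter q1 q2) {C : Set (ℕ × ℕ)} (pr : ∀ d ∈ C, ProperEdgeColoring L p1 p2 d)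
    (hC : Conf4 C) : Conf4 (Phi G L p1 p2 q1 q2 C) := by
  have o := (arc_data G hq).2.2.2
  refine ((all_P (G := HG G) (some '' G.verts) (G.finite_verts.image _)).2.2.1 {none}
    (fun a => a.elim ∅ L) C (some p1) (some p2) (some q1) (some q2) ctx_some
    (tg_some hq (qo o.1) (qo o.2)) (tg_some hi.adj hi.o1 hi.o2)
    (hi.std fun _ _ _ => rfl) hC pr).mono ?_
  rintro t ⟨φ, ⟨h1, h2⟩, m, e1, e2⟩
  exact ⟨fun v => φ (some v), fun v hv => h1 _ ⟨v, hv, rfl⟩, fun u v h => h2 _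
    ⟨u, G.adj_mem _ _ h, rfl⟩ _ ⟨v, G.adj_mem _ _ (G.adj_symm _ _ h), rfl⟩ (hg_some.2 h), m, e1, e2⟩

end GE

theorem government_extends {V : Type u} (G : PlaneGraph V) (p1 p2 q1 q2 : V)
    (L : V → Finset ℕ) (C : Set (ℕ × ℕ))
    (hT : IsPathCanvas G p1 p2 L)
    (hq : q1 ≠ q2) (hqadj : G.Adj q1 q2) (hqout : G.EdgeOnOuter q1 q2)
    (hCproper : ∀ c ∈ C, ProperEdgeColoring L p1 p2 c)
    (hC : IsGovernment C ∨ IsConfederacy C) :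
    (∃ D : Set (ℕ × ℕ), D ⊆ Phi G L p1 p2 q1 q2 C ∧ IsGovernment D) ∧
    ((∃ D : Set (ℕ × ℕ), D ⊆ Phi G L p1 p2 q1 q2 C ∧ IsConfederacy D) ∨
      (IsGovernment C ∧
        ∃ H : PlaneGraph V, H.IsSubgraph G ∧ IsHarmonica L H p1 p2 q1 q2 C)) := by
  have hi := GE.Inv.mk' hT
  rcases hC with hg | hC
  · have key : GE.Conf4 (Phi G L p1 p2 q1 q2 C) ∨ GE.Har G L q1 q2 (some '' G.verts) p1 p2 C ∧
        GE.Gov2 (Phi G L p1 p2 q1 q2 C) := by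
      rcases hg with hd | ⟨x, y, xy, rfl⟩
      · rcases hd.2 with ⟨c, hc⟩ | ⟨c, hc⟩
        · obtain ⟨Cw, e⟩ := ((L p2).finite_toSet.subset (show sndColors C ⊆ _ by
            rintro _ ⟨d, hd, rfl⟩; exact (hCproper d hd).2.1)).exists_finset_coe
          exact GE.dict_main hi hqadj hqout hCproper hd (Or.inl ⟨rfl, rfl, hc, e.symm⟩)
        · obtain ⟨Cw, e⟩ := ((L p1).finite_toSet.subset (show fstColors C ⊆ _ by
            rintro _ ⟨d, hd, rfl⟩; exact (hCproper d hd).1)).exists_finset_coe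
          exact GE.dict_main hi hqadj hqout hCproper hd (Or.inr ⟨rfl, rfl, hc, e.symm⟩)
      · exact GE.dem_main hi hqadj hqout xy (hCproper _ (Or.inl rfl)) (hCproper _ (Or.inr rfl))
    rcases key with h | ⟨⟨S, E, -, -, -, hh⟩, h⟩
    · exact ⟨h.conf.1, Or.inl h.conf.2⟩
    · exact ⟨h.gov, Or.inr ⟨hg, _, GE.sub_sub, hh⟩⟩
  · have h := (GE.conf_main hi hqadj hqout hCproper (GE.conf_conf4 hC)).conf
    exact ⟨h.1, Or.inl h.2⟩
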